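/- Let d = 4 and n ≥ 1. There exists L₀ such that for every integer L ≥ L₀ there exist δ > 0 and C > 0 such that for every g ∈ (0,δ] there exists ν_c < 0 with the following properties. For every ε ∈ (0,δ], with ν = ν_c + ε: the susceptibility χ(g,ν) exists and is positive; the pressure p(g,·) exists on (ν_c, ν_c + δ] and is differentiable at ν; the limit lim_{N→∞} ⟨|φ_0|²⟩_{g,ν,N} exists and −(∂p/∂ν)(g,ν) = ½·lim_{N→∞} ⟨|φ_0|²⟩_{g,ν,N}; and |½·lim_{N→∞} ⟨|φ_0|²⟩_{g,ν,N} − (n/2)·C_{1/χ(g,ν)}(0)| ≤ C·g·C_{1/χ(g,ν)}(0). Moreover lim_{ε↓0} of −(∂p/∂ν)(g,ν_c+ε) exists and differs from (n/2)·C_0(0) by at most C·g·C_0(0) in absolute value. -/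

import Mathlib

open MeasureTheory Filter Topology

noncomputable section

namespace Phi4

instance instNeZeroPowNat (L M : ℕ) [NeZero L] : NeZero (L ^ M) :=
  ⟨pow_ne_zero M (NeZero.ne L)⟩

/-- The discrete `4`-dimensional torus of side length `L^N`. -/
abbrev Torus (L N : ℕ) := Fin 4 → ZMod (L ^ N)

/-- Spin field configurations: `n`-component fields on the torus. -/
abbrev Conf (L N n : ℕ) := Torus L N → Fin n → ℝ

/-- The unit lattice vector in direction `j`. -/
def unitVec (L N : ℕ) (j : Fin 4) : Torus L N := fun i => if i = j then 1 else 0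

/-- The discrete Laplacian acting componentwise on fields. -/
def lap (L N n : ℕ) (φ : Conf L N n) (x : Torus L N) (i : Fin n) : ℝ :=
  ∑ j : Fin 4,
    ((φ (x + unitVec L N j) i - φ x i) + (φ (x - unitVec L N j) i - φ x i))

/-- Squared Euclidean norm on `ℝ^n`. -/
def normSq {n : ℕ} (v : Fin n → ℝ) : ℝ := ∑ i, v i ^ 2

/-- The `|φ|⁴` Hamiltonian. -/
def ham (L N n : ℕ) [NeZero L] (g ν : ℝ) (φ : Conf L N n) : ℝ :=
  ∑ x : Torus L N,
    (g / 4 * normSq (φ x) ^ 2 + ν / 2 * normSq (φ x)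
      + 1 / 2 * ∑ i : Fin n, φ x i * (-lap L N n φ x i))

/-- The partition function. -/
def partZ (L N n : ℕ) [NeZero L] (g ν : ℝ) : ℝ :=
  ∫ φ : Conf L N n, Real.exp (-ham L N n g ν φ)

/-- Expectation with respect to the `|φ|⁴` measure. -/
def expect (L N n : ℕ) [NeZero L] (g ν : ℝ) (F : Conf L N n → ℝ) : ℝ :=
  (∫ φ : Conf L N n, F φ * Real.exp (-ham L N n g ν φ)) / partZ L N n g ν

/-- The `|φ|⁴` probability measure. -/
def gibbs (L N n : ℕ) [NeZero L] (g ν : ℝ) : Measure (Conf L N n) :=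
  (ENNReal.ofReal (partZ L N n g ν))⁻¹ •
    volume.withDensity fun φ => ENNReal.ofReal (Real.exp (-ham L N n g ν φ))

/-- The finite-volume two-point sum. -/
def corrSum (L N n : ℕ) [NeZero L] [NeZero n] (g ν : ℝ) : ℝ :=
  ∑ x : Torus L N, expect L N n g ν fun φ => φ 0 0 * φ x 0

/-- The finite-volume pressure. -/
def pressureN (L N n : ℕ) [NeZero L] (g ν : ℝ) : ℝ :=
  ((L : ℝ) ^ (4 * N))⁻¹ * Real.log (partZ L N n g ν)

/-- The Fourier multiplier of the lattice Laplacian on `ℤ^4`. -/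
def lam (k : Fin 4 → ℝ) : ℝ := 4 * ∑ j : Fin 4, Real.sin (Real.pi * k j) ^ 2

/-- The unit cube `[0,1]^4`. -/
def cube : Set (Fin 4 → ℝ) := Set.univ.pi fun _ => Set.Icc 0 1

/-- The free pressure `p(0, m²)`. -/
def freePressure (n : ℕ) (m2 : ℝ) : ℝ :=
  -(n : ℝ) * ∫ k in cube, Real.log (lam k + m2)

/-- The lattice Green function at the origin. -/
def green (m2 : ℝ) : ℝ := ∫ k in cube, (lam k + m2)⁻¹

/-- Embedding of the discrete torus into the continuum torus. -/
def embed (L N : ℕ) (x : Torus L N) : Fin 4 → ℝ :=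
  fun j => ((x j).val : ℝ) / (L : ℝ) ^ N

/-- The pairing `φ⁽ᴺ⁾(h)` of a field with a test function. -/
def pairing (L N n : ℕ) [NeZero L] (h : (Fin 4 → ℝ) → Fin n → ℝ) (φ : Conf L N n) : ℝ :=
  ∑ x : Torus L N, ∑ i : Fin n, h (embed L N x) i * φ x i

/-- `h : ℝ^4 → ℝ^n` is `ℤ^4`-periodic, i.e. a function on the continuum torus. -/
def IsPeriodic {n : ℕ} (h : (Fin 4 → ℝ) → Fin n → ℝ) : Prop :=
  ∀ (x : Fin 4 → ℝ) (j : Fin 4), h (fun i => x i + if i = j then 1 else 0) = h x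

/-- The `L²(𝕋⁴, ℝⁿ)` inner product `(h, h)`. -/
def pairL2 {n : ℕ} (h : (Fin 4 → ℝ) → Fin n → ℝ) : ℝ := ∫ x in cube, normSq (h x)

/-- Fourier coefficients of a test function on the torus. -/
def fourierCoeff {n : ℕ} (h : (Fin 4 → ℝ) → Fin n → ℝ) (l : Fin 4 → ℤ) (i : Fin n) : ℂ :=
  ∫ x in cube, (h x i : ℂ) *
    Complex.exp (-(2 * (Real.pi : ℂ) * Complex.I) * ∑ j : Fin 4, (l j : ℂ) * (x j : ℂ))

/-- The variance `(h, (−m⁻²Δ + 1)⁻¹ h)` of the massive Gaussian free field on the torus,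
written via Fourier series. -/
def gffVar {n : ℕ} (h : (Fin 4 → ℝ) → Fin n → ℝ) (m2 : ℝ) : ℝ :=
  ∑' l : Fin 4 → ℤ,
    (∑ i : Fin n, ‖fourierCoeff h l i‖ ^ 2) /
      (4 * Real.pi ^ 2 * m2⁻¹ * (∑ j : Fin 4, ((l j : ℝ)) ^ 2) + 1)

/-- The matrix of `−Δ` on the discrete torus. -/
def negLapMatrix (L N : ℕ) [NeZero L] : Matrix (Torus L N) (Torus L N) ℝ :=
  Matrix.of fun x y => ∑ j : Fin 4,
    (((if y = x then (1 : ℝ) else 0) - if y = x + unitVec L N j then 1 else 0)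
      + ((if y = x then (1 : ℝ) else 0) - if y = x - unitVec L N j then 1 else 0))

/-- Forward difference in direction `j` on the torus. -/
def fwdDiff (L N : ℕ) (j : Fin 4) (f : Torus L N → ℝ) : Torus L N → ℝ :=
  fun x => f (x + unitVec L N j) - f x

/-- Iterated forward differences `∇^α` on the torus. -/
def fwdDiffMulti (L N : ℕ) (α : Fin 4 → ℕ) (f : Torus L N → ℝ) : Torus L N → ℝ :=
  (fwdDiff L N 0)^[α 0] ((fwdDiff L N 1)^[α 1] ((fwdDiff L N 2)^[α 2] ((fwdDiff L N 3)^[α 3] f)))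

/-- Partial derivative in direction `j`. -/
def pderiv1 (j : Fin 4) (f : (Fin 4 → ℝ) → ℝ) : (Fin 4 → ℝ) → ℝ :=
  fun x => fderiv ℝ f x (Pi.single j 1)

/-- Iterated partial derivatives `∂^β`. -/
def pderivMulti (β : Fin 4 → ℕ) (f : (Fin 4 → ℝ) → ℝ) : (Fin 4 → ℝ) → ℝ :=
  (pderiv1 0)^[β 0] ((pderiv1 1)^[β 1] ((pderiv1 2)^[β 2] ((pderiv1 3)^[β 3] f)))

/-- The lattice `ℤ^4`. -/
abbrev Zd := Fin 4 → ℤ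

/-- Forward difference in direction `j` on `ℤ^4`. -/
def fwdZ (j : Fin 4) (f : Zd → ℝ) : Zd → ℝ := fun x => f (x + Pi.single j 1) - f x

/-- Iterated forward differences `∇^α` on `ℤ^4`. -/
def fwdZMulti (α : Fin 4 → ℕ) (f : Zd → ℝ) : Zd → ℝ :=
  (fwdZ 0)^[α 0] ((fwdZ 1)^[α 1] ((fwdZ 2)^[α 2] ((fwdZ 3)^[α 3] f)))

/-- Euclidean norm on `ℤ^4`. -/
def eNorm (x : Zd) : ℝ := Real.sqrt (∑ j : Fin 4, ((x j : ℝ)) ^ 2)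

/-- `(ΔC)₀ = Σ_{|e|₁=1} (C_e − C_0)`. -/
def lapZ0 (C : Zd → ℝ) : ℝ :=
  ∑ j : Fin 4, ((C (Pi.single j 1) - C 0) + (C (-Pi.single j 1) - C 0))

/-- The rescaled Green quadratic form `m² L^{−4N} (h_N, (−Δ+m²)⁻¹ h_N)`. -/
def quadForm (L N n : ℕ) [NeZero L] (m2 : ℝ) (h : (Fin 4 → ℝ) → Fin n → ℝ) : ℝ :=
  m2 * ((L : ℝ) ^ (4 * N))⁻¹ *
    ∑ x : Torus L N, ∑ y : Torus L N, ∑ i : Fin n,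
      h (embed L N x) i *
        ((negLapMatrix L N + m2 • (1 : Matrix (Torus L N) (Torus L N) ℝ))⁻¹ x y) *
        h (embed L N y) i

set_option linter.unusedSectionVars false

section Calculus

variable {ι : Type*} [Fintype ι] [DecidableEq ι]

/-- `f'` is the partial derivative of `f` in the coordinate direction `a`, everywhere. -/
def HasPD (a : ι) (f f' : (ι → ℝ) → ℝ) : Prop :=
  ∀ x, HasLineDerivAt ℝ f (f' x) x (Pi.single a 1)

/-- Continuous functions of at most polynomial growth. -/
def Tame (f : (ι → ℝ) → ℝ) : Prop :=
  Continuous f ∧ ∃ (K : ℝ) (m : ℕ), ∀ x, |f x| ≤ K * (1 + ‖x‖) ^ m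

lemma HasPD.add {a : ι} {f f' g g' : (ι → ℝ) → ℝ} (hf : HasPD a f f') (hg : HasPD a g g') :
    HasPD a (fun x => f x + g x) (fun x => f' x + g' x) := fun x =>
  HasDerivAt.add (hf x) (hg x)

lemma HasPD.sub {a : ι} {f f' g g' : (ι → ℝ) → ℝ} (hf : HasPD a f f') (hg : HasPD a g g') :
    HasPD a (fun x => f x - g x) (fun x => f' x - g' x) := fun x =>
  HasDerivAt.sub (hf x) (hg x)

lemma HasPD.neg {a : ι} {f f' : (ι → ℝ) → ℝ} (hf : HasPD a f f') :
    HasPD a (fun x => -f x) (fun x => -f' x) := fun x => HasDerivAt.neg (hf x)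

lemma HasPD.mul {a : ι} {f f' g g' : (ι → ℝ) → ℝ} (hf : HasPD a f f') (hg : HasPD a g g') :
    HasPD a (fun x => f x * g x) (fun x => f' x * g x + f x * g' x) := fun x => by
  have := HasDerivAt.mul (hf x) (hg x)
  simp only [zero_smul, add_zero] at this
  exact this

lemma HasPD.const (a : ι) (c : ℝ) : HasPD a (fun _ => c) (fun _ => 0) := fun _ =>
  hasDerivAt_const _ _

lemma HasPD.coord (a b : ι) : HasPD a (fun x => x b) (fun _ => if b = a then 1 else 0) :=
  fun x => by
  have : HasDerivAt (fun t : ℝ => x b + t * (Pi.single a (1 : ℝ) : ι → ℝ) b)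
      (1 * (Pi.single a (1 : ℝ) : ι → ℝ) b) 0 :=
    ((hasDerivAt_id (0 : ℝ)).mul_const _).const_add _
  simpa [HasLineDerivAt, Pi.single_apply] using this

lemma HasPD.sum {κ : Type*} {a : ι} (s : Finset κ) {f f' : κ → (ι → ℝ) → ℝ}
    (h : ∀ k ∈ s, HasPD a (f k) (f' k)) :
    HasPD a (fun x => ∑ k ∈ s, f k x) (fun x => ∑ k ∈ s, f' k x) := fun x =>
  HasDerivAt.fun_sum fun k hk => h k hk x

lemma HasPD.comp {a : ι} {f f' : (ι → ℝ) → ℝ} {q q' : ℝ → ℝ} (hf : HasPD a f f')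
    (hq : ∀ x, HasDerivAt q (q' (f x)) (f x)) :
    HasPD a (fun x => q (f x)) (fun x => q' (f x) * f' x) := fun x => by
  have h := hf x
  have hq' : HasDerivAt q (q' (f x)) (f (x + (0 : ℝ) • (Pi.single a 1 : ι → ℝ))) := by
    simpa using hq x
  exact HasDerivAt.comp (0 : ℝ) hq' h

lemma HasPD.congr {a : ι} {f f' g g' : (ι → ℝ) → ℝ} (hf : HasPD a f f') (h : ∀ x, g x = f x)
    (h' : ∀ x, g' x = f' x) : HasPD a g g' := by
  obtain rfl : g = f := funext h
  obtain rfl : g' = f' := funext h'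
  exact hf

lemma HasPD.sq {a : ι} {f f' : (ι → ℝ) → ℝ} (hf : HasPD a f f') :
    HasPD a (fun x => f x ^ 2) (fun x => 2 * f x * f' x) :=
  (hf.mul hf).congr (fun x => by ring) fun x => by ring

lemma HasPD.const_mul {a : ι} {f f' : (ι → ℝ) → ℝ} (c : ℝ) (hf : HasPD a f f') :
    HasPD a (fun x => c * f x) (fun x => c * f' x) :=
  ((HasPD.const a c).mul hf).congr (fun x => rfl) fun x => by ring

lemma Tame.continuous {f : (ι → ℝ) → ℝ} (hf : Tame f) : Continuous f := hf.1

lemma Tame.exists_bound {f : (ι → ℝ) → ℝ} (hf : Tame f) :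
    ∃ (K : ℝ) (m : ℕ), 0 ≤ K ∧ ∀ x, |f x| ≤ K * (1 + ‖x‖) ^ m := by
  obtain ⟨_, K, m, h⟩ := hf
  refine ⟨|K|, m, abs_nonneg _, fun x => (h x).trans ?_⟩
  gcongr
  exact le_abs_self K

lemma Tame.of_le {f g : (ι → ℝ) → ℝ} (hg : Continuous g) (hf : Tame f)
    (h : ∀ x, |g x| ≤ |f x|) : Tame g := by
  obtain ⟨_, K, m, hK⟩ := hf
  exact ⟨hg, K, m, fun x => (h x).trans (hK x)⟩

lemma Tame.add {f g : (ι → ℝ) → ℝ} (hf : Tame f) (hg : Tame g) :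
    Tame (fun x => f x + g x) := by
  obtain ⟨K, m, hK, h⟩ := hf.exists_bound
  obtain ⟨K', m', hK', h'⟩ := hg.exists_bound
  refine ⟨hf.1.add hg.1, K + K', m + m', fun x => ?_⟩
  have h1 : (1 : ℝ) ≤ 1 + ‖x‖ := by linarith [norm_nonneg x]
  calc |f x + g x| ≤ |f x| + |g x| := abs_add_le _ _
    _ ≤ K * (1 + ‖x‖) ^ m + K' * (1 + ‖x‖) ^ m' := add_le_add (h x) (h' x)
    _ ≤ K * (1 + ‖x‖) ^ (m + m') + K' * (1 + ‖x‖) ^ (m + m') := by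
        gcongr <;> omega
    _ = _ := by ring

lemma Tame.mul {f g : (ι → ℝ) → ℝ} (hf : Tame f) (hg : Tame g) :
    Tame (fun x => f x * g x) := by
  obtain ⟨K, m, hK, h⟩ := hf.exists_bound
  obtain ⟨K', m', hK', h'⟩ := hg.exists_bound
  refine ⟨hf.1.mul hg.1, K * K', m + m', fun x => ?_⟩
  calc |f x * g x| = |f x| * |g x| := abs_mul _ _
    _ ≤ (K * (1 + ‖x‖) ^ m) * (K' * (1 + ‖x‖) ^ m') := by
        gcongr
        · exact h x
        · exact h' x
    _ = _ := by ring

lemma Tame.const (c : ℝ) : Tame (fun _ : ι → ℝ => c) :=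
  ⟨continuous_const, |c|, 0, fun x => by simp⟩

lemma Tame.coord (b : ι) : Tame (fun x : ι → ℝ => x b) :=
  ⟨continuous_apply b, 1, 1, fun x => by
    have := norm_le_pi_norm x b
    rw [Real.norm_eq_abs] at this
    linarith⟩

lemma Tame.neg {f : (ι → ℝ) → ℝ} (hf : Tame f) : Tame (fun x => -f x) :=
  Tame.of_le hf.1.neg hf fun x => by simp

lemma Tame.sub {f g : (ι → ℝ) → ℝ} (hf : Tame f) (hg : Tame g) :
    Tame (fun x => f x - g x) := by
  simpa [sub_eq_add_neg] using hf.add hg.neg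

lemma Tame.const_mul {f : (ι → ℝ) → ℝ} (c : ℝ) (hf : Tame f) : Tame (fun x => c * f x) :=
  (Tame.const c).mul hf

lemma Tame.pow {f : (ι → ℝ) → ℝ} (hf : Tame f) (k : ℕ) : Tame (fun x => f x ^ k) := by
  induction k with
  | zero => simpa using Tame.const 1
  | succ k ih => simpa [pow_succ] using ih.mul hf

lemma Tame.sum {κ : Type*} (s : Finset κ) {f : κ → (ι → ℝ) → ℝ} (h : ∀ k ∈ s, Tame (f k)) :
    Tame (fun x => ∑ k ∈ s, f k x) := by
  classical
  induction s using Finset.induction_on with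
  | empty => simpa using Tame.const 0
  | insert k s hk ih =>
    simp only [Finset.sum_insert hk]
    exact (h k (Finset.mem_insert_self _ _)).add
      (ih fun j hj => h j (Finset.mem_insert_of_mem hj))

lemma Tame.of_hasCompactSupport {f : (ι → ℝ) → ℝ} (hf : Continuous f) (hs : HasCompactSupport f) :
    Tame f := by
  obtain ⟨C, hC⟩ := hf.bounded_above_of_compact_support hs
  exact ⟨hf, C, 0, fun x => by simpa using hC x⟩

/-- A continuous potential growing at least linearly. -/
def Confining (V : (ι → ℝ) → ℝ) : Prop :=
  Continuous V ∧ ∃ c K : ℝ, 0 < c ∧ ∀ x, c * ‖x‖ - K ≤ V x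

lemma Confining.integrable {V f : (ι → ℝ) → ℝ} (hV : Confining V) (hf : Tame f) :
    Integrable (fun x => f x * Real.exp (-V x)) := by
  obtain ⟨hVc, c, K, hc, hV⟩ := hV
  obtain ⟨B, m, hB, hfB⟩ := hf.exists_bound
  set r : ℕ := Module.finrank ℝ (ι → ℝ) + 1 with hr
  have h_integrable : Integrable (fun x : ι → ℝ => (1 + ‖x‖) ^ (-(r : ℝ))) :=
    integrable_one_add_norm (by rw [hr]; push_cast; linarith)
  obtain ⟨M, hM⟩ : ∃ M : ℝ, ∀ t : ℝ, 0 ≤ t → (1 + t) ^ (m + r) * Real.exp (-(c * t)) ≤ M := by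
    refine ⟨((m + r).factorial : ℝ) * (c⁻¹ ^ (m + r)) * Real.exp c, fun t ht => ?_⟩
    have h1 : (c * (1 + t)) ^ (m + r) / (m + r).factorial ≤ Real.exp (c * (1 + t)) :=
      Real.pow_div_factorial_le_exp _ (by positivity) _
    rw [div_le_iff₀ (by positivity), mul_pow] at h1
    have h2 : Real.exp (c * (1 + t)) = Real.exp c * Real.exp (c * t) := by
      rw [← Real.exp_add]; ring_nf
    rw [h2] at h1
    rw [Real.exp_neg, ← div_eq_mul_inv, div_le_iff₀ (Real.exp_pos _)]
    have h3 : (1 + t) ^ (m + r) = c⁻¹ ^ (m + r) * (c ^ (m + r) * (1 + t) ^ (m + r)) := by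
      rw [← mul_assoc, ← mul_pow, inv_mul_cancel₀ hc.ne']; simp
    rw [h3]
    calc _ ≤ c⁻¹ ^ (m + r) * (Real.exp c * Real.exp (c * t) * (m + r).factorial) := by gcongr
      _ = _ := by ring
  refine (h_integrable.const_mul (B * Real.exp K * M)).mono'
    ((hf.1.mul (Real.continuous_exp.comp hVc.neg)).aestronglyMeasurable) (ae_of_all _ fun x => ?_)
  rw [Real.norm_eq_abs, abs_mul, abs_of_pos (Real.exp_pos _)]
  have hx : (0 : ℝ) < 1 + ‖x‖ := by linarith [norm_nonneg x]
  have hM' := hM ‖x‖ (norm_nonneg x)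
  have he : Real.exp (-V x) ≤ Real.exp K * Real.exp (-(c * ‖x‖)) := by
    rw [← Real.exp_add]; exact Real.exp_le_exp.2 (by linarith [hV x])
  have hpow : (1 + ‖x‖) ^ m = (1 + ‖x‖) ^ (m + r) * (1 + ‖x‖) ^ (-(r : ℝ)) := by
    rw [Real.rpow_neg hx.le, Real.rpow_natCast, pow_add]
    field_simp
  calc |f x| * Real.exp (-V x)
      ≤ (B * (1 + ‖x‖) ^ m) * (Real.exp K * Real.exp (-(c * ‖x‖))) := by
        gcongr
        exact hfB x
    _ = B * Real.exp K * ((1 + ‖x‖) ^ (m + r) * Real.exp (-(c * ‖x‖))) *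
          (1 + ‖x‖) ^ (-(r : ℝ)) := by rw [hpow]; ring
    _ ≤ _ := by gcongr

/-- Unnormalised expectation with weight `e^{-V}`. -/
def wint (V f : (ι → ℝ) → ℝ) : ℝ := ∫ x, f x * Real.exp (-V x)

section wint

variable {V : (ι → ℝ) → ℝ}

lemma wint_add (hV : Confining V) {f g : (ι → ℝ) → ℝ} (hf : Tame f) (hg : Tame g) :
    wint V (fun x => f x + g x) = wint V f + wint V g := by
  unfold wint
  simp only [add_mul]
  exact integral_add (hV.integrable hf) (hV.integrable hg)

lemma wint_sub (hV : Confining V) {f g : (ι → ℝ) → ℝ} (hf : Tame f) (hg : Tame g) :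
    wint V (fun x => f x - g x) = wint V f - wint V g := by
  unfold wint
  simp only [sub_mul]
  exact integral_sub (hV.integrable hf) (hV.integrable hg)

lemma wint_const_mul (c : ℝ) (f : (ι → ℝ) → ℝ) :
    wint V (fun x => c * f x) = c * wint V f := by
  unfold wint
  simp only [mul_assoc]
  exact integral_const_mul _ _

lemma wint_sum (hV : Confining V) {κ : Type*} (s : Finset κ) {f : κ → (ι → ℝ) → ℝ}
    (h : ∀ k ∈ s, Tame (f k)) :
    wint V (fun x => ∑ k ∈ s, f k x) = ∑ k ∈ s, wint V (f k) := by
  unfold wint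
  simp only [Finset.sum_mul]
  exact integral_finsetSum _ fun k hk => hV.integrable (h k hk)

lemma wint_mono (hV : Confining V) {f g : (ι → ℝ) → ℝ} (hf : Tame f) (hg : Tame g)
    (h : ∀ x, f x ≤ g x) : wint V f ≤ wint V g :=
  integral_mono (hV.integrable hf) (hV.integrable hg) fun x =>
    mul_le_mul_of_nonneg_right (h x) (Real.exp_pos _).le

lemma wint_nonneg {f : (ι → ℝ) → ℝ} (h : ∀ x, 0 ≤ f x) : 0 ≤ wint V f :=
  integral_nonneg fun x => mul_nonneg (h x) (Real.exp_pos _).le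

lemma wint_one_pos (hV : Confining V) : 0 < wint V (fun _ => 1) := by
  unfold wint
  rw [integral_pos_iff_support_of_nonneg (fun x => by positivity) (hV.integrable (Tame.const 1))]
  have : Function.support (fun x => (1 : ℝ) * Real.exp (-V x)) = Set.univ := by
    ext x; simp
  rw [this]
  exact NeZero.pos _

/-- Cauchy–Schwarz for the weighted integral. -/
lemma wint_mul_sq_le (hV : Confining V) {f g : (ι → ℝ) → ℝ} (hf : Tame f) (hg : Tame g) :
    wint V (fun x => f x * g x) ^ 2 ≤ wint V (fun x => f x ^ 2) * wint V (fun x => g x ^ 2) := by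
  have key : ∀ s t : ℝ, 0 ≤ s ^ 2 * wint V (fun x => f x ^ 2)
      + 2 * s * t * wint V (fun x => f x * g x) + t ^ 2 * wint V (fun x => g x ^ 2) := by
    intro s t
    have h := wint_nonneg (V := V) (f := fun x => (s * f x + t * g x) ^ 2) fun x => sq_nonneg _
    have e : (fun x => (s * f x + t * g x) ^ 2) = fun x =>
        (s ^ 2 * f x ^ 2 + 2 * s * t * (f x * g x)) + t ^ 2 * g x ^ 2 := by
      funext x; ring
    rw [e, wint_add hV (((hf.pow 2).const_mul _).add ((hf.mul hg).const_mul _))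
      ((hg.pow 2).const_mul _), wint_add hV ((hf.pow 2).const_mul _) ((hf.mul hg).const_mul _),
      wint_const_mul, wint_const_mul, wint_const_mul] at h
    exact h
  set a := wint V (fun x => f x ^ 2)
  set b := wint V (fun x => f x * g x)
  set c := wint V (fun x => g x ^ 2)
  have hd := discrim_le_zero (a := a) (b := 2 * b) (c := c) fun s => by
    have := key s 1
    nlinarith [this]
  unfold discrim at hd
  nlinarith [hd]

/-- Integration by parts. -/
lemma wint_ibp (hV : Confining V) {a : ι} {X X' V' : (ι → ℝ) → ℝ} (hX : HasPD a X X')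
    (hV' : HasPD a V V') (tX : Tame X) (tX' : Tame X') (tV' : Tame V') :
    wint V (fun x => X x * V' x) = wint V X' := by
  have hE : HasPD a (fun x => Real.exp (-V x)) (fun x => Real.exp (-V x) * -V' x) :=
    hV'.neg.comp (q := Real.exp) (q' := Real.exp) fun x => Real.hasDerivAt_exp _
  have h := integral_bilinear_hasLineDerivAt_right_eq_neg_left_of_integrable
    (μ := (volume : Measure (ι → ℝ))) (B := ContinuousLinearMap.mul ℝ ℝ)
    (f := X) (f' := X') (g := fun x => Real.exp (-V x)) (g' := fun x => Real.exp (-V x) * -V' x)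
    (v := Pi.single a 1) (by simpa using hV.integrable tX')
    (by
      refine (hV.integrable (tX.mul tV').neg).congr (ae_of_all _ fun x => ?_)
      simp; ring)
    (by simpa using hV.integrable tX) (fun x _ => hX x) (fun x _ => hE x)
  simp only [ContinuousLinearMap.mul_apply'] at h
  unfold wint
  have e : ∫ x, X x * V' x * Real.exp (-V x) = -∫ x, X x * (Real.exp (-V x) * -V' x) := by
    rw [← integral_neg]; congr 1; funext x; ring
  rw [e, h, neg_neg]

end wint

/-- Partial derivative in the coordinate direction `a`. -/
def pd (a : ι) (f : (ι → ℝ) → ℝ) (x : ι → ℝ) : ℝ := fderiv ℝ f x (Pi.single a 1)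

/-- Smooth compactly supported functions. -/
def IsTest (f : (ι → ℝ) → ℝ) : Prop := ContDiff ℝ (⊤ : ℕ∞) f ∧ HasCompactSupport f

lemma hasPD_pd {f : (ι → ℝ) → ℝ} (hf : Differentiable ℝ f) (a : ι) : HasPD a f (pd a f) :=
  fun x => (hf x).hasFDerivAt.hasLineDerivAt _

lemma HasPD.pd_eq {f f' : (ι → ℝ) → ℝ} {a : ι} (hf : Differentiable ℝ f) (h : HasPD a f f') :
    pd a f = f' := by
  funext x
  exact ((hf x).hasFDerivAt.hasLineDerivAt _).unique (h x)

lemma contDiff_pd {f : (ι → ℝ) → ℝ} (hf : ContDiff ℝ (⊤ : ℕ∞) f) (a : ι) :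
    ContDiff ℝ (⊤ : ℕ∞) (pd a f) :=
  (hf.fderiv_right (by norm_cast)).clm_apply contDiff_const

lemma pd_comm {f : (ι → ℝ) → ℝ} (hf : ContDiff ℝ (⊤ : ℕ∞) f) (a b : ι) :
    pd a (pd b f) = pd b (pd a f) := by
  funext x
  have hd : DifferentiableAt ℝ (fderiv ℝ f) x :=
    ((hf.fderiv_right (m := (⊤ : ℕ∞)) (by norm_cast)).differentiable (by simp)) x
  have h : ∀ c d : ι, pd c (pd d f) x =
      fderiv ℝ (fderiv ℝ f) x (Pi.single c 1) (Pi.single d 1) := by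
    intro c d
    unfold pd
    rw [fderiv_clm_apply hd (differentiableAt_const _)]
    simp
  rw [h, h]
  exact (hf.contDiffAt.isSymmSndFDerivAt (by
    rw [minSmoothness_of_isRCLikeNormedField]
    exact WithTop.coe_le_coe.2 (le_top : (2 : ℕ∞) ≤ ⊤))).eq _ _

lemma IsTest.differentiable {f : (ι → ℝ) → ℝ} (hf : IsTest f) : Differentiable ℝ f :=
  hf.1.differentiable (by simp)

lemma IsTest.deriv {f : (ι → ℝ) → ℝ} (hf : IsTest f) (a : ι) : IsTest (pd a f) :=
  ⟨contDiff_pd hf.1 a, (hf.2.fderiv ℝ).comp_left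
    (g := fun L : (ι → ℝ) →L[ℝ] ℝ => L (Pi.single a 1)) (by simp)⟩

lemma IsTest.tame {f : (ι → ℝ) → ℝ} (hf : IsTest f) : Tame f :=
  Tame.of_hasCompactSupport hf.1.continuous hf.2

lemma IsTest.hasPD {f : (ι → ℝ) → ℝ} (hf : IsTest f) (a : ι) : HasPD a f (pd a f) :=
  hasPD_pd hf.differentiable a

/-- The operator `∂_a^* ∂_a` with respect to `e^{-V}`. -/
def dirOp (V : (ι → ℝ) → ℝ) (a : ι) (f : (ι → ℝ) → ℝ) (x : ι → ℝ) : ℝ :=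
  -pd a (pd a f) x + pd a V x * pd a f x


end Calculus

section Mollifier

variable {ι : Type*} [Fintype ι] [DecidableEq ι]

/-- The convolution of `h` with a smooth kernel `ρ`. -/
def mol (ρ h : (ι → ℝ) → ℝ) (x : ι → ℝ) : ℝ := ∫ t, h t * ρ (x - t)

lemma mol_eq_convolution (ρ h : (ι → ℝ) → ℝ) :
    mol ρ h = MeasureTheory.convolution h ρ (ContinuousLinearMap.mul ℝ ℝ) volume := rfl

lemma LocallyIntegrable.mul_of_continuous {h f : (ι → ℝ) → ℝ} (hh : LocallyIntegrable h)
    (hf : Continuous f) : LocallyIntegrable (fun x => h x * f x) := by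
  rw [locallyIntegrable_iff] at hh ⊢
  exact fun k hk => (hh k hk).mul_continuousOn hf.continuousOn hk

lemma LocallyIntegrable.integrable_mul_of_compact {h f : (ι → ℝ) → ℝ} (hh : LocallyIntegrable h)
    (hf : Continuous f) (hs : HasCompactSupport f) : Integrable (fun x => h x * f x) :=
  hh.integrable_smul_right_of_hasCompactSupport hf hs

lemma IsTest.comp_sub_left {ρ : (ι → ℝ) → ℝ} (hρ : IsTest ρ) (x : ι → ℝ) :
    IsTest (fun t => ρ (x - t)) := by
  refine ⟨hρ.1.comp (contDiff_const.sub contDiff_id), ?_⟩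
  exact hρ.2.comp_homeomorph (Homeomorph.subLeft x)

lemma IsTest.integrable_kernel {ρ h : (ι → ℝ) → ℝ} (hρ : IsTest ρ) (hh : LocallyIntegrable h)
    (x : ι → ℝ) : Integrable (fun t => h t * ρ (x - t)) :=
  LocallyIntegrable.integrable_mul_of_compact hh (hρ.comp_sub_left x).1.continuous
    (hρ.comp_sub_left x).2

lemma contDiff_mol {ρ h : (ι → ℝ) → ℝ} (hρ : IsTest ρ) (hh : LocallyIntegrable h) :
    ContDiff ℝ (⊤ : ℕ∞) (mol ρ h) :=
  hρ.2.contDiff_convolution_right (ContinuousLinearMap.mul ℝ ℝ) hh hρ.1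

lemma pd_mol {ρ h : (ι → ℝ) → ℝ} (hρ : IsTest ρ) (hh : LocallyIntegrable h) (a : ι) :
    pd a (mol ρ h) = mol (pd a ρ) h := by
  funext x
  have h1 := hρ.2.hasFDerivAt_convolution_right (ContinuousLinearMap.mul ℝ ℝ) hh
    (hρ.1.of_le (by exact_mod_cast le_top)) x
  rw [← mol_eq_convolution] at h1
  unfold pd
  rw [h1.fderiv]
  exact convolution_precompR_apply (ContinuousLinearMap.mul ℝ ℝ) hh (hρ.2.fderiv ℝ)
    (hρ.1.continuous_fderiv (by simp)) x _

lemma pd_comp_sub_left {f : (ι → ℝ) → ℝ} (hf : Differentiable ℝ f) (a : ι) (x : ι → ℝ) :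
    pd a (fun t => f (x - t)) = fun t => -pd a f (x - t) := by
  funext t
  unfold pd
  have h : HasFDerivAt (fun t => f (x - t)) ((fderiv ℝ f (x - t)).comp
      (-ContinuousLinearMap.id ℝ (ι → ℝ))) t :=
    (hf (x - t)).hasFDerivAt.comp t ((hasFDerivAt_id t).const_sub x)
  rw [h.fderiv]
  simp

lemma fderiv_eq_zero_of_pd {f : (ι → ℝ) → ℝ} {x : ι → ℝ} (h : ∀ a, pd a f x = 0) :
    fderiv ℝ f x = 0 := by
  refine ContinuousLinearMap.coe_injective (LinearMap.pi_ext fun a t => ?_)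
  have : (Pi.single a t : ι → ℝ) = t • Pi.single a 1 := by
    rw [← Pi.single_smul]; simp
  rw [this, map_smul, map_smul]
  have := h a
  unfold pd at this
  simp [this]

/-- Smooth probability densities supported in small balls. -/
lemma exists_mollifier {r : ℝ} (hr : 0 < r) : ∃ ρ : (ι → ℝ) → ℝ, IsTest ρ ∧ (∀ x, 0 ≤ ρ x) ∧
    (∫ x, ρ x = 1) ∧ (∀ x, r ≤ ‖x‖ → ρ x = 0) ∧ (∀ x, ρ (-x) = ρ x) := by
  let φ : ContDiffBump (0 : ι → ℝ) := ⟨r / 2, r, by positivity, by linarith⟩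
  refine ⟨φ.normed volume, ⟨φ.contDiff_normed, φ.hasCompactSupport_normed⟩, φ.nonneg_normed,
    φ.integral_normed, fun x hx => ?_, φ.normed_neg⟩
  by_contra h
  have : x ∈ Function.support (φ.normed volume) := h
  rw [φ.support_normed_eq] at this
  simp [φ] at this
  linarith

/-- Smooth cutoffs with small gradient. -/
lemma exists_cutoff {η : ℝ} (hη : 0 < η) (R : ℝ) : ∃ χ : (ι → ℝ) → ℝ, IsTest χ ∧ (∀ x, 0 ≤ χ x) ∧
    (∀ x, χ x ≤ 1) ∧ (∀ x, ‖x‖ ≤ R → χ x = 1) ∧ ∀ a x, |pd a χ x| ≤ η := by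
  let φ : ContDiffBump (0 : ι → ℝ) := ⟨1, 2, by norm_num, by norm_num⟩
  have hφ : IsTest φ := ⟨φ.contDiff, φ.hasCompactSupport⟩
  obtain ⟨K, hK⟩ : ∃ K, ∀ a x, |pd a φ x| ≤ K := by
    have : ∀ a, ∃ K, ∀ x, |pd a φ x| ≤ K := fun a => by
      obtain ⟨K, hK⟩ := (hφ.deriv a).1.continuous.bounded_above_of_compact_support (hφ.deriv a).2
      exact ⟨K, hK⟩
    choose K hK using this
    exact ⟨∑ a, |K a|, fun a x => ((hK a x).trans (le_abs_self _)).trans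
      (Finset.single_le_sum (f := fun a => |K a|) (fun _ _ => abs_nonneg _) (Finset.mem_univ a))⟩
  set S : ℝ := max (max 1 R) (|K| / η) with hS
  have hS1 : 1 ≤ S := (le_max_left _ _).trans (le_max_left _ _)
  have hS0 : 0 < S := by linarith
  have hSR : R ≤ S := (le_max_right _ _).trans (le_max_left _ _)
  have hSK : |K| / η ≤ S := le_max_right _ _
  refine ⟨fun x => φ (S⁻¹ • x), ⟨hφ.1.comp (contDiff_const_smul _), ?_⟩, fun x => φ.nonneg,
    fun x => φ.le_one, fun x hx => φ.one_of_mem_closedBall ?_, fun a x => ?_⟩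
  · exact hφ.2.comp_homeomorph (Homeomorph.smulOfNeZero S⁻¹ (by positivity))
  · simp only [mem_closedBall_zero_iff, norm_smul, norm_inv, Real.norm_eq_abs, abs_of_pos hS0, φ]
    rw [inv_mul_le_iff₀ hS0]; linarith
  · have : pd a (fun x => φ (S⁻¹ • x)) x = S⁻¹ * pd a φ (S⁻¹ • x) := by
      unfold pd
      rw [fderiv_comp_smul]
      simp
    rw [this, abs_mul, abs_of_pos (by positivity : 0 < S⁻¹), inv_mul_le_iff₀ hS0]
    calc |pd a φ (S⁻¹ • x)| ≤ |K| := (hK a _).trans (le_abs_self _)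
      _ ≤ S * η := by rwa [div_le_iff₀ hη] at hSK

/-- A function with vanishing weak gradient is constant. -/
lemma ae_const_of_weak_pd_eq_zero {w : (ι → ℝ) → ℝ} (hw : LocallyIntegrable w)
    (h : ∀ ξ, IsTest ξ → ∀ a, ∫ x, w x * pd a ξ x = 0) : ∃ c, w =ᵐ[volume] fun _ => c := by
  let φ : ℕ → ContDiffBump (0 : ι → ℝ) := fun k =>
    ⟨1 / (k + 1) / 2, 1 / (k + 1), by positivity, by
      have : (0 : ℝ) < 1 / (k + 1) := by positivity
      linarith⟩
  have hae := ContDiffBump.ae_convolution_tendsto_right_of_locallyIntegrable (μ := volume)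
    (φ := φ) (l := atTop) (K := 2) (g := w) tendsto_one_div_add_atTop_nhds_zero_nat
    (Eventually.of_forall fun k => by simp only [φ]; linarith) hw
  have hc : ∀ k, ∃ c, ∀ x, mol ((φ k).normed volume) w x = c := by
    intro k
    have ht : IsTest ((φ k).normed (volume : Measure (ι → ℝ))) :=
      ⟨(φ k).contDiff_normed, (φ k).hasCompactSupport_normed⟩
    have hd : Differentiable ℝ (mol ((φ k).normed volume) w) :=
      (contDiff_mol ht hw).differentiable (by simp)
    refine ⟨mol ((φ k).normed volume) w 0, fun x =>
      is_const_of_fderiv_eq_zero (𝕜 := ℝ) hd (fun y => ?_) x 0⟩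
    refine fderiv_eq_zero_of_pd fun a => ?_
    have h1 := congrFun (pd_mol ht hw a) y
    have h2 := h _ (ht.comp_sub_left y) a
    rw [pd_comp_sub_left ht.differentiable] at h2
    simp only [mul_neg, integral_neg, neg_eq_zero] at h2
    have h3 : mol (pd a ((φ k).normed volume)) w y = 0 := h2
    rwa [h3] at h1
  choose c hc using hc
  have hae' : ∀ᵐ x, Tendsto c atTop (𝓝 (w x)) := by
    filter_upwards [hae] with x hx
    refine hx.congr fun k => ?_
    rw [← hc k x, convolution_lsmul_swap]
    unfold mol
    simp [mul_comm]
  obtain ⟨x₀, hx₀⟩ := hae'.exists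
  refine ⟨w x₀, ?_⟩
  filter_upwards [hae'] with x hx using tendsto_nhds_unique hx hx₀

end Mollifier

section Energy

variable {ι : Type*} [Fintype ι] [DecidableEq ι]

lemma exists_modulus {f : (ι → ℝ) → ℝ} (hf : Continuous f) (R : ℝ) {η : ℝ} (hη : 0 < η) :
    ∃ r, 0 < r ∧ ∀ x, ‖x‖ ≤ R → ∀ t, ‖x - t‖ < r → |f t - f x| ≤ η := by
  have hu := (isCompact_closedBall (0 : ι → ℝ) (R + 1)).uniformContinuousOn_of_continuous
    hf.continuousOn
  rw [Metric.uniformContinuousOn_iff] at hu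
  obtain ⟨r, hr, h⟩ := hu η hη
  refine ⟨min r 1, lt_min hr one_pos, fun x hx t ht => ?_⟩
  have h1 : ‖x - t‖ < r := ht.trans_le (min_le_left _ _)
  have h2 : ‖x - t‖ < 1 := ht.trans_le (min_le_right _ _)
  have h3 : ‖t‖ ≤ R + 1 := by
    have : ‖t‖ ≤ ‖x‖ + ‖x - t‖ := norm_le_insert x t
    linarith
  have := h t (by simpa using h3) x (by simp; linarith) (by rwa [dist_comm, dist_eq_norm])
  rw [Real.dist_eq] at this
  exact this.le

lemma sq_mol_le {V w m ρ : (ι → ℝ) → ℝ} {r ω : ℝ} {x : ι → ℝ} (hV : Continuous V)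
    (hw2 : Integrable fun t => w t ^ 2 * Real.exp (-V t))
    (hh : LocallyIntegrable fun t => w t * Real.exp (-V t)) (hm : Continuous m)
    (hρ : IsTest ρ) (hρ0 : ∀ x, 0 ≤ ρ x) (hρ1 : ∫ x, ρ x = 1) (hρr : ∀ x, r ≤ ‖x‖ → ρ x = 0)
    (hmω : ∀ t, ‖x - t‖ < r → |m t| ≤ ω)
    (hVx : ∀ t, ‖x - t‖ < r → Real.exp (-V t) ≤ 2 * Real.exp (-V x)) :
    (∫ t, w t * Real.exp (-V t) * m t * ρ (x - t)) ^ 2 ≤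
      2 * ω ^ 2 * Real.exp (-V x) * mol ρ (fun t => w t ^ 2 * Real.exp (-V t)) x := by
  set f : (ι → ℝ) → ℝ := fun t => w t * Real.exp (-V t) * m t with hf
  have hfl : LocallyIntegrable f := LocallyIntegrable.mul_of_continuous hh hm
  have hf2l : LocallyIntegrable fun t => f t ^ 2 := by
    have : LocallyIntegrable fun t => (w t ^ 2 * Real.exp (-V t)) * (Real.exp (-V t) * m t ^ 2) :=
      LocallyIntegrable.mul_of_continuous hw2.locallyIntegrable
        ((Real.continuous_exp.comp hV.neg).mul (hm.pow 2))
    refine this.congr (ae_of_all _ fun t => ?_)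
    simp only [hf]; ring
  have i0 : Integrable (fun t => ρ (x - t)) :=
    (hρ.comp_sub_left x).1.continuous.integrable_of_hasCompactSupport (hρ.comp_sub_left x).2
  have i1 : Integrable (fun t => f t * ρ (x - t)) := hρ.integrable_kernel hfl x
  have i2 : Integrable (fun t => f t ^ 2 * ρ (x - t)) := hρ.integrable_kernel hf2l x
  set c := ∫ t, f t * ρ (x - t) with hc
  have e0 : ∫ t, ρ (x - t) = 1 := by rw [integral_sub_left_eq_self]; exact hρ1
  have hvar : 0 ≤ ∫ t, (f t - c) ^ 2 * ρ (x - t) :=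
    integral_nonneg fun t => mul_nonneg (sq_nonneg _) (hρ0 _)
  have hexp : ∫ t, (f t - c) ^ 2 * ρ (x - t) = (∫ t, f t ^ 2 * ρ (x - t)) - c ^ 2 := by
    have : (fun t => (f t - c) ^ 2 * ρ (x - t)) = fun t =>
        (f t ^ 2 * ρ (x - t) - 2 * c * (f t * ρ (x - t))) + c ^ 2 * ρ (x - t) := by
      funext t; ring
    have i3 : Integrable fun t => f t ^ 2 * ρ (x - t) - 2 * c * (f t * ρ (x - t)) :=
      i2.sub (i1.const_mul _)
    rw [this, integral_add i3 (i0.const_mul _),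
      integral_sub i2 (i1.const_mul _), integral_const_mul, integral_const_mul, e0, ← hc]
    ring
  have hle : ∫ t, f t ^ 2 * ρ (x - t) ≤
      ∫ t, (2 * ω ^ 2 * Real.exp (-V x)) * (w t ^ 2 * Real.exp (-V t) * ρ (x - t)) := by
    refine integral_mono i2 ((hρ.integrable_kernel hw2.locallyIntegrable x).const_mul _)
      fun t => ?_
    by_cases ht : ‖x - t‖ < r
    · have h1 : m t ^ 2 ≤ ω ^ 2 := sq_le_sq' (by linarith [neg_abs_le (m t), hmω t ht])
        ((le_abs_self _).trans (hmω t ht))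
      have h2 := hVx t ht
      have h3 : Real.exp (-V t) * m t ^ 2 ≤ 2 * Real.exp (-V x) * ω ^ 2 := by gcongr
      have h4 : 0 ≤ w t ^ 2 * Real.exp (-V t) * ρ (x - t) :=
        mul_nonneg (by positivity) (hρ0 _)
      simp only [hf]
      nlinarith [mul_le_mul_of_nonneg_left h3 h4]
    · simp [hρr _ (not_lt.1 ht)]
  rw [integral_const_mul] at hle
  unfold mol
  linarith

set_option maxHeartbeats 1000000 in
/-- Interior energy estimate for mollified weak solutions. -/
lemma exists_energy_bound {V w : (ι → ℝ) → ℝ} (hV : ContDiff ℝ (⊤ : ℕ∞) V)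
    (hw2 : Integrable fun t => w t ^ 2 * Real.exp (-V t))
    (hh : LocallyIntegrable fun t => w t * Real.exp (-V t))
    (hweak : ∀ ξ, IsTest ξ → ∫ x, w x * Real.exp (-V x) * ∑ a, dirOp V a ξ x = 0)
    {η : ℝ} (hη : 0 < η) (R : ℝ) {r₀ : ℝ} (hr₀ : 0 < r₀) :
    ∃ ρ χ : (ι → ℝ) → ℝ, IsTest ρ ∧ (∀ x, 0 ≤ ρ x) ∧ (∫ x, ρ x = 1) ∧
      (∀ x, r₀ ≤ ‖x‖ → ρ x = 0) ∧ (∀ x, ρ (-x) = ρ x) ∧ IsTest χ ∧ (∀ x, ‖x‖ ≤ R → χ x = 1) ∧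
      ∑ a, ∫ x, Real.exp (-V x) *
        pd a (fun y => χ y * (mol ρ (fun t => w t * Real.exp (-V t)) y * Real.exp (V y))) x ^ 2 ≤
        10 * Fintype.card ι * η ^ 2 * ∫ t, w t ^ 2 * Real.exp (-V t) := by
  obtain ⟨χ, hχ, hχ0, hχ1, hχR, hχd⟩ := exists_cutoff (ι := ι) hη R
  obtain ⟨R', hR'⟩ : ∃ R', ∀ x ∈ tsupport χ, ‖x‖ ≤ R' := hχ.2.isBounded.exists_norm_le
  obtain ⟨r₁, hr₁, hmod₁⟩ := exists_modulus hV.continuous R' (η := Real.log 2)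
    (Real.log_pos one_lt_two)
  obtain ⟨r₂, hr₂, hmod₂⟩ : ∃ r, 0 < r ∧ ∀ a x, ‖x‖ ≤ R' → ∀ t, ‖x - t‖ < r →
      |pd a V t - pd a V x| ≤ η := by
    choose r hr h using fun a : ι => exists_modulus (contDiff_pd hV a).continuous R' hη
    obtain ⟨r', hr', h'⟩ : ∃ r', 0 < r' ∧ ∀ a, r' ≤ r a := by
      rcases isEmpty_or_nonempty ι with hι | hι
      · exact ⟨1, one_pos, fun a => (hι.false a).elim⟩
      · exact ⟨Finset.univ.inf' Finset.univ_nonempty r,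
          (Finset.lt_inf'_iff _).2 fun a _ => hr a, fun a => Finset.inf'_le _ (Finset.mem_univ a)⟩
    exact ⟨r', hr', fun a x hx t ht => h a x hx t (ht.trans_le (h' a))⟩
  set r := min r₀ (min r₁ r₂)
  have hr : 0 < r := lt_min hr₀ (lt_min hr₁ hr₂)
  obtain ⟨ρ, hρ, hρ0, hρ1, hρr, hρe⟩ := exists_mollifier (ι := ι) hr
  refine ⟨ρ, χ, hρ, hρ0, hρ1, fun x hx => hρr x ((min_le_left _ _).trans hx), hρe, hχ, hχR, ?_⟩
  set h : (ι → ℝ) → ℝ := fun t => w t * Real.exp (-V t) with hhdef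
  set W := ∫ t, w t ^ 2 * Real.exp (-V t) with hW
  have hVc := hV.continuous
  have hVd : Differentiable ℝ V := hV.differentiable (by simp)
  set he : (ι → ℝ) → ℝ := mol ρ h with hhe
  have hheC : ContDiff ℝ (⊤ : ℕ∞) he := contDiff_mol hρ hh
  set we : (ι → ℝ) → ℝ := fun y => he y * Real.exp (V y) with hwe
  have hweC : ContDiff ℝ (⊤ : ℕ∞) we := hheC.mul (Real.contDiff_exp.comp hV)
  set u : (ι → ℝ) → ℝ := fun y => χ y * we y with hu
  have huT : IsTest u := ⟨hχ.1.mul hweC, hχ.2.mul_right⟩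
  have hhV : ∀ a, LocallyIntegrable fun t => h t * pd a V t := fun a =>
    LocallyIntegrable.mul_of_continuous hh (contDiff_pd hV a).continuous
  set k : ι → (ι → ℝ) → ℝ := fun a => mol ρ fun t => h t * pd a V t with hk
  have hkC : ∀ a, ContDiff ℝ (⊤ : ℕ∞) (k a) := fun a => contDiff_mol hρ (hhV a)
  -- the divergence identity
  have hdiv : ∀ x, ∑ a, (pd a (pd a he) x + pd a (k a) x) = 0 := by
    intro x
    have h1 := hweak _ (hρ.comp_sub_left x)
    have h2 : ∀ a, ∀ t, dirOp V a (fun t => ρ (x - t)) t =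
        -(pd a (pd a ρ) (x - t) + pd a V t * pd a ρ (x - t)) := by
      intro a t
      unfold dirOp
      rw [pd_comp_sub_left hρ.differentiable]
      have : pd a (fun t => -pd a ρ (x - t)) t = pd a (pd a ρ) (x - t) := by
        have h3 := ((hasPD_pd ((hρ.deriv a).comp_sub_left x).differentiable a).neg).pd_eq
          (((hρ.deriv a).comp_sub_left x).differentiable.fun_neg)
        rw [h3, pd_comp_sub_left (hρ.deriv a).differentiable]
        simp
      rw [this]; ring
    simp_rw [h2, Finset.mul_sum] at h1
    have i1 : ∀ a, Integrable fun t => h t * pd a (pd a ρ) (x - t) := fun a =>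
      ((hρ.deriv a).deriv a).integrable_kernel hh x
    have i2 : ∀ a, Integrable fun t => h t * pd a V t * pd a ρ (x - t) := fun a =>
      (hρ.deriv a).integrable_kernel (hhV a) x
    have e1 : ∀ a, (fun t => w t * Real.exp (-V t) *
        -(pd a (pd a ρ) (x - t) + pd a V t * pd a ρ (x - t))) = fun t =>
        -(h t * pd a (pd a ρ) (x - t) + h t * pd a V t * pd a ρ (x - t)) := by
      intro a; funext t; simp only [hhdef]; ring
    have i3 : ∀ a, Integrable fun t =>
        -(h t * pd a (pd a ρ) (x - t) + h t * pd a V t * pd a ρ (x - t)) := fun a =>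
      ((i1 a).add (i2 a)).neg
    rw [integral_finsetSum _ fun a _ => (e1 a ▸ i3 a)] at h1
    simp_rw [e1] at h1
    rw [← neg_eq_zero, ← Finset.sum_neg_distrib, ← h1]
    refine Finset.sum_congr rfl fun a _ => ?_
    rw [integral_neg, integral_add (i1 a) (i2 a), hhe, hk, pd_mol hρ hh,
      pd_mol (hρ.deriv a) hh, pd_mol hρ (hhV a)]
    rfl
  -- derivative formulas
  have dwe : ∀ a x, pd a we x = (pd a he x + he x * pd a V x) * Real.exp (V x) := by
    intro a x
    have h1 := ((hasPD_pd (hheC.differentiable (by simp)) a).mul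
      ((hasPD_pd hVd a).comp (q := Real.exp) (q' := Real.exp) fun x => Real.hasDerivAt_exp _))
    rw [h1.pd_eq (hweC.differentiable (by simp))]
    ring
  have du : ∀ a x, pd a u x = pd a χ x * we x + χ x * pd a we x := by
    intro a x
    rw [((hasPD_pd hχ.differentiable a).mul
      (hasPD_pd (hweC.differentiable (by simp)) a)).pd_eq huT.differentiable]
  have hζT : IsTest fun x => χ x * u x := ⟨hχ.1.mul huT.1, hχ.2.mul_right⟩
  have dζ : ∀ a x, pd a (fun x => χ x * u x) x = χ x * (pd a u x + pd a χ x * we x) := by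
    intro a x
    rw [((hasPD_pd hχ.differentiable a).mul (huT.hasPD a)).pd_eq hζT.differentiable]
    simp only [hu]; ring
  set J : ι → (ι → ℝ) → ℝ := fun a x => pd a he x + k a x with hJ
  have hJC : ∀ a, ContDiff ℝ (⊤ : ℕ∞) (J a) := fun a => (contDiff_pd hheC a).add (hkC a)
  have dJ : ∀ a x, pd a (J a) x = pd a (pd a he) x + pd a (k a) x := by
    intro a x
    rw [((hasPD_pd ((contDiff_pd hheC a).differentiable (by simp)) a).add
      (hasPD_pd ((hkC a).differentiable (by simp)) a)).pd_eq ((hJC a).differentiable (by simp))]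
  have cint : ∀ {f : (ι → ℝ) → ℝ} {g : (ι → ℝ) → ℝ}, Continuous f → IsTest g →
      Integrable fun x => f x * g x := fun hf hg =>
    (hf.mul hg.1.continuous).integrable_of_hasCompactSupport hg.2.mul_left
  have hflux : ∑ a, ∫ x, J a x * pd a (fun x => χ x * u x) x = 0 := by
    have h1 : ∀ a, ∫ x, J a x * pd a (fun x => χ x * u x) x =
        -∫ x, pd a (J a) x * (χ x * u x) := fun a =>
      integral_mul_fderiv_eq_neg_fderiv_mul_of_integrable
        (cint (contDiff_pd (hJC a) a).continuous hζT) (cint (hJC a).continuous (hζT.deriv a))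
        (cint (hJC a).continuous hζT) (fun x _ => (hJC a).differentiable (by simp) x)
        (fun x _ => hζT.differentiable x)
    simp_rw [h1, Finset.sum_neg_distrib]
    rw [← integral_finsetSum _ fun a _ => cint (contDiff_pd (hJC a) a).continuous hζT]
    simp_rw [← Finset.sum_mul, dJ, hdiv]
    simp
  set c : ι → (ι → ℝ) → ℝ := fun a x => he x * pd a V x - k a x with hcdef
  have hcC : ∀ a, Continuous (c a) := fun a =>
    (hheC.continuous.mul (contDiff_pd hV a).continuous).sub (hkC a).continuous
  have Jeq : ∀ a x, J a x = Real.exp (-V x) * pd a we x - c a x := by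
    intro a x
    rw [dwe]
    simp only [hJ, hcdef]
    have : Real.exp (-V x) * ((pd a he x + he x * pd a V x) * Real.exp (V x)) =
        (pd a he x + he x * pd a V x) := by
      rw [mul_comm, mul_assoc, ← Real.exp_add]; simp
    rw [this]; ring
  -- local bounds
  set P := mol ρ fun t => w t ^ 2 * Real.exp (-V t) with hP
  have hPi : Integrable P :=
    hw2.integrable_convolution (ContinuousLinearMap.mul ℝ ℝ)
      (hρ.1.continuous.integrable_of_hasCompactSupport hρ.2)
  have hPint : ∫ x, P x = W := by
    have := integral_convolution (ContinuousLinearMap.mul ℝ ℝ) (μ := volume) (ν := volume) hw2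
      (hρ.1.continuous.integrable_of_hasCompactSupport (μ := volume) hρ.2)
    rw [ContinuousLinearMap.mul_apply', hρ1, mul_one] at this
    exact this
  have hP0 : ∀ x, 0 ≤ P x := fun x =>
    integral_nonneg fun t => mul_nonneg (by positivity) (hρ0 _)
  have hexpV : ∀ x ∈ tsupport χ, ∀ t, ‖x - t‖ < r → Real.exp (-V t) ≤ 2 * Real.exp (-V x) := by
    intro x hx t ht
    have h1 := hmod₁ x (hR' x hx) t
      (ht.trans_le ((min_le_right _ _).trans (min_le_left _ _)))
    have h2 : (2 : ℝ) * Real.exp (-V x) = Real.exp (Real.log 2 + -V x) := by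
      rw [Real.exp_add, Real.exp_log two_pos]
    rw [h2]
    exact Real.exp_le_exp.2 (by linarith [neg_abs_le (V t - V x)])
  have hebd : ∀ x ∈ tsupport χ, he x ^ 2 ≤ 2 * Real.exp (-V x) * P x := by
    intro x hx
    have := sq_mol_le (m := fun _ => 1) (ω := 1) hVc hw2 hh continuous_const hρ hρ0 hρ1 hρr
      (fun t _ => by simp) (hexpV x hx)
    simpa [hhe, hP, mol, hhdef] using this
  have hcbd : ∀ a, ∀ x ∈ tsupport χ, c a x ^ 2 ≤ 2 * η ^ 2 * Real.exp (-V x) * P x := by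
    intro a x hx
    have := sq_mol_le (m := fun t => pd a V x - pd a V t) (ω := η) hVc hw2 hh
      (continuous_const.sub (contDiff_pd hV a).continuous) hρ hρ0 hρ1 hρr
      (fun t ht => by
        rw [abs_sub_comm]
        exact hmod₂ a x (hR' x hx) t (ht.trans_le ((min_le_right _ _).trans (min_le_right _ _))))
      (hexpV x hx)
    have e : c a x = ∫ t, w t * Real.exp (-V t) * (pd a V x - pd a V t) * ρ (x - t) := by
      have i1 := (hρ.integrable_kernel hh x).mul_const (pd a V x)
      have i2 := hρ.integrable_kernel (hhV a) x
      simp only [hcdef, hhe, hk, mol]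
      rw [← integral_mul_const, ← integral_sub i1 i2]
      congr 1; funext t; simp only [hhdef]; ring
    rw [e]; exact this
  -- pointwise inequality
  have hpt : ∀ a x, 1 / 2 * (Real.exp (-V x) * pd a u x ^ 2) ≤
      J a x * pd a (fun x => χ x * u x) x + 5 * η ^ 2 * P x := by
    intro a x
    set q := Real.exp (-V x) with hq
    have hq0 : 0 < q := Real.exp_pos _
    have hqe : q * Real.exp (V x) = 1 := by rw [hq, ← Real.exp_add]; simp
    by_cases hx : x ∈ tsupport χ
    · rw [dζ, Jeq]
      have hχpd : χ x * pd a we x = pd a u x - pd a χ x * we x := by rw [du]; ring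
      have h1 : (q * pd a we x - c a x) * (χ x * (pd a u x + pd a χ x * we x)) =
          q * (pd a u x ^ 2 - (pd a χ x * we x) ^ 2) -
            c a x * χ x * (pd a u x + pd a χ x * we x) := by
        linear_combination q * (pd a u x + pd a χ x * we x) * hχpd
      rw [h1]
      set U := pd a u x
      set Z := pd a χ x * we x with hZ
      set d := c a x * χ x with hd
      have hZb : q * Z ^ 2 ≤ 2 * η ^ 2 * P x := by
        have h2 : q * we x ^ 2 ≤ 2 * P x := by
          have h3 : q * we x ^ 2 = he x ^ 2 * Real.exp (V x) := by
            simp only [hwe]; linear_combination he x ^ 2 * Real.exp (V x) * hqe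
          rw [h3]
          calc he x ^ 2 * Real.exp (V x) ≤ 2 * q * P x * Real.exp (V x) := by
                gcongr; exact hebd x hx
            _ = 2 * P x := by linear_combination 2 * P x * hqe
        have h4 : pd a χ x ^ 2 ≤ η ^ 2 := sq_le_sq' (by linarith [neg_abs_le (pd a χ x), hχd a x])
          ((le_abs_self _).trans (hχd a x))
        calc q * Z ^ 2 = pd a χ x ^ 2 * (q * we x ^ 2) := by rw [hZ]; ring
          _ ≤ η ^ 2 * (2 * P x) := by gcongr
          _ = _ := by ring
      have hdb : d ^ 2 * Real.exp (V x) ≤ 2 * η ^ 2 * P x := by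
        have h5 : d ^ 2 ≤ c a x ^ 2 := by
          rw [hd, mul_pow]
          have : χ x ^ 2 ≤ 1 := pow_le_one₀ (hχ0 x) (hχ1 x)
          nlinarith [sq_nonneg (c a x)]
        calc d ^ 2 * Real.exp (V x) ≤ (2 * η ^ 2 * q * P x) * Real.exp (V x) := by
              gcongr; exact h5.trans (hcbd a x hx)
          _ = _ := by linear_combination 2 * η ^ 2 * P x * hqe
      have hcross : d * (U + Z) ≤ 1 / 2 * (q * U ^ 2) + 1 / 2 * (q * Z ^ 2) +
          d ^ 2 * Real.exp (V x) := by
        set E := Real.exp (V x)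
        have hE0 : 0 < E := Real.exp_pos _
        have h7 : 0 ≤ q * (1 / 2 * (U + Z) - d * E) ^ 2 := by positivity
        have h8 : q * (1 / 2 * (U + Z) - d * E) ^ 2 =
            q * ((U + Z) ^ 2 / 4) - d * (U + Z) + d ^ 2 * E := by
          linear_combination (-(d * (U + Z)) + d ^ 2 * E) * hqe
        have h9 : 0 ≤ q * (U - Z) ^ 2 := by positivity
        linear_combination h7 + h8 + h9 / 4
      nlinarith [hP0 x]
    · have h0 : χ x = 0 := image_eq_zero_of_notMem_tsupport hx
      have h1 : pd a χ x = 0 := by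
        have : x ∉ tsupport (fderiv ℝ χ) := fun h' => hx (tsupport_fderiv_subset ℝ h')
        unfold pd
        rw [image_eq_zero_of_notMem_tsupport this]; simp
      rw [dζ, du, h0, h1]
      have := hP0 x
      simp
      positivity
  have hfin : ∀ a, 1 / 2 * ∫ x, Real.exp (-V x) * pd a u x ^ 2 ≤
      (∫ x, J a x * pd a (fun x => χ x * u x) x) + 5 * η ^ 2 * W := by
    intro a
    have i1 : Integrable fun x => Real.exp (-V x) * pd a u x ^ 2 := by
      have := cint ((Real.continuous_exp.comp hVc.neg).mul (huT.deriv a).1.continuous) (huT.deriv a)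
      refine this.congr (ae_of_all _ fun x => ?_)
      simp; ring
    have i2 := cint (hJC a).continuous (hζT.deriv a)
    rw [← integral_const_mul, ← hPint, ← integral_const_mul, ← integral_add i2 (hPi.const_mul _)]
    exact integral_mono (i1.const_mul _) (i2.add (hPi.const_mul _)) (hpt a)
  have := Finset.sum_le_sum fun a (_ : a ∈ Finset.univ) => hfin a
  rw [← Finset.mul_sum, Finset.sum_add_distrib, hflux] at this
  simp only [Finset.sum_const, Finset.card_univ, nsmul_eq_mul] at this
  linarith

end Energy

section Density

variable {ι : Type*} [Fintype ι] [DecidableEq ι]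

/-- Testing a mollified integrable function against a continuous function of small oscillation. -/
lemma abs_integral_mol_sub_le {h ψ ρ : (ι → ℝ) → ℝ} {r δ : ℝ} (hh : Integrable h)
    (hψ : Continuous ψ) (hψc : HasCompactSupport ψ) (hρ : IsTest ρ) (hρ0 : ∀ x, 0 ≤ ρ x)
    (hρ1 : ∫ x, ρ x = 1) (hρr : ∀ x, r ≤ ‖x‖ → ρ x = 0)
    (hδ : ∀ x y, ‖x - y‖ < r → |ψ x - ψ y| ≤ δ) :
    |(∫ x, mol ρ h x * ψ x) - ∫ x, h x * ψ x| ≤ δ * ∫ x, |h x| := by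
  obtain ⟨C, hC⟩ := hψ.bounded_above_of_compact_support hψc
  have hρi : Integrable ρ := hρ.1.continuous.integrable_of_hasCompactSupport hρ.2
  have hprod : Integrable (Function.uncurry fun x t : ι → ℝ => ψ x * (h t * ρ (x - t)))
      (volume.prod volume) :=
    Integrable.bdd_mul (c := C)
      (Integrable.convolution_integrand (ContinuousLinearMap.mul ℝ ℝ) hh hρi)
      (hψ.comp continuous_fst).aestronglyMeasurable (ae_of_all _ fun p => hC _)
  have e1 : ∫ x, mol ρ h x * ψ x = ∫ t, h t * ∫ x, ψ x * ρ (x - t) := by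
    calc ∫ x, mol ρ h x * ψ x = ∫ x, ∫ t, ψ x * (h t * ρ (x - t)) := by
          congr 1; funext x; rw [integral_const_mul, mul_comm]; rfl
      _ = ∫ t, ∫ x, ψ x * (h t * ρ (x - t)) := integral_integral_swap hprod
      _ = _ := by
          congr 1; funext t; rw [← integral_const_mul]; congr 1; funext x; ring
  have i1 : Integrable fun t => h t * ∫ x, ψ x * ρ (x - t) := by
    have := hprod.swap.integral_prod_left
    refine this.congr (ae_of_all _ fun t => ?_)
    simp only [Function.comp, Function.uncurry, Prod.swap]
    rw [← integral_const_mul]; congr 1; funext x; ring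
  have i2 : Integrable fun t => h t * ψ t :=
    hh.mul_bdd (c := C) hψ.aestronglyMeasurable (ae_of_all _ hC)
  rw [e1, ← integral_sub i1 i2, ← integral_const_mul]
  refine (abs_integral_le_integral_abs).trans (integral_mono (i1.sub i2).abs (hh.abs.const_mul _)
    fun t => ?_)
  have hsm : ∀ x, ρ (x - t) = ρ (x + -t) := fun x => by rw [sub_eq_add_neg]
  have ρi : Integrable fun x => ρ (x - t) := hρi.comp_sub_right t
  have ρ1 : ∫ x, ρ (x - t) = 1 := by rw [integral_sub_right_eq_self]; exact hρ1
  have i3 : Integrable fun x => ψ x * ρ (x - t) :=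
    Integrable.bdd_mul (c := C) ρi hψ.aestronglyMeasurable (ae_of_all _ hC)
  have hb : |(∫ x, ψ x * ρ (x - t)) - ψ t| ≤ δ := by
    have : (∫ x, ψ x * ρ (x - t)) - ψ t = ∫ x, (ψ x * ρ (x - t) - ψ t * ρ (x - t)) := by
      rw [integral_sub i3 (ρi.const_mul _), integral_const_mul, ρ1, mul_one]
    rw [this]
    refine (abs_integral_le_integral_abs).trans ?_
    calc ∫ x, |ψ x * ρ (x - t) - ψ t * ρ (x - t)| ≤ ∫ x, δ * ρ (x - t) := by
          refine integral_mono (i3.sub (ρi.const_mul _)).abs (ρi.const_mul _) fun x => ?_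
          rw [← sub_mul, abs_mul, abs_of_nonneg (hρ0 _)]
          by_cases hx : ‖x - t‖ < r
          · exact mul_le_mul_of_nonneg_right (hδ x t hx) (hρ0 _)
          · simp [hρr _ (not_lt.1 hx)]
      _ = δ := by rw [integral_const_mul, ρ1, mul_one]
  show |h t * (∫ x, ψ x * ρ (x - t)) - h t * ψ t| ≤ δ * |h t|
  rw [← mul_sub, abs_mul, mul_comm]
  exact mul_le_mul_of_nonneg_right hb (abs_nonneg _)

lemma IsTest.exists_supp_bound {ξ : (ι → ℝ) → ℝ} (hξ : IsTest ξ) :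
    ∃ R, ∀ x, R < ‖x‖ → ξ x = 0 := by
  obtain ⟨R, hR⟩ := hξ.2.isBounded.exists_norm_le
  exact ⟨R, fun x hx => image_eq_zero_of_notMem_tsupport fun h => absurd (hR x h) (not_le.2 hx)⟩

/-- Weak solutions in the weighted `L²` space are constant: the operator is essentially
self-adjoint and its kernel is trivial. -/
theorem ae_const_of_weak {V w : (ι → ℝ) → ℝ} (hV : ContDiff ℝ (⊤ : ℕ∞) V)
    (hVi : Integrable fun t => Real.exp (-V t))
    (hw : AEStronglyMeasurable w) (hw2 : Integrable fun t => w t ^ 2 * Real.exp (-V t))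
    (hweak : ∀ ξ, IsTest ξ → ∫ x, w x * Real.exp (-V x) * ∑ a, dirOp V a ξ x = 0) :
    ∃ c, w =ᵐ[volume] fun _ => c := by
  have hVc := hV.continuous
  set h : (ι → ℝ) → ℝ := fun t => w t * Real.exp (-V t) with hh
  have hhi : Integrable h := by
    refine (hw2.add hVi).mono' (hw.mul
      (Real.continuous_exp.comp hVc.neg).aestronglyMeasurable) (ae_of_all _ fun t => ?_)
    simp only [hh, Pi.add_apply, norm_mul, Real.norm_eq_abs, abs_of_pos (Real.exp_pos _)]
    have := Real.exp_pos (-V t)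
    nlinarith [sq_nonneg (|w t| - 1), sq_abs (w t), sq_nonneg (w t)]
  have hwh : ∀ x, w x = h x * Real.exp (V x) := fun x => by
    simp only [hh]; rw [mul_assoc, ← Real.exp_add]; simp
  have hwl : LocallyIntegrable w :=
    (LocallyIntegrable.mul_of_continuous hhi.locallyIntegrable
      (Real.continuous_exp.comp hVc)).congr (ae_of_all _ fun x => (hwh x).symm)
  refine ae_const_of_weak_pd_eq_zero hwl fun ξ hξ a => ?_
  set ψ : (ι → ℝ) → ℝ := fun x => Real.exp (V x) * pd a ξ x with hψd
  have hψ : Continuous ψ := (Real.continuous_exp.comp hVc).mul (hξ.deriv a).1.continuous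
  have hψc : HasCompactSupport ψ := (hξ.deriv a).2.mul_left
  have hgoal : ∫ x, w x * pd a ξ x = ∫ x, h x * ψ x := by
    congr 1; funext x; rw [hwh]; simp only [hψd]; ring
  rw [hgoal]
  obtain ⟨R, hR⟩ := hξ.exists_supp_bound
  obtain ⟨R', hR'⟩ := (hξ.deriv a).exists_supp_bound
  set W := ∫ t, w t ^ 2 * Real.exp (-V t) with hW
  set X := ∫ x, Real.exp (V x) * ξ x ^ 2 with hX
  set B := (∫ x, |h x|) + 5 * Fintype.card ι * W + X / 2 with hB
  have hW0 : 0 ≤ W := integral_nonneg fun x => by positivity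
  have hX0 : 0 ≤ X := integral_nonneg fun x => by positivity
  have hB0 : 0 ≤ B := by
    have : 0 ≤ ∫ x, |h x| := integral_nonneg fun x => abs_nonneg _
    positivity
  have main : ∀ δ, 0 < δ → |∫ x, h x * ψ x| ≤ δ * B := by
    intro δ hδ
    obtain ⟨r₀, hr₀, hr⟩ := Metric.uniformContinuous_iff.1
      (hψc.uniformContinuous_of_continuous hψ) δ hδ
    obtain ⟨ρ, χ, hρ, hρ0, hρ1, hρr, -, hχ, hχ1, hE⟩ :=
      exists_energy_bound hV hw2 hhi.locallyIntegrable hweak hδ (max R R') hr₀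
    have h1 := abs_integral_mol_sub_le hhi hψ hψc hρ hρ0 hρ1 hρr (δ := δ) (fun x y hxy => by
      rw [← Real.dist_eq]; exact (hr (by rwa [dist_eq_norm])).le)
    set u : (ι → ℝ) → ℝ := fun y => χ y * (mol ρ h y * Real.exp (V y)) with hu
    have huT : IsTest u := ⟨hχ.1.mul ((contDiff_mol hρ hhi.locallyIntegrable).mul
      (Real.contDiff_exp.comp hV)), hχ.2.mul_right⟩
    have e1 : ∀ x, mol ρ h x * ψ x = u x * pd a ξ x := by
      intro x
      simp only [hψd, hu]
      by_cases hx : ‖x‖ ≤ max R R'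
      · rw [hχ1 x hx]; ring
      · rw [hR' x ((le_max_right _ _).trans_lt (not_le.1 hx))]; ring
    have tint : ∀ {f g : (ι → ℝ) → ℝ}, Continuous f → IsTest g → Integrable fun x => f x * g x :=
      fun hf hg => (hf.mul hg.1.continuous).integrable_of_hasCompactSupport hg.2.mul_left
    have e2 : ∫ x, u x * pd a ξ x = -∫ x, pd a u x * ξ x :=
      integral_mul_fderiv_eq_neg_fderiv_mul_of_integrable
        (tint (huT.deriv a).1.continuous hξ) (tint huT.1.continuous (hξ.deriv a))
        (tint huT.1.continuous hξ) (fun x _ => huT.differentiable x)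
        (fun x _ => hξ.differentiable x)
    have i1 : ∀ b, Integrable fun x => Real.exp (-V x) * pd b u x ^ 2 := by
      intro b
      refine (tint ((Real.continuous_exp.comp hVc.neg).mul (huT.deriv b).1.continuous)
        (huT.deriv b)).congr (ae_of_all _ fun x => ?_)
      simp; ring
    have i2 : Integrable fun x => Real.exp (V x) * ξ x ^ 2 := by
      refine (tint ((Real.continuous_exp.comp hVc).mul hξ.1.continuous) hξ).congr
        (ae_of_all _ fun x => ?_)
      simp; ring
    have h2 : ∫ x, Real.exp (-V x) * pd a u x ^ 2 ≤ 10 * Fintype.card ι * δ ^ 2 * W :=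
      (Finset.single_le_sum (f := fun b => ∫ x, Real.exp (-V x) * pd b u x ^ 2)
        (fun b _ => integral_nonneg fun x => by positivity) (Finset.mem_univ a)).trans hE
    have h3 : |∫ x, pd a u x * ξ x| ≤ δ * (5 * Fintype.card ι * W + X / 2) := by
      calc |∫ x, pd a u x * ξ x| ≤ ∫ x, |pd a u x * ξ x| := abs_integral_le_integral_abs
        _ ≤ ∫ x, (1 / (2 * δ) * (Real.exp (-V x) * pd a u x ^ 2) +
              δ / 2 * (Real.exp (V x) * ξ x ^ 2)) := by
            refine integral_mono (tint (huT.deriv a).1.continuous hξ).abs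
              ((i1 a).const_mul _ |>.add (i2.const_mul _)) fun x => ?_
            have hE : Real.exp (-V x) * Real.exp (V x) = 1 := by rw [← Real.exp_add]; simp
            have hp := Real.exp_pos (-V x)
            simp only [abs_mul]
            set p := Real.exp (-V x)
            set q := Real.exp (V x)
            have key : 0 ≤ 1 / (2 * δ) * (p * (|pd a u x| - δ * q * |ξ x|) ^ 2) := by positivity
            have : 1 / (2 * δ) * (p * (|pd a u x| - δ * q * |ξ x|) ^ 2) =
                1 / (2 * δ) * (p * pd a u x ^ 2) + δ / 2 * (q * ξ x ^ 2) -
                |pd a u x| * |ξ x| := by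
              rw [← sq_abs (pd a u x), ← sq_abs (ξ x)]
              field_simp
              linear_combination (-2 * |pd a u x| * δ * |ξ x| + δ ^ 2 * q * |ξ x| ^ 2) * hE
            linarith
        _ = 1 / (2 * δ) * (∫ x, Real.exp (-V x) * pd a u x ^ 2) + δ / 2 * X := by
            rw [integral_add ((i1 a).const_mul _) (i2.const_mul _), integral_const_mul,
              integral_const_mul]
        _ ≤ 1 / (2 * δ) * (10 * Fintype.card ι * δ ^ 2 * W) + δ / 2 * X := by gcongr
        _ = _ := by field_simp; ring
    simp_rw [e1] at h1
    rw [e2] at h1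
    rw [hB]
    have h4 := abs_sub_abs_le_abs_sub (∫ x, h x * ψ x) (-∫ x, pd a u x * ξ x)
    rw [abs_sub_comm, abs_neg] at h4
    linarith
  have h0 : |∫ x, h x * ψ x| ≤ 0 := by
    refine le_of_forall_pos_le_add fun ε hε => ?_
    have := main (ε / (B + 1)) (by positivity)
    have h2 : ε / (B + 1) * B ≤ ε := by
      rw [div_mul_eq_mul_div, div_le_iff₀ (by positivity)]; nlinarith
    linarith
  exact abs_nonpos_iff.1 h0

end Density

section L2

variable {ι : Type*} [Fintype ι] [DecidableEq ι]

lemma IsTest.add {f g : (ι → ℝ) → ℝ} (hf : IsTest f) (hg : IsTest g) :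
    IsTest fun x => f x + g x := ⟨hf.1.add hg.1, hf.2.add hg.2⟩

lemma IsTest.const_mul {f : (ι → ℝ) → ℝ} (c : ℝ) (hf : IsTest f) :
    IsTest fun x => c * f x := ⟨contDiff_const.mul hf.1, hf.2.mul_left⟩

lemma IsTest.mul_left {f g : (ι → ℝ) → ℝ} (hf : ContDiff ℝ (⊤ : ℕ∞) f) (hg : IsTest g) :
    IsTest fun x => f x * g x := ⟨hf.mul hg.1, hg.2.mul_left⟩

lemma IsTest.zero : IsTest fun _ : ι → ℝ => (0 : ℝ) :=
  ⟨contDiff_const, HasCompactSupport.zero⟩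

lemma IsTest.neg {f : (ι → ℝ) → ℝ} (hf : IsTest f) : IsTest fun x => -f x := by
  simpa using hf.const_mul (-1)

lemma IsTest.sum {κ : Type*} (s : Finset κ) {f : κ → (ι → ℝ) → ℝ} (h : ∀ k ∈ s, IsTest (f k)) :
    IsTest fun x => ∑ k ∈ s, f k x := by
  classical
  induction s using Finset.induction_on with
  | empty => simpa using IsTest.zero
  | insert a s ha ih =>
    simp only [Finset.sum_insert ha]
    exact (h a (by simp)).add (ih fun k hk => h k (by simp [hk]))

lemma IsTest.dirOp {V f : (ι → ℝ) → ℝ} (hV : ContDiff ℝ (⊤ : ℕ∞) V) (hf : IsTest f) (a : ι) :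
    IsTest (dirOp V a f) :=
  ((hf.deriv a).deriv a).neg.add (IsTest.mul_left (contDiff_pd hV a) (hf.deriv a))

lemma pd_add {f g : (ι → ℝ) → ℝ} (hf : Differentiable ℝ f) (hg : Differentiable ℝ g) (a : ι) :
    pd a (fun x => f x + g x) = fun x => pd a f x + pd a g x :=
  ((hasPD_pd hf a).add (hasPD_pd hg a)).pd_eq (hf.add hg)

lemma pd_const_mul {f : (ι → ℝ) → ℝ} (hf : Differentiable ℝ f) (c : ℝ) (a : ι) :
    pd a (fun x => c * f x) = fun x => c * pd a f x :=
  ((hasPD_pd hf a).const_mul c).pd_eq (hf.const_mul c)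

lemma dirOp_add {V f g : (ι → ℝ) → ℝ} (hf : IsTest f) (hg : IsTest g) (a : ι) (x : ι → ℝ) :
    dirOp V a (fun x => f x + g x) x = dirOp V a f x + dirOp V a g x := by
  unfold dirOp
  rw [pd_add hf.differentiable hg.differentiable,
    pd_add (hf.deriv a).differentiable (hg.deriv a).differentiable]
  ring

lemma dirOp_const_mul {V f : (ι → ℝ) → ℝ} (hf : IsTest f) (c : ℝ) (a : ι) (x : ι → ℝ) :
    dirOp V a (fun x => c * f x) x = c * dirOp V a f x := by
  unfold dirOp
  rw [pd_const_mul hf.differentiable, pd_const_mul (hf.deriv a).differentiable]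
  ring

/-- Centred square-integrable functions are approximated by the range of the generator. -/
theorem exists_generator_approx {V F : (ι → ℝ) → ℝ} (hV : ContDiff ℝ (⊤ : ℕ∞) V)
    (hC : Confining V) (hF : Tame F) (hF0 : wint V F = 0) {ε : ℝ} (hε : 0 < ε) :
    ∃ η, IsTest η ∧ wint V (fun x => (F x - ∑ a, dirOp V a η x) ^ 2) < ε := by
  have hVc := hV.continuous
  set s : (ι → ℝ) → ℝ := fun x => Real.exp (-(V x) / 2) with hs
  have hsc : Continuous s := Real.continuous_exp.comp (hVc.neg.div_const 2)
  have hs2 : ∀ x, s x * s x = Real.exp (-V x) := fun x => by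
    simp only [hs]; rw [← Real.exp_add]; congr 1; ring
  have hsp : ∀ x, 0 < s x := fun x => Real.exp_pos _
  have mem : ∀ {f : (ι → ℝ) → ℝ}, Tame f → MemLp (fun x => f x * s x) 2 volume := by
    intro f hf
    refine (memLp_two_iff_integrable_sq (hf.1.mul hsc).aestronglyMeasurable).2 ?_
    refine (hC.integrable (hf.pow 2)).congr (ae_of_all _ fun x => ?_)
    simp only [← hs2, Pi.mul_apply]; ring
  have hgt : ∀ {η}, IsTest η → IsTest fun x => ∑ a, dirOp V a η x := fun hη =>
    IsTest.sum _ fun a _ => hη.dirOp hV a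
  let K : Submodule ℝ (Lp ℝ 2 (volume : Measure (ι → ℝ))) :=
    { carrier := {f | ∃ η, IsTest η ∧ f =ᵐ[volume] fun x => (∑ a, dirOp V a η x) * s x}
      add_mem' := by
        rintro f g ⟨η, hη, hf⟩ ⟨ζ, hζ, hg⟩
        refine ⟨_, hη.add hζ, ?_⟩
        filter_upwards [Lp.coeFn_add f g, hf, hg] with x h1 h2 h3
        rw [h1, Pi.add_apply, h2, h3]
        simp only [dirOp_add hη hζ, Finset.sum_add_distrib]; ring
      zero_mem' := by
        refine ⟨_, IsTest.zero, ?_⟩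
        filter_upwards [Lp.coeFn_zero ℝ 2 (volume : Measure (ι → ℝ))] with x h1
        rw [h1]
        have := fun a => dirOp_const_mul (V := V) IsTest.zero (0 : ℝ) a x
        simp only [zero_mul] at this
        simp [this]
      smul_mem' := by
        rintro c f ⟨η, hη, hf⟩
        refine ⟨_, hη.const_mul c, ?_⟩
        filter_upwards [Lp.coeFn_smul c f, hf] with x h1 h2
        rw [h1, Pi.smul_apply, h2]
        simp only [dirOp_const_mul hη, ← Finset.mul_sum, smul_eq_mul]; ring }
  set Ft := (mem hF).toLp with hFt
  have hmem : Ft ∈ K.topologicalClosure := by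
    rw [← Submodule.orthogonal_orthogonal_eq_closure]
    intro Q hQ
    rw [L2.inner_def]
    set w : (ι → ℝ) → ℝ := fun x => Q x * (s x)⁻¹ with hw
    have hwm : AEStronglyMeasurable w volume := (Lp.aestronglyMeasurable Q).mul
      (hsc.inv₀ fun x => (hsp x).ne').aestronglyMeasurable
    have hw2 : Integrable fun t => w t ^ 2 * Real.exp (-V t) := by
      refine ((memLp_two_iff_integrable_sq (Lp.aestronglyMeasurable Q)).1 (Lp.memLp Q)).congr
        (ae_of_all _ fun x => ?_)
      simp only [hw, ← hs2]
      have := (hsp x).ne'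
      field_simp
    have hwk : ∀ ξ, IsTest ξ → ∫ x, w x * Real.exp (-V x) * ∑ a, dirOp V a ξ x = 0 := by
      intro ξ hξ
      have h1 := hQ ((mem (hgt hξ).tame).toLp) ⟨ξ, hξ, MemLp.coeFn_toLp _⟩
      rw [L2.inner_def] at h1
      rw [← h1]
      refine integral_congr_ae ?_
      filter_upwards [MemLp.coeFn_toLp (mem (hgt hξ).tame)] with x h2
      rw [h2]
      simp only [hw, ← hs2, RCLike.inner_apply, conj_trivial]
      have := (hsp x).ne'
      field_simp
    obtain ⟨c, hc⟩ := ae_const_of_weak hV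
      (by simpa using hC.integrable (Tame.const 1)) hwm hw2 hwk
    have : ∫ x, inner ℝ (Q x) (Ft x) = c * wint V F := by
      unfold wint
      rw [← integral_const_mul]
      refine integral_congr_ae ?_
      filter_upwards [MemLp.coeFn_toLp (mem hF), hc] with x h2 h3
      rw [hFt, h2]
      have h4 : Q x = c * s x := by
        rw [← h3]; simp only [hw]
        have := (hsp x).ne'
        field_simp
      rw [h4]
      simp only [← hs2, RCLike.inner_apply, conj_trivial]
      ring
    rw [this, hF0, mul_zero]
  obtain ⟨k, ⟨η, hη, hk⟩, hd⟩ := Metric.mem_closure_iff.1 hmem (Real.sqrt ε) (Real.sqrt_pos.2 hε)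
  refine ⟨η, hη, ?_⟩
  have h1 : wint V (fun x => (F x - ∑ a, dirOp V a η x) ^ 2) = ‖Ft - k‖ ^ 2 := by
    rw [← real_inner_self_eq_norm_sq, L2.inner_def]
    unfold wint
    refine integral_congr_ae ?_
    filter_upwards [MemLp.coeFn_toLp (mem hF), hk, Lp.coeFn_sub Ft k] with x h2 h3 h4
    rw [h4, Pi.sub_apply, hFt, h2, h3]
    simp only [← hs2, RCLike.inner_apply, conj_trivial]
    ring
  rw [h1]
  rw [dist_eq_norm] at hd
  calc ‖Ft - k‖ ^ 2 < Real.sqrt ε ^ 2 := by gcongr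
    _ = ε := Real.sq_sqrt hε.le

end L2

section Bochner

variable {ι : Type*} [Fintype ι] [DecidableEq ι]

/-- Smooth confining potentials with derivatives of polynomial growth. -/
structure Nice (V : (ι → ℝ) → ℝ) : Prop where
  smooth : ContDiff ℝ (⊤ : ℕ∞) V
  conf : Confining V
  tame₁ : ∀ a, Tame (pd a V)

lemma Nice.hasPD {V : (ι → ℝ) → ℝ} (hV : Nice V) (a : ι) : HasPD a V (pd a V) :=
  hasPD_pd (hV.smooth.differentiable (by simp)) a

variable {V : (ι → ℝ) → ℝ}

lemma wint_dirOp_mul (hV : Nice V) {η f f' : (ι → ℝ) → ℝ} (hη : IsTest η) {a : ι}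
    (hf : HasPD a f f') (tf : Tame f) (tf' : Tame f') :
    wint V (fun x => dirOp V a η x * f x) = wint V (fun x => pd a η x * f' x) := by
  have tη := (hη.deriv a).tame
  have tη2 := ((hη.deriv a).deriv a).tame
  have h1 := wint_ibp hV.conf (((hη.deriv a).hasPD a).mul hf) (hV.hasPD a) (tη.mul tf)
    ((tη2.mul tf).add (tη.mul tf')) (hV.tame₁ a)
  rw [wint_add hV.conf (tη2.mul tf) (tη.mul tf')] at h1
  have h2 : (fun x => dirOp V a η x * f x) = fun x =>
      pd a η x * f x * pd a V x - pd a (pd a η) x * f x := by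
    funext x; unfold dirOp; ring
  rw [h2, wint_sub hV.conf ((tη.mul tf).mul (hV.tame₁ a)) (tη2.mul tf), h1]
  ring

lemma wint_dirOp_mul_dirOp (hV : Nice V) {η : (ι → ℝ) → ℝ} (hη : IsTest η) (a b : ι) :
    wint V (fun x => dirOp V a η x * dirOp V b η x) =
      wint V (fun x => pd a (pd b η) x ^ 2 + pd a (pd b V) x * (pd a η x * pd b η x)) := by
  have hb := hη.dirOp hV.smooth b
  have e : pd a (dirOp V b η) = fun x =>
      dirOp V b (pd a η) x + pd a (pd b V) x * pd b η x := by
    have h1 := ((((hη.deriv b).deriv b).hasPD a).neg.add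
      ((hasPD_pd ((contDiff_pd hV.smooth b).differentiable (by simp)) a).mul
        ((hη.deriv b).hasPD a)))
    have h2 := h1.pd_eq (f := dirOp V b η) hb.differentiable
    rw [h2]
    funext x
    unfold dirOp
    rw [pd_comm (hη.deriv b).1 a b, pd_comm hη.1 a b]
    ring
  rw [wint_dirOp_mul hV hη (hb.hasPD a) hb.tame (hb.deriv a).tame, e]
  have t1 : Tame fun x => dirOp V b (pd a η) x * pd a η x :=
    (((hη.deriv a).dirOp hV.smooth b).tame).mul (hη.deriv a).tame
  have t2 : Tame fun x => pd a (pd b V) x * (pd a η x * pd b η x) :=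
    Tame.of_hasCompactSupport ((contDiff_pd (contDiff_pd hV.smooth b) a).continuous.mul
      ((hη.deriv a).1.continuous.mul (hη.deriv b).1.continuous))
      ((hη.deriv b).2.mul_left).mul_left
  have e2 : (fun x => pd a η x * (dirOp V b (pd a η) x + pd a (pd b V) x * pd b η x)) =
      fun x => dirOp V b (pd a η) x * pd a η x + pd a (pd b V) x * (pd a η x * pd b η x) := by
    funext x; ring
  have t3 : Tame fun x => pd a (pd b η) x ^ 2 := ((hη.deriv b).deriv a).tame.pow 2
  rw [e2, wint_add hV.conf t1 t2, wint_add hV.conf t3 t2,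
    wint_dirOp_mul hV (hη.deriv a) ((hη.deriv a).hasPD b) (hη.deriv a).tame
      ((hη.deriv a).deriv b).tame]
  congr 2
  funext x
  rw [pd_comm hη.1 a b]; ring

/-- The generator `-Δ + ∇V·∇`. -/
def gen (V η : (ι → ℝ) → ℝ) (x : ι → ℝ) : ℝ := ∑ a, dirOp V a η x

lemma IsTest.gen (hV : ContDiff ℝ (⊤ : ℕ∞) V) {η : (ι → ℝ) → ℝ} (hη : IsTest η) :
    IsTest (gen V η) := IsTest.sum _ fun a _ => hη.dirOp hV a

lemma wint_gen_mul (hV : Nice V) {η f : (ι → ℝ) → ℝ} {f' : ι → (ι → ℝ) → ℝ} (hη : IsTest η)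
    (hf : ∀ a, HasPD a f (f' a)) (tf : Tame f) (tf' : ∀ a, Tame (f' a)) :
    wint V (fun x => gen V η x * f x) = wint V (fun x => ∑ a, pd a η x * f' a x) := by
  unfold gen
  simp_rw [Finset.sum_mul]
  rw [wint_sum hV.conf _ fun a _ => (hη.dirOp hV.smooth a).tame.mul tf,
    wint_sum hV.conf _ fun a _ => (hη.deriv a).tame.mul (tf' a)]
  exact Finset.sum_congr rfl fun a _ => wint_dirOp_mul hV hη (hf a) tf (tf' a)

/-- Dual variance bound. -/
lemma wint_sq_le_of_gen (hV : Nice V) {f : (ι → ℝ) → ℝ} {f' : ι → (ι → ℝ) → ℝ} {B : ℝ}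
    (hf : ∀ a, HasPD a f (f' a)) (tf : Tame f) (tf' : ∀ a, Tame (f' a)) (hf0 : wint V f = 0)
    (hB : ∀ η, IsTest η → 2 * wint V (fun x => ∑ a, pd a η x * f' a x) ≤
      wint V (fun x => gen V η x ^ 2) + B) :
    wint V (fun x => f x ^ 2) ≤ B := by
  refine le_of_forall_pos_le_add fun ε hε => ?_
  obtain ⟨η, hη, h⟩ := exists_generator_approx hV.smooth hV.conf tf hf0 hε
  have h1 := hB η hη
  rw [← wint_gen_mul hV hη hf tf tf'] at h1
  have tg := (hη.gen hV.smooth).tame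
  have h2 : (fun x => (f x - ∑ a, dirOp V a η x) ^ 2) =
      fun x => f x ^ 2 + (gen V η x ^ 2 - 2 * (gen V η x * f x)) := by
    funext x; unfold gen; ring
  rw [h2, wint_add hV.conf (tf.pow 2) ((tg.pow 2).sub ((tg.mul tf).const_mul 2)),
    wint_sub hV.conf (tg.pow 2) ((tg.mul tf).const_mul 2), wint_const_mul] at h
  linarith

end Bochner

section Graph

variable {Λ : Type*} [Fintype Λ] [DecidableEq Λ]

/-- Symmetric nonnegative edge weights. -/
structure IsWeight (J : Λ → Λ → ℝ) : Prop where
  symm : ∀ x y, J x y = J y x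
  nonneg : ∀ x y, 0 ≤ J x y

/-- The (positive) graph Laplacian. -/
def gl (J : Λ → Λ → ℝ) (f : Λ → ℝ) (x : Λ) : ℝ := ∑ y, J x y * (f x - f y)

lemma gl_add (J : Λ → Λ → ℝ) (f g : Λ → ℝ) (x : Λ) :
    gl J (fun y => f y + g y) x = gl J f x + gl J g x := by
  unfold gl; rw [← Finset.sum_add_distrib]; exact Finset.sum_congr rfl fun y _ => by ring

lemma gl_sub (J : Λ → Λ → ℝ) (f g : Λ → ℝ) (x : Λ) :
    gl J (fun y => f y - g y) x = gl J f x - gl J g x := by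
  unfold gl; rw [← Finset.sum_sub_distrib]; exact Finset.sum_congr rfl fun y _ => by ring

lemma gl_const_mul (J : Λ → Λ → ℝ) (c : ℝ) (f : Λ → ℝ) (x : Λ) :
    gl J (fun y => c * f y) x = c * gl J f x := by
  unfold gl; rw [Finset.mul_sum]; exact Finset.sum_congr rfl fun y _ => by ring

lemma gl_sum {κ : Type*} (s : Finset κ) (J : Λ → Λ → ℝ) (f : κ → Λ → ℝ) (x : Λ) :
    gl J (fun y => ∑ k ∈ s, f k y) x = ∑ k ∈ s, gl J (f k) x := by
  unfold gl; rw [Finset.sum_comm]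
  exact Finset.sum_congr rfl fun y _ => by rw [← Finset.mul_sum, Finset.sum_sub_distrib]

variable {J : Λ → Λ → ℝ}

lemma IsWeight.sum_mul_gl (hJ : IsWeight J) (f g : Λ → ℝ) :
    ∑ x, f x * gl J g x = 1 / 2 * ∑ x, ∑ y, J x y * ((f x - f y) * (g x - g y)) := by
  have h1 : ∑ x, f x * gl J g x = ∑ x, ∑ y, J x y * (f x * (g x - g y)) := by
    unfold gl; refine Finset.sum_congr rfl fun x _ => ?_
    rw [Finset.mul_sum]; exact Finset.sum_congr rfl fun y _ => by ring
  have h2 : ∑ x, f x * gl J g x = ∑ x, ∑ y, J x y * (f y * (g y - g x)) := by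
    rw [h1, Finset.sum_comm]
    exact Finset.sum_congr rfl fun x _ => Finset.sum_congr rfl fun y _ => by rw [hJ.symm]
  have h3 : ∑ x, ∑ y, J x y * ((f x - f y) * (g x - g y)) =
      (∑ x, ∑ y, J x y * (f x * (g x - g y))) + ∑ x, ∑ y, J x y * (f y * (g y - g x)) := by
    simp_rw [← Finset.sum_add_distrib]
    exact Finset.sum_congr rfl fun x _ => Finset.sum_congr rfl fun y _ => by ring
  rw [h3, ← h1, ← h2]; ring

lemma IsWeight.gl_selfadjoint (hJ : IsWeight J) (f g : Λ → ℝ) :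
    ∑ x, f x * gl J g x = ∑ x, gl J f x * g x := by
  simp_rw [mul_comm (gl J f _)]
  rw [hJ.sum_mul_gl, hJ.sum_mul_gl]
  congr 1
  exact Finset.sum_congr rfl fun x _ => Finset.sum_congr rfl fun y _ => by ring

lemma IsWeight.sum_mul_gl_self_nonneg (hJ : IsWeight J) (f : Λ → ℝ) :
    0 ≤ ∑ x, f x * gl J f x := by
  rw [hJ.sum_mul_gl]
  have : 0 ≤ ∑ x, ∑ y, J x y * ((f x - f y) * (f x - f y)) :=
    Finset.sum_nonneg fun x _ => Finset.sum_nonneg fun y _ =>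
      mul_nonneg (hJ.nonneg x y) (mul_self_nonneg _)
  linarith

lemma IsWeight.sum_gl (hJ : IsWeight J) (f : Λ → ℝ) : ∑ x, gl J f x = 0 := by
  have := hJ.sum_mul_gl (fun _ => 1) f
  simpa using this

lemma IsWeight.min_principle (hJ : IsWeight J) {m : ℝ} (hm : 0 < m) {f : Λ → ℝ}
    (h : ∀ x, 0 ≤ m * f x + gl J f x) (x : Λ) : 0 ≤ f x := by
  obtain ⟨z, -, hz⟩ := Finset.exists_min_image Finset.univ f ⟨x, Finset.mem_univ x⟩
  have h1 : gl J f z ≤ 0 := Finset.sum_nonpos fun y _ =>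
    mul_nonpos_of_nonneg_of_nonpos (hJ.nonneg z y) (by linarith [hz y (Finset.mem_univ y)])
  have h2 := h z
  have h3 : 0 ≤ f z := by
    by_contra hneg
    push Not at hneg
    nlinarith
  exact h3.trans (hz x (Finset.mem_univ x))

lemma IsWeight.resolvent_unique (hJ : IsWeight J) {m : ℝ} (hm : 0 < m) {f g : Λ → ℝ}
    (h : ∀ x, m * f x + gl J f x = m * g x + gl J g x) : f = g := by
  funext x
  refine le_antisymm ?_ ?_
  · have := hJ.min_principle hm (f := fun y => g y - f y)
      (fun y => by rw [gl_sub]; linarith [h y]) x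
    linarith
  · have := hJ.min_principle hm (f := fun y => f y - g y)
      (fun y => by rw [gl_sub]; linarith [h y]) x
    linarith

lemma IsWeight.exists_resolvent (hJ : IsWeight J) {m : ℝ} (hm : 0 < m) (f : Λ → ℝ) :
    ∃ u : Λ → ℝ, ∀ x, m * u x + gl J u x = f x := by
  let T : (Λ → ℝ) →ₗ[ℝ] (Λ → ℝ) :=
    { toFun := fun u x => m * u x + gl J u x
      map_add' := fun u v => by
        funext x
        have := gl_add J u v x
        simp only [Pi.add_apply]
        change m * (u x + v x) + gl J (fun y => u y + v y) x = _
        rw [this]; ring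
      map_smul' := fun c u => by
        funext x
        have := gl_const_mul J c u x
        simp only [Pi.smul_apply, smul_eq_mul, RingHom.id_apply]
        change m * (c * u x) + gl J (fun y => c * u y) x = _
        rw [this]; ring }
  have hinj : Function.Injective T := fun u v h =>
    hJ.resolvent_unique hm fun x => congrFun h x
  obtain ⟨u, hu⟩ := (LinearMap.injective_iff_surjective.1 hinj) f
  exact ⟨u, fun x => congrFun hu x⟩

lemma IsWeight.sum_resolvent (hJ : IsWeight J) {m : ℝ} {f u : Λ → ℝ}
    (h : ∀ x, m * u x + gl J u x = f x) : m * ∑ x, u x = ∑ x, f x := by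
  rw [← Finset.sum_congr rfl fun x _ => h x, Finset.sum_add_distrib, hJ.sum_gl, Finset.mul_sum,
    add_zero]

/-- Matrix-vector product for kernels. -/
def mv (A : Λ → Λ → ℝ) (f : Λ → ℝ) (x : Λ) : ℝ := ∑ y, A x y * f y

lemma mv_sub (A : Λ → Λ → ℝ) (f g : Λ → ℝ) (x : Λ) :
    mv A (fun y => f y - g y) x = mv A f x - mv A g x := by
  unfold mv; rw [← Finset.sum_sub_distrib]; exact Finset.sum_congr rfl fun y _ => by ring

lemma mv_const_mul (A : Λ → Λ → ℝ) (c : ℝ) (f : Λ → ℝ) (x : Λ) :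
    mv A (fun y => c * f y) x = c * mv A f x := by
  unfold mv; rw [Finset.mul_sum]; exact Finset.sum_congr rfl fun y _ => by ring

lemma sum_mul_mv_comm {A : Λ → Λ → ℝ} (hA : ∀ y z, A y z = A z y) (f g : Λ → ℝ) :
    ∑ y, f y * mv A g y = ∑ y, g y * mv A f y := by
  unfold mv
  simp_rw [Finset.mul_sum]
  rw [Finset.sum_comm]
  exact Finset.sum_congr rfl fun x _ => Finset.sum_congr rfl fun y _ => by rw [hA]; ring

/-- The solution of the Lyapunov equation `HA + AH = δ_x δ_xᵀ`, `H = β - Δ`. -/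
structure Lyap (J : Λ → Λ → ℝ) (β : ℝ) (x : Λ) (A : Λ → Λ → ℝ) (ρ : Λ → ℝ) : Prop where
  symm : ∀ y z, A y z = A z y
  nonneg : ∀ y z, 0 ≤ A y z
  psd : ∀ f : Λ → ℝ, 0 ≤ ∑ y, f y * mv A f y
  lyap : ∀ f : Λ → ℝ, 2 * ∑ y, mv A f y * (β * f y + gl J f y) = f x ^ 2
  row : ∀ y, ∑ z, A y z = ρ y
  res : ∀ y, 2 * β * ρ y + gl J ρ y = if y = x then 1 else 0
  trace : ∀ f : Λ → ℝ, 2 * f x - ∑ y, f y * (β * f y + gl J f y) ≤ 2 * ∑ y, A y y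

lemma psd_of_lyap (hJ : IsWeight J) {β : ℝ} (hβ : 0 < β) {x : Λ} {A : Λ → Λ → ℝ}
    (hA : ∀ y z, A y z = A z y)
    (hl : ∀ f : Λ → ℝ, 2 * ∑ y, mv A f y * (β * f y + gl J f y) = f x ^ 2) (f : Λ → ℝ) :
    0 ≤ ∑ y, f y * mv A f y := by
  let M : Matrix Λ Λ ℝ := Matrix.of A
  have hM : M.IsHermitian := by
    ext y z; simp [M, hA y z]
  have hmv : ∀ (f : Λ → ℝ) y, (M.mulVec f) y = mv A f y := fun f y => rfl
  have hpsd : M.PosSemidef := by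
    rw [hM.posSemidef_iff_eigenvalues_nonneg]
    intro j
    by_contra hneg
    simp only [Pi.zero_apply, not_le] at hneg
    set v : Λ → ℝ := (hM.eigenvectorBasis j).ofLp with hv
    have he : ∀ y, mv A v y = hM.eigenvalues j * v y := fun y => by
      rw [← hmv, hv, hM.mulVec_eigenvectorBasis j]; simp
    have h1 := hl v
    simp_rw [he] at h1
    have h2 : ∑ y, hM.eigenvalues j * v y * (β * v y + gl J v y) =
        hM.eigenvalues j * (β * ∑ y, v y ^ 2 + ∑ y, v y * gl J v y) := by
      rw [mul_add, Finset.mul_sum, Finset.mul_sum, Finset.mul_sum, ← Finset.sum_add_distrib]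
      exact Finset.sum_congr rfl fun y _ => by ring
    rw [h2] at h1
    have h3 := hJ.sum_mul_gl_self_nonneg v
    have h4 : ∑ y, v y ^ 2 = 1 := by
      have := hM.eigenvectorBasis.orthonormal.1 j
      rw [EuclideanSpace.norm_eq, Real.sqrt_eq_one] at this
      simpa using this
    rw [h4] at h1
    nlinarith [sq_nonneg (v x)]
  have := hpsd.dotProduct_mulVec_nonneg f
  simpa [dotProduct, hmv] using this

lemma IsWeight.exists_lyap (hJ : IsWeight J) {β : ℝ} (hβ : 0 < β) (x : Λ) :
    ∃ A ρ, Lyap J β x A ρ := by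
  let J2 : Λ × Λ → Λ × Λ → ℝ := fun p q =>
    J p.1 q.1 * (if p.2 = q.2 then 1 else 0) + (if p.1 = q.1 then 1 else 0) * J p.2 q.2
  have hJ2 : IsWeight J2 := by
    refine ⟨fun p q => ?_, fun p q => ?_⟩
    · simp only [J2, hJ.symm p.1 q.1, hJ.symm p.2 q.2, eq_comm]
    · have h1 := hJ.nonneg p.1 q.1
      have h2 := hJ.nonneg p.2 q.2
      simp only [J2]
      refine add_nonneg (mul_nonneg h1 ?_) (mul_nonneg ?_ h2) <;> split_ifs <;> norm_num
  have hgl : ∀ (u : Λ × Λ → ℝ) y z, gl J2 u (y, z) =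
      gl J (fun y' => u (y', z)) y + gl J (fun z' => u (y, z')) z := by
    intro u y z
    unfold gl
    rw [Fintype.sum_prod_type]
    simp only [J2, add_mul, Finset.sum_add_distrib]
    congr 1
    · refine Finset.sum_congr rfl fun y' _ => ?_
      simp
    · rw [Finset.sum_comm]
      refine Finset.sum_congr rfl fun y' _ => ?_
      simp
  obtain ⟨u, hu⟩ := hJ2.exists_resolvent (m := 2 * β) (by positivity)
    (fun p => (if p.1 = x then 1 else 0) * (if p.2 = x then 1 else 0))
  have hu' : ∀ y z, 2 * β * u (y, z) +
      (gl J (fun y' => u (y', z)) y + gl J (fun z' => u (y, z')) z) =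
      (if y = x then 1 else 0) * (if z = x then 1 else 0) := fun y z => by
    rw [← hgl]; exact hu (y, z)
  have hsymm : ∀ y z, u (y, z) = u (z, y) := by
    have : u = fun p => u (p.2, p.1) := by
      refine hJ2.resolvent_unique (m := 2 * β) (by positivity) fun p => ?_
      rw [hu, hgl (fun p => u (p.2, p.1)) p.1 p.2]
      have := hu' p.2 p.1
      simp only
      linarith
    exact fun y z => congrFun this (y, z)
  set A : Λ → Λ → ℝ := fun y z => u (y, z) with hA
  have lyap : ∀ f : Λ → ℝ, 2 * ∑ y, mv A f y * (β * f y + gl J f y) = f x ^ 2 := by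
    intro f
    have h1 : ∑ y, ∑ z, f y * f z * (2 * β * u (y, z) +
        (gl J (fun y' => u (y', z)) y + gl J (fun z' => u (y, z')) z)) = f x ^ 2 := by
      simp_rw [hu']
      simp [sq]
    have h2 : ∑ y, ∑ z, f y * f z * (2 * β * u (y, z)) = 2 * ∑ y, mv A f y * (β * f y) := by
      simp only [mv, Finset.mul_sum, Finset.sum_mul]
      exact Finset.sum_congr rfl fun y _ => Finset.sum_congr rfl fun z _ => by
        simp only [hA]; ring
    have h3 : ∑ y, ∑ z, f y * f z * gl J (fun z' => u (y, z')) z =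
        ∑ y, mv A f y * gl J f y := by
      have : ∀ y, ∑ z, f y * f z * gl J (fun z' => u (y, z')) z =
          f y * ∑ z, gl J f z * u (y, z) := fun y => by
        rw [← hJ.gl_selfadjoint, Finset.mul_sum]
        exact Finset.sum_congr rfl fun z _ => by ring
      simp_rw [this, Finset.mul_sum]
      rw [Finset.sum_comm]
      simp only [mv, Finset.sum_mul]
      exact Finset.sum_congr rfl fun y _ => Finset.sum_congr rfl fun z _ => by
        simp only [hA, hsymm z y]; ring
    have h4 : ∑ y, ∑ z, f y * f z * gl J (fun y' => u (y', z)) y =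
        ∑ y, mv A f y * gl J f y := by
      rw [← h3, Finset.sum_comm]
      refine Finset.sum_congr rfl fun y _ => Finset.sum_congr rfl fun z _ => ?_
      simp_rw [hsymm _ y]; ring
    simp only [mul_add, Finset.sum_add_distrib] at h1 ⊢
    linarith
  have nonneg : ∀ p, 0 ≤ u p := hJ2.min_principle (m := 2 * β) (by positivity) fun p => by
    rw [hu]; split_ifs <;> norm_num
  refine ⟨A, fun y => ∑ z, A y z, hsymm, fun y z => nonneg _,
    psd_of_lyap hJ hβ hsymm lyap, lyap, fun y => rfl, fun y => ?_, fun f => ?_⟩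
  · rw [gl_sum, Finset.mul_sum]
    have h1 : ∑ z, (2 * β * u (y, z) +
        (gl J (fun y' => u (y', z)) y + gl J (fun z' => u (y, z')) z)) =
        if y = x then 1 else 0 := by
      simp_rw [hu']; simp
    rw [Finset.sum_add_distrib, Finset.sum_add_distrib, hJ.sum_gl] at h1
    simp only [hA]
    linarith
  · -- trace identity through the resolvent kernel
    choose G hG using fun y => hJ.exists_resolvent hβ (fun z => if z = y then 1 else 0)
    have hGs : ∀ y z, G y z = G z y := by
      intro y z
      have h1 : ∑ w, G z w * (β * G y w + gl J (G y) w) = G z y := by simp_rw [hG y]; simp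
      have h2 : ∑ w, (β * G z w + gl J (G z) w) * G y w = G y z := by simp_rw [hG z]; simp
      rw [← h1, ← h2]
      simp only [mul_add, add_mul, Finset.sum_add_distrib, hJ.gl_selfadjoint]
      congr 1
      exact Finset.sum_congr rfl fun w _ => by ring
    have h1 : ∑ y, ∑ z, G y z * (2 * β * u (y, z) +
        (gl J (fun y' => u (y', z)) y + gl J (fun z' => u (y, z')) z)) = G x x := by
      simp_rw [hu']; simp
    have h2 : ∀ y, ∑ z, G y z * (β * u (y, z) + gl J (fun z' => u (y, z')) z) = u (y, y) := by
      intro y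
      have : ∑ z, (β * G y z + gl J (G y) z) * u (y, z) = u (y, y) := by simp_rw [hG]; simp
      rw [← this]
      simp only [mul_add, add_mul, Finset.sum_add_distrib, hJ.gl_selfadjoint]
      congr 1
      exact Finset.sum_congr rfl fun w _ => by ring
    have h3 : ∑ y, ∑ z, G y z * (β * u (y, z) + gl J (fun y' => u (y', z)) y) =
        ∑ y, u (y, y) := by
      rw [Finset.sum_comm, ← Finset.sum_congr rfl fun y _ => h2 y]
      refine Finset.sum_congr rfl fun y _ => Finset.sum_congr rfl fun z _ => ?_
      simp_rw [hGs z y, hsymm _ y]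
    have h4 : G x x = 2 * ∑ y, A y y := by
      have h5 : ∑ y, ∑ z, G y z * (2 * β * u (y, z) +
          (gl J (fun y' => u (y', z)) y + gl J (fun z' => u (y, z')) z)) =
          (∑ y, ∑ z, G y z * (β * u (y, z) + gl J (fun y' => u (y', z)) y)) +
          ∑ y, ∑ z, G y z * (β * u (y, z) + gl J (fun z' => u (y, z')) z) := by
        simp_rw [← Finset.sum_add_distrib]
        exact Finset.sum_congr rfl fun y _ => Finset.sum_congr rfl fun z _ => by ring
      rw [← h1, h5, h3]
      simp_rw [h2]
      simp only [hA]; ring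
    rw [← h4]
    have h5 : 0 ≤ ∑ y, (f y - G x y) * (β * (f y - G x y) + gl J (fun y => f y - G x y) y) := by
      simp only [mul_add, Finset.sum_add_distrib]
      refine add_nonneg (Finset.sum_nonneg fun y _ => ?_) (hJ.sum_mul_gl_self_nonneg _)
      have : (f y - G x y) * (β * (f y - G x y)) = β * (f y - G x y) ^ 2 := by ring
      rw [this]; positivity
    have h6 : ∑ y, f y * (β * G x y + gl J (G x) y) = f x := by simp_rw [hG]; simp
    have h7 : ∑ y, G x y * (β * G x y + gl J (G x) y) = G x x := by simp_rw [hG]; simp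
    have h8 : ∑ y, G x y * (β * f y + gl J f y) = f x := by
      rw [← h6]
      simp only [mul_add, Finset.sum_add_distrib, hJ.gl_selfadjoint (G x) f]
      congr 1 <;> exact Finset.sum_congr rfl fun w _ => by ring
    have h9 : ∑ y, (f y - G x y) * (β * (f y - G x y) + gl J (fun y => f y - G x y) y) =
        ((∑ y, f y * (β * f y + gl J f y)) - ∑ y, f y * (β * G x y + gl J (G x) y)) -
        ((∑ y, G x y * (β * f y + gl J f y)) - ∑ y, G x y * (β * G x y + gl J (G x) y)) := by
      simp_rw [← Finset.sum_sub_distrib, gl_sub]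
      exact Finset.sum_congr rfl fun w _ => by ring
    rw [h9, h6, h7, h8] at h5
    linarith

variable {β : ℝ} {x : Λ} {A : Λ → Λ → ℝ} {ρ : Λ → ℝ}

lemma Lyap.row_nonneg (h : Lyap J β x A ρ) (y : Λ) : 0 ≤ ρ y := by
  rw [← h.row]; exact Finset.sum_nonneg fun z _ => h.nonneg y z

lemma Lyap.sum_row (h : Lyap J β x A ρ) (hJ : IsWeight J) (hβ : 0 < β) :
    ∑ y, ρ y = 1 / (2 * β) := by
  have := hJ.sum_resolvent h.res
  rw [eq_div_iff (by positivity), mul_comm, this]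
  simp

lemma Lyap.quad_le_row (h : Lyap J β x A ρ) (f : Λ → ℝ) :
    ∑ y, f y * mv A f y ≤ ∑ y, ρ y * f y ^ 2 := by
  have h1 : ∑ y, f y * mv A f y ≤ ∑ y, ∑ z, A y z * (f y ^ 2 / 2 + f z ^ 2 / 2) := by
    refine Finset.sum_le_sum fun y _ => ?_
    unfold mv
    rw [Finset.mul_sum]
    refine Finset.sum_le_sum fun z _ => ?_
    nlinarith [mul_nonneg (h.nonneg y z) (sq_nonneg (f y - f z))]
  refine h1.trans (le_of_eq ?_)
  simp only [mul_add, Finset.sum_add_distrib]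
  have h2 : ∑ y, ∑ z, A y z * (f y ^ 2 / 2) = ∑ y, ρ y * (f y ^ 2 / 2) :=
    Finset.sum_congr rfl fun y _ => by rw [← h.row, Finset.sum_mul]
  have h3 : ∑ y, ∑ z, A y z * (f z ^ 2 / 2) = ∑ y, ρ y * (f y ^ 2 / 2) := by
    rw [Finset.sum_comm, ← h2]
    exact Finset.sum_congr rfl fun y _ => Finset.sum_congr rfl fun z _ => by rw [h.symm]
  rw [h2, h3, ← Finset.sum_add_distrib]
  exact Finset.sum_congr rfl fun y _ => by ring

lemma Lyap.sum_mv_sq_le (h : Lyap J β x A ρ) {t : ℝ} (ht : 0 < t) (hρ : ∀ y, ρ y ≤ t)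
    (f : Λ → ℝ) : ∑ y, mv A f y ^ 2 ≤ t * ∑ y, f y * mv A f y := by
  have h1 := h.psd fun y => t * f y - mv A f y
  have h2 : ∑ y, (t * f y - mv A f y) * mv A (fun y => t * f y - mv A f y) y =
      t ^ 2 * (∑ y, f y * mv A f y) - t * (∑ y, f y * mv A (mv A f) y) -
      t * (∑ y, mv A f y * mv A f y) + ∑ y, mv A f y * mv A (mv A f) y := by
    simp_rw [mv_sub, mv_const_mul, Finset.mul_sum, ← Finset.sum_sub_distrib,
      ← Finset.sum_add_distrib]
    exact Finset.sum_congr rfl fun y _ => by ring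
  rw [h2, sum_mul_mv_comm h.symm f (mv A f)] at h1
  have h3 : ∑ y, mv A f y * mv A (mv A f) y ≤ t * ∑ y, mv A f y ^ 2 := by
    refine (h.quad_le_row _).trans ?_
    rw [Finset.mul_sum]
    exact Finset.sum_le_sum fun y _ => mul_le_mul_of_nonneg_right (hρ y) (sq_nonneg _)
  have h4 : ∑ y, mv A f y * mv A f y = ∑ y, mv A f y ^ 2 :=
    Finset.sum_congr rfl fun y _ => by ring
  rw [h4] at h1
  nlinarith

/-- Weighted Cauchy-Schwarz for the positive semidefinite form. -/
lemma Lyap.cross_le (h : Lyap J β x A ρ) {t : ℝ} (ht : 0 < t) (f c : Λ → ℝ) :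
    2 * ∑ y, c y * mv A f y ≤ t * (∑ y, f y * mv A f y) + t⁻¹ * ∑ y, ρ y * c y ^ 2 := by
  have h1 := h.psd fun y => t * f y - c y
  have h2 : ∑ y, (t * f y - c y) * mv A (fun y => t * f y - c y) y =
      t ^ 2 * (∑ y, f y * mv A f y) - t * (∑ y, f y * mv A c y) -
      t * (∑ y, c y * mv A f y) + ∑ y, c y * mv A c y := by
    simp_rw [mv_sub, mv_const_mul, Finset.mul_sum, ← Finset.sum_sub_distrib,
      ← Finset.sum_add_distrib]
    exact Finset.sum_congr rfl fun y _ => by ring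
  rw [h2, sum_mul_mv_comm h.symm f c] at h1
  have h3 := h.quad_le_row c
  have h4 : t * (2 * ∑ y, c y * mv A f y) ≤
      t * (t * (∑ y, f y * mv A f y) + t⁻¹ * ∑ y, ρ y * c y ^ 2) := by
    rw [mul_add t (t * _), ← mul_assoc t t⁻¹, mul_inv_cancel₀ ht.ne']
    nlinarith
  exact le_of_mul_le_mul_left h4 ht

end Graph

section Potential

variable {Λ : Type*} [Fintype Λ] [DecidableEq Λ] {n : ℕ}

/-- The `k`-th component of a field. -/
def cmp (φ : Λ × Fin n → ℝ) (k : Fin n) (y : Λ) : ℝ := φ (y, k)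

/-- The projection of a field on a vector. -/
def prj (v : Fin n → ℝ) (φ : Λ × Fin n → ℝ) (y : Λ) : ℝ := ∑ i, v i * φ (y, i)

/-- The squared length of a field at a site. -/
def sN (φ : Λ × Fin n → ℝ) (y : Λ) : ℝ := ∑ i, φ (y, i) ^ 2

lemma sN_nonneg (φ : Λ × Fin n → ℝ) (y : Λ) : 0 ≤ sN φ y :=
  Finset.sum_nonneg fun _ _ => sq_nonneg _

/-- The `|φ|⁴` potential on a weighted graph. -/
def pot (J : Λ → Λ → ℝ) (g ν : ℝ) (φ : Λ × Fin n → ℝ) : ℝ :=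
  ∑ y, (g / 4 * sN φ y ^ 2 + ν / 2 * sN φ y) + 1 / 2 * ∑ k, ∑ y, φ (y, k) * gl J (cmp φ k) y

/-- The gradient of the potential. -/
def dpot (J : Λ → Λ → ℝ) (g ν : ℝ) (a : Λ × Fin n) (φ : Λ × Fin n → ℝ) : ℝ :=
  gl J (cmp φ a.2) a.1 + ν * φ a + g * sN φ a.1 * φ a

variable {J : Λ → Λ → ℝ} {g ν : ℝ}

lemma hasPD_sN (y : Λ) (a : Λ × Fin n) :
    HasPD a (fun φ : Λ × Fin n → ℝ => sN φ y) (fun φ => if y = a.1 then 2 * φ a else 0) := by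
  refine (HasPD.sum Finset.univ fun i _ => (HasPD.coord a (y, i)).sq).congr (fun φ => rfl) ?_
  intro φ
  obtain ⟨x, k⟩ := a
  by_cases h : y = x
  · subst h; simp
  · simp [h]

lemma hasPD_gl (J : Λ → Λ → ℝ) (k : Fin n) (y : Λ) (a : Λ × Fin n) :
    HasPD a (fun φ : Λ × Fin n → ℝ => gl J (cmp φ k) y)
      (fun _ => if k = a.2 then gl J (fun z => if z = a.1 then 1 else 0) y else 0) := by
  unfold gl
  refine (HasPD.sum Finset.univ fun z _ =>
    ((HasPD.coord a (y, k)).sub (HasPD.coord a (z, k))).const_mul (J y z)).congr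
      (fun φ => rfl) ?_
  intro φ
  obtain ⟨x, i⟩ := a
  by_cases h : k = i
  · subst h; simp
  · simp [h]

lemma tame_gl (J : Λ → Λ → ℝ) (k : Fin n) (y : Λ) :
    Tame (fun φ : Λ × Fin n → ℝ => gl J (cmp φ k) y) :=
  Tame.sum _ fun z _ => ((Tame.coord (y, k)).sub (Tame.coord (z, k))).const_mul _

lemma tame_sN (y : Λ) : Tame (fun φ : Λ × Fin n → ℝ => sN φ y) :=
  Tame.sum _ fun i _ => (Tame.coord (y, i)).pow 2

lemma tame_dpot (J : Λ → Λ → ℝ) (g ν : ℝ) (a : Λ × Fin n) : Tame (dpot J g ν a) :=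
  ((tame_gl J a.2 a.1).add ((Tame.coord a).const_mul ν)).add
    (((tame_sN a.1).const_mul g).mul (Tame.coord a))

lemma hasPD_pot (hJ : IsWeight J) (a : Λ × Fin n) : HasPD a (pot J g ν) (dpot J g ν a) := by
  have h1 : ∀ y : Λ, HasPD a (fun φ : Λ × Fin n → ℝ => g / 4 * sN φ y ^ 2 + ν / 2 * sN φ y) _ :=
    fun y => ((hasPD_sN y a).sq.const_mul (g / 4)).add ((hasPD_sN y a).const_mul (ν / 2))
  have h2 : ∀ (k : Fin n) (y : Λ),
      HasPD a (fun φ : Λ × Fin n → ℝ => φ (y, k) * gl J (cmp φ k) y) _ :=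
    fun k y => (HasPD.coord a (y, k)).mul (hasPD_gl J k y a)
  refine ((HasPD.sum Finset.univ fun y _ => h1 y).add ((HasPD.sum Finset.univ fun k _ =>
    HasPD.sum Finset.univ fun y _ => h2 k y).const_mul (1 / 2))).congr (fun φ => rfl) ?_
  intro φ
  obtain ⟨x, i⟩ := a
  have e1 : ∑ y, (g / 4 * (2 * sN φ y * (if y = x then 2 * φ (x, i) else 0)) +
      ν / 2 * (if y = x then 2 * φ (x, i) else 0)) = ν * φ (x, i) + g * sN φ x * φ (x, i) := by
    rw [Finset.sum_eq_single x (fun y _ hy => by simp [hy]) (by simp)]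
    simp only [if_true]; ring
  have e2 : ∑ k, ∑ y, ((if (y, k) = (x, i) then (1 : ℝ) else 0) * gl J (cmp φ k) y +
      φ (y, k) * (if k = i then gl J (fun z => if z = x then 1 else 0) y else 0)) =
      2 * gl J (cmp φ i) x := by
    rw [Finset.sum_eq_single i (fun k _ hk => by simp [hk]) (by simp)]
    rw [Finset.sum_add_distrib]
    have e3 : ∑ y, φ (y, i) * gl J (fun z => if z = x then 1 else 0) y = gl J (cmp φ i) x := by
      have := hJ.gl_selfadjoint (cmp φ i) (fun z => if z = x then 1 else 0)
      simp only [cmp] at this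
      rw [this]; simp
    simp [e3]; ring
  simp only [dpot] at *
  rw [e1, e2]; ring

lemma contDiff_pot : ContDiff ℝ (⊤ : ℕ∞) (pot J g ν : (Λ × Fin n → ℝ) → ℝ) := by
  unfold pot sN gl cmp
  fun_prop

lemma pot_le_shift (hJ : IsWeight J) (hg : 0 < g) (φ : Λ × Fin n → ℝ) :
    ∑ y, (sN φ y - (1 - ν / 2) ^ 2 / g) ≤ pot J g ν φ := by
  unfold pot
  have h1 : 0 ≤ ∑ k : Fin n, ∑ y, φ (y, k) * gl J (cmp φ k) y :=
    Finset.sum_nonneg fun k _ => hJ.sum_mul_gl_self_nonneg (cmp φ k)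
  have h2 : ∑ y, (sN φ y - (1 - ν / 2) ^ 2 / g) ≤
      ∑ y, (g / 4 * sN φ y ^ 2 + ν / 2 * sN φ y) := by
    refine Finset.sum_le_sum fun y _ => ?_
    have : g / 4 * sN φ y ^ 2 + ν / 2 * sN φ y - (sN φ y - (1 - ν / 2) ^ 2 / g) =
        g * (sN φ y / 2 - (1 - ν / 2) / g) ^ 2 := by field_simp; ring
    nlinarith [mul_nonneg hg.le (sq_nonneg (sN φ y / 2 - (1 - ν / 2) / g))]
  linarith

lemma confining_pot (hJ : IsWeight J) (hg : 0 < g) :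
    Confining (pot J g ν : (Λ × Fin n → ℝ) → ℝ) := by
  refine ⟨contDiff_pot.continuous, 2, 1 + ∑ _y : Λ, (1 - ν / 2) ^ 2 / g, two_pos, fun φ => ?_⟩
  have h := pot_le_shift (ν := ν) hJ hg φ
  rw [Finset.sum_sub_distrib] at h
  have h2 : ‖φ‖ ^ 2 ≤ ∑ y, sN φ y := by
    have h3 : ∑ y, sN φ y = ∑ a, φ a ^ 2 := (Fintype.sum_prod_type fun a => φ a ^ 2).symm
    rw [h3, ← Real.sq_sqrt (Finset.sum_nonneg fun a _ => sq_nonneg (φ a))]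
    refine pow_le_pow_left₀ (norm_nonneg _) ?_ 2
    refine (pi_norm_le_iff_of_nonneg (Real.sqrt_nonneg _)).2 fun a => ?_
    refine Real.le_sqrt_of_sq_le ?_
    rw [Real.norm_eq_abs, sq_abs]
    exact Finset.single_le_sum (f := fun a => φ a ^ 2) (fun a _ => sq_nonneg _) (Finset.mem_univ a)
  nlinarith [sq_nonneg (‖φ‖ - 1)]

lemma pd_pot (hJ : IsWeight J) (a : Λ × Fin n) : pd a (pot J g ν) = dpot J g ν a :=
  (hasPD_pot hJ a).pd_eq (contDiff_pot.differentiable (by simp))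

lemma nice_pot (hJ : IsWeight J) (hg : 0 < g) : Nice (pot J g ν : (Λ × Fin n → ℝ) → ℝ) :=
  ⟨contDiff_pot, confining_pot hJ hg, fun a => by rw [pd_pot hJ]; exact tame_dpot J g ν a⟩

/-- The Hessian of the potential. -/
def ddpot (J : Λ → Λ → ℝ) (g ν : ℝ) (a b : Λ × Fin n) (φ : Λ × Fin n → ℝ) : ℝ :=
  (if b.2 = a.2 then gl J (fun z => if z = a.1 then 1 else 0) b.1 else 0) +
    ν * (if b = a then 1 else 0) +
    ((if b.1 = a.1 then 2 * g * φ a * φ b else 0) + g * sN φ b.1 * (if b = a then 1 else 0))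

lemma pd_pd_pot (hJ : IsWeight J) (a b : Λ × Fin n) :
    pd a (pd b (pot J g ν)) = ddpot J g ν a b := by
  rw [pd_pot hJ]
  refine HasPD.pd_eq ?_ ?_
  · rw [← pd_pot hJ]
    exact (contDiff_pd contDiff_pot b).differentiable (by simp)
  · refine (((hasPD_gl J b.2 b.1 a).add ((HasPD.coord a b).const_mul ν)).add
      (((hasPD_sN b.1 a).const_mul g).mul (HasPD.coord a b))).congr (fun φ => rfl) fun φ => ?_
    unfold ddpot
    congr 2
    split_ifs <;> ring

lemma sum_ddpot_mul (hJ : IsWeight J) (w : Λ → ℝ) (φ u : Λ × Fin n → ℝ) :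
    ∑ a : Λ × Fin n, ∑ b, w a.1 * (ddpot J g ν a b φ * (u a * u b)) =
      (∑ k, ∑ y, w y * u (y, k) * gl J (cmp u k) y) +
      ∑ y, w y * (ν * sN u y + (g * sN φ y * sN u y + 2 * g * (∑ i, u (y, i) * φ (y, i)) ^ 2)) := by
  have h : ∀ a : Λ × Fin n, ∑ b, w a.1 * (ddpot J g ν a b φ * (u a * u b)) =
      w a.1 * u a * gl J (cmp u a.2) a.1 + w a.1 * (ν * u a ^ 2 + (g * sN φ a.1 * u a ^ 2 +
        2 * g * (u a * φ a * ∑ i, u (a.1, i) * φ (a.1, i)))) := by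
    rintro ⟨x, k⟩
    have e1 : ∑ b : Λ × Fin n, (if b.2 = k then gl J (fun z => if z = x then 1 else 0) b.1
        else 0) * u b = gl J (cmp u k) x := by
      rw [Fintype.sum_prod_type_right]
      rw [Finset.sum_eq_single k (fun j _ hj => by simp [hj]) (by simp)]
      have := hJ.gl_selfadjoint (fun z => if z = x then 1 else 0) (cmp u k)
      simp only [if_true]
      simp only [cmp] at this ⊢
      rw [← this]; simp
    have e2 : ∑ b : Λ × Fin n, (if b.1 = x then 2 * g * φ (x, k) * φ b else 0) * u b =
        2 * g * φ (x, k) * ∑ i, u (x, i) * φ (x, i) := by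
      rw [Fintype.sum_prod_type]
      rw [Finset.sum_eq_single x (fun j _ hj => by simp [hj]) (by simp)]
      simp only [if_true]
      rw [Finset.mul_sum]
      exact Finset.sum_congr rfl fun i _ => by ring
    have e3 : ∑ b : Λ × Fin n, ν * (if b = (x, k) then 1 else 0) * u b = ν * u (x, k) := by simp
    have e4 : ∑ b : Λ × Fin n, g * sN φ b.1 * (if b = (x, k) then 1 else 0) * u b =
        g * sN φ x * u (x, k) := by simp
    have e5 : ∑ b : Λ × Fin n, w x * (ddpot J g ν (x, k) b φ * (u (x, k) * u b)) =
        w x * u (x, k) * (∑ b : Λ × Fin n,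
          (if b.2 = k then gl J (fun z => if z = x then 1 else 0) b.1 else 0) * u b +
          ∑ b : Λ × Fin n, ν * (if b = (x, k) then 1 else 0) * u b +
        (∑ b : Λ × Fin n, (if b.1 = x then 2 * g * φ (x, k) * φ b else 0) * u b +
        ∑ b : Λ × Fin n, g * sN φ b.1 * (if b = (x, k) then 1 else 0) * u b)) := by
      simp only [← Finset.sum_add_distrib, Finset.mul_sum]
      refine Finset.sum_congr rfl fun b _ => ?_
      unfold ddpot
      ring
    rw [e5, e1, e2, e3, e4]
    ring
  rw [Finset.sum_congr rfl fun a _ => h a, Finset.sum_add_distrib]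
  congr 1
  · rw [Fintype.sum_prod_type_right]
  · rw [Fintype.sum_prod_type]
    refine Finset.sum_congr rfl fun y _ => ?_
    simp only [← Finset.mul_sum, Finset.sum_add_distrib, ← Finset.sum_mul]
    unfold sN
    ring

/-- Weighted Bochner identity for the potential. -/
lemma wint_weighted_gen (hJ : IsWeight J) (hg : 0 < g) {η : (Λ × Fin n → ℝ) → ℝ} (hη : IsTest η)
    (w : Λ → ℝ) :
    wint (pot J g ν) (fun φ => (∑ a : Λ × Fin n, w a.1 * dirOp (pot J g ν) a η φ) *
        gen (pot J g ν) η φ) =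
      wint (pot J g ν) (fun φ => ∑ y, w y * (∑ i, ∑ b, pd b (pd (y, i) η) φ ^ 2 +
        (g * sN φ y * (∑ i, pd (y, i) η φ ^ 2) + 2 * g * (∑ i, pd (y, i) η φ * φ (y, i)) ^ 2))) +
      wint (pot J g ν) (fun φ => (∑ k, ∑ y, w y * pd (y, k) η φ *
          gl J (fun z => pd (z, k) η φ) y) + ν * ∑ y, w y * ∑ i, pd (y, i) η φ ^ 2) := by
  have hV := nice_pot (ν := ν) (n := n) hJ hg
  have tA : ∀ a, Tame (dirOp (pot J g ν) a η) := fun a => (hη.dirOp hV.smooth a).tame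
  have e1 : (fun φ => (∑ a : Λ × Fin n, w a.1 * dirOp (pot J g ν) a η φ) *
        gen (pot J g ν) η φ) = fun φ => ∑ a : Λ × Fin n, ∑ b,
        w a.1 * (dirOp (pot J g ν) a η φ * dirOp (pot J g ν) b η φ) := by
    funext φ
    unfold gen
    rw [Finset.sum_mul_sum]
    exact Finset.sum_congr rfl fun a _ => Finset.sum_congr rfl fun b _ => by ring
  have t2 : ∀ a b, Tame fun φ => pd a (pd b η) φ ^ 2 := fun a b =>
    ((hη.deriv b).deriv a).tame.pow 2
  have tdd : ∀ a b, Tame fun φ => pd a (pd b (pot J g ν)) φ * (pd a η φ * pd b η φ) := fun a b =>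
    Tame.of_hasCompactSupport ((contDiff_pd (contDiff_pd hV.smooth b) a).continuous.mul
      ((hη.deriv a).1.continuous.mul (hη.deriv b).1.continuous))
      ((hη.deriv b).2.mul_left).mul_left
  rw [e1, wint_sum hV.conf _ fun a _ => Tame.sum _ fun b _ => ((tA a).mul (tA b)).const_mul _]
  have e2 : ∀ a : Λ × Fin n, wint (pot J g ν) (fun φ => ∑ b,
      w a.1 * (dirOp (pot J g ν) a η φ * dirOp (pot J g ν) b η φ)) =
      wint (pot J g ν) (fun φ => ∑ b, w a.1 * (pd a (pd b η) φ ^ 2 +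
        pd a (pd b (pot J g ν)) φ * (pd a η φ * pd b η φ))) := fun a => by
    rw [wint_sum hV.conf _ fun b _ => ((tA a).mul (tA b)).const_mul _,
      wint_sum hV.conf _ fun b _ => ((t2 a b).add (tdd a b)).const_mul _]
    refine Finset.sum_congr rfl fun b _ => ?_
    rw [wint_const_mul, wint_const_mul, wint_dirOp_mul_dirOp hV hη]
  simp_rw [e2]
  have tp : ∀ a, Tame (pd a η) := fun a => (hη.deriv a).tame
  rw [← wint_sum hV.conf _ fun a _ => Tame.sum _ fun b _ =>
    ((t2 a b).add (tdd a b)).const_mul _, ← wint_add hV.conf]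
  · congr 1
    funext φ
    simp only [mul_add, Finset.sum_add_distrib, pd_pd_pot hJ]
    have := sum_ddpot_mul (g := g) (ν := ν) hJ w φ (fun a => pd a η φ)
    rw [this]
    have e3 : ∑ a : Λ × Fin n, ∑ b, w a.1 * pd a (pd b η) φ ^ 2 =
        ∑ y, w y * ∑ i, ∑ b, pd b (pd (y, i) η) φ ^ 2 := by
      rw [Fintype.sum_prod_type]
      simp only [Finset.mul_sum]
      refine Finset.sum_congr rfl fun y _ => Finset.sum_congr rfl fun i _ =>
        Finset.sum_congr rfl fun b _ => ?_
      rw [pd_comm hη.1]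
    rw [e3]
    have e4 : ν * ∑ y, w y * ∑ i, pd (y, i) η φ ^ 2 =
        ∑ y, w y * (ν * ∑ i, pd (y, i) η φ ^ 2) := by
      rw [Finset.mul_sum]; exact Finset.sum_congr rfl fun y _ => by ring
    rw [e4]
    unfold sN cmp
    simp only [mul_add, Finset.sum_add_distrib]
    ring
  · exact Tame.sum _ fun y _ => ((Tame.sum _ fun i _ => Tame.sum _ fun b _ => t2 b _).add
      ((((tame_sN y).const_mul g).mul (Tame.sum _ fun i _ => (tp _).pow 2)).add
      (((Tame.sum _ fun i _ => (tp _).mul (Tame.coord _)).pow 2).const_mul _))).const_mul _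
  · refine (Tame.sum _ fun k _ => Tame.sum _ fun y _ => ((tp _).const_mul _).mul ?_).add
      ((Tame.sum _ fun y _ => (Tame.sum _ fun i _ => (tp _).pow 2).const_mul _).const_mul _)
    exact Tame.sum _ fun z _ => ((tp (y, k)).sub (tp (z, k))).const_mul _

end Potential

section Cutoff

/-- A smooth version of the identity on `[0, ∞)`, quadratically small near the origin. -/
def qf (Q a : ℝ) : ℝ := a ^ 2 * (a + 3 / 2 * Q) / (a + Q) ^ 2

/-- The derivative of `qf`. -/
def qf' (Q a : ℝ) : ℝ := 1 - Q ^ 3 / (a + Q) ^ 3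

/-- Half of a primitive of `qf`. -/
def thf (Q a : ℝ) : ℝ := a ^ 3 / (4 * (a + Q))

variable {Q a b : ℝ}

lemma hasDerivAt_qf (hQ : 0 < Q) (ha : 0 ≤ a) : HasDerivAt (qf Q) (qf' Q a) a := by
  unfold qf
  have h0 : a + Q ≠ 0 := by positivity
  have := (((hasDerivAt_id a).pow 2).mul ((hasDerivAt_id a).add_const (3 / 2 * Q))).div
    (((hasDerivAt_id a).add_const Q).pow 2) (by simpa using pow_ne_zero 2 h0)
  refine this.congr_deriv ?_
  unfold qf'
  simp only [id, Pi.pow_apply, Pi.mul_apply]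
  field_simp
  push_cast
  ring

lemma qf_nonneg (hQ : 0 < Q) (ha : 0 ≤ a) : 0 ≤ qf Q a := by unfold qf; positivity

lemma qf_le (hQ : 0 < Q) (ha : 0 ≤ a) : qf Q a ≤ a := by
  unfold qf
  rw [div_le_iff₀ (by positivity)]
  nlinarith [mul_nonneg (mul_nonneg ha ha) hQ.le, mul_nonneg ha (mul_nonneg hQ.le hQ.le)]

lemma qf'_nonneg (hQ : 0 < Q) (ha : 0 ≤ a) : 0 ≤ qf' Q a := by
  unfold qf'
  rw [sub_nonneg, div_le_one (by positivity)]
  exact pow_le_pow_left₀ hQ.le (by linarith) 3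

lemma qf'_le (hQ : 0 < Q) (ha : 0 ≤ a) : qf' Q a ≤ 1 := by
  unfold qf'
  have : 0 ≤ Q ^ 3 / (a + Q) ^ 3 := by positivity
  linarith

lemma qf'_mul_le (hQ : 0 < Q) (ha : 0 ≤ a) : qf' Q a * a ≤ 2 * qf Q a := by
  have h0 : 0 < a + Q := by positivity
  have : 2 * qf Q a - qf' Q a * a = a ^ 3 * (a + 2 * Q) / (a + Q) ^ 3 := by
    unfold qf qf'; field_simp; ring
  have h : 0 ≤ a ^ 3 * (a + 2 * Q) / (a + Q) ^ 3 := by positivity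
  linarith

lemma thf_nonneg (hQ : 0 < Q) (ha : 0 ≤ a) : 0 ≤ thf Q a := by unfold thf; positivity

lemma thf_le (hQ : 0 < Q) (ha : 0 ≤ a) : thf Q a ≤ 1 / 2 * (qf Q a * a) := by
  have h0 : 0 < a + Q := by positivity
  have : 1 / 2 * (qf Q a * a) - thf Q a = a ^ 3 * (a + 2 * Q) / (4 * (a + Q) ^ 2) := by
    unfold qf thf; field_simp; ring
  have h : 0 ≤ a ^ 3 * (a + 2 * Q) / (4 * (a + Q) ^ 2) := by positivity
  linarith

lemma thf_convex (hQ : 0 < Q) (ha : 0 ≤ a) (hb : 0 ≤ b) :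
    thf Q a - thf Q b ≤ qf Q a * (1 / 2 * (a - b)) := by
  have h0 : 0 < a + Q := by positivity
  have h1 : 0 < b + Q := by positivity
  have : qf Q a * (1 / 2 * (a - b)) - (thf Q a - thf Q b) =
      (b - a) ^ 2 * ((a + Q) ^ 2 * (b + Q) - Q ^ 3) / (4 * ((a + Q) ^ 2 * (b + Q))) := by
    unfold qf thf; field_simp; ring
  have h3 : 0 ≤ (a + Q) ^ 2 * (b + Q) - Q ^ 3 := by
    have : Q ^ 2 * Q ≤ (a + Q) ^ 2 * (b + Q) :=
      mul_le_mul (pow_le_pow_left₀ hQ.le (by linarith) 2) (by linarith) hQ.le (by positivity)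
    linarith
  have h : 0 ≤ (b - a) ^ 2 * ((a + Q) ^ 2 * (b + Q) - Q ^ 3) /
      (4 * ((a + Q) ^ 2 * (b + Q))) := by positivity
  linarith

lemma cube_le_qf (hQ : 0 < Q) (ha : 0 ≤ a) : a ^ 3 ≤ 2 * (qf Q a * a ^ 2) + Q ^ 3 := by
  rcases le_total a Q with h | h
  · have := pow_le_pow_left₀ ha h 3
    have h2 := mul_nonneg (qf_nonneg hQ ha) (sq_nonneg a)
    linarith
  · have h2 : a ≤ 2 * qf Q a := by
      unfold qf
      rw [mul_div_assoc', le_div_iff₀ (by positivity)]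
      nlinarith [mul_nonneg ha (mul_nonneg ha (sub_nonneg.2 h)),
        mul_nonneg ha (mul_nonneg hQ.le (sub_nonneg.2 h)), mul_nonneg ha (mul_nonneg hQ.le ha)]
    have h3 : 0 < Q ^ 3 := by positivity
    nlinarith [mul_le_mul_of_nonneg_right h2 (sq_nonneg a)]

lemma qf_le_sq (hQ : 0 < Q) (ha : 0 ≤ a) : qf Q a ≤ 3 / 2 * a ^ 2 / Q := by
  unfold qf
  rw [div_le_div_iff₀ (by positivity) hQ]
  nlinarith [mul_nonneg (mul_nonneg (sq_nonneg a) ha) hQ.le,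
    mul_nonneg (mul_nonneg (sq_nonneg a) ha) ha, mul_nonneg (sq_nonneg a) (sq_nonneg Q)]

/-- The drift created by the cutoff is bounded below. -/
lemma qf_drift_ge {g τ m : ℝ} (hQ : 0 < Q) (hg : 0 < g) (hτ : τ ^ 2 ≤ g)
    (hm : 0 ≤ m) (ha : 0 ≤ a) :
    -(6 * (m + 9) ^ 2 / (g * Q)) ≤
      qf Q a * (3 / 8 * g * a ^ 2 - 3 / 2 * τ * a - (m + 4)) := by
  have h1 : 3 / 2 * τ * a ≤ 1 / 8 * g * a ^ 2 + 9 / 2 := by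
    have : (τ * a) ^ 2 ≤ g * a ^ 2 := by
      rw [mul_pow]; exact mul_le_mul_of_nonneg_right hτ (sq_nonneg a)
    nlinarith [sq_nonneg (τ * a - 6)]
  have hq := qf_nonneg hQ ha
  have h2 : qf Q a * (1 / 4 * g * a ^ 2 - (m + 9)) ≤
      qf Q a * (3 / 8 * g * a ^ 2 - 3 / 2 * τ * a - (m + 4)) :=
    mul_le_mul_of_nonneg_left (by linarith) hq
  refine le_trans ?_ h2
  rcases le_total (m + 9) (1 / 4 * g * a ^ 2) with h | h
  · refine le_trans ?_ (mul_nonneg hq (sub_nonneg.2 h))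
    have : 0 ≤ 6 * (m + 9) ^ 2 / (g * Q) := by positivity
    linarith
  · have h3 : a ^ 2 ≤ 4 * (m + 9) / g := by rw [le_div_iff₀ hg]; linarith
    have h4 : qf Q a ≤ 6 * (m + 9) / (g * Q) := by
      refine (qf_le_sq hQ ha).trans ?_
      calc 3 / 2 * a ^ 2 / Q ≤ 3 / 2 * (4 * (m + 9) / g) / Q := by gcongr
        _ = 6 * (m + 9) / (g * Q) := by field_simp; ring
    have h5 : -(m + 9) ≤ 1 / 4 * g * a ^ 2 - (m + 9) := by
      have : 0 ≤ 1 / 4 * g * a ^ 2 := by positivity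
      linarith
    have h6 := mul_le_mul_of_nonneg_left h5 hq
    have h7 : qf Q a * (m + 9) ≤ 6 * (m + 9) / (g * Q) * (m + 9) :=
      mul_le_mul_of_nonneg_right h4 (by linarith)
    have h8 : 6 * (m + 9) / (g * Q) * (m + 9) = 6 * (m + 9) ^ 2 / (g * Q) := by ring
    linarith

end Cutoff

section Field

variable {Λ : Type*} [Fintype Λ] [DecidableEq Λ] {n : ℕ}

/-- The main part of the vector field. -/
def xiA (g : ℝ) (A : Λ → Λ → ℝ) (φ : Λ × Fin n → ℝ) (v : Fin n → ℝ) (a : Λ × Fin n) : ℝ :=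
  -2 * g * (mv A (cmp φ a.2) a.1 * normSq v +
    2 * ((∑ i, v i * mv A (cmp φ i) a.1) * v a.2))

/-- The correction part of the vector field. -/
def xiX (c Q : ℝ) (R : Λ → ℝ) (φ : Λ × Fin n → ℝ) (v : Fin n → ℝ) (a : Λ × Fin n) : ℝ :=
  c * R a.1 * (qf Q (sN φ a.1) * φ a * normSq v)

/-- The coefficient of `∂u` produced by the main part. -/
def sA (g : ℝ) (A : Λ → Λ → ℝ) (φ : Λ × Fin n → ℝ) (v : Fin n → ℝ) (a : Λ × Fin n)
    (i : Fin n) : ℝ :=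
  2 * g * (mv A (cmp φ a.2) a.1 * v i + mv A (cmp φ i) a.1 * v a.2 +
    (if i = a.2 then ∑ j, v j * mv A (cmp φ j) a.1 else 0))

/-- The coefficient of `∂u` produced by the correction part. -/
def sX (c Q : ℝ) (R : Λ → ℝ) (φ : Λ × Fin n → ℝ) (v : Fin n → ℝ) (a : Λ × Fin n) (i : Fin n) : ℝ :=
  c * R a.1 * (qf Q (sN φ a.1) * φ a * v i)

/-- The derivative of the main part. -/
def dxiA (g : ℝ) (A : Λ → Λ → ℝ) (φ : Λ × Fin n → ℝ) (v : Fin n → ℝ) (p : Fin n → ℝ)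
    (a : Λ × Fin n) : ℝ :=
  -2 * g * (A a.1 a.1 * (normSq v + 2 * v a.2 ^ 2)) - 2 * ∑ i, sA g A φ v a i * p i

/-- The derivative of the correction part. -/
def dxiX (c Q : ℝ) (R : Λ → ℝ) (φ : Λ × Fin n → ℝ) (v : Fin n → ℝ) (p : Fin n → ℝ)
    (a : Λ × Fin n) : ℝ :=
  c * R a.1 * ((qf' Q (sN φ a.1) * (2 * φ a ^ 2) + qf Q (sN φ a.1)) * normSq v) +
    2 * ∑ i, sX c Q R φ v a i * p i

lemma hasPD_mv (A : Λ → Λ → ℝ) (k : Fin n) (y : Λ) (a : Λ × Fin n) :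
    HasPD a (fun φ : Λ × Fin n → ℝ => mv A (cmp φ k) y)
      (fun _ => if k = a.2 then A y a.1 else 0) := by
  refine (HasPD.sum Finset.univ fun z _ => (HasPD.coord a (z, k)).const_mul (A y z)).congr
      (fun φ => rfl) fun φ => ?_
  obtain ⟨x, i⟩ := a
  by_cases h : k = i
  · subst h; simp
  · simp [h]

lemma tame_mv (A : Λ → Λ → ℝ) (k : Fin n) (y : Λ) :
    Tame (fun φ : Λ × Fin n → ℝ => mv A (cmp φ k) y) :=
  Tame.sum _ fun z _ => (Tame.coord (z, k)).const_mul _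

lemma hasPD_normSq {u p : Fin n → (Λ × Fin n → ℝ) → ℝ} {a : Λ × Fin n}
    (h : ∀ i, HasPD a (u i) (p i)) :
    HasPD a (fun φ => normSq fun i => u i φ) (fun φ => 2 * ∑ i, u i φ * p i φ) :=
  (HasPD.sum Finset.univ fun i _ => (h i).sq).congr (fun φ => rfl) fun φ => by
    rw [Finset.mul_sum]; exact Finset.sum_congr rfl fun i _ => by ring

lemma tame_normSq {u : Fin n → (Λ × Fin n → ℝ) → ℝ} (h : ∀ i, Tame (u i)) :
    Tame (fun φ => normSq fun i => u i φ) := Tame.sum _ fun i _ => (h i).pow 2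

lemma hasPD_xiA (g : ℝ) (A : Λ → Λ → ℝ) {u p : Fin n → (Λ × Fin n → ℝ) → ℝ} {a : Λ × Fin n}
    (h : ∀ i, HasPD a (u i) (p i)) :
    HasPD a (fun φ => xiA g A φ (fun i => u i φ) a)
      (fun φ => dxiA g A φ (fun i => u i φ) (fun i => p i φ) a) := by
  have h1 := ((hasPD_mv A a.2 a.1 a).mul (hasPD_normSq h)).add
    (((HasPD.sum Finset.univ fun i _ => (h i).mul (hasPD_mv A i a.1 a)).mul (h a.2)).const_mul 2)
  refine (h1.const_mul (-2 * g)).congr (fun φ => rfl) fun φ => ?_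
  unfold dxiA sA
  simp only [if_true, mul_add, add_mul, Finset.sum_add_distrib, mul_ite, mul_zero,
    Finset.sum_ite_eq', Finset.mem_univ, ite_mul, zero_mul]
  have e1 : ∑ i, 2 * g * (mv A (cmp φ a.2) a.1 * u i φ) * p i φ =
      2 * g * mv A (cmp φ a.2) a.1 * ∑ i, u i φ * p i φ := by
    rw [Finset.mul_sum]; exact Finset.sum_congr rfl fun i _ => by ring
  have e2 : ∑ i, 2 * g * (mv A (cmp φ i) a.1 * u a.2 φ) * p i φ =
      2 * g * u a.2 φ * ∑ i, p i φ * mv A (cmp φ i) a.1 := by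
    rw [Finset.mul_sum]; exact Finset.sum_congr rfl fun i _ => by ring
  rw [e1, e2]
  ring

lemma hasPD_xiX {c Q : ℝ} (hQ : 0 < Q) (R : Λ → ℝ) {u p : Fin n → (Λ × Fin n → ℝ) → ℝ}
    {a : Λ × Fin n} (h : ∀ i, HasPD a (u i) (p i)) :
    HasPD a (fun φ => xiX c Q R φ (fun i => u i φ) a)
      (fun φ => dxiX c Q R φ (fun i => u i φ) (fun i => p i φ) a) := by
  have h0 := (hasPD_sN (n := n) a.1 a).comp (q := qf Q) (q' := qf' Q)
    fun φ => hasDerivAt_qf hQ (sN_nonneg φ a.1)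
  have h1 := ((h0.mul (HasPD.coord a a)).mul (hasPD_normSq h)).const_mul (c * R a.1)
  refine h1.congr (fun φ => rfl) fun φ => ?_
  unfold dxiX sX
  have e1 : ∑ i, c * R a.1 * (qf Q (sN φ a.1) * φ a * u i φ) * p i φ =
      c * R a.1 * (qf Q (sN φ a.1) * φ a) * ∑ i, u i φ * p i φ := by
    rw [Finset.mul_sum]; exact Finset.sum_congr rfl fun i _ => by ring
  rw [e1]
  simp only [if_true]
  ring

lemma tame_qf {Q : ℝ} (hQ : 0 < Q) (y : Λ) : Tame (fun φ : Λ × Fin n → ℝ => qf Q (sN φ y)) := by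
  refine Tame.of_le ?_ (tame_sN y) fun φ => ?_
  · have := (tame_sN (n := n) y).continuous
    refine Continuous.div (by fun_prop) (by fun_prop) fun φ => ?_
    have := sN_nonneg φ y
    positivity
  · rw [abs_of_nonneg (qf_nonneg hQ (sN_nonneg φ y)), abs_of_nonneg (sN_nonneg φ y)]
    exact qf_le hQ (sN_nonneg φ y)

lemma tame_qf' {Q : ℝ} (hQ : 0 < Q) (y : Λ) :
    Tame (fun φ : Λ × Fin n → ℝ => qf' Q (sN φ y)) := by
  refine Tame.of_le ?_ (Tame.const 1) fun φ => ?_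
  · have := (tame_sN (n := n) y).continuous
    refine Continuous.sub (by fun_prop) (Continuous.div (by fun_prop) (by fun_prop) fun φ => ?_)
    have := sN_nonneg φ y
    positivity
  · rw [abs_of_nonneg (qf'_nonneg hQ (sN_nonneg φ y)), abs_one]
    exact qf'_le hQ (sN_nonneg φ y)

lemma tame_xiA (g : ℝ) (A : Λ → Λ → ℝ) {u : Fin n → (Λ × Fin n → ℝ) → ℝ} (a : Λ × Fin n)
    (h : ∀ i, Tame (u i)) : Tame (fun φ => xiA g A φ (fun i => u i φ) a) :=
  (((tame_mv A a.2 a.1).mul (tame_normSq h)).add (((Tame.sum _ fun i _ =>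
    (h i).mul (tame_mv A i a.1)).mul (h a.2)).const_mul 2)).const_mul _

lemma tame_xiX {c Q : ℝ} (hQ : 0 < Q) (R : Λ → ℝ) {u : Fin n → (Λ × Fin n → ℝ) → ℝ}
    (a : Λ × Fin n) (h : ∀ i, Tame (u i)) : Tame (fun φ => xiX c Q R φ (fun i => u i φ) a) :=
  (((tame_qf hQ a.1).mul (Tame.coord a)).mul (tame_normSq h)).const_mul _

lemma tame_dxiA (g : ℝ) (A : Λ → Λ → ℝ) {u p : Fin n → (Λ × Fin n → ℝ) → ℝ} (a : Λ × Fin n)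
    (h : ∀ i, Tame (u i)) (hp : ∀ i, Tame (p i)) :
    Tame (fun φ => dxiA g A φ (fun i => u i φ) (fun i => p i φ) a) := by
  unfold dxiA sA
  refine ((((tame_normSq h).add (((h a.2).pow 2).const_mul 2)).const_mul _).const_mul _).sub
    ((Tame.sum _ fun i _ => ((((((tame_mv A a.2 a.1).mul (h i)).add
      ((tame_mv A i a.1).mul (h a.2))).add ?_).const_mul _).mul (hp i))).const_mul 2)
  by_cases hi : i = a.2
  · simp only [hi, if_true]
    exact Tame.sum _ fun j _ => (h j).mul (tame_mv A j a.1)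
  · simp only [hi, if_false]; exact Tame.const 0

lemma tame_dxiX {c Q : ℝ} (hQ : 0 < Q) (R : Λ → ℝ) {u p : Fin n → (Λ × Fin n → ℝ) → ℝ}
    (a : Λ × Fin n) (h : ∀ i, Tame (u i)) (hp : ∀ i, Tame (p i)) :
    Tame (fun φ => dxiX c Q R φ (fun i => u i φ) (fun i => p i φ) a) := by
  unfold dxiX sX
  exact ((((((tame_qf' hQ a.1).mul (((Tame.coord a).pow 2).const_mul 2)).add
    (tame_qf hQ a.1)).mul (tame_normSq h)).const_mul _)).add
    ((Tame.sum _ fun i _ => ((((tame_qf hQ a.1).mul (Tame.coord a)).mul (h i)).const_mul _).mul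
      (hp i)).const_mul 2)

end Field

section FormBound

variable {Λ : Type*} [Fintype Λ] [DecidableEq Λ] {n : ℕ}
variable {J A : Λ → Λ → ℝ} {g ν β τ : ℝ} {x : Λ} {ρ : Λ → ℝ}

lemma normSq_nonneg (v : Fin n → ℝ) : 0 ≤ normSq v := Finset.sum_nonneg fun _ _ => sq_nonneg _

lemma prj_sq_le (v : Fin n → ℝ) (φ : Λ × Fin n → ℝ) (y : Λ) :
    prj v φ y ^ 2 ≤ normSq v * sN φ y := Finset.sum_mul_sq_le_sq_mul_sq _ _ _

lemma Lyap.drift_le (h : Lyap J β x A ρ) (hg : 0 < g) (hτ : 0 < τ) (hβ : τ ≤ β - ν)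
    (f N : Λ → ℝ) :
    2 * ∑ y, mv A f y * (gl J f y + ν * f y + g * N y * f y) ≤
      f x ^ 2 - τ * ∑ y, f y * mv A f y + g ^ 2 / τ * ∑ y, ρ y * (N y * f y) ^ 2 := by
  have h1 := h.lyap f
  have h2 := h.cross_le (t := τ / g) (by positivity) f (fun y => N y * f y)
  have h3 := h.psd f
  have e : 2 * ∑ y, mv A f y * (gl J f y + ν * f y + g * N y * f y) =
      2 * ∑ y, mv A f y * (β * f y + gl J f y) - 2 * (β - ν) * ∑ y, f y * mv A f y +
      g * (2 * ∑ y, N y * f y * mv A f y) := by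
    simp only [Finset.mul_sum, ← Finset.sum_add_distrib, ← Finset.sum_sub_distrib]
    exact Finset.sum_congr rfl fun y _ => by ring
  have h4 := mul_le_mul_of_nonneg_left h2 hg.le
  have e2 : g * (τ / g * ∑ y, f y * mv A f y + (τ / g)⁻¹ * ∑ y, ρ y * (N y * f y) ^ 2) =
      τ * ∑ y, f y * mv A f y + g ^ 2 / τ * ∑ y, ρ y * (N y * f y) ^ 2 := by
    field_simp
  rw [e, h1]
  nlinarith [mul_le_mul_of_nonneg_right hβ h3]

lemma mv_prj (A : Λ → Λ → ℝ) (v : Fin n → ℝ) (φ : Λ × Fin n → ℝ) (y : Λ) :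
    mv A (prj v φ) y = ∑ i, v i * mv A (cmp φ i) y := by
  unfold mv prj cmp
  simp only [Finset.mul_sum]
  rw [Finset.sum_comm]
  exact Finset.sum_congr rfl fun i _ => Finset.sum_congr rfl fun z _ => by ring

lemma gl_prj (J : Λ → Λ → ℝ) (v : Fin n → ℝ) (φ : Λ × Fin n → ℝ) (y : Λ) :
    gl J (prj v φ) y = ∑ i, v i * gl J (cmp φ i) y := by
  unfold prj
  rw [gl_sum]
  exact Finset.sum_congr rfl fun i _ => gl_const_mul _ _ _ _

lemma sum_xiA_mul_dpot_ge (h : Lyap J β x A ρ) (hg : 0 < g) (hτ : 0 < τ) (hβ : τ ≤ β - ν)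
    (φ : Λ × Fin n → ℝ) (v : Fin n → ℝ) :
    -(g * sN φ x * normSq v + 2 * g * prj v φ x ^ 2) +
      g * τ * ((∑ k, ∑ y, cmp φ k y * mv A (cmp φ k) y) * normSq v +
        2 * ∑ y, prj v φ y * mv A (prj v φ) y) -
      3 * (g ^ 3 / τ) * ((∑ y, ρ y * sN φ y ^ 3) * normSq v) ≤
    ∑ a, xiA g A φ v a * dpot J g ν a φ := by
  have e : ∑ a, xiA g A φ v a * dpot J g ν a φ =
      -g * (normSq v * ∑ k, 2 * ∑ y, mv A (cmp φ k) y * (gl J (cmp φ k) y + ν * cmp φ k y +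
        g * sN φ y * cmp φ k y) + 2 * (2 * ∑ y, mv A (prj v φ) y * (gl J (prj v φ) y +
          ν * prj v φ y + g * sN φ y * prj v φ y))) := by
    have e1 : ∀ y, gl J (prj v φ) y + ν * prj v φ y + g * sN φ y * prj v φ y =
        ∑ k, v k * dpot J g ν (y, k) φ := fun y => by
      rw [gl_prj]
      unfold prj dpot
      simp only [Finset.mul_sum, ← Finset.sum_add_distrib]
      exact Finset.sum_congr rfl fun i _ => by ring
    have e2 : ∑ k, 2 * ∑ y, mv A (cmp φ k) y * (gl J (cmp φ k) y + ν * cmp φ k y +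
        g * sN φ y * cmp φ k y) = ∑ y, ∑ k, 2 * (mv A (cmp φ k) y * dpot J g ν (y, k) φ) := by
      rw [Finset.sum_comm]
      exact Finset.sum_congr rfl fun k _ => by rw [Finset.mul_sum]; rfl
    rw [e2, Fintype.sum_prod_type]
    simp_rw [e1, mv_prj]
    simp only [Finset.mul_sum, ← Finset.sum_add_distrib]
    refine Finset.sum_congr rfl fun y _ => ?_
    refine Finset.sum_congr rfl fun k _ => ?_
    unfold xiA
    simp only
    ring
  have h1 : ∀ k, _ := fun k => h.drift_le hg hτ hβ (cmp φ k) (sN φ)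
  have h2 := h.drift_le hg hτ hβ (prj v φ) (sN φ)
  have h3 := Finset.sum_le_sum fun k (_ : k ∈ Finset.univ) => h1 k
  rw [Finset.sum_add_distrib, Finset.sum_sub_distrib, ← Finset.mul_sum (a := τ),
    ← Finset.mul_sum (a := g ^ 2 / τ)] at h3
  have e3 : ∑ k, cmp φ k x ^ 2 = sN φ x := rfl
  have e4 : ∑ k, ∑ y, ρ y * (sN φ y * cmp φ k y) ^ 2 = ∑ y, ρ y * sN φ y ^ 3 := by
    rw [Finset.sum_comm]
    refine Finset.sum_congr rfl fun y _ => ?_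
    have : sN φ y ^ 3 = sN φ y ^ 2 * ∑ k, φ (y, k) ^ 2 := by
      rw [pow_succ]; rfl
    rw [this, Finset.mul_sum, Finset.mul_sum]
    exact Finset.sum_congr rfl fun k _ => by unfold cmp; ring
  have h5 : ∑ y, ρ y * (sN φ y * prj v φ y) ^ 2 ≤ (∑ y, ρ y * sN φ y ^ 3) * normSq v := by
    rw [Finset.sum_mul]
    refine Finset.sum_le_sum fun y _ => ?_
    have := mul_le_mul_of_nonneg_left (prj_sq_le v φ y)
      (mul_nonneg (h.row_nonneg y) (sq_nonneg (sN φ y)))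
    linarith
  rw [e3, e4] at h3
  rw [e]
  have h6 := mul_le_mul_of_nonneg_left h3 (mul_nonneg hg.le (normSq_nonneg v))
  have h7 := mul_le_mul_of_nonneg_left h2 hg.le
  have h8 := mul_le_mul_of_nonneg_left h5 (show 0 ≤ g ^ 3 / τ by positivity)
  have e5 : g * (g ^ 2 / τ) = g ^ 3 / τ := by ring
  have e6 : ∀ z : ℝ, g * (g ^ 2 / τ * z) = g ^ 3 / τ * z := fun z => by rw [← e5]; ring
  rw [mul_add, e6] at h7
  have e7 : ∀ z : ℝ, g * normSq v * (g ^ 2 / τ * z) = g ^ 3 / τ * (z * normSq v) :=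
    fun z => by rw [← e5]; ring
  rw [mul_add, e7] at h6
  linarith

lemma sum_sA_sq_le (h : Lyap J β x A ρ) {t : ℝ} (ht : 0 < t) (hρ : ∀ y, ρ y ≤ t)
    (φ : Λ × Fin n → ℝ) (v : Fin n → ℝ) :
    ∑ a, ∑ i, sA g A φ v a i ^ 2 ≤ 12 * g ^ 2 * t *
      (2 * ((∑ k, ∑ y, cmp φ k y * mv A (cmp φ k) y) * normSq v) +
        n * ∑ y, prj v φ y * mv A (prj v φ) y) := by
  have h1 : ∀ a : Λ × Fin n, ∑ i, sA g A φ v a i ^ 2 ≤ 12 * g ^ 2 *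
      (mv A (cmp φ a.2) a.1 ^ 2 * normSq v + (∑ i, mv A (cmp φ i) a.1 ^ 2) * v a.2 ^ 2 +
        mv A (prj v φ) a.1 ^ 2) := by
    intro a
    have : ∀ i, sA g A φ v a i ^ 2 ≤ 12 * g ^ 2 * (mv A (cmp φ a.2) a.1 ^ 2 * v i ^ 2 +
        mv A (cmp φ i) a.1 ^ 2 * v a.2 ^ 2 +
        if i = a.2 then mv A (prj v φ) a.1 ^ 2 else 0) := by
      intro i
      unfold sA
      rw [← mv_prj]
      have key : ∀ p q r : ℝ, (2 * g * (p + q + r)) ^ 2 ≤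
          12 * g ^ 2 * (p ^ 2 + q ^ 2 + r ^ 2) := fun p q r => by
        nlinarith [mul_nonneg (sq_nonneg g) (sq_nonneg (p - q)),
          mul_nonneg (sq_nonneg g) (sq_nonneg (p - r)),
          mul_nonneg (sq_nonneg g) (sq_nonneg (q - r))]
      refine (key _ _ _).trans (le_of_eq ?_)
      split_ifs <;> ring
    refine (Finset.sum_le_sum fun i _ => this i).trans (le_of_eq ?_)
    rw [← Finset.mul_sum, Finset.sum_add_distrib, Finset.sum_add_distrib, ← Finset.mul_sum,
      ← Finset.sum_mul]
    simp [normSq]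
  refine (Finset.sum_le_sum fun a _ => h1 a).trans ?_
  have e : ∑ a : Λ × Fin n, 12 * g ^ 2 *
      (mv A (cmp φ a.2) a.1 ^ 2 * normSq v + (∑ i, mv A (cmp φ i) a.1 ^ 2) * v a.2 ^ 2 +
        mv A (prj v φ) a.1 ^ 2) = 12 * g ^ 2 *
      (2 * ((∑ k, ∑ y, mv A (cmp φ k) y ^ 2) * normSq v) +
        n * ∑ y, mv A (prj v φ) y ^ 2) := by
    rw [← Finset.mul_sum, Fintype.sum_prod_type]
    congr 1
    simp only [Finset.sum_add_distrib, ← Finset.mul_sum, ← Finset.sum_mul, Finset.sum_const,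
      Finset.card_univ, Fintype.card_fin, nsmul_eq_mul]
    rw [Finset.sum_comm]
    unfold normSq
    ring
  rw [e]
  have h2 : ∑ k, ∑ y, mv A (cmp φ k) y ^ 2 ≤ t * ∑ k, ∑ y, cmp φ k y * mv A (cmp φ k) y := by
    rw [Finset.mul_sum]
    exact Finset.sum_le_sum fun k _ => h.sum_mv_sq_le ht hρ _
  have h3 := h.sum_mv_sq_le ht hρ (prj v φ)
  have h4 := mul_le_mul_of_nonneg_right h2 (normSq_nonneg v)
  have h5 := mul_le_mul_of_nonneg_left h3 (Nat.cast_nonneg (α := ℝ) n)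
  have : 12 * g ^ 2 * t *
      (2 * ((∑ k, ∑ y, cmp φ k y * mv A (cmp φ k) y) * normSq v) +
        n * ∑ y, prj v φ y * mv A (prj v φ) y) = 12 * g ^ 2 *
      (2 * (t * (∑ k, ∑ y, cmp φ k y * mv A (cmp φ k) y) * normSq v) +
        n * (t * ∑ y, prj v φ y * mv A (prj v φ) y)) := by ring
  rw [this]
  exact mul_le_mul_of_nonneg_left (by linarith) (by positivity)

lemma sum_xiX_mul_dpot_ge (hJ : IsWeight J) {c Q τ₂ : ℝ} {R : Λ → ℝ} (hc : 0 ≤ c) (hQ : 0 < Q)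
    (hR0 : ∀ y, 0 ≤ R y) (hR : ∀ y, τ₂ * R y + gl J R y = ρ y) (hρ : ∀ y, 0 ≤ ρ y) (hτ : 0 ≤ τ₂)
    (hν : -τ₂ ≤ ν) (φ : Λ × Fin n → ℝ) (v : Fin n → ℝ) :
    c * normSq v * ∑ y, R y * (qf Q (sN φ y) * (g * sN φ y ^ 2 - 3 / 2 * τ₂ * sN φ y)) ≤
      ∑ a, xiX c Q R φ v a * dpot J g ν a φ := by
  have e : ∑ a, xiX c Q R φ v a * dpot J g ν a φ = c * normSq v * ∑ y, R y * (qf Q (sN φ y) *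
      (∑ k, φ (y, k) * gl J (cmp φ k) y + ν * sN φ y + g * sN φ y ^ 2)) := by
    rw [Fintype.sum_prod_type, Finset.mul_sum]
    refine Finset.sum_congr rfl fun y _ => ?_
    have : ∑ k, φ (y, k) * gl J (cmp φ k) y + ν * sN φ y + g * sN φ y ^ 2 =
        ∑ k, φ (y, k) * dpot J g ν (y, k) φ := by
      rw [sq, ← mul_assoc]
      conv_lhs => enter [1, 2, 2]; unfold sN
      conv_lhs => enter [2, 2]; unfold sN
      simp only [Finset.mul_sum, ← Finset.sum_add_distrib]
      exact Finset.sum_congr rfl fun k _ => by unfold dpot; ring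
    rw [this]
    simp only [Finset.mul_sum]
    exact Finset.sum_congr rfl fun k _ => by unfold xiX; ring
  rw [e]
  refine mul_le_mul_of_nonneg_left ?_ (mul_nonneg hc (normSq_nonneg v))
  have h1 : ∀ y, gl J (fun z => thf Q (sN φ z)) y ≤
      qf Q (sN φ y) * ∑ k, φ (y, k) * gl J (cmp φ k) y := by
    intro y
    have : ∑ k, φ (y, k) * gl J (cmp φ k) y =
        ∑ z, J y z * ∑ k, φ (y, k) * (φ (y, k) - φ (z, k)) := by
      unfold gl cmp
      simp only [Finset.mul_sum]
      rw [Finset.sum_comm]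
      exact Finset.sum_congr rfl fun z _ => Finset.sum_congr rfl fun k _ => by ring
    rw [this, Finset.mul_sum]
    refine Finset.sum_le_sum fun z _ => ?_
    have h2 : 1 / 2 * (sN φ y - sN φ z) ≤ ∑ k, φ (y, k) * (φ (y, k) - φ (z, k)) := by
      unfold sN
      rw [← Finset.sum_sub_distrib, Finset.mul_sum]
      exact Finset.sum_le_sum fun k _ => by nlinarith [sq_nonneg (φ (y, k) - φ (z, k))]
    have h3 := (thf_convex hQ (sN_nonneg φ y) (sN_nonneg φ z)).trans
      (mul_le_mul_of_nonneg_left h2 (qf_nonneg hQ (sN_nonneg φ y)))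
    have := mul_le_mul_of_nonneg_left h3 (hJ.nonneg y z)
    linarith
  have h2 : -(1 / 2 * τ₂ * ∑ y, R y * (qf Q (sN φ y) * sN φ y)) ≤
      ∑ y, R y * gl J (fun z => thf Q (sN φ z)) y := by
    rw [hJ.gl_selfadjoint, Finset.mul_sum, ← Finset.sum_neg_distrib]
    refine Finset.sum_le_sum fun y _ => ?_
    have h0 := thf_nonneg hQ (sN_nonneg φ y)
    have e1 : gl J R y * thf Q (sN φ y) =
        ρ y * thf Q (sN φ y) - τ₂ * R y * thf Q (sN φ y) := by rw [← hR y]; ring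
    have h3 := mul_le_mul_of_nonneg_left (thf_le hQ (sN_nonneg φ y)) (mul_nonneg hτ (hR0 y))
    have h4 := mul_nonneg (hρ y) h0
    rw [e1]
    linarith
  have h3 : ∑ y, R y * (gl J (fun z => thf Q (sN φ z)) y +
      qf Q (sN φ y) * (-τ₂ * sN φ y + g * sN φ y ^ 2)) ≤ ∑ y, R y * (qf Q (sN φ y) *
      (∑ k, φ (y, k) * gl J (cmp φ k) y + ν * sN φ y + g * sN φ y ^ 2)) := by
    refine Finset.sum_le_sum fun y _ => mul_le_mul_of_nonneg_left ?_ (hR0 y)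
    have h4 := mul_le_mul_of_nonneg_left (mul_le_mul_of_nonneg_right hν (sN_nonneg φ y))
      (qf_nonneg hQ (sN_nonneg φ y))
    linarith [h1 y]
  refine le_trans ?_ h3
  have e2 : ∑ y, R y * (qf Q (sN φ y) * (g * sN φ y ^ 2 - 3 / 2 * τ₂ * sN φ y)) =
      -(1 / 2 * τ₂ * ∑ y, R y * (qf Q (sN φ y) * sN φ y)) +
      ∑ y, R y * (qf Q (sN φ y) * (-τ₂ * sN φ y + g * sN φ y ^ 2)) := by
    rw [Finset.mul_sum, ← Finset.sum_neg_distrib, ← Finset.sum_add_distrib]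
    exact Finset.sum_congr rfl fun y _ => by ring
  rw [e2]
  simp only [mul_add, Finset.sum_add_distrib] at h2 ⊢
  linarith

end FormBound

section FormBound

/-- Smallness conditions on the auxiliary scales of the form bound. -/
structure Admissible (n : ℕ) (g τ₁ τ₂ Q : ℝ) : Prop where
  hg : 0 < g
  hτ₁ : 0 < τ₁
  hτ₂ : 0 < τ₂
  hQ : 0 < Q
  h24 : 24 * g ≤ τ₁ ^ 2
  h6 : 6 * n * g ≤ τ₁ ^ 2
  hsq : τ₂ ^ 2 ≤ g
  hR : 960 * g ≤ τ₁ ^ 2 * τ₂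

/-- The error in the form bound. -/
def tolf (n : ℕ) (g τ₁ τ₂ Q : ℝ) : ℝ :=
  360 * (n + 9) ^ 2 * g / (τ₁ ^ 2 * τ₂ * Q) + 3 / 2 * g ^ 3 * Q ^ 3 / τ₁ ^ 2

variable {Λ : Type*} [Fintype Λ] [DecidableEq Λ] {n : ℕ}
variable {J A : Λ → Λ → ℝ} {g ν β τ₁ τ₂ Q D : ℝ} {x : Λ} {ρ : Λ → ℝ}

lemma sum_dxiA (φ : Λ × Fin n → ℝ) (v : Fin n → ℝ) (p : Λ × Fin n → Fin n → ℝ) :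
    ∑ a, dxiA g A φ v (p a) a =
      -((n + 2) * g * (2 * ∑ y, A y y)) * normSq v - 2 * ∑ a, ∑ i, sA g A φ v a i * p a i := by
  unfold dxiA
  rw [Finset.sum_sub_distrib, ← Finset.mul_sum, ← Finset.mul_sum, Fintype.sum_prod_type]
  congr 1
  have : ∑ y, ∑ k, A y y * (normSq v + 2 * v k ^ 2) = ((n + 2) * normSq v) * ∑ y, A y y := by
    rw [Finset.mul_sum]
    refine Finset.sum_congr rfl fun y _ => ?_
    rw [← Finset.mul_sum, Finset.sum_add_distrib, ← Finset.mul_sum]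
    simp only [Finset.sum_const, Finset.card_univ, Fintype.card_fin, nsmul_eq_mul]
    unfold normSq
    ring
  rw [this]; ring

lemma sum_dxiX {c : ℝ} {R : Λ → ℝ} (φ : Λ × Fin n → ℝ) (v : Fin n → ℝ)
    (p : Λ × Fin n → Fin n → ℝ) :
    ∑ a, dxiX c Q R φ v (p a) a =
      (∑ y, c * R y * (2 * (qf' Q (sN φ y) * sN φ y) + n * qf Q (sN φ y))) * normSq v +
        2 * ∑ a, ∑ i, sX c Q R φ v a i * p a i := by
  unfold dxiX
  rw [Finset.sum_add_distrib, ← Finset.mul_sum, Fintype.sum_prod_type]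
  congr 1
  rw [Finset.sum_mul]
  refine Finset.sum_congr rfl fun y _ => ?_
  dsimp only
  rw [← Finset.mul_sum, ← Finset.sum_mul, Finset.sum_add_distrib, ← Finset.mul_sum]
  simp only [Finset.sum_const, Finset.card_univ, Fintype.card_fin, nsmul_eq_mul]
  rw [← Finset.mul_sum, show ∑ k, φ (y, k) ^ 2 = sN φ y from rfl]
  ring

lemma sum_sX_sq {c : ℝ} {R : Λ → ℝ} (φ : Λ × Fin n → ℝ) (v : Fin n → ℝ) :
    ∑ a, ∑ i, sX c Q R φ v a i ^ 2 =
      (∑ y, (c * R y) ^ 2 * (qf Q (sN φ y) ^ 2 * sN φ y)) * normSq v := by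
  rw [Fintype.sum_prod_type, Finset.sum_mul]
  refine Finset.sum_congr rfl fun y _ => ?_
  have h : (c * R y) ^ 2 * (qf Q (sN φ y) ^ 2 * sN φ y) * normSq v =
      ((c * R y) ^ 2 * qf Q (sN φ y) ^ 2) * ((∑ k, φ (y, k) ^ 2) * ∑ i, v i ^ 2) := by
    rw [show ∑ k, φ (y, k) ^ 2 = sN φ y from rfl, show ∑ i, v i ^ 2 = normSq v from rfl]; ring
  rw [h, Finset.sum_mul_sum, Finset.mul_sum]
  simp only [Finset.mul_sum]
  refine Finset.sum_congr rfl fun k _ => Finset.sum_congr rfl fun i _ => ?_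
  unfold sX; ring

lemma scalar_bound (hA : Admissible n g τ₁ τ₂ Q) (hJ : IsWeight J) {R N : Λ → ℝ}
    (hD : ∀ y, ∑ z, J y z ≤ D) (hDτ : D + τ₂ ≤ 10) (hβ : τ₁ ≤ β)
    (hR0 : ∀ y, 0 ≤ R y) (hR : ∀ y, τ₂ * R y + gl J R y = ρ y) (hρ : ∀ y, 0 ≤ ρ y)
    (hρs : ∑ y, ρ y = 1 / (2 * β)) (hN : ∀ y, 0 ≤ N y) :
    -tolf n g τ₁ τ₂ Q ≤
      120 * g ^ 2 / τ₁ * (∑ y, R y * (qf Q (N y) * (g * N y ^ 2 - 3 / 2 * τ₂ * N y))) -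
      (∑ y, 120 * g ^ 2 / τ₁ * R y * (2 * (qf' Q (N y) * N y) + n * qf Q (N y))) -
      2 * (∑ y, (120 * g ^ 2 / τ₁ * R y) ^ 2 * (qf Q (N y) ^ 2 * N y)) -
      3 * (g ^ 3 / τ₁) * ∑ y, ρ y * N y ^ 3 := by
  have hg := hA.hg
  have hτ₁ := hA.hτ₁
  have hτ₂ := hA.hτ₂
  have hQ := hA.hQ
  have hβ0 : 0 < β := hτ₁.trans_le hβ
  set c := 120 * g ^ 2 / τ₁ with hc
  have hc0 : 0 < c := by positivity
  have hRs : τ₂ * ∑ y, R y = 1 / (2 * β) := by rw [hJ.sum_resolvent hR, hρs]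
  have hb : 1 / (2 * β) ≤ 1 / (2 * τ₁) := one_div_le_one_div_of_le (by positivity) (by linarith)
  have hRsum : ∑ y, R y ≤ 1 / (2 * τ₁ * τ₂) := by
    rw [← hRs] at hb
    rw [le_div_iff₀ (by positivity)] at hb ⊢
    linarith
  have hcR : ∀ y, 16 * (c * R y) ≤ g := by
    intro y
    have h1 : R y ≤ 1 / (2 * τ₁ * τ₂) :=
      (Finset.single_le_sum (fun z _ => hR0 z) (Finset.mem_univ y)).trans hRsum
    have h2 : c * R y ≤ c * (1 / (2 * τ₁ * τ₂)) := mul_le_mul_of_nonneg_left h1 hc0.le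
    have h3 : 16 * (c * (1 / (2 * τ₁ * τ₂))) = 960 * g * (g / (τ₁ ^ 2 * τ₂)) := by
      rw [hc]; field_simp; ring
    have h4 : 960 * g * (g / (τ₁ ^ 2 * τ₂)) ≤ τ₁ ^ 2 * τ₂ * (g / (τ₁ ^ 2 * τ₂)) :=
      mul_le_mul_of_nonneg_right hA.hR (by positivity)
    have h5 : τ₁ ^ 2 * τ₂ * (g / (τ₁ ^ 2 * τ₂)) = g := by field_simp
    linarith
  have hρR : ∀ y, ρ y ≤ 10 * R y := by
    intro y
    rw [← hR y]
    have h1 : gl J R y ≤ D * R y := by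
      have : gl J R y ≤ ∑ z, J y z * R y :=
        Finset.sum_le_sum fun z _ => mul_le_mul_of_nonneg_left (by linarith [hR0 z]) (hJ.nonneg y z)
      rw [← Finset.sum_mul] at this
      exact this.trans (mul_le_mul_of_nonneg_right (hD y) (hR0 y))
    nlinarith [mul_le_mul_of_nonneg_right hDτ (hR0 y)]
  set E := 6 * ((n : ℝ) + 9) ^ 2 / (g * Q) with hE
  have hE0 : 0 ≤ E := by positivity
  have key : ∀ y, -(c * E) * R y - 3 * (g ^ 3 / τ₁) * Q ^ 3 * ρ y ≤
      c * (R y * (qf Q (N y) * (g * N y ^ 2 - 3 / 2 * τ₂ * N y))) -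
      c * R y * (2 * (qf' Q (N y) * N y) + n * qf Q (N y)) -
      2 * ((c * R y) ^ 2 * (qf Q (N y) ^ 2 * N y)) - 3 * (g ^ 3 / τ₁) * (ρ y * N y ^ 3) := by
    intro y
    have hq0 := qf_nonneg hQ (hN y)
    have hcR0 : 0 ≤ c * R y := mul_nonneg hc0.le (hR0 y)
    have h1 := mul_le_mul_of_nonneg_left (qf'_mul_le hQ (hN y)) hcR0
    have h2 : 2 * ((c * R y) ^ 2 * (qf Q (N y) ^ 2 * N y)) ≤
        g / 8 * (c * R y * (qf Q (N y) * N y ^ 2)) := by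
      have a1 : qf Q (N y) ^ 2 * N y ≤ qf Q (N y) * N y ^ 2 := by
        nlinarith [mul_le_mul_of_nonneg_left (qf_le hQ (hN y)) (mul_nonneg hq0 (hN y))]
      have a2 := mul_le_mul_of_nonneg_left a1 (mul_nonneg hcR0 hcR0)
      have a3 := mul_le_mul_of_nonneg_right (hcR y)
        (mul_nonneg hcR0 (mul_nonneg hq0 (sq_nonneg (N y))))
      linarith
    have h3 : 3 * (g ^ 3 / τ₁) * (ρ y * N y ^ 3) ≤
        g / 2 * (c * R y * (qf Q (N y) * N y ^ 2)) + 3 * (g ^ 3 / τ₁) * Q ^ 3 * ρ y := by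
      have hk : 0 ≤ 3 * (g ^ 3 / τ₁) := by positivity
      have a1 := mul_le_mul_of_nonneg_left (cube_le_qf hQ (hN y)) (mul_nonneg hk (hρ y))
      have a2 := mul_le_mul_of_nonneg_right (hρR y)
        (mul_nonneg hk (mul_nonneg hq0 (sq_nonneg (N y))))
      have a3 : 3 * (g ^ 3 / τ₁) * 20 = g / 2 * c := by rw [hc]; field_simp; ring
      have a4 : g / 2 * (c * R y * (qf Q (N y) * N y ^ 2)) =
          3 * (g ^ 3 / τ₁) * 20 * (R y * (qf Q (N y) * N y ^ 2)) := by rw [a3]; ring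
      rw [a4]
      linarith
    have h4 := mul_le_mul_of_nonneg_left
      (qf_drift_ge hQ hg hA.hsq (Nat.cast_nonneg (α := ℝ) n) (hN y)) hcR0
    rw [← hE] at h4
    linarith
  have hsum := Finset.sum_le_sum fun y (_ : y ∈ Finset.univ) => key y
  simp only [Finset.sum_sub_distrib, ← Finset.mul_sum] at hsum
  rw [hρs] at hsum
  simp only [Finset.mul_sum] at hsum ⊢
  refine le_trans ?_ hsum
  rw [← Finset.mul_sum]
  have f1 : c * E * ∑ y, R y ≤ c * E * (1 / (2 * τ₁ * τ₂)) :=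
    mul_le_mul_of_nonneg_left hRsum (by positivity)
  have f2 : 3 * (g ^ 3 / τ₁) * Q ^ 3 * (1 / (2 * β)) ≤
      3 * (g ^ 3 / τ₁) * Q ^ 3 * (1 / (2 * τ₁)) := mul_le_mul_of_nonneg_left hb (by positivity)
  have f3 : tolf n g τ₁ τ₂ Q = c * E * (1 / (2 * τ₁ * τ₂)) +
      3 * (g ^ 3 / τ₁) * Q ^ 3 * (1 / (2 * τ₁)) := by
    rw [hc, hE]; unfold tolf; field_simp; ring
  rw [f3]
  linarith

lemma pointwise_form_bound (hA : Admissible n g τ₁ τ₂ Q) (hJ : IsWeight J)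
    (hD : ∀ y, ∑ z, J y z ≤ D) (hDτ : D + τ₂ ≤ 10) (hβ : τ₁ ≤ β) (hβν : τ₁ ≤ β - ν)
    (hν : -τ₂ ≤ ν) (h : Lyap J β x A ρ) {R : Λ → ℝ}
    (hR0 : ∀ y, 0 ≤ R y) (hR : ∀ y, τ₂ * R y + gl J R y = ρ y)
    (φ : Λ × Fin n → ℝ) (v : Fin n → ℝ) (p : Λ × Fin n → Fin n → ℝ) :
    ((n + 2) * g * (2 * ∑ y, A y y) - tolf n g τ₁ τ₂ Q) * normSq v ≤
      ∑ a, ∑ i, p a i ^ 2 + (g * sN φ x * normSq v + 2 * g * prj v φ x ^ 2) +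
      (∑ a, (xiA g A φ v a + xiX (120 * g ^ 2 / τ₁) Q R φ v a) * dpot J g ν a φ -
        ∑ a, (dxiA g A φ v (p a) a + dxiX (120 * g ^ 2 / τ₁) Q R φ v (p a) a)) := by
  have hg := hA.hg
  have hτ₁ := hA.hτ₁
  have hβ0 : 0 < β := hτ₁.trans_le hβ
  have hρs := h.sum_row hJ hβ0
  have hρ0 := h.row_nonneg
  set c := 120 * g ^ 2 / τ₁ with hc
  have h1 := sum_xiA_mul_dpot_ge h hg hτ₁ hβν φ v
  have h2 := sum_xiX_mul_dpot_ge (g := g) hJ (c := c) (by positivity) hA.hQ hR0 hR hρ0 hA.hτ₂.le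
    hν φ v
  have hρt : ∀ y, ρ y ≤ 1 / (2 * τ₁) := fun y =>
    (Finset.single_le_sum (fun z _ => hρ0 z) (Finset.mem_univ y)).trans
      (hρs.le.trans (one_div_le_one_div_of_le (by positivity) (by linarith)))
  have h3 := sum_sA_sq_le (g := g) h (by positivity) hρt φ v
  have h4 := mul_le_mul_of_nonneg_right (scalar_bound hA hJ hD hDτ hβ hR0 hR hρ0 hρs
    (sN_nonneg φ)) (normSq_nonneg v)
  have h5 := sum_sX_sq (c := c) (Q := Q) (R := R) φ v
  have h6 : -(2 * ∑ a, ∑ i, sA g A φ v a i ^ 2) - 2 * ∑ a, ∑ i, sX c Q R φ v a i ^ 2 ≤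
      ∑ a, ∑ i, p a i ^ 2 + 2 * ∑ a, ∑ i, sA g A φ v a i * p a i -
        2 * ∑ a, ∑ i, sX c Q R φ v a i * p a i := by
    simp only [Finset.mul_sum, ← Finset.sum_neg_distrib, ← Finset.sum_add_distrib,
      ← Finset.sum_sub_distrib]
    refine Finset.sum_le_sum fun a _ => Finset.sum_le_sum fun i _ => ?_
    nlinarith [sq_nonneg (p a i + sA g A φ v a i - sX c Q R φ v a i),
      sq_nonneg (sA g A φ v a i + sX c Q R φ v a i)]
  have hα : 0 ≤ (∑ k, ∑ y, cmp φ k y * mv A (cmp φ k) y) * normSq v :=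
    mul_nonneg (Finset.sum_nonneg fun k _ => h.psd _) (normSq_nonneg v)
  have hα2 := h.psd (prj v φ)
  set a1 := (∑ k, ∑ y, cmp φ k y * mv A (cmp φ k) y) * normSq v
  set a2 := ∑ y, prj v φ y * mv A (prj v φ) y
  have h7 : 2 * (12 * g ^ 2 * (1 / (2 * τ₁)) * (2 * a1 + n * a2)) ≤ g * τ₁ * (a1 + 2 * a2) := by
    have e1 : 2 * (12 * g ^ 2 * (1 / (2 * τ₁)) * (2 * a1 + n * a2)) =
        (g / τ₁) * (24 * g * a1 + 2 * (6 * n * g) * a2) := by field_simp; ring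
    have e2 : g * τ₁ * (a1 + 2 * a2) = (g / τ₁) * (τ₁ ^ 2 * a1 + 2 * τ₁ ^ 2 * a2) := by
      field_simp
    rw [e1, e2]
    refine mul_le_mul_of_nonneg_left ?_ (by positivity)
    nlinarith [mul_le_mul_of_nonneg_right hA.h24 hα, mul_le_mul_of_nonneg_right hA.h6 hα2]
  simp only [add_mul (xiA _ _ _ _ _), Finset.sum_add_distrib]
  rw [sum_dxiA, sum_dxiX]
  linarith

/-- The form bound. -/
lemma wint_form_bound (hA : Admissible n g τ₁ τ₂ Q) (hJ : IsWeight J)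
    (hD : ∀ y, ∑ z, J y z ≤ D) (hDτ : D + τ₂ ≤ 10) (hβ : τ₁ ≤ β) (hβν : τ₁ ≤ β - ν)
    (hν : -τ₂ ≤ ν) {κ : ℝ} (hκ : ∀ x, ∃ A ρ, Lyap J β x A ρ ∧ κ ≤ 2 * ∑ y, A y y) (x : Λ)
    {u : Fin n → (Λ × Fin n → ℝ) → ℝ} (hu : ∀ i, IsTest (u i)) :
    ((n + 2) * g * κ - tolf n g τ₁ τ₂ Q) *
        wint (pot J g ν) (fun φ => ∑ i, u i φ ^ 2) ≤
      wint (pot J g ν) (fun φ => ∑ i, ∑ b, pd b (u i) φ ^ 2 +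
        (g * sN φ x * (∑ i, u i φ ^ 2) + 2 * g * (∑ i, u i φ * φ (x, i)) ^ 2)) := by
  obtain ⟨A, ρ, h, hk⟩ := hκ x
  obtain ⟨R, hR⟩ := hJ.exists_resolvent hA.hτ₂ ρ
  have hR0 : ∀ y, 0 ≤ R y := hJ.min_principle hA.hτ₂ fun y => by
    rw [hR]; exact h.row_nonneg y
  have hV := nice_pot (ν := ν) (n := n) hJ hA.hg
  have hC := hV.conf
  have tu : ∀ i, Tame (u i) := fun i => (hu i).tame
  have tp : ∀ a i, Tame (pd a (u i)) := fun a i => ((hu i).deriv a).tame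
  set c := 120 * g ^ 2 / τ₁ with hc
  have ibp : ∀ a, wint (pot J g ν) (fun φ => (xiA g A φ (fun i => u i φ) a +
      xiX c Q R φ (fun i => u i φ) a) * dpot J g ν a φ) =
      wint (pot J g ν) (fun φ => dxiA g A φ (fun i => u i φ) (fun i => pd a (u i) φ) a +
        dxiX c Q R φ (fun i => u i φ) (fun i => pd a (u i) φ) a) := fun a =>
    wint_ibp hC ((hasPD_xiA g A fun i => (hu i).hasPD a).add
      (hasPD_xiX hA.hQ R fun i => (hu i).hasPD a)) (hasPD_pot hJ a)
      ((tame_xiA g A a tu).add (tame_xiX hA.hQ R a tu))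
      ((tame_dxiA g A a tu (tp a)).add (tame_dxiX hA.hQ R a tu (tp a))) (tame_dpot J g ν a)
  have t1 : ∀ a, Tame fun φ => (xiA g A φ (fun i => u i φ) a +
      xiX c Q R φ (fun i => u i φ) a) * dpot J g ν a φ := fun a =>
    ((tame_xiA g A a tu).add (tame_xiX hA.hQ R a tu)).mul (tame_dpot J g ν a)
  have t2 : ∀ a, Tame fun φ => dxiA g A φ (fun i => u i φ) (fun i => pd a (u i) φ) a +
        dxiX c Q R φ (fun i => u i φ) (fun i => pd a (u i) φ) a := fun a =>
    (tame_dxiA g A a tu (tp a)).add (tame_dxiX hA.hQ R a tu (tp a))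
  have t0 : Tame fun φ => normSq fun i => u i φ := tame_normSq tu
  have t3 : Tame fun φ => ∑ a, ∑ i, pd a (u i) φ ^ 2 :=
    Tame.sum _ fun a _ => Tame.sum _ fun i _ => (tp a i).pow 2
  have t4 : Tame fun φ => g * sN φ x * normSq (fun i => u i φ) +
      2 * g * prj (fun i => u i φ) φ x ^ 2 :=
    (((tame_sN x).const_mul g).mul t0).add
      (((Tame.sum _ fun i _ => (tu i).mul (Tame.coord _)).pow 2).const_mul _)
  have hz : wint (pot J g ν) (fun φ => ∑ a, (xiA g A φ (fun i => u i φ) a +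
      xiX c Q R φ (fun i => u i φ) a) * dpot J g ν a φ - ∑ a, (dxiA g A φ (fun i => u i φ)
      (fun i => pd a (u i) φ) a + dxiX c Q R φ (fun i => u i φ)
      (fun i => pd a (u i) φ) a)) = 0 := by
    rw [wint_sub hC (Tame.sum _ fun a _ => t1 a) (Tame.sum _ fun a _ => t2 a),
      wint_sum hC _ fun a _ => t1 a, wint_sum hC _ fun a _ => t2 a, sub_eq_zero]
    exact Finset.sum_congr rfl fun a _ => ibp a
  have h1 := wint_mono hC (t0.const_mul _) ((t3.add t4).add
    ((Tame.sum Finset.univ fun a _ => t1 a).sub (Tame.sum Finset.univ fun a _ => t2 a)))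
    fun φ => pointwise_form_bound hA hJ hD hDτ hβ hβν hν h hR0 hR φ (fun i => u i φ)
      (fun a i => pd a (u i) φ)
  rw [wint_const_mul, wint_add hC (t3.add t4) ((Tame.sum Finset.univ fun a _ => t1 a).sub
    (Tame.sum Finset.univ fun a _ => t2 a)), hz, add_zero] at h1
  have h2 : 0 ≤ wint (pot J g ν) (fun φ => normSq fun i => u i φ) :=
    wint_nonneg fun φ => normSq_nonneg _
  have h3 : ((n : ℝ) + 2) * g * κ - tolf n g τ₁ τ₂ Q ≤
      (n + 2) * g * (2 * ∑ y, A y y) - tolf n g τ₁ τ₂ Q := by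
    have := mul_le_mul_of_nonneg_left hk (show 0 ≤ ((n : ℝ) + 2) * g by have := hA.hg; positivity)
    linarith
  refine ((mul_le_mul_of_nonneg_right h3 h2).trans h1).trans (le_of_eq ?_)
  congr 1
  funext φ
  rw [Finset.sum_comm]
  rfl

end FormBound

section Gap

variable {Λ : Type*} [Fintype Λ] [DecidableEq Λ] {n : ℕ}
variable {J : Λ → Λ → ℝ} {g ν m : ℝ}

/-- The sitewise form bound with squared mass `m`. -/
def Gap (n : ℕ) (J : Λ → Λ → ℝ) (g ν m : ℝ) : Prop :=
  ∀ (x : Λ) (u : Fin n → (Λ × Fin n → ℝ) → ℝ), (∀ i, IsTest (u i)) →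
    (m - ν) * wint (pot J g ν) (fun φ => ∑ i, u i φ ^ 2) ≤
      wint (pot J g ν) (fun φ => ∑ i, ∑ b, pd b (u i) φ ^ 2 +
        (g * sN φ x * (∑ i, u i φ ^ 2) + 2 * g * (∑ i, u i φ * φ (x, i)) ^ 2))

lemma tame_site_form {u : Fin n → (Λ × Fin n → ℝ) → ℝ} (hu : ∀ i, IsTest (u i)) (x : Λ) :
    Tame (fun φ : Λ × Fin n → ℝ => ∑ i, ∑ b, pd b (u i) φ ^ 2 +
        (g * sN φ x * (∑ i, u i φ ^ 2) + 2 * g * (∑ i, u i φ * φ (x, i)) ^ 2)) :=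
  (Tame.sum _ fun i _ => Tame.sum _ fun b _ => ((hu i).deriv b).tame.pow 2).add
    ((((tame_sN x).const_mul g).mul (Tame.sum _ fun i _ => (hu i).tame.pow 2)).add
      (((Tame.sum _ fun i _ => (hu i).tame.mul (Tame.coord (x, i))).pow 2).const_mul (2 * g)))

lemma tame_grad_form {η : (Λ × Fin n → ℝ) → ℝ} (hη : IsTest η) (w : Λ → ℝ) :
    Tame (fun φ : Λ × Fin n → ℝ => ∑ k, ∑ y, w y * pd (y, k) η φ *
      gl J (fun z => pd (z, k) η φ) y) := by
  unfold gl
  exact Tame.sum _ fun k _ => Tame.sum _ fun y _ => ((hη.deriv _).tame.const_mul _).mul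
    (Tame.sum _ fun z _ => ((hη.deriv _).tame.sub (hη.deriv _).tame).const_mul _)

lemma tame_grad_sq {η : (Λ × Fin n → ℝ) → ℝ} (hη : IsTest η) (w : Λ → ℝ) :
    Tame (fun φ : Λ × Fin n → ℝ => ∑ y, w y * ∑ i, pd (y, i) η φ ^ 2) :=
  Tame.sum _ fun y _ => (Tame.sum _ fun i _ => (hη.deriv (y, i)).tame.pow 2).const_mul _

lemma Gap.weighted (hG : Gap n J g ν m) (hJ : IsWeight J) (hg : 0 < g)
    {η : (Λ × Fin n → ℝ) → ℝ} (hη : IsTest η) {w : Λ → ℝ} (hw : ∀ y, 0 ≤ w y) :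
    wint (pot J g ν) (fun φ => (∑ k, ∑ y, w y * pd (y, k) η φ *
        gl J (fun z => pd (z, k) η φ) y) + m * ∑ y, w y * ∑ i, pd (y, i) η φ ^ 2) ≤
      wint (pot J g ν) (fun φ => (∑ a : Λ × Fin n, w a.1 * dirOp (pot J g ν) a η φ) *
        gen (pot J g ν) η φ) := by
  have hC := confining_pot (n := n) (ν := ν) hJ hg
  have tF := tame_grad_form (J := J) hη w
  have tS := tame_grad_sq hη w
  have tsite := fun y => tame_site_form (g := g) (fun i => hη.deriv (y, i)) y
  have tsq : ∀ y : Λ, Tame (fun φ : Λ × Fin n → ℝ => ∑ i, pd (y, i) η φ ^ 2) :=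
    fun y => Tame.sum _ fun i _ => (hη.deriv (y, i)).tame.pow 2
  rw [wint_weighted_gen hJ hg hη w, wint_add hC tF (tS.const_mul m),
    wint_add hC tF (tS.const_mul ν), wint_const_mul, wint_const_mul,
    wint_sum hC _ fun y _ => (tsite y).const_mul _, wint_sum hC _ fun y _ => (tsq y).const_mul _]
  have key : ∑ y, (m - ν) * wint (pot J g ν) (fun φ => w y * ∑ i, pd (y, i) η φ ^ 2) ≤
      ∑ y, wint (pot J g ν) (fun φ => w y * (∑ i, ∑ b, pd b (pd (y, i) η) φ ^ 2 +
        (g * sN φ y * (∑ i, pd (y, i) η φ ^ 2) +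
          2 * g * (∑ i, pd (y, i) η φ * φ (y, i)) ^ 2))) := by
    refine Finset.sum_le_sum fun y _ => ?_
    rw [wint_const_mul, wint_const_mul]
    have := mul_le_mul_of_nonneg_left (hG y _ fun i => hη.deriv (y, i)) (hw y)
    linarith
  rw [← Finset.mul_sum] at key
  linarith

lemma Gap.gen_sq (hG : Gap n J g ν m) (hJ : IsWeight J) (hg : 0 < g)
    {η : (Λ × Fin n → ℝ) → ℝ} (hη : IsTest η) :
    wint (pot J g ν) (fun φ => (∑ k, ∑ y, pd (y, k) η φ * gl J (fun z => pd (z, k) η φ) y) +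
        m * ∑ y, ∑ i, pd (y, i) η φ ^ 2) ≤ wint (pot J g ν) (fun φ => gen (pot J g ν) η φ ^ 2) := by
  have h := hG.weighted hJ hg hη (w := fun _ => 1) fun _ => zero_le_one
  simp only [one_mul] at h
  refine h.trans (le_of_eq ?_)
  congr 1
  funext φ
  unfold gen
  ring

lemma wint_odd {f : (Λ × Fin n → ℝ) → ℝ} (hf : ∀ φ, f (fun a => -φ a) = -f φ) :
    wint (pot J g ν) f = 0 := by
  have hp : ∀ φ : Λ × Fin n → ℝ, pot J g ν (-φ) = pot J g ν φ := by
    intro φ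
    have h1 : ∀ y, sN (-φ) y = sN φ y := fun y => by simp [sN]
    have h2 : ∀ (k : Fin n) y, (-φ) (y, k) * gl J (cmp (-φ) k) y =
        φ (y, k) * gl J (cmp φ k) y := by
      intro k y
      have : cmp (-φ) k = fun z => -1 * cmp φ k z := by funext z; simp [cmp]
      rw [this, gl_const_mul, Pi.neg_apply]
      ring
    unfold pot
    simp_rw [h1, h2]
  have h := integral_neg_eq_self (fun φ : Λ × Fin n → ℝ => f φ * Real.exp (-pot J g ν φ)) volume
  have h2 : ∀ φ : Λ × Fin n → ℝ, f (-φ) * Real.exp (-pot J g ν (-φ)) =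
      -(f φ * Real.exp (-pot J g ν φ)) := by
    intro φ
    rw [hp, show f (-φ) = -f φ from hf φ, neg_mul]
  simp only [h2, integral_neg] at h
  unfold wint
  linarith

/-- Brascamp–Lieb type bound for linear functions. -/
lemma Gap.wint_linear_sq_le (hG : Gap n J g ν m) (hJ : IsWeight J) (hg : 0 < g) (hm : 0 ≤ m)
    (i : Fin n) {ψ ξ : Λ → ℝ} (hξ : ∀ y, m * ξ y + gl J ξ y = ψ y) :
    wint (pot J g ν) (fun φ => (∑ y, ψ y * φ (y, i)) ^ 2) ≤
      (∑ y, ψ y * ξ y) * wint (pot J g ν) (fun _ : Λ × Fin n → ℝ => 1) := by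
  have hV := nice_pot (n := n) (ν := ν) hJ hg
  have hC := hV.conf
  refine wint_sq_le_of_gen hV (f := fun φ => ∑ y, ψ y * φ (y, i))
    (f' := fun a _ => ψ a.1 * if a.2 = i then 1 else 0) ?_
    (Tame.sum _ fun y _ => (Tame.coord _).const_mul _) (fun a => Tame.const _) ?_ ?_
  · intro a
    refine (HasPD.sum Finset.univ fun y _ => (HasPD.coord a (y, i)).const_mul (ψ y)).congr
      (fun φ => rfl) fun φ => ?_
    obtain ⟨x, k⟩ := a
    rw [Finset.sum_eq_single x]
    · by_cases h : k = i
      · subst h; simp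
      · have h' : ¬ i = k := fun e => h e.symm
        simp [h, h']
    · intro y _ hy; simp [hy]
    · simp
  · refine wint_odd fun φ => ?_
    simp
  · intro η hη
    refine le_trans ?_ (add_le_add_left (hG.gen_sq hJ hg hη) _)
    have tF := tame_grad_form (J := J) hη (fun _ => 1)
    have tS := tame_grad_sq hη (fun _ => 1)
    simp only [one_mul] at tF tS
    rw [← wint_const_mul, ← wint_const_mul, ← wint_add hC (tF.add (tS.const_mul m))
      ((Tame.const _).const_mul _)]
    refine wint_mono hC ((Tame.sum _ fun a _ => (hη.deriv a).tame.mul (Tame.const _)).const_mul _)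
      ((tF.add (tS.const_mul m)).add ((Tame.const _).const_mul _)) fun φ => ?_
    set u : Fin n → Λ → ℝ := fun k y => pd (y, k) η φ with hu
    have e1 : ∑ a : Λ × Fin n, pd a η φ * (ψ a.1 * if a.2 = i then 1 else 0) =
        ∑ y, ψ y * u i y := by
      rw [Fintype.sum_prod_type]
      refine Finset.sum_congr rfl fun y _ => ?_
      rw [Finset.sum_eq_single i]
      · simp [hu]; ring
      · intro k _ hk; simp [hk]
      · simp
    have e2 : ∑ y, ∑ k, pd (y, k) η φ ^ 2 = ∑ k, ∑ y, u k y ^ 2 := Finset.sum_comm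
    rw [e1, e2]
    have e3 : (∑ k, ∑ y, u k y * gl J (u k) y) + m * ∑ k, ∑ y, u k y ^ 2 =
        ∑ k, ∑ y, u k y * (m * u k y + gl J (u k) y) := by
      rw [Finset.mul_sum, ← Finset.sum_add_distrib]
      refine Finset.sum_congr rfl fun k _ => ?_
      rw [Finset.mul_sum, ← Finset.sum_add_distrib]
      exact Finset.sum_congr rfl fun y _ => by ring
    have hpos : ∀ f : Λ → ℝ, 0 ≤ ∑ y, f y * (m * f y + gl J f y) := by
      intro f
      have h1 := hJ.sum_mul_gl_self_nonneg f
      have h2 : ∑ y, f y * (m * f y + gl J f y) =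
          m * ∑ y, f y ^ 2 + ∑ y, f y * gl J f y := by
        rw [Finset.mul_sum, ← Finset.sum_add_distrib]
        exact Finset.sum_congr rfl fun y _ => by ring
      rw [h2]
      have : 0 ≤ ∑ y, f y ^ 2 := Finset.sum_nonneg fun _ _ => sq_nonneg _
      positivity
    have e4 : ∑ y, u i y * (m * u i y + gl J (u i) y) ≤
        ∑ k, ∑ y, u k y * (m * u k y + gl J (u k) y) :=
      Finset.single_le_sum (f := fun k => ∑ y, u k y * (m * u k y + gl J (u k) y))
        (fun k _ => hpos (u k)) (Finset.mem_univ i)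
    have e5 := hpos (fun y => u i y - ξ y)
    have e6 : ∑ y, (u i y - ξ y) * (m * (u i y - ξ y) + gl J (fun z => u i z - ξ z) y) =
        ∑ y, u i y * (m * u i y + gl J (u i) y) - ∑ y, ψ y * u i y -
          (m * ∑ y, ξ y * u i y + ∑ y, ξ y * gl J (u i) y) + ∑ y, ψ y * ξ y := by
      rw [Finset.mul_sum, ← Finset.sum_add_distrib, ← Finset.sum_sub_distrib,
        ← Finset.sum_sub_distrib, ← Finset.sum_add_distrib]
      refine Finset.sum_congr rfl fun y _ => ?_
      rw [gl_sub, ← hξ y]; ring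
    have e7 : m * ∑ y, ξ y * u i y + ∑ y, ξ y * gl J (u i) y = ∑ y, ψ y * u i y := by
      rw [hJ.gl_selfadjoint, Finset.mul_sum, ← Finset.sum_add_distrib]
      exact Finset.sum_congr rfl fun y _ => by rw [← hξ y]; ring
    rw [e6, e7] at e5
    have e8 : ∑ k, ∑ y, pd (y, k) η φ * gl J (fun z => pd (z, k) η φ) y =
      ∑ k, ∑ y, u k y * gl J (u k) y := rfl
    rw [e8, e3]
    linarith

/-- Poincaré inequality. -/
lemma Gap.poincare (hG : Gap n J g ν m) (hJ : IsWeight J) (hg : 0 < g) (hm : 0 < m)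
    {f : (Λ × Fin n → ℝ) → ℝ} {f' : Λ × Fin n → (Λ × Fin n → ℝ) → ℝ}
    (hf : ∀ a, HasPD a f (f' a)) (tf : Tame f) (tf' : ∀ a, Tame (f' a))
    (hf0 : wint (pot J g ν) f = 0) :
    wint (pot J g ν) (fun φ => f φ ^ 2) ≤
      1 / m * wint (pot J g ν) (fun φ => ∑ a, f' a φ ^ 2) := by
  have hV := nice_pot (n := n) (ν := ν) hJ hg
  have hC := hV.conf
  refine wint_sq_le_of_gen hV hf tf tf' hf0 fun η hη => ?_
  refine le_trans ?_ (add_le_add_left (hG.gen_sq hJ hg hη) _)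
  have tF := tame_grad_form (J := J) hη (fun _ => 1)
  have tS := tame_grad_sq hη (fun _ => 1)
  simp only [one_mul] at tF tS
  have tf2 : Tame (fun φ => ∑ a, f' a φ ^ 2) := Tame.sum _ fun a _ => (tf' a).pow 2
  rw [← wint_const_mul, ← wint_const_mul, ← wint_add hC (tF.add (tS.const_mul m))
    (tf2.const_mul _)]
  refine wint_mono hC ((Tame.sum _ fun a _ => (hη.deriv a).tame.mul (tf' a)).const_mul _)
    ((tF.add (tS.const_mul m)).add (tf2.const_mul _)) fun φ => ?_
  have h1 : 0 ≤ ∑ k, ∑ y, pd (y, k) η φ * gl J (fun z => pd (z, k) η φ) y :=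
    Finset.sum_nonneg fun k _ => hJ.sum_mul_gl_self_nonneg fun z => pd (z, k) η φ
  have h2 : 2 * ∑ a, pd a η φ * f' a φ ≤
      m * ∑ y, ∑ i, pd (y, i) η φ ^ 2 + 1 / m * ∑ a, f' a φ ^ 2 := by
    rw [← Fintype.sum_prod_type (f := fun a : Λ × Fin n => pd a η φ ^ 2), Finset.mul_sum,
      Finset.mul_sum, Finset.mul_sum, ← Finset.sum_add_distrib]
    refine Finset.sum_le_sum fun a _ => ?_
    have h3 : m * pd a η φ ^ 2 + 1 / m * f' a φ ^ 2 - 2 * (pd a η φ * f' a φ) =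
        1 / m * (m * pd a η φ - f' a φ) ^ 2 := by field_simp; ring
    have h4 : 0 ≤ 1 / m * (m * pd a η φ - f' a φ) ^ 2 := by positivity
    linarith
  linarith

/-- A priori moment bound, uniform in the graph. -/
lemma wint_sN_le (hJ : IsWeight J) (hg : 0 < g) (x : Λ) :
    wint (pot J g ν) (fun φ : Λ × Fin n → ℝ => sN φ x) ≤
      (2 * n + (ν - 1 / 2) ^ 2 / (2 * g)) * wint (pot J g ν) (fun _ : Λ × Fin n → ℝ => 1) := by
  have hV := nice_pot (n := n) (ν := ν) hJ hg
  have hC := hV.conf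
  obtain ⟨R, hR⟩ := hJ.exists_resolvent one_pos (fun y => if y = x then 1 else 0)
  have hR0 : ∀ y, 0 ≤ R y := hJ.min_principle one_pos fun y => by
    rw [hR]; split_ifs <;> norm_num
  have hRs : ∑ y, R y = 1 := by
    have := hJ.sum_resolvent hR; simpa using this
  have ibp : ∀ a : Λ × Fin n, wint (pot J g ν) (fun φ => R a.1 * φ a * dpot J g ν a φ) =
      wint (pot J g ν) (fun _ : Λ × Fin n → ℝ => R a.1 * 1) := by
    intro a
    refine wint_ibp hC ?_ (hasPD_pot hJ a) ((Tame.coord a).const_mul _) (Tame.const _)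
      (tame_dpot J g ν a)
    exact ((HasPD.coord a a).const_mul (R a.1)).congr (fun _ => rfl) fun _ => by simp
  have h1 : wint (pot J g ν) (fun φ : Λ × Fin n → ℝ => ∑ a : Λ × Fin n,
      R a.1 * φ a * dpot J g ν a φ) =
      n * wint (pot J g ν) (fun _ : Λ × Fin n → ℝ => 1) := by
    rw [wint_sum hC _ fun a _ => ((Tame.coord a).const_mul _).mul (tame_dpot J g ν a)]
    simp_rw [ibp, wint_const_mul]
    rw [← Finset.sum_mul, Fintype.sum_prod_type]
    congr 1
    simp only [Finset.sum_const, Finset.card_univ, Fintype.card_fin, nsmul_eq_mul]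
    rw [← Finset.mul_sum, hRs, mul_one]
  have h2 : wint (pot J g ν) (fun φ : Λ × Fin n → ℝ =>
      1 / 2 * sN φ x - (ν - 1 / 2) ^ 2 / (4 * g) * 1) ≤
      wint (pot J g ν) (fun φ : Λ × Fin n → ℝ => ∑ a : Λ × Fin n,
        R a.1 * φ a * dpot J g ν a φ) := by
    refine wint_mono hC (((tame_sN x).const_mul _).sub ((Tame.const _).const_mul _))
      (Tame.sum _ fun a _ => ((Tame.coord a).const_mul _).mul (tame_dpot J g ν a)) fun φ => ?_
    have e1 : ∑ a : Λ × Fin n, R a.1 * φ a * dpot J g ν a φ =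
        ∑ k, (∑ y, R y * φ (y, k) * gl J (cmp φ k) y) +
          ∑ y, R y * (ν * sN φ y + g * sN φ y ^ 2) := by
      have : ∀ a : Λ × Fin n, R a.1 * φ a * dpot J g ν a φ =
          R a.1 * φ a * gl J (cmp φ a.2) a.1 +
            R a.1 * ((ν + g * sN φ a.1) * φ a ^ 2) := fun a => by unfold dpot; ring
      simp_rw [this]
      rw [Finset.sum_add_distrib, Fintype.sum_prod_type_right, Fintype.sum_prod_type]
      congr 1
      refine Finset.sum_congr rfl fun y _ => ?_
      dsimp only
      rw [← Finset.mul_sum, ← Finset.mul_sum, show ∑ k, φ (y, k) ^ 2 = sN φ y from rfl]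
      ring
    have e2 : ∀ f : Λ → ℝ, ∑ y, R y * gl J (fun z => f z ^ 2) y =
        f x ^ 2 - ∑ y, R y * f y ^ 2 := by
      intro f
      rw [hJ.gl_selfadjoint]
      have : ∀ y, gl J R y = (if y = x then 1 else 0) - R y := fun y => by linarith [hR y]
      simp_rw [this, sub_mul]
      rw [Finset.sum_sub_distrib]
      simp
    have e3 : ∀ f : Λ → ℝ, 1 / 2 * (f x ^ 2 - ∑ y, R y * f y ^ 2) ≤
        ∑ y, R y * f y * gl J f y := by
      intro f
      rw [← e2, Finset.mul_sum]
      refine Finset.sum_le_sum fun y _ => ?_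
      have : 1 / 2 * gl J (fun z => f z ^ 2) y ≤ f y * gl J f y := by
        unfold gl
        rw [Finset.mul_sum, Finset.mul_sum]
        refine Finset.sum_le_sum fun z _ => ?_
        have := mul_nonneg (hJ.nonneg y z) (sq_nonneg (f y - f z))
        linarith
      calc 1 / 2 * (R y * gl J (fun z => f z ^ 2) y)
          = R y * (1 / 2 * gl J (fun z => f z ^ 2) y) := by ring
        _ ≤ R y * (f y * gl J f y) := mul_le_mul_of_nonneg_left this (hR0 y)
        _ = _ := by ring
    have e4 : 1 / 2 * (sN φ x - ∑ y, R y * sN φ y) ≤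
        ∑ k, ∑ y, R y * φ (y, k) * gl J (cmp φ k) y := by
      have : 1 / 2 * (sN φ x - ∑ y, R y * sN φ y) =
          ∑ k : Fin n, 1 / 2 * (cmp φ k x ^ 2 - ∑ y, R y * cmp φ k y ^ 2) := by
        rw [← Finset.mul_sum, Finset.sum_sub_distrib]
        congr 2
        rw [Finset.sum_comm]
        exact Finset.sum_congr rfl fun y _ => by rw [← Finset.mul_sum]; rfl
      rw [this]
      exact Finset.sum_le_sum fun k _ => e3 (cmp φ k)
    have e5 : ∑ y, R y * (-((ν - 1 / 2) ^ 2 / (4 * g))) ≤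
        ∑ y, R y * (ν * sN φ y + g * sN φ y ^ 2) - 1 / 2 * ∑ y, R y * sN φ y := by
      rw [Finset.mul_sum, ← Finset.sum_sub_distrib]
      refine Finset.sum_le_sum fun y _ => ?_
      have h3 : 0 ≤ g * (sN φ y + (ν - 1 / 2) / (2 * g)) ^ 2 := by positivity
      have h4 : g * (sN φ y + (ν - 1 / 2) / (2 * g)) ^ 2 =
          (ν - 1 / 2) * sN φ y + g * sN φ y ^ 2 + (ν - 1 / 2) ^ 2 / (4 * g) := by
        field_simp; ring
      have h5 := mul_le_mul_of_nonneg_left (show -((ν - 1 / 2) ^ 2 / (4 * g)) ≤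
        (ν - 1 / 2) * sN φ y + g * sN φ y ^ 2 by linarith) (hR0 y)
      linarith
    rw [← Finset.sum_mul, hRs] at e5
    rw [e1]
    linarith
  rw [h1, wint_sub hC ((tame_sN x).const_mul _) ((Tame.const 1).const_mul _), wint_const_mul,
    wint_const_mul] at h2
  have h3 : (2 * n + (ν - 1 / 2) ^ 2 / (2 * g)) =
    2 * (n + (ν - 1 / 2) ^ 2 / (4 * g)) := by field_simp; ring
  rw [h3]
  linarith

end Gap

section LowerBound

variable {Λ : Type*} [Fintype Λ] [DecidableEq Λ] {n : ℕ}
variable {J : Λ → Λ → ℝ} {g ν : ℝ}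

lemma hasPD_dpot (hJ : IsWeight J) (a b : Λ × Fin n) :
    HasPD a (dpot J g ν b) (ddpot J g ν a b) := by
  rw [← pd_pd_pot hJ, pd_pot hJ]
  refine hasPD_pd ?_ a
  rw [← pd_pot hJ]
  exact (contDiff_pd contDiff_pot b).differentiable (by simp)

lemma tame_ddpot (J : Λ → Λ → ℝ) (g ν : ℝ) (a b : Λ × Fin n) : Tame (ddpot J g ν a b) := by
  unfold ddpot
  have h1 : Tame (fun φ : Λ × Fin n → ℝ => if b.1 = a.1 then 2 * g * φ a * φ b else 0) := by
    by_cases h : b.1 = a.1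
    · simp only [h, if_true]
      exact ((Tame.coord a).const_mul (2 * g)).mul (Tame.coord b)
    · simp only [h, if_false]
      exact Tame.const 0
  exact ((Tame.const _).add (Tame.const _)).add
    (h1.add (((tame_sN b.1).const_mul g).mul (Tame.const _)))

/-- Lower bound on the variance of linear functions. -/
lemma wint_linear_sq_ge (hJ : IsWeight J) (hg : 0 < g) {a : ℝ} (i : Fin n)
    (h : ∀ y, ν * wint (pot J g ν) (fun _ : Λ × Fin n → ℝ => 1) +
      g * wint (pot J g ν) (fun φ : Λ × Fin n → ℝ => sN φ y) +
      2 * g * wint (pot J g ν) (fun φ => φ (y, i) ^ 2) ≤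
      a * wint (pot J g ν) (fun _ : Λ × Fin n → ℝ => 1))
    {ψ ξ : Λ → ℝ} (hξ : ∀ y, a * ξ y + gl J ξ y = ψ y) :
    (∑ y, ψ y * ξ y) * wint (pot J g ν) (fun _ : Λ × Fin n → ℝ => 1) ≤
      wint (pot J g ν) (fun φ => (∑ y, ψ y * φ (y, i)) ^ 2) := by
  have hV := nice_pot (n := n) (ν := ν) hJ hg
  have hC := hV.conf
  set Z := wint (pot J g ν) (fun _ : Λ × Fin n → ℝ => 1) with hZ
  have hZ0 : 0 < Z := wint_one_pos hC
  have tF : Tame (fun φ : Λ × Fin n → ℝ => ∑ y, ψ y * φ (y, i)) :=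
    Tame.sum _ fun y _ => (Tame.coord _).const_mul _
  have tY : Tame (fun φ : Λ × Fin n → ℝ => ∑ y, ξ y * dpot J g ν (y, i) φ) :=
    Tame.sum _ fun y _ => (tame_dpot J g ν _).const_mul _
  have cs := wint_mul_sq_le hC tF tY
  have e1 : wint (pot J g ν) (fun φ : Λ × Fin n → ℝ =>
      (∑ y, ψ y * φ (y, i)) * ∑ y, ξ y * dpot J g ν (y, i) φ) = (∑ y, ψ y * ξ y) * Z := by
    have : (fun φ : Λ × Fin n → ℝ =>
      (∑ y, ψ y * φ (y, i)) * ∑ y, ξ y * dpot J g ν (y, i) φ) = fun φ => ∑ y,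
        (ξ y * ∑ z, ψ z * φ (z, i)) * dpot J g ν (y, i) φ := by
      funext φ
      rw [Finset.mul_sum]
      exact Finset.sum_congr rfl fun y _ => by ring
    rw [this, wint_sum hC _ fun y _ => (tF.const_mul _).mul (tame_dpot J g ν _), Finset.sum_mul]
    refine Finset.sum_congr rfl fun y _ => ?_
    have hX : HasPD (y, i) (fun φ : Λ × Fin n → ℝ => ξ y * ∑ z, ψ z * φ (z, i))
        (fun _ => (ψ y * ξ y) * 1) := by
      refine ((HasPD.sum Finset.univ fun z _ =>
        (HasPD.coord (y, i) (z, i)).const_mul (ψ z)).const_mul (ξ y)).congr (fun _ => rfl) ?_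
      intro φ
      rw [Finset.sum_eq_single y]
      · simp; ring
      · intro z _ hz; simp [hz]
      · simp
    rw [wint_ibp hC hX (hasPD_pot hJ _) (tF.const_mul _) (Tame.const _) (tame_dpot J g ν _),
      wint_const_mul]
  have e2 : wint (pot J g ν) (fun φ : Λ × Fin n → ℝ =>
      (∑ y, ξ y * dpot J g ν (y, i) φ) ^ 2) = wint (pot J g ν) (fun φ =>
        ∑ y, ∑ z, ξ y * ξ z * ddpot J g ν (y, i) (z, i) φ) := by
    have : (fun φ : Λ × Fin n → ℝ => (∑ y, ξ y * dpot J g ν (y, i) φ) ^ 2) = fun φ => ∑ y,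
        (∑ z, ξ y * ξ z * dpot J g ν (z, i) φ) * dpot J g ν (y, i) φ := by
      funext φ
      rw [sq, Finset.sum_mul]
      refine Finset.sum_congr rfl fun y _ => ?_
      rw [Finset.mul_sum, Finset.sum_mul]
      exact Finset.sum_congr rfl fun z _ => by ring
    have tX : ∀ y, Tame (fun φ : Λ × Fin n → ℝ => ∑ z, ξ y * ξ z * dpot J g ν (z, i) φ) :=
      fun y => Tame.sum _ fun z _ => (tame_dpot J g ν _).const_mul _
    have tX' : ∀ y, Tame (fun φ : Λ × Fin n → ℝ => ∑ z, ξ y * ξ z * ddpot J g ν (y, i) (z, i) φ) :=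
      fun y => Tame.sum _ fun z _ => (tame_ddpot J g ν _ _).const_mul _
    rw [this, wint_sum hC _ fun y _ => (tX y).mul (tame_dpot J g ν _),
      wint_sum hC _ fun y _ => tX' y]
    refine Finset.sum_congr rfl fun y _ => ?_
    exact wint_ibp hC (HasPD.sum _ fun z _ => (hasPD_dpot hJ (y, i) (z, i)).const_mul _)
      (hasPD_pot hJ _) (tX y) (tX' y) (tame_dpot J g ν _)
  have e3 : ∀ φ : Λ × Fin n → ℝ, ∑ y, ∑ z, ξ y * ξ z * ddpot J g ν (y, i) (z, i) φ =
      (∑ y, ξ y * gl J ξ y) * 1 + ∑ y, ξ y ^ 2 * (ν * 1 + g * sN φ y + 2 * g * φ (y, i) ^ 2) := by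
    intro φ
    have h0 := sum_ddpot_mul (g := g) (ν := ν) hJ (fun _ => 1) φ
      (fun a : Λ × Fin n => if a.2 = i then ξ a.1 else 0)
    rw [Fintype.sum_prod_type] at h0
    have h1 : ∀ y, ∑ k : Fin n, ∑ b : Λ × Fin n, (1 : ℝ) * (ddpot J g ν (y, k) b φ *
        ((if k = i then ξ y else 0) * (if b.2 = i then ξ b.1 else 0))) =
        ∑ z, ξ y * ξ z * ddpot J g ν (y, i) (z, i) φ := by
      intro y
      rw [Finset.sum_eq_single i]
      · rw [Fintype.sum_prod_type]
        refine Finset.sum_congr rfl fun z _ => ?_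
        rw [Finset.sum_eq_single i]
        · simp; ring
        · intro k _ hk; simp [hk]
        · simp
      · intro k _ hk; simp [hk]
      · simp
    simp only [h1] at h0
    rw [h0, mul_one]
    congr 1
    · rw [Finset.sum_eq_single i]
      · refine Finset.sum_congr rfl fun y _ => ?_
        have : cmp (fun a : Λ × Fin n => if a.2 = i then ξ a.1 else 0) i = ξ := by
          funext z; simp [cmp]
        rw [this]; simp
      · intro k _ hk; simp [hk]
      · simp
    · refine Finset.sum_congr rfl fun y _ => ?_
      have h2 : sN (fun a : Λ × Fin n => if a.2 = i then ξ a.1 else 0) y = ξ y ^ 2 := by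
        simp [sN]
      rw [h2]
      simp
      ring
  have e4 : wint (pot J g ν) (fun φ : Λ × Fin n → ℝ =>
      (∑ y, ξ y * dpot J g ν (y, i) φ) ^ 2) ≤ (∑ y, ψ y * ξ y) * Z := by
    have t1 : ∀ y, Tame (fun φ : Λ × Fin n → ℝ => ν * 1 + g * sN φ y) :=
      fun y => ((Tame.const _).const_mul ν).add ((tame_sN y).const_mul g)
    have t2 : ∀ y, Tame (fun φ : Λ × Fin n → ℝ => 2 * g * φ (y, i) ^ 2) :=
      fun y => ((Tame.coord (y, i)).pow 2).const_mul _
    have t3 : ∀ y, Tame (fun φ : Λ × Fin n → ℝ =>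
        ξ y ^ 2 * (ν * 1 + g * sN φ y + 2 * g * φ (y, i) ^ 2)) :=
      fun y => ((t1 y).add (t2 y)).const_mul _
    rw [e2]
    simp_rw [e3]
    rw [wint_add hC ((Tame.const _).const_mul _) (Tame.sum _ fun y _ => t3 y), wint_const_mul,
      wint_sum hC _ fun y _ => t3 y]
    have : ∀ y, wint (pot J g ν) (fun φ : Λ × Fin n → ℝ =>
        ξ y ^ 2 * (ν * 1 + g * sN φ y + 2 * g * φ (y, i) ^ 2)) ≤ a * ξ y ^ 2 * Z := by
      intro y
      rw [wint_const_mul, wint_add hC (t1 y) (t2 y),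
        wint_add hC ((Tame.const _).const_mul ν) ((tame_sN y).const_mul g),
        wint_const_mul, wint_const_mul, wint_const_mul]
      have := mul_le_mul_of_nonneg_left (h y) (sq_nonneg (ξ y))
      linarith
    refine (add_le_add_right (Finset.sum_le_sum fun y _ => this y) _).trans (le_of_eq ?_)
    rw [← Finset.sum_mul, ← add_mul, ← Finset.sum_add_distrib]
    congr 1
    exact Finset.sum_congr rfl fun y _ => by rw [← hξ y]; ring
  have hF0 : 0 ≤ wint (pot J g ν) (fun φ : Λ × Fin n → ℝ => (∑ y, ψ y * φ (y, i)) ^ 2) :=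
    wint_nonneg fun _ => sq_nonneg _
  rw [e1] at cs
  set S := (∑ y, ψ y * ξ y) * Z
  rcases le_or_gt S 0 with hS | hS
  · exact hS.trans hF0
  · have h5 := cs.trans (mul_le_mul_of_nonneg_left e4 hF0)
    rw [sq] at h5
    exact le_of_mul_le_mul_right h5 hS

end LowerBound

section Decay

variable {Λ : Type*} [Fintype Λ] [DecidableEq Λ] {n : ℕ}
variable {J : Λ → Λ → ℝ} {g ν m : ℝ}

lemma IsWeight.weighted_gl_ge (hJ : IsWeight J) {D κ : ℝ} (hD : ∀ y, ∑ z, J y z ≤ D)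
    (hκ : 0 ≤ κ) {r : Λ → ℝ}
    (hrr : ∀ y z, J y z ≠ 0 → (r y - r z) ^ 2 ≤ κ * (r y * r z)) (f : Λ → ℝ) :
    -(κ * D / 2) * ∑ y, r y ^ 2 * f y ^ 2 ≤ ∑ y, r y ^ 2 * f y * gl J f y := by
  rw [hJ.sum_mul_gl (fun y => r y ^ 2 * f y) f]
  have h1 : ∀ y z, -(κ / 2) * (J y z * (r y ^ 2 * f y ^ 2) + J y z * (r z ^ 2 * f z ^ 2)) ≤
      J y z * ((r y ^ 2 * f y - r z ^ 2 * f z) * (f y - f z)) := by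
    intro y z
    by_cases hyz : J y z = 0
    · simp [hyz]
    · have e : (r y ^ 2 * f y - r z ^ 2 * f z) * (f y - f z) =
          (r y * f y - r z * f z) ^ 2 - f y * f z * (r y - r z) ^ 2 := by ring
      have h2 : f y * f z * (r y - r z) ^ 2 ≤
          κ / 2 * (r y ^ 2 * f y ^ 2 + r z ^ 2 * f z ^ 2) := by
        calc f y * f z * (r y - r z) ^ 2 ≤ |f y * f z| * (r y - r z) ^ 2 :=
              mul_le_mul_of_nonneg_right (le_abs_self _) (sq_nonneg _)
          _ ≤ |f y * f z| * (κ * (r y * r z)) :=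
              mul_le_mul_of_nonneg_left (hrr y z hyz) (abs_nonneg _)
          _ = κ * ((r y * |f y|) * (r z * |f z|)) := by rw [abs_mul]; ring
          _ ≤ κ * (((r y * |f y|) ^ 2 + (r z * |f z|) ^ 2) / 2) := by
              refine mul_le_mul_of_nonneg_left ?_ hκ
              linarith [two_mul_le_add_sq (r y * |f y|) (r z * |f z|)]
          _ = _ := by rw [mul_pow, mul_pow, sq_abs, sq_abs]; ring
      have h3 := mul_le_mul_of_nonneg_left
        (show -(κ / 2) * (r y ^ 2 * f y ^ 2 + r z ^ 2 * f z ^ 2) ≤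
        (r y ^ 2 * f y - r z ^ 2 * f z) * (f y - f z) by
          rw [e]; linarith [sq_nonneg (r y * f y - r z * f z)]) (hJ.nonneg y z)
      linarith
  have h2 : ∑ y, ∑ z, J y z * (r y ^ 2 * f y ^ 2) ≤ D * ∑ y, r y ^ 2 * f y ^ 2 := by
    rw [Finset.mul_sum]
    refine Finset.sum_le_sum fun y _ => ?_
    rw [← Finset.sum_mul]
    exact mul_le_mul_of_nonneg_right (hD y) (by positivity)
  have h3 : ∑ y, ∑ z, J y z * (r z ^ 2 * f z ^ 2) = ∑ y, ∑ z, J y z * (r y ^ 2 * f y ^ 2) := by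
    rw [Finset.sum_comm]
    exact Finset.sum_congr rfl fun y _ => Finset.sum_congr rfl fun z _ => by rw [hJ.symm]
  have h4 := Finset.sum_le_sum fun y (_ : y ∈ Finset.univ) =>
    Finset.sum_le_sum fun z (_ : z ∈ Finset.univ) => h1 y z
  simp only [← Finset.mul_sum, Finset.sum_add_distrib] at h4
  rw [h3] at h4
  have h5 := mul_le_mul_of_nonneg_left h2 hκ
  linarith

end Decay

section Decay

variable {Λ : Type*} [Fintype Λ] [DecidableEq Λ] {n : ℕ}
variable {J : Λ → Λ → ℝ} {g ν m : ℝ}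

lemma wint_site_sq_le (hJ : IsWeight J) (hg : 0 < g) {D : ℝ} (hD : ∀ y, ∑ z, J y z ≤ D)
    {η : (Λ × Fin n → ℝ) → ℝ} (hη : IsTest η) (y : Λ) :
    wint (pot J g ν) (fun φ => (∑ i, dirOp (pot J g ν) (y, i) η φ) ^ 2) ≤
      wint (pot J g ν) (fun φ => ∑ i, ∑ b, pd b (pd (y, i) η) φ ^ 2 +
        (g * sN φ y * (∑ i, pd (y, i) η φ ^ 2) + 2 * g * (∑ i, pd (y, i) η φ * φ (y, i)) ^ 2)) +
      (|ν| + D) * wint (pot J g ν) (fun φ => ∑ i, pd (y, i) η φ ^ 2) := by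
  have hV := nice_pot (n := n) (ν := ν) hJ hg
  have hC := hV.conf
  have tA : ∀ a, Tame (dirOp (pot J g ν) a η) := fun a => (hη.dirOp hV.smooth a).tame
  have tS : Tame (fun φ => ∑ i, pd (y, i) η φ ^ 2) :=
    Tame.sum _ fun i _ => (hη.deriv (y, i)).tame.pow 2
  have tH : ∀ i j : Fin n, Tame (fun φ => pd (y, i) (pd (y, j) η) φ ^ 2 +
      pd (y, i) (pd (y, j) (pot J g ν)) φ * (pd (y, i) η φ * pd (y, j) η φ)) := fun i j =>
    (((hη.deriv _).deriv _).tame.pow 2).add (by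
      rw [pd_pd_pot hJ]
      exact (tame_ddpot J g ν _ _).mul ((hη.deriv _).tame.mul (hη.deriv _).tame))
  have tsite := tame_site_form (g := g) (fun i => hη.deriv (y, i)) y
  have e1 : (fun φ => (∑ i, dirOp (pot J g ν) (y, i) η φ) ^ 2) = fun φ => ∑ i, ∑ j,
      dirOp (pot J g ν) (y, i) η φ * dirOp (pot J g ν) (y, j) η φ := by
    funext φ; rw [sq, Finset.sum_mul_sum]
  rw [e1, wint_sum hC _ fun i _ => Tame.sum _ fun j _ => (tA _).mul (tA _)]
  simp_rw [wint_sum hC _ fun j _ => (tA (y, _)).mul (tA (y, j)), wint_dirOp_mul_dirOp hV hη]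
  simp_rw [← wint_sum hC _ fun j _ => tH _ j]
  rw [← wint_sum hC _ fun i _ => Tame.sum _ fun j _ => tH i j, ← wint_const_mul,
    ← wint_add hC tsite (tS.const_mul _)]
  refine wint_mono hC (Tame.sum _ fun i _ => Tame.sum _ fun j _ => tH i j)
    (tsite.add (tS.const_mul _)) fun φ => ?_
  have h1 : ∑ i, ∑ j, pd (y, i) (pd (y, j) η) φ ^ 2 ≤ ∑ i, ∑ b, pd b (pd (y, i) η) φ ^ 2 := by
    rw [Finset.sum_comm]
    refine Finset.sum_le_sum fun i _ => ?_
    rw [Fintype.sum_prod_type]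
    exact Finset.single_le_sum (f := fun z => ∑ j, pd (z, j) (pd (y, i) η) φ ^ 2)
      (fun z _ => Finset.sum_nonneg fun j _ => sq_nonneg _) (Finset.mem_univ y)
  have hgl : gl J (fun z => if z = y then 1 else 0) y ≤ D := by
    refine le_trans (Finset.sum_le_sum fun z _ => ?_) (hD y)
    by_cases h : z = y
    · simpa [h] using hJ.nonneg y y
    · simp [h]
  have h2 : ∑ i, ∑ j, pd (y, i) (pd (y, j) (pot J g ν)) φ * (pd (y, i) η φ * pd (y, j) η φ) ≤
      g * sN φ y * (∑ i, pd (y, i) η φ ^ 2) + 2 * g * (∑ i, pd (y, i) η φ * φ (y, i)) ^ 2 +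
      (|ν| + D) * ∑ i, pd (y, i) η φ ^ 2 := by
    set G := gl J (fun z => if z = y then 1 else 0) y with hG
    have e2 : ∀ i j : Fin n, pd (y, i) (pd (y, j) (pot J g ν)) φ *
        (pd (y, i) η φ * pd (y, j) η φ) =
        (if j = i then (G + ν + g * sN φ y) * pd (y, i) η φ ^ 2 else 0) +
        2 * g * ((pd (y, i) η φ * φ (y, i)) * (pd (y, j) η φ * φ (y, j))) := by
      intro i j
      rw [pd_pd_pot hJ]
      unfold ddpot
      by_cases h : j = i
      · subst h; simp [← hG]; ring
      · simp [h]; ring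
    simp_rw [e2, Finset.sum_add_distrib, ← Finset.mul_sum]
    simp only [Finset.sum_ite_eq', Finset.mem_univ, if_true]
    rw [← Finset.sum_mul, ← Finset.mul_sum, ← sq]
    have h3 : (G + ν) * ∑ i, pd (y, i) η φ ^ 2 ≤ (|ν| + D) * ∑ i, pd (y, i) η φ ^ 2 :=
      mul_le_mul_of_nonneg_right (by linarith [le_abs_self ν])
        (Finset.sum_nonneg fun _ _ => sq_nonneg _)
    linarith
  simp only [Finset.sum_add_distrib] at h1 h2 ⊢
  linarith

lemma Gap.wint_weighted_op_sq_le (hG : Gap n J g ν m) (hJ : IsWeight J) (hg : 0 < g) (hm : 0 < m)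
    {D : ℝ} (hD : ∀ y, ∑ z, J y z ≤ D) (hD0 : 0 ≤ D) {η : (Λ × Fin n → ℝ) → ℝ} (hη : IsTest η)
    (w : Λ → ℝ) :
    wint (pot J g ν) (fun φ => (∑ a : Λ × Fin n, w a.1 * dirOp (pot J g ν) a η φ) ^ 2) ≤
      (∑ y, w y ^ 2) * (1 + (2 * |ν| + D) / m) *
        wint (pot J g ν) (fun φ => gen (pot J g ν) η φ ^ 2) := by
  have hV := nice_pot (n := n) (ν := ν) hJ hg
  have hC := hV.conf
  have tA : ∀ a, Tame (dirOp (pot J g ν) a η) := fun a => (hη.dirOp hV.smooth a).tame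
  have tAy : ∀ y : Λ, Tame (fun φ => (∑ i, dirOp (pot J g ν) (y, i) η φ) ^ 2) :=
    fun y => (Tame.sum _ fun i _ => tA (y, i)).pow 2
  have tF := tame_grad_form (J := J) hη (fun _ => 1)
  have tS := tame_grad_sq hη (fun _ => 1)
  simp only [one_mul] at tF tS
  have tsq : ∀ y : Λ, Tame (fun φ => ∑ i, pd (y, i) η φ ^ 2) :=
    fun y => Tame.sum _ fun i _ => (hη.deriv (y, i)).tame.pow 2
  have tsite := fun y => tame_site_form (g := g) (fun i => hη.deriv (y, i)) y
  set G2 := wint (pot J g ν) (fun φ => gen (pot J g ν) η φ ^ 2) with hG2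
  set U := wint (pot J g ν) (fun φ => ∑ y, ∑ i, pd (y, i) η φ ^ 2) with hU
  have hU0 : 0 ≤ U := wint_nonneg fun φ => Finset.sum_nonneg fun _ _ =>
    Finset.sum_nonneg fun _ _ => sq_nonneg _
  have hF0 : 0 ≤ wint (pot J g ν)
      (fun φ => ∑ k, ∑ y, pd (y, k) η φ * gl J (fun z => pd (z, k) η φ) y) :=
    wint_nonneg fun φ => Finset.sum_nonneg fun k _ =>
      hJ.sum_mul_gl_self_nonneg fun z => pd (z, k) η φ
  have hUG : m * U ≤ G2 := by
    have := hG.gen_sq hJ hg hη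
    rw [wint_add hC tF (tS.const_mul m), wint_const_mul] at this
    linarith
  have hsites : wint (pot J g ν) (fun φ => ∑ y, (∑ i, ∑ b, pd b (pd (y, i) η) φ ^ 2 +
      (g * sN φ y * (∑ i, pd (y, i) η φ ^ 2) +
        2 * g * (∑ i, pd (y, i) η φ * φ (y, i)) ^ 2))) ≤ G2 + |ν| * U := by
    have h := wint_weighted_gen (ν := ν) hJ hg hη (fun _ => 1)
    simp only [one_mul] at h
    rw [wint_add hC tF (tS.const_mul ν), wint_const_mul] at h
    have e : wint (pot J g ν) (fun φ => (∑ a, dirOp (pot J g ν) a η φ) * gen (pot J g ν) η φ) =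
        G2 := by
      rw [hG2]; congr 1; funext φ; unfold gen; ring
    rw [e] at h
    have h1 : -|ν| * U ≤ ν * U := mul_le_mul_of_nonneg_right (neg_abs_le ν) hU0
    linarith
  have h1 : wint (pot J g ν) (fun φ => (∑ a : Λ × Fin n, w a.1 * dirOp (pot J g ν) a η φ) ^ 2) ≤
      (∑ y, w y ^ 2) * ∑ y, wint (pot J g ν)
        (fun φ => (∑ i, dirOp (pot J g ν) (y, i) η φ) ^ 2) := by
    rw [← wint_sum hC _ fun y _ => tAy y, ← wint_const_mul]
    refine wint_mono hC ((Tame.sum _ fun a _ => (tA a).const_mul _).pow 2)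
      ((Tame.sum _ fun y _ => tAy y).const_mul _) fun φ => ?_
    rw [Fintype.sum_prod_type]
    simp_rw [← Finset.mul_sum]
    exact Finset.sum_mul_sq_le_sq_mul_sq _ _ _
  have h2 : ∑ y, wint (pot J g ν) (fun φ => (∑ i, dirOp (pot J g ν) (y, i) η φ) ^ 2) ≤
      G2 + |ν| * U + (|ν| + D) * U := by
    refine (Finset.sum_le_sum fun y _ => wint_site_sq_le hJ hg hD hη y).trans ?_
    rw [Finset.sum_add_distrib, ← Finset.mul_sum, ← wint_sum hC _ fun y _ => tsite y,
      ← wint_sum hC _ fun y _ => tsq y]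
    linarith
  have h3 : G2 + |ν| * U + (|ν| + D) * U ≤ (1 + (2 * |ν| + D) / m) * G2 := by
    have : (2 * |ν| + D) * U ≤ (2 * |ν| + D) / m * G2 := by
      rw [div_mul_eq_mul_div, le_div_iff₀ hm]
      calc (2 * |ν| + D) * U * m = (2 * |ν| + D) * (m * U) := by ring
        _ ≤ _ := mul_le_mul_of_nonneg_left hUG (by positivity)
    linarith
  refine h1.trans ?_
  rw [mul_assoc]
  exact mul_le_mul_of_nonneg_left (h2.trans h3) (Finset.sum_nonneg fun _ _ => sq_nonneg _)

/-- Weighted decay of the two-point function. -/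
lemma Gap.two_point_decay (hG : Gap n J g ν m) (hJ : IsWeight J) (hg : 0 < g) (hm : 0 < m)
    {D κ c : ℝ} (hD : ∀ y, ∑ z, J y z ≤ D) (hD0 : 0 ≤ D) (hκ : 0 ≤ κ) (hc : 0 < c)
    (hcm : c ≤ m - κ * D / 2) {r : Λ → ℝ}
    (hrr : ∀ y z, J y z ≠ 0 → (r y - r z) ^ 2 ≤ κ * (r y * r z)) {o : Λ} (ho : r o = 1)
    (i : Fin n) (x : Λ) :
    |r x| * |wint (pot J g ν) (fun φ : Λ × Fin n → ℝ => φ (o, i) * φ (x, i))| ≤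
      1 / c * wint (pot J g ν) (fun _ : Λ × Fin n → ℝ => 1) := by
  have hV := nice_pot (n := n) (ν := ν) hJ hg
  have hC := hV.conf
  set Z := wint (pot J g ν) (fun _ : Λ × Fin n → ℝ => 1) with hZ
  have hZ0 : 0 < Z := wint_one_pos hC
  have tF : ∀ y : Λ, Tame (fun φ : Λ × Fin n → ℝ => φ (y, i)) := fun y => Tame.coord _
  have hFp : ∀ (y : Λ) (a : Λ × Fin n), HasPD a (fun φ : Λ × Fin n → ℝ => φ (y, i))
    (fun _ => if (y, i) = a then 1 else 0) := fun y a =>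
    (HasPD.coord a (y, i)).congr (fun _ => rfl) fun _ => by by_cases h : (y, i) = a <;> simp [h]
  set F : (Λ × Fin n → ℝ) → ℝ := fun φ => φ (o, i) with hF
  set B := fun y : Λ => wint (pot J g ν) (fun φ : Λ × Fin n → ℝ => φ (y, i) ^ 2) with hB
  have hB0 : ∀ y, 0 ≤ B y := fun y => wint_nonneg fun _ => sq_nonneg _
  set K := (∑ y, (r y ^ 2) ^ 2) * (1 + (2 * |ν| + D) / m) with hK
  have hK0 : 0 ≤ K := by positivity
  let f : ℝ → ℝ := fun ε => √(Z * (Z / c ^ 2 + 2 * √(K * (2 * B o + 2 * ε) * ε) / c)) +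
    |r x| * √(ε * B x)
  have hf0 : f 0 = 1 / c * Z := by
    have : Z * (Z / c ^ 2) = (Z / c) ^ 2 := by ring
    simp only [f, mul_zero, zero_mul, Real.sqrt_zero, zero_div, add_zero, this]
    rw [Real.sqrt_sq (by positivity)]; ring
  have hfc : Tendsto f (𝓝[>] 0) (𝓝 (f 0)) := by
    have : Continuous f := by fun_prop
    exact this.continuousAt.mono_left nhdsWithin_le_nhds
  rw [← hf0]
  refine ge_of_tendsto hfc ?_
  filter_upwards [self_mem_nhdsWithin] with ε hε
  replace hε : 0 < ε := hε
  obtain ⟨η, hη, herr⟩ := exists_generator_approx hV.smooth hC (tF o)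
    (wint_odd (g := g) (ν := ν) (J := J) fun φ => rfl) hε
  change wint (pot J g ν) (fun φ => (F φ - gen (pot J g ν) η φ) ^ 2) < ε at herr
  have tA : ∀ a, Tame (dirOp (pot J g ν) a η) := fun a => (hη.dirOp hV.smooth a).tame
  have tg : Tame (gen (pot J g ν) η) := Tame.sum _ fun a _ => tA a
  have tu : ∀ a, Tame (pd a η) := fun a => (hη.deriv a).tame
  set Lr : (Λ × Fin n → ℝ) → ℝ :=
    fun φ => ∑ a : Λ × Fin n, r a.1 ^ 2 * dirOp (pot J g ν) a η φ with hLr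
  have tL : Tame Lr := Tame.sum _ fun a _ => (tA a).const_mul _
  have tFo : Tame F := tF o
  have tE : Tame (fun φ => F φ - gen (pot J g ν) η φ) := tFo.sub tg
  have tY : Tame (fun φ : Λ × Fin n → ℝ => ∑ y, r y ^ 2 * ∑ i, pd (y, i) η φ ^ 2) :=
    tame_grad_sq hη _
  set Y := wint (pot J g ν) (fun φ => ∑ y, r y ^ 2 * ∑ i, pd (y, i) η φ ^ 2) with hY
  set G2 := wint (pot J g ν) (fun φ => gen (pot J g ν) η φ ^ 2) with hG2
  set P := fun y : Λ => wint (pot J g ν) (pd (y, i) η) with hP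
  have hP2 : ∀ y, r y ^ 2 * P y ^ 2 ≤ Z * Y := by
    intro y
    have h1 := wint_mul_sq_le hC (Tame.const 1) (tu (y, i))
    simp only [one_mul, one_pow] at h1
    have h2 : r y ^ 2 * wint (pot J g ν) (fun φ => pd (y, i) η φ ^ 2) ≤ Y := by
      rw [← wint_const_mul]
      refine wint_mono hC (((tu (y, i)).pow 2).const_mul _) tY fun φ => ?_
      refine le_trans (mul_le_mul_of_nonneg_left ?_ (sq_nonneg _))
        (Finset.single_le_sum (f := fun y => r y ^ 2 * ∑ i, pd (y, i) η φ ^ 2)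
          (fun z _ => mul_nonneg (sq_nonneg _) (Finset.sum_nonneg fun _ _ => sq_nonneg _))
          (Finset.mem_univ y))
      exact Finset.single_le_sum (f := fun i => pd (y, i) η φ ^ 2) (fun _ _ => sq_nonneg _)
        (Finset.mem_univ i)
    calc r y ^ 2 * P y ^ 2 ≤ r y ^ 2 * (Z * wint (pot J g ν) (fun φ => pd (y, i) η φ ^ 2)) :=
          mul_le_mul_of_nonneg_left h1 (sq_nonneg _)
      _ = Z * (r y ^ 2 * wint (pot J g ν) (fun φ => pd (y, i) η φ ^ 2)) := by ring
      _ ≤ _ := mul_le_mul_of_nonneg_left h2 hZ0.le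
  have hLF : wint (pot J g ν) (fun φ => Lr φ * F φ) = P o := by
    have e : (fun φ => Lr φ * F φ) = fun φ =>
        ∑ a : Λ × Fin n, r a.1 ^ 2 * (dirOp (pot J g ν) a η φ * F φ) := by
      funext φ; rw [hLr, Finset.sum_mul]; exact Finset.sum_congr rfl fun a _ => by ring
    rw [e, wint_sum hC _ fun a _ => ((tA a).mul tFo).const_mul _]
    have e2 : ∀ a : Λ × Fin n, wint (pot J g ν)
        (fun φ => r a.1 ^ 2 * (dirOp (pot J g ν) a η φ * F φ)) =
        r a.1 ^ 2 * wint (pot J g ν) (fun φ => pd a η φ * if (o, i) = a then 1 else 0) :=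
      fun a => by
        rw [wint_const_mul, wint_dirOp_mul hV hη (hFp o _) tFo (Tame.const _)]
    simp_rw [e2]
    rw [Finset.sum_eq_single (o, i)]
    · simp [ho, hP]
    · intro a _ ha
      simp [ha.symm, wint]
    · simp
  have hgx : wint (pot J g ν) (fun φ => gen (pot J g ν) η φ * φ (x, i)) = P x := by
    rw [wint_gen_mul hV hη (hFp x) (tF x) fun a => Tame.const _]
    congr 1
    funext φ
    rw [Finset.sum_eq_single (x, i)]
    · simp
    · intro a _ ha; simp [ha.symm]
    · simp
  have hG2le : G2 ≤ 2 * B o + 2 * ε := by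
    have : G2 ≤ 2 * B o + 2 * wint (pot J g ν) (fun φ => (F φ - gen (pot J g ν) η φ) ^ 2) := by
      rw [hB, ← wint_const_mul, ← wint_const_mul, ← wint_add hC (((tF o).pow 2).const_mul 2)
        ((tE.pow 2).const_mul 2)]
      refine wint_mono hC (tg.pow 2) ((((tF o).pow 2).const_mul 2).add
        ((tE.pow 2).const_mul 2)) fun φ => ?_
      have : F φ = φ (o, i) := rfl
      nlinarith [sq_nonneg (2 * F φ - gen (pot J g ν) η φ)]
    linarith
  have hG20 : 0 ≤ G2 := wint_nonneg fun _ => sq_nonneg _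
  set E := √(K * (2 * B o + 2 * ε) * ε) with hE
  have hE0 : 0 ≤ E := Real.sqrt_nonneg _
  have hLE : -E ≤ wint (pot J g ν) (fun φ => Lr φ * (F φ - gen (pot J g ν) η φ)) := by
    refine (abs_le.1 (Real.abs_le_sqrt ?_)).1
    refine (wint_mul_sq_le hC tL tE).trans ?_
    have h1 := hG.wint_weighted_op_sq_le hJ hg hm hD hD0 hη fun y => r y ^ 2
    have h2 : wint (pot J g ν) (fun φ => Lr φ ^ 2) ≤ K * (2 * B o + 2 * ε) :=
      h1.trans (mul_le_mul_of_nonneg_left hG2le hK0)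
    exact mul_le_mul h2 herr.le (wint_nonneg fun _ => sq_nonneg _)
      (mul_nonneg hK0 (hG20.trans hG2le))
  have hcY : c * Y ≤ P o + E := by
    have h1 := hG.weighted hJ hg hη (w := fun y => r y ^ 2) fun y => sq_nonneg _
    have tFr := tame_grad_form (J := J) hη (fun y => r y ^ 2)
    have h2 : c * Y ≤ wint (pot J g ν) (fun φ => (∑ k, ∑ y, r y ^ 2 * pd (y, k) η φ *
        gl J (fun z => pd (z, k) η φ) y) + m * ∑ y, r y ^ 2 * ∑ i, pd (y, i) η φ ^ 2) := by
      rw [hY, ← wint_const_mul]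
      refine wint_mono hC (tY.const_mul c) (tFr.add (tY.const_mul m)) fun φ => ?_
      have h3 := Finset.sum_le_sum fun k (_ : k ∈ Finset.univ) =>
        hJ.weighted_gl_ge hD hκ hrr fun z => pd (z, k) η φ
      rw [← Finset.mul_sum] at h3
      have h4 : ∑ k, ∑ y, r y ^ 2 * pd (y, k) η φ ^ 2 =
          ∑ y, r y ^ 2 * ∑ k, pd (y, k) η φ ^ 2 := by
        rw [Finset.sum_comm]
        exact Finset.sum_congr rfl fun y _ => by rw [Finset.mul_sum]
      rw [h4] at h3
      have h5 : 0 ≤ ∑ y, r y ^ 2 * ∑ k, pd (y, k) η φ ^ 2 := Finset.sum_nonneg fun _ _ =>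
        mul_nonneg (sq_nonneg _) (Finset.sum_nonneg fun _ _ => sq_nonneg _)
      have h6 := mul_le_mul_of_nonneg_right hcm h5
      linarith
    have h3 : wint (pot J g ν) (fun φ => Lr φ * gen (pot J g ν) η φ) =
        P o - wint (pot J g ν) (fun φ => Lr φ * (F φ - gen (pot J g ν) η φ)) := by
      rw [← hLF, ← wint_sub hC (tL.mul tFo) (tL.mul tE)]
      congr 1; funext φ; ring
    have h4 := h2.trans h1
    rw [show wint (pot J g ν) (fun φ => (∑ a : Λ × Fin n, r a.1 ^ 2 *
      dirOp (pot J g ν) a η φ) * gen (pot J g ν) η φ) =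
      wint (pot J g ν) (fun φ => Lr φ * gen (pot J g ν) η φ) from rfl, h3] at h4
    linarith
  have hYle : Y ≤ Z / c ^ 2 + 2 * E / c := by
    have h1 := hP2 o
    rw [ho, one_pow, one_mul] at h1
    have h2 : P o ≤ Z / (2 * c) + c * Y / 2 := by
      have h3 : 0 ≤ Y := wint_nonneg fun φ => Finset.sum_nonneg fun _ _ =>
        mul_nonneg (sq_nonneg _) (Finset.sum_nonneg fun _ _ => sq_nonneg _)
      refine le_trans (le_abs_self _) (abs_le_of_sq_le_sq (h1.trans ?_) (by positivity))
      have h4 : (Z / (2 * c) + c * Y / 2) ^ 2 - Z * Y = (Z / (2 * c) - c * Y / 2) ^ 2 := by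
        field_simp; ring
      linarith [sq_nonneg (Z / (2 * c) - c * Y / 2)]
    have h3 : c * Y / 2 ≤ Z / (2 * c) + E := by linarith
    calc Y = 2 / c * (c * Y / 2) := by field_simp
      _ ≤ 2 / c * (Z / (2 * c) + E) := mul_le_mul_of_nonneg_left h3 (by positivity)
      _ = _ := by field_simp
  have hT : |r x| * |P x| ≤ √(Z * (Z / c ^ 2 + 2 * E / c)) := by
    rw [← abs_mul]
    refine Real.abs_le_sqrt ?_
    rw [mul_pow]
    exact (hP2 x).trans (mul_le_mul_of_nonneg_left hYle hZ0.le)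
  have hS : |wint (pot J g ν) (fun φ : Λ × Fin n → ℝ => φ (o, i) * φ (x, i)) - P x| ≤
      √(ε * B x) := by
    rw [← hgx, ← wint_sub hC ((tF o).mul (tF x)) (tg.mul (tF x))]
    refine Real.abs_le_sqrt ?_
    have e : (fun φ : Λ × Fin n → ℝ => φ (o, i) * φ (x, i) - gen (pot J g ν) η φ * φ (x, i)) =
      fun φ => (F φ - gen (pot J g ν) η φ) * φ (x, i) := by funext φ; rw [hF]; ring
    rw [e]
    exact (wint_mul_sq_le hC tE (tF x)).trans (mul_le_mul_of_nonneg_right herr.le (hB0 x))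
  set S := wint (pot J g ν) (fun φ : Λ × Fin n → ℝ => φ (o, i) * φ (x, i))
  have h9 : |S| ≤ |P x| + √(ε * B x) := by
    have := abs_sub_abs_le_abs_sub S (P x)
    linarith
  calc |r x| * |S| ≤ |r x| * (|P x| + √(ε * B x)) :=
        mul_le_mul_of_nonneg_left h9 (abs_nonneg _)
    _ = |r x| * |P x| + |r x| * √(ε * B x) := by ring
    _ ≤ _ := add_le_add_left hT _

end Decay

section FreeEnergy

variable {ι : Type*} [Fintype ι] [DecidableEq ι] {V V' F G : (ι → ℝ) → ℝ}

lemma Confining.of_le (hV : Confining V) (hc : Continuous V') (h : ∀ x, V x ≤ V' x) :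
    Confining V' := by
  obtain ⟨-, c, K, h0, hK⟩ := hV
  exact ⟨hc, c, K, h0, fun x => (hK x).trans (h x)⟩

/-- The Gibbs (Jensen) variational inequality. -/
lemma log_wint_ge (hV : Confining V) (hV' : Confining V') (hF : Tame fun x => V' x - V x) :
    Real.log (wint V fun _ => 1) - wint V (fun x => V' x - V x) / wint V (fun _ => 1)
      ≤ Real.log (wint V' fun _ => 1) := by
  set Z := wint V (fun _ => 1) with hZ
  have hZ0 : 0 < Z := wint_one_pos hV
  set c := wint V (fun x => V' x - V x) / Z with hc
  have hcZ : c * Z = wint V (fun x => V' x - V x) := div_mul_cancel₀ _ hZ0.ne'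
  have key : Real.exp (-c) * Z ≤ wint V' (fun _ => 1) := by
    have h1 : wint V (fun x => Real.exp (-c) * ((1 + c) - (V' x - V x)))
        = Real.exp (-c) * Z := by
      rw [wint_const_mul, wint_sub hV (Tame.const _) hF]
      have : wint V (fun _ => 1 + c) = (1 + c) * Z := by
        rw [hZ, ← wint_const_mul]; simp
      rw [this, ← hcZ]; ring
    rw [← h1]
    unfold wint
    refine integral_mono (hV.integrable (((Tame.const _).sub hF).const_mul _))
      (hV'.integrable (Tame.const 1)) fun x => ?_
    have e : Real.exp (-V' x) = Real.exp (-c) * Real.exp (c - (V' x - V x)) * Real.exp (-V x) := by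
      rw [← Real.exp_add, ← Real.exp_add]; congr 1; ring
    dsimp only
    rw [one_mul, e]
    refine mul_le_mul_of_nonneg_right ?_ (Real.exp_pos _).le
    refine mul_le_mul_of_nonneg_left ?_ (Real.exp_pos _).le
    have := Real.add_one_le_exp (c - (V' x - V x))
    linarith
  have := Real.log_le_log (by positivity) key
  rw [Real.log_mul (Real.exp_pos _).ne' hZ0.ne', Real.log_exp] at this
  linarith

lemma exp_neg_add_mul_le (v f : ℝ) {t s : ℝ} (h : |s - t| ≤ 1) :
    Real.exp (-(v + s * f)) ≤ Real.exp (-(v + (t - 1) * f)) + Real.exp (-(v + (t + 1) * f)) := by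
  rw [abs_le] at h
  rcases le_total 0 f with hf | hf
  · have : Real.exp (-(v + s * f)) ≤ Real.exp (-(v + (t - 1) * f)) :=
      Real.exp_le_exp.2 (by nlinarith)
    linarith [Real.exp_pos (-(v + (t + 1) * f))]
  · have : Real.exp (-(v + s * f)) ≤ Real.exp (-(v + (t + 1) * f)) :=
      Real.exp_le_exp.2 (by nlinarith)
    linarith [Real.exp_pos (-(v + (t - 1) * f))]

lemma hasDerivAt_wint (hV : ∀ t : ℝ, Confining fun x => V x + t * F x) (hF : Tame F)
    (hG : Tame G) (t : ℝ) :
    HasDerivAt (fun s => wint (fun x => V x + s * F x) G)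
      (-wint (fun x => V x + t * F x) (fun x => F x * G x)) t := by
  have hFG := hF.mul hG
  have hb : Tame fun x => |F x * G x| := Tame.of_le hFG.continuous.abs hFG fun x => by simp
  have := (hasDerivAt_integral_of_dominated_loc_of_deriv_le (μ := volume) (x₀ := t)
    (s := Metric.ball t 1)
    (F := fun s x => G x * Real.exp (-(V x + s * F x)))
    (F' := fun s x => -(F x * G x) * Real.exp (-(V x + s * F x)))
    (bound := fun x => |F x * G x| * Real.exp (-(V x + (t - 1) * F x))
      + |F x * G x| * Real.exp (-(V x + (t + 1) * F x)))
    (Metric.ball_mem_nhds t one_pos)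
    (Eventually.of_forall fun s => ((hV s).integrable hG).aestronglyMeasurable)
    ((hV t).integrable hG) ((hV t).integrable hFG.neg).aestronglyMeasurable
    (Eventually.of_forall fun x s hs => ?_)
    (((hV (t - 1)).integrable hb).add ((hV (t + 1)).integrable hb))
    (Eventually.of_forall fun x s hs => ?_)).2
  · have e : (-wint (fun x => V x + t * F x) (fun x => F x * G x))
        = ∫ x, -(F x * G x) * Real.exp (-(V x + t * F x)) := by
      unfold wint
      rw [← integral_neg]
      exact integral_congr_ae (Eventually.of_forall fun x => by simp)
    rw [e]
    exact this
  · rw [norm_mul, Real.norm_eq_abs, Real.norm_eq_abs, abs_neg, Real.abs_exp, ← mul_add]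
    refine mul_le_mul_of_nonneg_left (exp_neg_add_mul_le _ _ ?_) (abs_nonneg _)
    rw [Metric.mem_ball, Real.dist_eq] at hs
    exact hs.le
  · have h1 : HasDerivAt (fun s : ℝ => -(V x + s * F x)) (-(F x)) s := by
      have := (((hasDerivAt_id s).mul_const (F x)).const_add (V x)).neg
      rw [one_mul] at this
      exact this
    have h2 := (h1.exp).const_mul (G x)
    have e : -(F x * G x) * Real.exp (-(V x + s * F x))
        = G x * (Real.exp (-(V x + s * F x)) * -F x) := by ring
    rw [e]
    exact h2

/-- The logarithmic derivative of the partition function. -/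
lemma hasDerivAt_log_wint (hV : ∀ t : ℝ, Confining fun x => V x + t * F x) (hF : Tame F) (t : ℝ) :
    HasDerivAt (fun s => Real.log (wint (fun x => V x + s * F x) fun _ => 1))
      (-(wint (fun x => V x + t * F x) F / wint (fun x => V x + t * F x) fun _ => 1)) t := by
  have h := (hasDerivAt_wint hV hF (Tame.const 1) t).log (wint_one_pos (hV t)).ne'
  simpa [neg_div] using h

/-- The derivative of an expectation is minus the variance. -/
lemma hasDerivAt_wint_div (hV : ∀ t : ℝ, Confining fun x => V x + t * F x) (hF : Tame F) (t : ℝ) :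
    ∃ v, HasDerivAt (fun s => wint (fun x => V x + s * F x) F /
        wint (fun x => V x + s * F x) fun _ => 1) (-v) t ∧
      v * wint (fun x => V x + t * F x) (fun _ => 1) = wint (fun x => V x + t * F x) (fun x =>
        (F x - wint (fun x => V x + t * F x) F /
          wint (fun x => V x + t * F x) fun _ => 1) ^ 2) := by
  have hZ := wint_one_pos (hV t)
  have h := (hasDerivAt_wint hV hF hF t).div (hasDerivAt_wint hV hF (Tame.const 1) t) hZ.ne'
  set W := fun x => V x + t * F x with hW
  set Z := wint W (fun _ => 1) with hZd
  set c := wint W F / Z with hc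
  have hcZ : wint W F = c * Z := (div_mul_cancel₀ _ hZ.ne').symm
  refine ⟨-(((-wint W fun x => F x * F x) * Z - wint W F * -wint W fun x => F x * 1) / Z ^ 2),
    by rw [neg_neg]; exact h, ?_⟩
  have e : (fun x => (F x - c) ^ 2) = fun x => F x * F x - (2 * c * F x - c ^ 2 * 1) := by
    funext x; ring
  rw [e, wint_sub (hV t) (hF.mul hF) ((hF.const_mul _).sub ((Tame.const 1).const_mul _)),
    wint_sub (hV t) (hF.const_mul _) ((Tame.const 1).const_mul _), wint_const_mul,
    wint_const_mul]
  simp only [mul_one]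
  rw [hcZ]
  field_simp
  ring

end FreeEnergy

/-- First order Taylor expansion with a two-sided bound on the second derivative. -/
lemma taylor_bound_of_deriv {f e v : ℝ → ℝ} {a b K : ℝ} (hf : ∀ t, HasDerivAt f (e t) t)
    (he : ∀ t, HasDerivAt e (v t) t) (hv : ∀ t ∈ Set.Icc a b, |v t| ≤ K) {t s : ℝ}
    (ht : t ∈ Set.Icc a b) (hs : s ∈ Set.Icc a b) :
    |f s - f t - (s - t) * e t| ≤ K * (s - t) ^ 2 := by
  have h1 : ∀ r ∈ Set.Icc a b, |e r - e t| ≤ K * |r - t| := fun r hr =>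
    (convex_Icc a b).norm_image_sub_le_of_norm_hasDerivWithin_le
      (fun x _ => (he x).hasDerivWithinAt) (fun x hx => hv x hx) ht hr
  have h2 := (convex_uIcc t s).norm_image_sub_le_of_norm_hasDerivWithin_le
    (f := fun r => f r - r * e t) (f' := fun r => e r - e t) (C := K * |s - t|) (x := t) (y := s)
    (fun r _ => by
      have := ((hf r).sub ((hasDerivAt_id r).mul_const (e t))).hasDerivWithinAt (s := Set.uIcc t s)
      rw [one_mul] at this
      exact this)
    (fun r hr => by
      have hr' : r ∈ Set.Icc a b := Set.uIcc_subset_Icc ht hs hr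
      refine (h1 r hr').trans ?_
      have hK : 0 ≤ K := (abs_nonneg _).trans (hv t ht)
      exact mul_le_mul_of_nonneg_left (Set.abs_sub_left_of_mem_uIcc hr) hK)
    Set.left_mem_uIcc Set.right_mem_uIcc
  rw [Real.norm_eq_abs, Real.norm_eq_abs] at h2
  calc |f s - f t - (s - t) * e t| = |f s - s * e t - (f t - t * e t)| := by congr 1; ring
    _ ≤ K * |s - t| * |s - t| := h2
    _ = K * (s - t) ^ 2 := by rw [mul_assoc, abs_mul_abs_self]; ring

/-- Convergence of functions with a uniform quadratic Taylor bound entails convergence of the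
first-order coefficients. -/
lemma exists_tendsto_coeff {f e : ℕ → ℝ → ℝ} {K t r : ℝ} (hr : 0 < r) {F : ℝ → ℝ}
    (hf : ∀ s ∈ Set.Icc t (t + r), Tendsto (fun N => f N s) atTop (𝓝 (F s)))
    (hb : ∀ᶠ N in atTop, ∀ s ∈ Set.Icc t (t + r),
      |f N s - f N t - (s - t) * e N t| ≤ K * (s - t) ^ 2) :
    ∃ E, Tendsto (fun N => e N t) atTop (𝓝 E) := by
  refine cauchySeq_tendsto_of_complete (Metric.cauchySeq_iff'.2 fun ε hε => ?_)
  have hK : 0 ≤ K := by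
    obtain ⟨N, hN⟩ := hb.exists
    have := (abs_nonneg _).trans (hN (t + r) ⟨by linarith, le_rfl⟩)
    have h2 : 0 < (t + r - t) ^ 2 := by rw [add_sub_cancel_left]; positivity
    nlinarith
  obtain ⟨d, hd0, hdr, hd⟩ : ∃ d, 0 < d ∧ d ≤ r ∧ K * d ≤ ε / 8 := by
    refine ⟨min r (ε / 8 / (K + 1)), by positivity, min_le_left _ _, ?_⟩
    calc K * min r (ε / 8 / (K + 1)) ≤ (K + 1) * (ε / 8 / (K + 1)) :=
          mul_le_mul (by linarith) (min_le_right _ _) (by positivity) (by positivity)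
      _ = ε / 8 := by field_simp
  have h1 := hf (t + d) ⟨by linarith, by linarith⟩
  have h0 := hf t ⟨le_rfl, by linarith⟩
  have h2 := (h1.sub h0).cauchySeq
  obtain ⟨N₁, hN₁⟩ := Metric.cauchySeq_iff'.1 h2 (ε / 2 * d) (by positivity)
  obtain ⟨N₂, hN₂⟩ := eventually_atTop.1 hb
  obtain ⟨N₃, hN₃⟩ := Metric.cauchySeq_iff.1 h2 (ε / 2 * d) (by positivity)
  refine ⟨max N₂ N₃, fun N hN => ?_⟩
  have a1 := hN₂ N ((le_max_left _ _).trans hN) (t + d) ⟨by linarith, by linarith⟩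
  have a2 := hN₂ (max N₂ N₃) (le_max_left _ _) (t + d) ⟨by linarith, by linarith⟩
  have a3 := hN₃ N ((le_max_right _ _).trans hN) (max N₂ N₃) (le_max_right _ _)
  rw [Real.dist_eq] at a3 ⊢
  rw [add_sub_cancel_left] at a1 a2
  rw [abs_le] at a1 a2
  rw [abs_lt] at a3 ⊢
  have hKd : K * d ^ 2 ≤ ε / 8 * d := by nlinarith
  have hed : 0 < ε * d := by positivity
  constructor <;> nlinarith

lemma hasDerivAt_of_tendsto {f e : ℕ → ℝ → ℝ} {K t r : ℝ} (hr : 0 < r) {F : ℝ → ℝ}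
    (hf : ∀ s ∈ Set.Icc (t - r) (t + r), Tendsto (fun N => f N s) atTop (𝓝 (F s)))
    (hb : ∀ᶠ N in atTop, ∀ s ∈ Set.Icc (t - r) (t + r),
      |f N s - f N t - (s - t) * e N t| ≤ K * (s - t) ^ 2) :
    ∃ E, Tendsto (fun N => e N t) atTop (𝓝 E) ∧ HasDerivAt F E t := by
  obtain ⟨E, hE⟩ := exists_tendsto_coeff hr (fun s hs => hf s ⟨by linarith [hs.1], hs.2⟩)
    (hb.mono fun N h s hs => h s ⟨by linarith [hs.1], hs.2⟩)
  refine ⟨E, hE, ?_⟩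
  have h0 := hf t ⟨by linarith, by linarith⟩
  have hF : ∀ s ∈ Set.Icc (t - r) (t + r), |F s - F t - (s - t) * E| ≤ K * (s - t) ^ 2 :=
    fun s hs => le_of_tendsto ((((hf s hs).sub h0).sub (hE.const_mul _)).abs)
      (hb.mono fun N h => h s hs)
  rw [hasDerivAt_iff_isLittleO]
  have hO : (fun s => F s - F t - (s - t) • E) =O[𝓝 t] fun s => (s - t) ^ 2 := by
    refine Asymptotics.IsBigO.of_bound K ?_
    filter_upwards [Icc_mem_nhds (by linarith : t - r < t) (by linarith : t < t + r)] with s hs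
    rw [Real.norm_eq_abs, Real.norm_eq_abs, abs_of_nonneg (sq_nonneg (s - t)), smul_eq_mul]
    exact hF s hs
  refine hO.trans_isLittleO ?_
  have : (fun s => (s - t) ^ 2) =o[𝓝 t] fun s => (s - t) ^ 1 := by
    have h := Asymptotics.isLittleO_pow_pow (𝕜 := ℝ) (m := 1) (n := 2) (by norm_num)
    have ht : Tendsto (fun s => s - t) (𝓝 t) (𝓝 0) := by
      simpa using (tendsto_id (x := 𝓝 t)).sub_const t
    exact h.comp_tendsto ht
  simpa using this

section GraphFreeEnergy

variable {Λ : Type*} [Fintype Λ] [DecidableEq Λ] {n : ℕ}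
variable {J J' : Λ → Λ → ℝ} {g ν : ℝ}

/-- The logarithm of the partition function on a weighted graph. -/
def fe (n : ℕ) (J : Λ → Λ → ℝ) (g ν : ℝ) : ℝ :=
  Real.log (wint (pot J g ν) fun _ : Λ × Fin n → ℝ => 1)

/-- Expectations on a weighted graph. -/
def ev (J : Λ → Λ → ℝ) (g ν : ℝ) (F : (Λ × Fin n → ℝ) → ℝ) : ℝ :=
  wint (pot J g ν) F / wint (pot J g ν) fun _ : Λ × Fin n → ℝ => 1

lemma tame_pot (J : Λ → Λ → ℝ) (g ν : ℝ) : Tame (pot J g ν : (Λ × Fin n → ℝ) → ℝ) :=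
  (Tame.sum _ fun y _ => (((tame_sN y).pow 2).const_mul _).add ((tame_sN y).const_mul _)).add
    ((Tame.sum _ fun k _ => Tame.sum _ fun y _ =>
      (Tame.coord (y, k)).mul (tame_gl J k y)).const_mul _)

lemma gl_add_weight (J J' : Λ → Λ → ℝ) (t : ℝ) (f : Λ → ℝ) (x : Λ) :
    gl (fun x y => J x y + t * J' x y) f x = gl J f x + t * gl J' f x := by
  unfold gl
  rw [Finset.mul_sum, ← Finset.sum_add_distrib]
  exact Finset.sum_congr rfl fun y _ => by ring

lemma pot_add_mul (J J' : Λ → Λ → ℝ) (g ν c t : ℝ) (φ : Λ × Fin n → ℝ) :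
    pot (fun x y => J x y + t * J' x y) g (ν + t * c) φ = pot J g ν φ + t * pot J' 0 c φ := by
  unfold pot
  simp only [gl_add_weight, mul_add, Finset.sum_add_distrib, Finset.mul_sum, add_div, add_mul]
  have e1 : ∀ k : Fin n, ∑ i, 1 / 2 * (φ (i, k) * (t * gl J' (cmp φ k) i))
      = ∑ i, t * (1 / 2 * (φ (i, k) * gl J' (cmp φ k) i)) :=
    fun k => Finset.sum_congr rfl fun i _ => by ring
  have e2 : ∑ i, t * c / 2 * sN φ i = ∑ i, t * (c / 2 * sN φ i) :=
    Finset.sum_congr rfl fun i _ => by ring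
  simp_rw [e1]
  rw [e2]
  simp
  ring

lemma IsWeight.sum_mul_gl_self_le (hJ : IsWeight J) {D : ℝ} (hD : ∀ y, ∑ z, J y z ≤ D)
    (f : Λ → ℝ) : ∑ x, f x * gl J f x ≤ 2 * D * ∑ x, f x ^ 2 := by
  rw [hJ.sum_mul_gl]
  have h1 : ∑ x, ∑ y, J x y * ((f x - f y) * (f x - f y)) ≤
      ∑ x, ∑ y, (J x y * (2 * f x ^ 2) + J x y * (2 * f y ^ 2)) :=
    Finset.sum_le_sum fun x _ => Finset.sum_le_sum fun y _ => by
      nlinarith [mul_nonneg (hJ.nonneg x y) (sq_nonneg (f x + f y))]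
  have h2 : ∑ x, ∑ y, J x y * (2 * f x ^ 2) ≤ ∑ x, D * (2 * f x ^ 2) :=
    Finset.sum_le_sum fun x _ => by
      rw [← Finset.sum_mul]
      exact mul_le_mul_of_nonneg_right (hD x) (by positivity)
  have h3 : ∑ x, ∑ y, J x y * (2 * f y ^ 2) = ∑ x, ∑ y, J x y * (2 * f x ^ 2) := by
    rw [Finset.sum_comm]
    exact Finset.sum_congr rfl fun y _ => Finset.sum_congr rfl fun x _ => by rw [hJ.symm]
  simp only [Finset.sum_add_distrib] at h1
  rw [h3] at h1
  have h4 : ∑ x, D * (2 * f x ^ 2) = 2 * D * ∑ x, f x ^ 2 := by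
    rw [Finset.mul_sum]; exact Finset.sum_congr rfl fun x _ => by ring
  linarith

lemma IsWeight.sum_gl_sq_le (hJ : IsWeight J) {D : ℝ} (hD0 : 0 ≤ D) (hD : ∀ y, ∑ z, J y z ≤ D)
    (f : Λ → ℝ) : ∑ x, gl J f x ^ 2 ≤ 4 * D ^ 2 * ∑ x, f x ^ 2 := by
  have h1 : ∀ x, gl J f x ^ 2 ≤ D * ∑ y, J x y * (f x - f y) ^ 2 := fun x => by
    have := Finset.sum_sq_le_sum_mul_sum_of_sq_le_mul Finset.univ
      (r := fun y => J x y * (f x - f y)) (f := fun y => J x y) (g := fun y => J x y * (f x - f y) ^ 2)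
      (fun y _ => hJ.nonneg x y) (fun y _ => mul_nonneg (hJ.nonneg x y) (sq_nonneg _))
      (fun y _ => le_of_eq (by ring))
    exact this.trans (mul_le_mul_of_nonneg_right (hD x)
      (Finset.sum_nonneg fun y _ => mul_nonneg (hJ.nonneg x y) (sq_nonneg _)))
  have h2 := hJ.sum_mul_gl_self_le hD f
  rw [hJ.sum_mul_gl] at h2
  have h3 := Finset.sum_le_sum fun x (_ : x ∈ Finset.univ) => h1 x
  rw [← Finset.mul_sum] at h3
  have h4 : ∑ x, ∑ y, J x y * (f x - f y) ^ 2 = ∑ x, ∑ y, J x y * ((f x - f y) * (f x - f y)) :=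
    Finset.sum_congr rfl fun x _ => Finset.sum_congr rfl fun y _ => by ring
  rw [h4] at h3
  nlinarith

lemma sum_cmp_sq (φ : Λ × Fin n → ℝ) : ∑ k, ∑ y, cmp φ k y ^ 2 = ∑ y, sN φ y :=
  Finset.sum_comm

lemma confining_pot_add_mul (hJ : IsWeight J) (hg : 0 < g) (hJ' : IsWeight J') {D : ℝ}
    (hD : ∀ y, ∑ z, J' y z ≤ D) (c t : ℝ) :
    Confining fun φ : Λ × Fin n → ℝ => pot J g ν φ + t * pot J' 0 c φ := by
  refine (confining_pot (n := n) (ν := ν - |t| * (2 * D + |c|)) hJ hg).of_le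
    (((tame_pot J g ν).add ((tame_pot J' 0 c).const_mul t)).continuous) fun φ => ?_
  have h0 : 0 ≤ ∑ k : Fin n, ∑ y, φ (y, k) * gl J' (cmp φ k) y :=
    Finset.sum_nonneg fun k _ => hJ'.sum_mul_gl_self_nonneg (cmp φ k)
  have h1 : ∑ k : Fin n, ∑ y, φ (y, k) * gl J' (cmp φ k) y ≤ 2 * D * ∑ y, sN φ y := by
    rw [← sum_cmp_sq, Finset.mul_sum]
    exact Finset.sum_le_sum fun k _ => hJ'.sum_mul_gl_self_le hD (cmp φ k)
  have hS : 0 ≤ ∑ y, sN φ y := Finset.sum_nonneg fun y _ => sN_nonneg φ y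
  have e : pot J' 0 c φ = c / 2 * (∑ y, sN φ y)
      + 1 / 2 * ∑ k : Fin n, ∑ y, φ (y, k) * gl J' (cmp φ k) y := by
    unfold pot; simp [Finset.mul_sum]
  have h2 : |pot J' 0 c φ| ≤ (2 * D + |c|) / 2 * ∑ y, sN φ y := by
    rw [e]
    refine (abs_add_le _ _).trans ?_
    rw [abs_mul, abs_mul, abs_of_nonneg hS, abs_of_nonneg h0, abs_div]
    norm_num
    linarith
  have h3 : -(|t| * ((2 * D + |c|) / 2 * ∑ y, sN φ y)) ≤ t * pot J' 0 c φ := by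
    refine le_trans ?_ (neg_abs_le _)
    rw [abs_mul]
    exact neg_le_neg (mul_le_mul_of_nonneg_left h2 (abs_nonneg _))
  have h4 := pot_add_mul (n := n) J (fun _ _ => 0) g ν (-(|t| * (2 * D + |c|))) 1 φ
  have h5 : pot (fun _ _ => 0) 0 (-(|t| * (2 * D + |c|))) φ
      = -(|t| * (2 * D + |c|)) / 2 * ∑ y, sN φ y := by
    unfold pot gl; simp [Finset.mul_sum]
  rw [h5] at h4
  simp only [mul_zero, add_zero, one_mul] at h4
  rw [sub_eq_add_neg]
  change pot (fun x y => J x y) g _ φ ≤ _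
  rw [h4]
  linarith

/-- The variance of a quadratic perturbation is at most of the order of the volume. -/
lemma Gap.variance_le {m D c v : ℝ} (hG : Gap n J g ν m) (hJ : IsWeight J) (hg : 0 < g)
    (hm : 0 < m) (hJ' : IsWeight J') (hD0 : 0 ≤ D) (hD : ∀ y, ∑ z, J' y z ≤ D)
    (hv : v * wint (pot J g ν) (fun _ : Λ × Fin n → ℝ => 1) =
      wint (pot J g ν) fun φ : Λ × Fin n → ℝ =>
        (pot J' 0 c φ - ev J g ν (pot J' 0 c : (Λ × Fin n → ℝ) → ℝ)) ^ 2) :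
    |v| ≤ 1 / m * ((8 * D ^ 2 + 2 * c ^ 2) *
      (Fintype.card Λ * (2 * n + (ν - 1 / 2) ^ 2 / (2 * g)))) := by
  have hC := confining_pot (n := n) (ν := ν) hJ hg
  set Z := wint (pot J g ν) (fun _ : Λ × Fin n → ℝ => 1) with hZ
  have hZ0 : 0 < Z := wint_one_pos hC
  set E := ev J g ν (pot J' 0 c : (Λ × Fin n → ℝ) → ℝ) with hE
  have tP := tame_pot (n := n) J' 0 c
  have hv0 : 0 ≤ v := by
    have : 0 ≤ v * Z := by rw [hv]; exact wint_nonneg fun _ => sq_nonneg _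
    exact nonneg_of_mul_nonneg_left this hZ0
  have h1 := hG.poincare hJ hg hm (f := fun φ => pot J' 0 c φ - E)
    (f' := fun a φ => dpot J' 0 c a φ - 0)
    (fun a => (hasPD_pot hJ' a).sub (HasPD.const a E)) (tP.sub (Tame.const E))
    (fun a => (tame_dpot J' 0 c a).sub (Tame.const 0)) (by
      rw [wint_sub hC tP (Tame.const E)]
      have : wint (pot J g ν) (fun _ : Λ × Fin n → ℝ => E) = E * Z := by
        rw [hZ, ← wint_const_mul]; simp
      rw [this, hE]
      unfold ev
      rw [div_mul_cancel₀ _ hZ0.ne', sub_self])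
  rw [← hv] at h1
  have h2 : wint (pot J g ν) (fun φ : Λ × Fin n → ℝ => ∑ a, (dpot J' 0 c a φ - 0) ^ 2) ≤
      wint (pot J g ν) (fun φ : Λ × Fin n → ℝ => (8 * D ^ 2 + 2 * c ^ 2) * ∑ y, sN φ y) := by
    refine wint_mono hC (Tame.sum _ fun a _ => ((tame_dpot J' 0 c a).sub (Tame.const 0)).pow 2)
      ((Tame.sum _ fun y _ => tame_sN y).const_mul _) fun φ => ?_
    have a1 : ∀ a : Λ × Fin n, (dpot J' 0 c a φ - 0) ^ 2 ≤
        2 * gl J' (cmp φ a.2) a.1 ^ 2 + 2 * c ^ 2 * φ a ^ 2 := fun a => by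
      unfold dpot
      nlinarith [sq_nonneg (gl J' (cmp φ a.2) a.1 - c * φ a)]
    refine (Finset.sum_le_sum fun a _ => a1 a).trans ?_
    rw [Finset.sum_add_distrib, ← Finset.mul_sum, ← Finset.mul_sum, Fintype.sum_prod_type_right,
      Fintype.sum_prod_type]
    dsimp only
    have a2 : ∑ k : Fin n, ∑ y, gl J' (cmp φ k) y ^ 2 ≤ 4 * D ^ 2 * ∑ y, sN φ y := by
      rw [← sum_cmp_sq, Finset.mul_sum]
      exact Finset.sum_le_sum fun k _ => hJ'.sum_gl_sq_le hD0 hD (cmp φ k)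
    have a3 : ∑ y, ∑ k : Fin n, φ (y, k) ^ 2 = ∑ y, sN φ y := rfl
    rw [a3]
    linarith
  have h3 : wint (pot J g ν) (fun φ : Λ × Fin n → ℝ => (8 * D ^ 2 + 2 * c ^ 2) * ∑ y, sN φ y) ≤
      (8 * D ^ 2 + 2 * c ^ 2) * (Fintype.card Λ * (2 * n + (ν - 1 / 2) ^ 2 / (2 * g))) * Z := by
    rw [wint_const_mul, wint_sum hC _ fun y _ => tame_sN y, mul_assoc]
    refine mul_le_mul_of_nonneg_left ?_ (by positivity)
    refine (Finset.sum_le_sum fun y _ => wint_sN_le hJ hg y).trans ?_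
    rw [Finset.sum_const, nsmul_eq_mul, Finset.card_univ, mul_assoc]
  rw [abs_of_nonneg hv0]
  refine le_of_mul_le_mul_right ?_ hZ0
  have h4 := mul_le_mul_of_nonneg_left (h2.trans h3) (by positivity : 0 ≤ 1 / m)
  linarith

lemma fe_ge_sub (hJ : IsWeight J) (hg : 0 < g) (hJ' : IsWeight J') :
    fe n J g ν - (2 * n + (ν - 1 / 2) ^ 2 / (2 * g)) * ∑ x, ∑ y, |J' x y - J x y|
      ≤ fe n J' g ν := by
  have hC := confining_pot (n := n) (ν := ν) hJ hg
  have hC' := confining_pot (n := n) (ν := ν) hJ' hg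
  have tD := (tame_pot (n := n) J' g ν).sub (tame_pot J g ν)
  have h := log_wint_ge hC hC' tD
  set Z := wint (pot J g ν) (fun _ : Λ × Fin n → ℝ => 1) with hZ
  have hZ0 : 0 < Z := wint_one_pos hC
  set K := (2 * n + (ν - 1 / 2) ^ 2 / (2 * g)) with hK
  have key : wint (pot J g ν) (fun φ : Λ × Fin n → ℝ => pot J' g ν φ - pot J g ν φ) ≤
      (K * ∑ x, ∑ y, |J' x y - J x y|) * Z := by
    have h1 : ∀ φ : Λ × Fin n → ℝ, pot J' g ν φ - pot J g ν φ ≤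
        ∑ x, ∑ y, |J' x y - J x y| * (3 / 4 * sN φ x + 1 / 4 * sN φ y) := fun φ => by
      have e : pot J' g ν φ - pot J g ν φ = ∑ x, ∑ y, (J' x y - J x y) *
          (1 / 2 * ∑ k, φ (x, k) * (φ (x, k) - φ (y, k))) := by
        unfold pot gl
        simp only [Finset.mul_sum]
        rw [add_sub_add_left_eq_sub, Finset.sum_comm,
          Finset.sum_comm (s := Finset.univ (α := Fin n)), ← Finset.sum_sub_distrib]
        refine Finset.sum_congr rfl fun x _ => ?_
        rw [Finset.sum_comm, Finset.sum_comm (s := Finset.univ (α := Fin n)),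
          ← Finset.sum_sub_distrib]
        refine Finset.sum_congr rfl fun y _ => ?_
        rw [← Finset.sum_sub_distrib]
        refine Finset.sum_congr rfl fun k _ => ?_
        unfold cmp
        ring
      rw [e]
      refine Finset.sum_le_sum fun x _ => Finset.sum_le_sum fun y _ => ?_
      refine (le_abs_self _).trans ?_
      rw [abs_mul]
      refine mul_le_mul_of_nonneg_left ?_ (abs_nonneg _)
      rw [abs_mul, abs_of_pos (by norm_num : (0 : ℝ) < 1 / 2)]
      have : |∑ k, φ (x, k) * (φ (x, k) - φ (y, k))| ≤ 3 / 2 * sN φ x + 1 / 2 * sN φ y := by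
        unfold sN
        rw [Finset.mul_sum, Finset.mul_sum, ← Finset.sum_add_distrib]
        refine (Finset.abs_sum_le_sum_abs _ _).trans (Finset.sum_le_sum fun k _ => ?_)
        rw [abs_le]
        constructor <;>
          nlinarith [sq_nonneg (φ (x, k) - φ (y, k)), sq_nonneg (φ (x, k) + φ (y, k))]
      linarith
    have tT : ∀ x y, Tame fun φ : Λ × Fin n → ℝ =>
        |J' x y - J x y| * (3 / 4 * sN φ x + 1 / 4 * sN φ y) := fun x y =>
      (((tame_sN x).const_mul _).add ((tame_sN y).const_mul _)).const_mul _
    refine (wint_mono hC tD (Tame.sum _ fun x _ => Tame.sum _ fun y _ => tT x y) h1).trans ?_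
    rw [wint_sum hC _ fun x _ => Tame.sum _ fun y _ => tT x y, Finset.mul_sum, Finset.sum_mul]
    refine Finset.sum_le_sum fun x _ => ?_
    rw [wint_sum hC _ fun y _ => tT x y, Finset.mul_sum, Finset.sum_mul]
    refine Finset.sum_le_sum fun y _ => ?_
    rw [wint_const_mul, wint_add hC ((tame_sN x).const_mul _) ((tame_sN y).const_mul _),
      wint_const_mul, wint_const_mul]
    have b1 := wint_sN_le (n := n) (ν := ν) hJ hg x
    have b2 := wint_sN_le (n := n) (ν := ν) hJ hg y
    rw [mul_comm K, mul_assoc]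
    refine mul_le_mul_of_nonneg_left ?_ (abs_nonneg _)
    linarith
  have h2 := (div_le_iff₀ hZ0).2 key
  unfold fe
  linarith

/-- Lipschitz dependence of the free energy on the edge weights. -/
lemma abs_fe_sub_le (hJ : IsWeight J) (hg : 0 < g) (hJ' : IsWeight J') :
    |fe n J' g ν - fe n J g ν| ≤
      (2 * n + (ν - 1 / 2) ^ 2 / (2 * g)) * ∑ x, ∑ y, |J' x y - J x y| := by
  have h1 := fe_ge_sub (n := n) (ν := ν) hJ hg hJ'
  have h2 := fe_ge_sub (n := n) (ν := ν) hJ' hg hJ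
  simp_rw [abs_sub_comm (J _ _) (J' _ _)] at h2
  rw [abs_le]
  constructor <;> linarith

/-- The first-order expansion of the free energy along a quadratic perturbation. -/
lemma fe_taylor {a b K c D : ℝ} (hJ : IsWeight J) (hg : 0 < g) (hJ' : IsWeight J') (hD0 : 0 ≤ D)
    (hD : ∀ y, ∑ z, J' y z ≤ D)
    (hG : ∀ t ∈ Set.Icc a b, IsWeight (fun x y => J x y + t * J' x y) ∧
      ∃ m, 0 < m ∧ Gap n (fun x y => J x y + t * J' x y) g (ν + t * c) m ∧
        1 / m * ((8 * D ^ 2 + 2 * c ^ 2) *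
          (2 * n + (ν + t * c - 1 / 2) ^ 2 / (2 * g))) ≤ K) {t s : ℝ}
    (ht : t ∈ Set.Icc a b) (hs : s ∈ Set.Icc a b) :
    |fe n (fun x y => J x y + s * J' x y) g (ν + s * c) -
      fe n (fun x y => J x y + t * J' x y) g (ν + t * c) -
      (s - t) * -ev (fun x y => J x y + t * J' x y) g (ν + t * c)
        (pot J' 0 c : (Λ × Fin n → ℝ) → ℝ)| ≤ K * Fintype.card Λ * (s - t) ^ 2 := by
  have hC := confining_pot_add_mul (n := n) (ν := ν) hJ hg hJ' hD c
  have e : ∀ r : ℝ, (pot (fun x y => J x y + r * J' x y) g (ν + r * c) : (Λ × Fin n → ℝ) → ℝ) =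
      fun φ => pot J g ν φ + r * pot J' 0 c φ := fun r => funext fun φ => pot_add_mul _ _ _ _ _ _ _
  choose v hv1 hv2 using hasDerivAt_wint_div hC (tame_pot J' 0 c)
  have := taylor_bound_of_deriv
    (f := fun r => fe n (fun x y => J x y + r * J' x y) g (ν + r * c))
    (e := fun r => -ev (fun x y => J x y + r * J' x y) g (ν + r * c)
        (pot J' 0 c : (Λ × Fin n → ℝ) → ℝ)) (v := v) (a := a) (b := b)
    (K := K * Fintype.card Λ)
    (fun r => by
      unfold fe ev
      simp_rw [e]
      exact hasDerivAt_log_wint hC (tame_pot J' 0 c) r)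
    (fun r => by
      unfold ev
      simp_rw [e]
      have := (hv1 r).neg
      rw [neg_neg] at this
      exact this)
    (fun r hr => by
      obtain ⟨hJr, m, hm, hGm, hK⟩ := hG r hr
      have h := hGm.variance_le (c := c) (v := v r) hJr hg hm hJ' hD0 hD (by
        unfold ev
        rw [e]
        exact hv2 r)
      refine h.trans ?_
      calc _ = 1 / m * ((8 * D ^ 2 + 2 * c ^ 2) *
          (2 * n + (ν + r * c - 1 / 2) ^ 2 / (2 * g))) * Fintype.card Λ := by ring
        _ ≤ _ := mul_le_mul_of_nonneg_right hK (Nat.cast_nonneg _)) ht hs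
  exact this

end GraphFreeEnergy

section Relabelling

lemma integral_uncurry {S ι : Type*} [Fintype S] [Fintype ι] (f : (S × ι → ℝ) → ℝ) :
    ∫ x : S → ι → ℝ, f (fun p => x p.1 p.2) = ∫ x : S × ι → ℝ, f x := by
  have h : MeasurePreserving (MeasurableEquiv.curry S ι ℝ).symm volume volume := by
    refine ⟨(MeasurableEquiv.curry S ι ℝ).symm.measurable, ?_⟩
    symm
    refine Measure.pi_eq fun s hs => ?_
    rw [(MeasurableEquiv.curry S ι ℝ).symm.map_apply]
    have : (MeasurableEquiv.curry S ι ℝ).symm ⁻¹' Set.univ.pi s =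
        Set.univ.pi fun a => Set.univ.pi fun i => s (a, i) := by
      ext x
      simp only [Set.mem_preimage, Set.mem_univ_pi, Prod.forall]
      rfl
    rw [this, volume_pi_pi, Fintype.prod_prod_type]
    exact Finset.prod_congr rfl fun a _ => volume_pi_pi _
  exact h.integral_comp' f

lemma integral_comp_equiv {ι κ : Type*} [Fintype ι] [Fintype κ] (e : ι ≃ κ)
    (f : (ι → ℝ) → ℝ) : ∫ x : κ → ℝ, f (fun i => x (e i)) = ∫ x : ι → ℝ, f x := by
  have h := (volume_measurePreserving_piCongrLeft (fun _ : ι => ℝ) e.symm).integral_comp' f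
  rw [← h]
  refine integral_congr_ae (Eventually.of_forall fun x => ?_)
  dsimp only
  congr 1
  funext i
  rw [MeasurableEquiv.coe_piCongrLeft]
  obtain ⟨k, rfl⟩ := e.symm.surjective i
  rw [Equiv.piCongrLeft_apply_apply, Equiv.apply_symm_apply]

variable {Λ Λ' S : Type*} [Fintype Λ] [DecidableEq Λ] [Fintype Λ'] [DecidableEq Λ'] [Fintype S]
  [DecidableEq S] {n : ℕ}

/-- Transport of a field along a bijection of the vertices. -/
def relabel (e : Λ ≃ Λ') (φ : Λ' × Fin n → ℝ) (a : Λ × Fin n) : ℝ := φ (e a.1, a.2)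

lemma wint_pot_relabel (e : Λ ≃ Λ') {J : Λ → Λ → ℝ} {J' : Λ' → Λ' → ℝ}
    (h : ∀ x y, J x y = J' (e x) (e y)) (g ν : ℝ) (F : (Λ × Fin n → ℝ) → ℝ) :
    wint (pot J' g ν) (fun φ => F (relabel e φ)) = wint (pot J g ν) F := by
  unfold wint
  rw [← integral_comp_equiv (e.prodCongr (Equiv.refl (Fin n)))]
  refine integral_congr_ae (Eventually.of_forall fun φ => ?_)
  have hp : pot J' g ν φ = pot J g ν (relabel e φ) := by
    unfold pot gl cmp sN relabel
    congr 1
    · exact (Equiv.sum_comp e fun y => g / 4 * (∑ i, φ (y, i) ^ 2) ^ 2 +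
        ν / 2 * ∑ i, φ (y, i) ^ 2).symm
    · congr 1
      refine Finset.sum_congr rfl fun k _ => ?_
      rw [← Equiv.sum_comp e]
      refine Finset.sum_congr rfl fun y _ => ?_
      rw [← Equiv.sum_comp e]
      simp_rw [h]
  dsimp only
  rw [hp]
  rfl

lemma fe_relabel (e : Λ ≃ Λ') {J : Λ → Λ → ℝ} {J' : Λ' → Λ' → ℝ}
    (h : ∀ x y, J x y = J' (e x) (e y)) (g ν : ℝ) : fe n J' g ν = fe n J g ν := by
  unfold fe
  rw [← wint_pot_relabel e h]

lemma fe_copies (S : Type*) [Fintype S] [DecidableEq S] (J : Λ → Λ → ℝ) (g ν : ℝ) :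
    fe n (fun p q : S × Λ => if p.1 = q.1 then J p.2 q.2 else 0) g ν
      = Fintype.card S * fe n J g ν := by
  unfold fe
  rw [← Real.log_pow]
  congr 1
  unfold wint
  rw [← integral_fintype_prod_volume_eq_pow
    (fun φ : Λ × Fin n → ℝ => 1 * Real.exp (-pot J g ν φ)), integral_uncurry (S := S)
    (ι := Λ × Fin n) (fun x => ∏ s, 1 * Real.exp (-pot J g ν fun a => x (s, a))),
    ← integral_comp_equiv (Equiv.prodAssoc S Λ (Fin n)).symm]
  refine integral_congr_ae (Eventually.of_forall fun φ => ?_)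
  dsimp only
  rw [Finset.prod_congr rfl fun s _ => one_mul _, one_mul, ← Real.exp_sum,
    Finset.sum_neg_distrib]
  congr 2
  unfold pot gl cmp sN
  conv_rhs => rw [Finset.sum_add_distrib, ← Finset.mul_sum]
  rw [Fintype.sum_prod_type]
  congr 1
  congr 1
  conv_rhs => rw [Finset.sum_comm]
  refine Finset.sum_congr rfl fun k _ => ?_
  rw [Fintype.sum_prod_type]
  refine Finset.sum_congr rfl fun s _ => Finset.sum_congr rfl fun y _ => ?_
  rw [Fintype.sum_prod_type, Finset.sum_eq_single s (fun t _ ht => by simp [ht.symm]) (by simp)]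
  simp

end Relabelling

section PermutationGraphs

variable {X : Type*} [Fintype X] [DecidableEq X]

lemma hammingDist_mul_le (a a' b b' : Equiv.Perm X) :
    hammingDist (⇑(a * b)) (⇑(a' * b')) ≤ hammingDist ⇑a ⇑a' + hammingDist ⇑b ⇑b' := by
  refine (hammingDist_triangle _ (⇑(a * b')) _).trans ?_
  rw [add_comm]
  refine add_le_add ?_ ?_
  · unfold hammingDist
    refine Finset.card_le_card_of_injOn b' (fun x hx => ?_) b'.injective.injOn
    have h1 := (Finset.mem_filter.1 (Finset.mem_coe.1 hx)).2
    exact Finset.mem_coe.2 (Finset.mem_filter.2 ⟨Finset.mem_univ _, h1⟩)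
  · unfold hammingDist
    refine Finset.card_le_card fun x hx => ?_
    have h1 := (Finset.mem_filter.1 hx).2
    exact Finset.mem_filter.2 ⟨Finset.mem_univ _, fun h => h1 (congrArg a h)⟩

lemma hammingDist_inv_le (a a' : Equiv.Perm X) :
    hammingDist ⇑a⁻¹ ⇑a'⁻¹ ≤ hammingDist ⇑a ⇑a' := by
  unfold hammingDist
  refine Finset.card_le_card_of_injOn ⇑a⁻¹ (fun x hx => ?_) (a⁻¹).injective.injOn
  have h1 := (Finset.mem_filter.1 (Finset.mem_coe.1 hx)).2
  refine Finset.mem_coe.2 (Finset.mem_filter.2 ⟨Finset.mem_univ _, fun h => h1 ?_⟩)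
  have h2 : a (a⁻¹ x) = x := a.apply_symm_apply x
  rw [h2] at h
  change a.symm x = a'.symm x
  rw [Equiv.eq_symm_apply]
  exact h.symm

lemma exists_hammingDist_le {I : Type*} {Y : I → Type*} [∀ i, Fintype (Y i)]
    [∀ i, DecidableEq (Y i)] (T σ : ∀ i, Multiplicative (Fin 4 → ℤ) →* Equiv.Perm (Y i))
    (B : I → ℕ) (h : ∀ i j, hammingDist ⇑(T i (Multiplicative.ofAdd (Pi.single j 1)))
      ⇑(σ i (Multiplicative.ofAdd (Pi.single j 1))) ≤ B i) (v : Fin 4 → ℤ) :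
    ∃ c : ℕ, ∀ i, hammingDist ⇑(T i (Multiplicative.ofAdd v)) ⇑(σ i (Multiplicative.ofAdd v)) ≤
      c * B i := by
  let H : AddSubgroup (Fin 4 → ℤ) :=
    { carrier := {v | ∃ c : ℕ, ∀ i, hammingDist ⇑(T i (Multiplicative.ofAdd v))
        ⇑(σ i (Multiplicative.ofAdd v)) ≤ c * B i}
      zero_mem' := ⟨0, fun i => by simp⟩
      add_mem' := by
        rintro v w ⟨c, hc⟩ ⟨d, hd⟩
        refine ⟨c + d, fun i => ?_⟩
        rw [ofAdd_add, map_mul, map_mul, add_mul]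
        exact (hammingDist_mul_le _ _ _ _).trans (add_le_add (hc i) (hd i))
      neg_mem' := by
        rintro v ⟨c, hc⟩
        refine ⟨c, fun i => ?_⟩
        rw [ofAdd_neg, map_inv, map_inv]
        exact (hammingDist_inv_le _ _).trans (hc i) }
  have hv : v ∈ H := by
    have e : v = ∑ j, v j • Pi.single (M := fun _ => ℤ) j 1 := by
      funext k
      simp [Finset.sum_apply, Pi.single_apply]
    rw [e]
    exact H.sum_mem fun j _ => H.zsmul_mem ⟨1, fun i => by simpa using h i j⟩ _
  exact hv

/-- The weights joining each point with its image under a permutation. -/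
def permW (σ : Equiv.Perm X) (x y : X) : ℝ :=
  (if σ x = y then 1 else 0) + if σ y = x then 1 else 0

lemma isWeight_permW (σ : Equiv.Perm X) : IsWeight (permW σ) :=
  ⟨fun x y => add_comm _ _, fun x y => by unfold permW; positivity⟩

lemma sum_permW_mul (σ : Equiv.Perm X) (x : X) (f : X → ℝ) :
    ∑ y, permW σ x y * f y = f (σ x) + f (σ.symm x) := by
  unfold permW
  simp only [add_mul, Finset.sum_add_distrib, ite_mul, one_mul, zero_mul, Finset.sum_ite_eq,
    Finset.mem_univ, if_true]
  congr 1
  rw [Finset.sum_eq_single (σ.symm x)]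
  · simp
  · intro y _ hy
    rw [if_neg]
    rintro rfl
    simp at hy
  · simp

lemma sum_permW (σ : Equiv.Perm X) (x : X) : ∑ y, permW σ x y = 2 := by
  have := sum_permW_mul σ x fun _ => 1
  simp only [mul_one] at this
  rw [this]; norm_num

lemma gl_permW (σ : Equiv.Perm X) (f : X → ℝ) (x : X) :
    gl (permW σ) f x = (f x - f (σ x)) + (f x - f (σ.symm x)) := by
  unfold gl
  rw [sum_permW_mul σ x fun y => f x - f y]

lemma sum_abs_permW_sub_le (σ τ : Equiv.Perm X) :
    ∑ x, ∑ y, |permW σ x y - permW τ x y| ≤ 4 * hammingDist ⇑σ ⇑τ := by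
  have h1 : ∀ x, ∑ y, |(if σ x = y then (1 : ℝ) else 0) - if τ x = y then 1 else 0| ≤
      if σ x ≠ τ x then 2 else 0 := fun x => by
    by_cases h : σ x = τ x
    · simp [h]
    · rw [if_pos h]
      refine (Finset.sum_le_sum fun y _ => (abs_sub _ _).trans
        (le_of_eq (b := (if σ x = y then (1 : ℝ) else 0) + if τ x = y then 1 else 0) ?_)).trans ?_
      · congr 1 <;> split_ifs <;> simp
      · rw [Finset.sum_add_distrib]
        simp
        norm_num
  have h2 : ∑ x, ∑ y, |(if σ x = y then (1 : ℝ) else 0) - if τ x = y then 1 else 0| ≤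
      2 * hammingDist ⇑σ ⇑τ := by
    refine (Finset.sum_le_sum fun x _ => h1 x).trans ?_
    rw [← Finset.sum_filter, Finset.sum_const, nsmul_eq_mul, mul_comm]
    rfl
  have h3 : ∑ x, ∑ y, |permW σ x y - permW τ x y| ≤ ∑ x, ∑ y,
      (|(if σ x = y then (1 : ℝ) else 0) - if τ x = y then 1 else 0| +
        |(if σ y = x then (1 : ℝ) else 0) - if τ y = x then 1 else 0|) :=
    Finset.sum_le_sum fun x _ => Finset.sum_le_sum fun y _ => by
      unfold permW
      rw [add_sub_add_comm]
      exact abs_add_le _ _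
  simp only [Finset.sum_add_distrib] at h3
  rw [Finset.sum_comm (f := fun x y =>
    |(if σ y = x then (1 : ℝ) else 0) - if τ y = x then 1 else 0|)] at h3
  linarith

end PermutationGraphs

section TorusGraph

/-- Translations of the torus. -/
def trans (M : ℕ) : Multiplicative (Fin 4 → ℤ) →* Equiv.Perm (Fin 4 → ZMod M) where
  toFun v := Equiv.addRight fun j => ((Multiplicative.toAdd v j : ℤ) : ZMod M)
  map_one' := by ext; simp
  map_mul' v w := by
    ext x j
    simp [add_comm, add_left_comm]

lemma trans_apply (M : ℕ) (v : Fin 4 → ℤ) (x : Fin 4 → ZMod M) :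
    trans M (Multiplicative.ofAdd v) x = x + fun j => (v j : ZMod M) := rfl

lemma trans_symm_apply (M : ℕ) (v : Fin 4 → ℤ) (x : Fin 4 → ZMod M) :
    (trans M (Multiplicative.ofAdd v)).symm x = x - fun j => (v j : ZMod M) :=
  (sub_eq_add_neg _ _).symm

/-- Weights of a family of translation bonds: nearest neighbours and, with weight `s`, the
translation by `v`. -/
def torW {X : Type*} [Fintype X] [DecidableEq X] (T : Multiplicative (Fin 4 → ℤ) →* Equiv.Perm X)
    (v : Fin 4 → ℤ) (s : ℝ) (x y : X) : ℝ :=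
  (∑ j : Fin 4, permW (T (Multiplicative.ofAdd (Pi.single j 1))) x y) +
    s * permW (T (Multiplicative.ofAdd v)) x y

variable {X : Type*} [Fintype X] [DecidableEq X]

lemma isWeight_torW (T : Multiplicative (Fin 4 → ℤ) →* Equiv.Perm X) (v : Fin 4 → ℤ) {s : ℝ}
    (hs : 0 ≤ s) : IsWeight (torW T v s) :=
  ⟨fun x y => by unfold torW; simp_rw [(isWeight_permW _).symm x y], fun x y =>
    add_nonneg (Finset.sum_nonneg fun j _ => (isWeight_permW _).nonneg x y)
      (mul_nonneg hs ((isWeight_permW _).nonneg x y))⟩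

lemma sum_torW (T : Multiplicative (Fin 4 → ℤ) →* Equiv.Perm X) (v : Fin 4 → ℤ) (s : ℝ) (x : X) :
    ∑ y, torW T v s x y = 8 + 2 * s := by
  unfold torW
  rw [Finset.sum_add_distrib, Finset.sum_comm, ← Finset.mul_sum]
  simp_rw [sum_permW]
  simp
  ring

lemma sum_abs_torW_sub_le {T σ : Multiplicative (Fin 4 → ℤ) →* Equiv.Perm X} {v : Fin 4 → ℤ}
    {s : ℝ} (hs : 0 ≤ s) {B c : ℕ} (h : ∀ j, hammingDist ⇑(T (Multiplicative.ofAdd (Pi.single j 1)))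
      ⇑(σ (Multiplicative.ofAdd (Pi.single j 1))) ≤ B)
    (hv : hammingDist ⇑(T (Multiplicative.ofAdd v)) ⇑(σ (Multiplicative.ofAdd v)) ≤ c * B) :
    ∑ x, ∑ y, |torW T v s x y - torW σ v s x y| ≤ (16 + 4 * s * c) * B := by
  have h1 : ∑ x, ∑ y, |torW T v s x y - torW σ v s x y| ≤
      ∑ x, ∑ y, ((∑ j : Fin 4, |permW (T (Multiplicative.ofAdd (Pi.single j 1))) x y -
        permW (σ (Multiplicative.ofAdd (Pi.single j 1))) x y|) +
        s * |permW (T (Multiplicative.ofAdd v)) x y - permW (σ (Multiplicative.ofAdd v)) x y|) :=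
    Finset.sum_le_sum fun x _ => Finset.sum_le_sum fun y _ => by
      unfold torW
      rw [add_sub_add_comm, ← Finset.sum_sub_distrib, ← mul_sub]
      refine (abs_add_le _ _).trans (add_le_add (Finset.abs_sum_le_sum_abs _ _) ?_)
      rw [abs_mul, abs_of_nonneg hs]
  refine h1.trans ?_
  simp only [Finset.sum_add_distrib, ← Finset.mul_sum]
  have h2 : ∑ x, ∑ y, ∑ j : Fin 4, |permW (T (Multiplicative.ofAdd (Pi.single j 1))) x y -
        permW (σ (Multiplicative.ofAdd (Pi.single j 1))) x y| ≤ 16 * B := by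
    calc _ = ∑ j : Fin 4, ∑ x, ∑ y, |permW (T (Multiplicative.ofAdd (Pi.single j 1))) x y -
        permW (σ (Multiplicative.ofAdd (Pi.single j 1))) x y| := by
          simp_rw [Finset.sum_comm (s := Finset.univ (α := X)) (t := Finset.univ (α := Fin 4))]
      _ ≤ ∑ j : Fin 4, 4 * (B : ℝ) := Finset.sum_le_sum fun j _ =>
          (sum_abs_permW_sub_le _ _).trans (by have := h j; norm_cast; omega)
      _ = 16 * B := by simp; ring
  have h3 : s * ∑ x, ∑ y, |permW (T (Multiplicative.ofAdd v)) x y -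
      permW (σ (Multiplicative.ofAdd v)) x y| ≤ s * (4 * (c * B)) := by
    refine mul_le_mul_of_nonneg_left ((sum_abs_permW_sub_le _ _).trans ?_) hs
    norm_cast
    omega
  linarith

/-- Splitting a cycle of length `M * L` into `L` blocks. -/
def blockEquiv (M L K : ℕ) [NeZero M] [NeZero L] [NeZero K] (h : K = M * L) :
    ZMod K ≃ Fin L × ZMod M where
  toFun z := (⟨z.val / M, Nat.div_lt_of_lt_mul (h ▸ z.val_lt)⟩, (z.val : ZMod M))
  invFun p := ((p.1.1 * M + p.2.val : ℕ) : ZMod K)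
  left_inv z := by
    dsimp only
    rw [ZMod.val_natCast, mul_comm, Nat.div_add_mod, ZMod.natCast_zmod_val]
  right_inv p := by
    have hp := p.2.val_lt
    have h1 : p.1.1 * M + p.2.val < K := by
      rw [h]
      calc p.1.1 * M + p.2.val < p.1.1 * M + M := by omega
        _ = (p.1.1 + 1) * M := by ring
        _ ≤ L * M := Nat.mul_le_mul_right _ p.1.2
        _ = M * L := mul_comm _ _
    have h2 : (((p.1.1 * M + p.2.val : ℕ) : ZMod K)).val = p.1.1 * M + p.2.val := by
      rw [ZMod.val_natCast, Nat.mod_eq_of_lt h1]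
    ext1
    · ext1
      dsimp only
      rw [h2, mul_comm, Nat.mul_add_div (NeZero.pos M), Nat.div_eq_of_lt hp, add_zero]
    · dsimp only
      rw [h2]
      simp

/-- Splitting a torus into blocks. -/
def torusEquiv (M L K : ℕ) [NeZero M] [NeZero L] [NeZero K] (h : K = M * L) :
    (Fin 4 → ZMod K) ≃ (Fin 4 → Fin L) × (Fin 4 → ZMod M) :=
  (Equiv.piCongrRight fun _ => blockEquiv M L K h).trans (Equiv.arrowProdEquivProdArrow _ _ _)

/-- Translations inside each block. -/
def blockTrans (M L K : ℕ) [NeZero M] [NeZero L] [NeZero K] (h : K = M * L) :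
    Multiplicative (Fin 4 → ℤ) →* Equiv.Perm (Fin 4 → ZMod K) where
  toFun v := (torusEquiv M L K h).trans
    (((Equiv.refl _).prodCongr (trans M v)).trans (torusEquiv M L K h).symm)
  map_one' := by ext1 x; simp
  map_mul' v w := by
    ext1 x
    simp
    rfl

lemma trans_eq_blockTrans {M L K : ℕ} [NeZero M] [NeZero L] [NeZero K] (h : K = M * L)
    (j : Fin 4) (x : Fin 4 → ZMod K) (hx : (torusEquiv M L K h x).2 j ≠ -1) :
    trans K (Multiplicative.ofAdd (Pi.single j 1)) x =
      blockTrans M L K h (Multiplicative.ofAdd (Pi.single j 1)) x := by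
  funext i
  have hb : blockTrans M L K h (Multiplicative.ofAdd (Pi.single j 1)) x i =
      (blockEquiv M L K h).symm ((blockEquiv M L K h (x i)).1,
        (blockEquiv M L K h (x i)).2 + ((Pi.single (M := fun _ => ℤ) j 1 i : ℤ) : ZMod M)) := rfl
  rw [hb, trans_apply]
  dsimp only [Pi.add_apply]
  by_cases hij : i = j
  · subst hij
    have hx' : (blockEquiv M L K h (x i)).2 ≠ -1 := hx
    simp only [Pi.single_eq_same, Int.cast_one]
    obtain ⟨⟨a, u⟩, hz⟩ := (blockEquiv M L K h).symm.surjective (x i)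
    rw [← hz] at hx' ⊢
    rw [Equiv.apply_symm_apply] at hx' ⊢
    have hu : (u + 1).val = u.val + 1 := by
      have h1 := u.val_lt
      rcases Nat.lt_or_ge u.val (M - 1) with h2 | h2
      · have h3 : u + 1 = ((u.val + 1 : ℕ) : ZMod M) := by
          push_cast
          rw [ZMod.natCast_zmod_val]
        rw [h3, ZMod.val_natCast, Nat.mod_eq_of_lt (by omega)]
      · exfalso
        apply hx'
        have h3 : u.val + 1 = M := by omega
        have h4 : ((u.val + 1 : ℕ) : ZMod M) = 0 := by rw [h3]; simp
        push_cast at h4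
        rw [ZMod.natCast_zmod_val] at h4
        exact eq_neg_of_add_eq_zero_left h4
    change ((a.1 * M + u.val : ℕ) : ZMod K) + 1 = ((a.1 * M + (u + 1).val : ℕ) : ZMod K)
    rw [hu]
    push_cast
    ring
  · simp [hij]

lemma card_filter_apply_eq {A : Type*} [Fintype A] [DecidableEq A] (j : Fin 4) (a : A) :
    (Finset.univ.filter fun u : Fin 4 → A => u j = a).card = Fintype.card A ^ 3 := by
  have e : (Finset.univ.filter fun u : Fin 4 → A => u j = a) =
      Fintype.piFinset fun i => if i = j then {a} else Finset.univ := by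
    ext u
    simp only [Finset.mem_filter, Finset.mem_univ, true_and, Fintype.mem_piFinset]
    constructor
    · intro h i
      split_ifs with hi
      · subst hi; simp [h]
      · simp
    · intro h
      simpa using h j
  rw [e, Fintype.card_piFinset]
  have : ∀ i, (if i = j then ({a} : Finset A) else Finset.univ).card =
      if i = j then 1 else Fintype.card A := fun i => by split_ifs <;> simp
  simp_rw [this]
  rw [Finset.prod_ite]
  simp [Finset.filter_ne']

lemma hammingDist_trans_blockTrans_le {M L K : ℕ} [NeZero M] [NeZero L] [NeZero K]
    (h : K = M * L) (j : Fin 4) :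
    hammingDist ⇑(trans K (Multiplicative.ofAdd (Pi.single j 1)))
      ⇑(blockTrans M L K h (Multiplicative.ofAdd (Pi.single j 1))) ≤ L ^ 4 * M ^ 3 := by
  unfold hammingDist
  have h1 : (Finset.univ.filter fun x => trans K (Multiplicative.ofAdd (Pi.single j 1)) x ≠
      blockTrans M L K h (Multiplicative.ofAdd (Pi.single j 1)) x).card ≤
      ((Finset.univ : Finset (Fin 4 → Fin L)) ×ˢ
        (Finset.univ.filter fun u : Fin 4 → ZMod M => u j = -1)).card := by
    refine Finset.card_le_card_of_injOn (torusEquiv M L K h) (fun x hx => ?_)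
      (torusEquiv M L K h).injective.injOn
    simp only [Finset.coe_filter, Finset.mem_univ, true_and, Set.mem_ofPred_eq] at hx
    simp only [Finset.coe_product, Set.mem_prod, Finset.coe_univ, Set.mem_univ, true_and,
      Finset.coe_filter, Finset.mem_univ, Set.mem_ofPred_eq]
    by_contra hc
    exact hx (trans_eq_blockTrans h j x hc)
  refine h1.trans (le_of_eq ?_)
  rw [Finset.card_product, card_filter_apply_eq, ZMod.card]
  simp

lemma fe_blockTrans {M L K : ℕ} [NeZero M] [NeZero L] [NeZero K] (h : K = M * L)
    (n : ℕ) (v : Fin 4 → ℤ) (s g ν : ℝ) :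
    fe n (torW (blockTrans M L K h) v s) g ν = L ^ 4 * fe n (torW (trans M) v s) g ν := by
  have h1 := fe_relabel (n := n) (torusEquiv M L K h) (J := torW (blockTrans M L K h) v s)
    (J' := fun p q => if p.1 = q.1 then torW (trans M) v s p.2 q.2 else 0) (fun x y => ?_) g ν
  · rw [← h1, fe_copies]
    simp
  · have h2 : ∀ w, permW (blockTrans M L K h w) x y =
        if (torusEquiv M L K h x).1 = (torusEquiv M L K h y).1 then
          permW (trans M w) (torusEquiv M L K h x).2 (torusEquiv M L K h y).2 else 0 := fun w => by
      have h3 : ∀ x y, blockTrans M L K h w x = y ↔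
          (torusEquiv M L K h x).1 = (torusEquiv M L K h y).1 ∧
          trans M w (torusEquiv M L K h x).2 = (torusEquiv M L K h y).2 := fun x y => by
        change (torusEquiv M L K h).symm ((torusEquiv M L K h x).1,
          trans M w (torusEquiv M L K h x).2) = y ↔ _
        rw [Equiv.symm_apply_eq, Prod.ext_iff]
      unfold permW
      simp_rw [h3, eq_comm (a := (torusEquiv M L K h y).1)]
      by_cases hxy : (torusEquiv M L K h x).1 = (torusEquiv M L K h y).1 <;> simp [hxy]
    unfold torW
    simp_rw [h2]
    by_cases hxy : (torusEquiv M L K h x).1 = (torusEquiv M L K h y).1 <;> simp [hxy]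

/-- Existence of the infinite-volume pressure. -/
lemma exists_tendsto_fe {L : ℕ} [NeZero L] (hL : 2 ≤ L) (n : ℕ) (v : Fin 4 → ℤ) {s g : ℝ}
    (hs : 0 ≤ s) (hg : 0 < g) (ν : ℝ) :
    ∃ p, Tendsto (fun N : ℕ => ((L : ℝ) ^ (4 * N))⁻¹ * fe n (torW (trans (L ^ N)) v s) g ν)
      atTop (𝓝 p) := by
  obtain ⟨c, hc⟩ := exists_hammingDist_le (fun N : ℕ => trans (L ^ (N + 1)))
    (fun N => blockTrans (L ^ N) L (L ^ (N + 1)) (pow_succ L N)) (fun N => L ^ 4 * (L ^ N) ^ 3)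
    (fun N j => hammingDist_trans_blockTrans_le _ j) v
  set C := (2 * n + (ν - 1 / 2) ^ 2 / (2 * g)) * (16 + 4 * s * c) with hC'
  have hL0 : (0 : ℝ) < L := by exact_mod_cast (by omega : 0 < L)
  have hr : ((L : ℝ))⁻¹ < 1 := inv_lt_one_of_one_lt₀ (by exact_mod_cast (by omega : 1 < L))
  refine cauchySeq_tendsto_of_complete (cauchySeq_of_le_geometric (L : ℝ)⁻¹ C hr fun N => ?_)
  have h1 := abs_fe_sub_le (n := n) (ν := ν)
    (isWeight_torW (blockTrans (L ^ N) L (L ^ (N + 1)) (pow_succ L N)) v hs) hg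
    (isWeight_torW (trans (L ^ (N + 1))) v hs)
  have h2 := sum_abs_torW_sub_le (T := trans (L ^ (N + 1)))
    (σ := blockTrans (L ^ N) L (L ^ (N + 1)) (pow_succ L N)) (v := v) hs
    (B := L ^ 4 * (L ^ N) ^ 3) (fun j => hammingDist_trans_blockTrans_le _ j) (hc N)
  rw [fe_blockTrans] at h1
  have h3 := h1.trans (mul_le_mul_of_nonneg_left h2 (by positivity))
  rw [dist_comm, Real.dist_eq]
  have e : ((L : ℝ) ^ (4 * (N + 1)))⁻¹ * fe n (torW (trans (L ^ (N + 1))) v s) g ν -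
      ((L : ℝ) ^ (4 * N))⁻¹ * fe n (torW (trans (L ^ N)) v s) g ν =
      ((L : ℝ) ^ (4 * (N + 1)))⁻¹ * (fe n (torW (trans (L ^ (N + 1))) v s) g ν -
        L ^ 4 * fe n (torW (trans (L ^ N)) v s) g ν) := by
    have e1 : (L : ℝ) ^ (4 * (N + 1)) = L ^ 4 * L ^ (4 * N) := by ring
    rw [e1]
    field_simp
  rw [e, abs_mul, abs_of_pos (by positivity)]
  refine (mul_le_mul_of_nonneg_left h3 (by positivity)).trans (le_of_eq ?_)
  have e1 : (L : ℝ) ^ (4 * (N + 1)) = L ^ 4 * ((L ^ N) ^ 3 * L ^ N) := by ring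
  push_cast
  rw [e1, inv_pow, hC']
  field_simp

end TorusGraph

section Symmetry

variable {n M : ℕ} [NeZero M] {g ν : ℝ}

lemma permW_apply_apply {X : Type*} [Fintype X] [DecidableEq X] {σ τ : Equiv.Perm X}
    (h : ∀ x, σ (τ x) = τ (σ x)) (x y : X) : permW σ (τ x) (τ y) = permW σ x y := by
  unfold permW
  rw [h, h]
  simp only [τ.injective.eq_iff]

lemma torW_add (v : Fin 4 → ℤ) (s : ℝ) (z x y : Fin 4 → ZMod M) :
    torW (trans M) v s (x + z) (y + z) = torW (trans M) v s x y := by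
  have h : ∀ w, permW (trans M w) (x + z) (y + z) = permW (trans M w) x y := fun w =>
    permW_apply_apply (σ := trans M w) (τ := Equiv.addRight z) (fun x => add_right_comm _ _ _) x y
  unfold torW
  simp_rw [h]

lemma torW_zero {X : Type*} [Fintype X] [DecidableEq X]
    (T : Multiplicative (Fin 4 → ℤ) →* Equiv.Perm X) (v : Fin 4 → ℤ) :
    torW T v 0 = torW T 0 0 := by
  funext x y
  unfold torW
  rw [zero_mul, zero_mul]

lemma gl_torW {X : Type*} [Fintype X] [DecidableEq X]
    (T : Multiplicative (Fin 4 → ℤ) →* Equiv.Perm X) (v : Fin 4 → ℤ) (s : ℝ) (f : X → ℝ) (x : X) :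
    gl (torW T v s) f x = ∑ j : Fin 4, gl (permW (T (Multiplicative.ofAdd (Pi.single j 1)))) f x +
      s * gl (permW (T (Multiplicative.ofAdd v))) f x := by
  unfold gl torW
  simp_rw [add_mul, Finset.sum_add_distrib, Finset.sum_mul, mul_assoc]
  rw [Finset.sum_comm, Finset.mul_sum]

/-- Translation invariance. -/
lemma wint_torW_shift (v : Fin 4 → ℤ) (s : ℝ) (z : Fin 4 → ZMod M)
    (F : ((Fin 4 → ZMod M) × Fin n → ℝ) → ℝ) :
    wint (pot (torW (trans M) v s) g ν) (fun φ => F fun a => φ (a.1 + z, a.2)) =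
      wint (pot (torW (trans M) v s) g ν) F :=
  wint_pot_relabel (Equiv.addRight z) (fun x y => (torW_add v s z x y).symm) g ν F

lemma wint_sN_eq (v : Fin 4 → ℤ) (s : ℝ) (x : Fin 4 → ZMod M) :
    wint (pot (torW (trans M) v s) g ν) (fun φ : (Fin 4 → ZMod M) × Fin n → ℝ => sN φ x) =
      wint (pot (torW (trans M) v s) g ν)
        (fun φ : (Fin 4 → ZMod M) × Fin n → ℝ => sN φ 0) := by
  conv_rhs => rw [← wint_torW_shift v s x]
  simp [sN]

lemma wint_two_point_eq (v : Fin 4 → ℤ) (s : ℝ) (i : Fin n) (x y : Fin 4 → ZMod M) :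
    wint (pot (torW (trans M) v s) g ν)
        (fun φ : (Fin 4 → ZMod M) × Fin n → ℝ => φ (x, i) * φ (x + y, i)) =
      wint (pot (torW (trans M) v s) g ν) (fun φ => φ (0, i) * φ (y, i)) := by
  conv_rhs => rw [← wint_torW_shift v s x]
  simp [add_comm]

/-- Invariance under permutations of the components. -/
lemma wint_pot_perm {Λ : Type*} [Fintype Λ] [DecidableEq Λ] (J : Λ → Λ → ℝ)
    (e : Equiv.Perm (Fin n)) (F : (Λ × Fin n → ℝ) → ℝ) :
    wint (pot J g ν) (fun φ => F fun a => φ (a.1, e a.2)) = wint (pot J g ν) F := by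
  unfold wint
  conv_rhs => rw [← integral_comp_equiv ((Equiv.refl Λ).prodCongr e)]
  refine integral_congr_ae (Eventually.of_forall fun φ => ?_)
  have hp : pot J g ν φ = pot J g ν (fun a => φ (a.1, e a.2)) := by
    unfold pot cmp sN
    have h : ∀ y, ∑ i, φ (y, e i) ^ 2 = ∑ i, φ (y, i) ^ 2 := fun y =>
      Equiv.sum_comp e fun i => φ (y, i) ^ 2
    dsimp only
    simp_rw [h]
    rw [Equiv.sum_comp e fun k => ∑ y, φ (y, k) * gl J (fun y => φ (y, k)) y]
  dsimp only
  rw [hp]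
  rfl

lemma wint_component_eq {Λ : Type*} [Fintype Λ] [DecidableEq Λ] (J : Λ → Λ → ℝ) (x y : Λ)
    (i j : Fin n) :
    wint (pot J g ν) (fun φ : Λ × Fin n → ℝ => φ (x, i) * φ (y, i)) =
      wint (pot J g ν) (fun φ => φ (x, j) * φ (y, j)) := by
  rw [← wint_pot_perm J (Equiv.swap i j)]
  simp

lemma wint_sum_component {Λ : Type*} [Fintype Λ] [DecidableEq Λ] {J : Λ → Λ → ℝ} (hJ : IsWeight J)
    (hg : 0 < g) (x y : Λ) (i : Fin n) :
    wint (pot J g ν) (fun φ : Λ × Fin n → ℝ => ∑ j, φ (x, j) * φ (y, j)) =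
      n * wint (pot J g ν) (fun φ => φ (x, i) * φ (y, i)) := by
  rw [wint_sum (nice_pot hJ hg).conf _ fun j _ => (Tame.coord _).mul (Tame.coord _)]
  rw [Finset.sum_congr rfl fun j _ => wint_component_eq J x y j i]
  simp

lemma wint_sN_component {Λ : Type*} [Fintype Λ] [DecidableEq Λ] {J : Λ → Λ → ℝ} (hJ : IsWeight J)
    (hg : 0 < g) (x : Λ) (i : Fin n) :
    wint (pot J g ν) (fun φ : Λ × Fin n → ℝ => sN φ x) =
      n * wint (pot J g ν) (fun φ => φ (x, i) ^ 2) := by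
  have := wint_sum_component (ν := ν) hJ hg x x i
  simp_rw [← sq] at this
  exact this

end Symmetry

section Transfer

variable {L n : ℕ} [NeZero L]

/-- The nearest-neighbour weights of the torus. -/
def latW (L N : ℕ) [NeZero L] : Torus L N → Torus L N → ℝ := torW (trans (L ^ N)) 0 0

lemma isWeight_latW (L N : ℕ) [NeZero L] : IsWeight (latW L N) := isWeight_torW _ _ le_rfl

lemma gl_latW (N : ℕ) (f : Torus L N → ℝ) (x : Torus L N) :
    gl (latW L N) f x =
      ∑ j, ((f x - f (x + unitVec L N j)) + (f x - f (x - unitVec L N j))) := by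
  unfold latW
  rw [gl_torW, zero_mul, add_zero]
  refine Finset.sum_congr rfl fun j _ => ?_
  have e : (fun i => ((Pi.single (M := fun _ => ℤ) j 1 i : ℤ) : ZMod (L ^ N))) =
      unitVec L N j := by
    funext i
    simp only [unitVec, Pi.single_apply]
    split_ifs <;> simp
  rw [gl_permW, trans_apply, trans_symm_apply, e]

lemma ham_eq_pot (N : ℕ) (g ν : ℝ) (φ : Conf L N n) :
    ham L N n g ν φ = pot (latW L N) g ν fun p => φ p.1 p.2 := by
  unfold ham pot
  rw [Finset.sum_add_distrib, ← Finset.mul_sum, Finset.sum_comm]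
  congr 2
  refine Finset.sum_congr rfl fun i _ => Finset.sum_congr rfl fun x _ => ?_
  rw [gl_latW, lap, ← Finset.sum_neg_distrib]
  congr 1
  refine Finset.sum_congr rfl fun j _ => ?_
  unfold cmp
  ring

lemma partZ_eq (N : ℕ) (g ν : ℝ) :
    partZ L N n g ν = wint (pot (latW L N) g ν) (fun _ : Torus L N × Fin n → ℝ => 1) := by
  unfold partZ wint
  simp_rw [ham_eq_pot, one_mul]
  exact integral_uncurry fun φ : Torus L N × Fin n → ℝ => Real.exp (-pot (latW L N) g ν φ)

lemma expect_eq (N : ℕ) (g ν : ℝ) (F : (Torus L N × Fin n → ℝ) → ℝ) :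
    expect L N n g ν (fun φ => F fun p => φ p.1 p.2) = ev (latW L N) g ν F := by
  unfold expect ev
  rw [partZ_eq]
  congr 1
  unfold wint
  simp_rw [ham_eq_pot]
  exact integral_uncurry fun φ : Torus L N × Fin n → ℝ => F φ * Real.exp (-pot (latW L N) g ν φ)

lemma pressureN_eq (N : ℕ) (g ν : ℝ) :
    pressureN L N n g ν = ((L : ℝ) ^ (4 * N))⁻¹ * fe n (latW L N) g ν := by
  unfold pressureN fe
  rw [partZ_eq]

lemma expect_normSq_eq (N : ℕ) (g ν : ℝ) :
    expect L N n g ν (fun φ => normSq (φ 0)) =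
      ev (latW L N) g ν fun φ : Torus L N × Fin n → ℝ => sN φ 0 :=
  expect_eq N g ν fun φ => sN φ 0

lemma corrSum_eq [NeZero n] (N : ℕ) (g ν : ℝ) :
    corrSum L N n g ν =
      ∑ x, ev (latW L N) g ν fun φ : Torus L N × Fin n → ℝ => φ (0, 0) * φ (x, 0) :=
  Finset.sum_congr rfl fun x _ => expect_eq N g ν fun φ => φ (0, 0) * φ (x, 0)

lemma card_torus (L N : ℕ) [NeZero L] : (Fintype.card (Torus L N) : ℝ) = (L : ℝ) ^ (4 * N) := by
  rw [Fintype.card_fun, ZMod.card]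
  simp
  ring

end Transfer

section ThermodynamicLimit

variable {L n : ℕ} [NeZero L] {g ν m : ℝ}

/-- A spectral gap bound which is uniform in the volume and stable under small perturbations. -/
def UGap (n L : ℕ) [NeZero L] (g ν m : ℝ) : Prop :=
  ∃ η > 0, ∀ v : Fin 4 → ℤ, ∀ᶠ N : ℕ in atTop, ∀ ν' ∈ Set.Icc (ν - η) (ν + η),
    ∀ s ∈ Set.Icc 0 η, Gap n (torW (trans (L ^ N)) v s) g ν' m

lemma UGap.eventually_gap (hG : UGap n L g ν m) :
    ∀ᶠ N : ℕ in atTop, Gap n (latW L N) g ν m := by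
  obtain ⟨η, hη, h⟩ := hG
  refine (h 0).mono fun N hN => hN ν ⟨by linarith, by linarith⟩ 0 ⟨le_rfl, hη.le⟩

lemma wint_latW_one_pos (hg : 0 < g) (N : ℕ) :
    0 < wint (pot (latW L N) g ν) (fun _ : Torus L N × Fin n → ℝ => 1) :=
  wint_one_pos (nice_pot (isWeight_latW L N) hg).conf

lemma wint_latW_sN_eq (N : ℕ) (x : Torus L N) :
    wint (pot (latW L N) g ν) (fun φ : Torus L N × Fin n → ℝ => sN φ x) =
      wint (pot (latW L N) g ν) (fun φ : Torus L N × Fin n → ℝ => sN φ 0) :=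
  wint_sN_eq 0 0 x

lemma wint_latW_two_point_eq (N : ℕ) (i : Fin n) (x y : Torus L N) :
    wint (pot (latW L N) g ν) (fun φ : Torus L N × Fin n → ℝ => φ (x, i) * φ (x + y, i)) =
      wint (pot (latW L N) g ν) (fun φ : Torus L N × Fin n → ℝ => φ (0, i) * φ (y, i)) :=
  wint_two_point_eq 0 0 i x y

lemma ev_latW_mass (hg : 0 < g) (N : ℕ) :
    ((L : ℝ) ^ (4 * N))⁻¹ * ev (latW L N) g ν
      (pot (fun _ _ => 0) 0 1 : (Torus L N × Fin n → ℝ) → ℝ) =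
      1 / 2 * ev (latW L N) g ν fun φ : Torus L N × Fin n → ℝ => sN φ 0 := by
  have hC := (nice_pot (n := n) (ν := ν) (isWeight_latW L N) hg).conf
  have e : (pot (fun _ _ => 0) 0 1 : (Torus L N × Fin n → ℝ) → ℝ) =
      fun φ => 1 / 2 * ∑ y, sN φ y := by
    funext φ
    unfold pot gl
    simp only [zero_mul, Finset.sum_const_zero, mul_zero, add_zero, zero_div, zero_add]
    rw [← Finset.mul_sum]
  unfold ev
  rw [e, wint_const_mul, wint_sum hC _ fun y _ => tame_sN y,
    Finset.sum_congr rfl fun y _ => wint_latW_sN_eq N y, Finset.sum_const, Finset.card_univ,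
    nsmul_eq_mul, card_torus]
  have hL : (0 : ℝ) < L := Nat.cast_pos.2 (NeZero.pos L)
  field_simp

/-- Convergence of `⟨|φ_0|²⟩` and differentiability of the pressure. -/
lemma UGap.hasDerivAt_pressure (hG : UGap n L g ν m) (hm : 0 < m) (hg : 0 < g) {p : ℝ → ℝ}
    (hp : ∀ ν', Tendsto (fun N : ℕ => ((L : ℝ) ^ (4 * N))⁻¹ * fe n (latW L N) g ν') atTop
      (𝓝 (p ν'))) :
    ∃ M, Tendsto (fun N : ℕ => ev (latW L N) g ν fun φ : Torus L N × Fin n → ℝ => sN φ 0) atTop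
      (𝓝 M) ∧ HasDerivAt p (-(M / 2)) ν := by
  obtain ⟨η, hη, h⟩ := hG
  have hL : (0 : ℝ) < L := Nat.cast_pos.2 (NeZero.pos L)
  set K := 1 / m * ((8 * 0 ^ 2 + 2 * 1 ^ 2) * (2 * n + (|ν| + η + 1 / 2) ^ 2 / (2 * g))) with hK
  obtain ⟨E, hE, hd⟩ := hasDerivAt_of_tendsto (t := ν) (K := K) hη (F := p)
    (f := fun N s => ((L : ℝ) ^ (4 * N))⁻¹ * fe n (latW L N) g s)
    (e := fun N s => -(1 / 2 * ev (latW L N) g s fun φ : Torus L N × Fin n → ℝ => sN φ 0))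
    (fun s _ => hp s) (by
    refine (h 0).mono fun N hN s hs => ?_
    have h1 := fe_taylor (n := n) (ν := 0) (a := ν - η) (b := ν + η) (K := K) (c := 1) (D := 0)
      (t := ν) (s := s) (isWeight_latW L N) hg (J' := fun _ _ => 0)
      ⟨fun _ _ => rfl, fun _ _ => le_rfl⟩ le_rfl (fun y => by simp)
      (fun t ht => ?_) ⟨by linarith, by linarith⟩ hs
    · simp only [mul_zero, add_zero, mul_one, zero_add] at h1
      change |fe n (latW L N) g s - fe n (latW L N) g ν - (s - ν) * -ev (latW L N) g ν
        (pot (fun _ _ => 0) 0 1 : (Torus L N × Fin n → ℝ) → ℝ)| ≤ _ at h1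
      have h2 : (0 : ℝ) < ((L : ℝ) ^ (4 * N))⁻¹ := by positivity
      have h3 := mul_le_mul_of_nonneg_left h1 h2.le
      rw [← abs_of_pos h2, ← abs_mul, abs_of_pos h2, card_torus] at h3
      have h4 := ev_latW_mass (n := n) (L := L) (ν := ν) hg N
      refine le_of_eq_of_le ?_ (h3.trans (le_of_eq ?_))
      · congr 1
        linear_combination -(s - ν) * h4
      · field_simp
    · simp only [mul_zero, add_zero, mul_one, zero_add]
      refine ⟨isWeight_latW L N, m, hm, hN t ht 0 ⟨le_rfl, hη.le⟩, ?_⟩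
      rw [hK]
      have h5 : (t - 1 / 2) ^ 2 ≤ (|ν| + η + 1 / 2) ^ 2 := by
        refine sq_le_sq' ?_ ?_ <;> linarith [ht.1, ht.2, le_abs_self ν, neg_abs_le ν]
      norm_num
      gcongr)
  refine ⟨-2 * E, ?_, by convert hd using 1; ring⟩
  refine (hE.const_mul (-2)).congr fun N => by ring

lemma ev_latW_permW [NeZero n] (hg : 0 < g) (N : ℕ) (v : Fin 4 → ℤ) :
    ((L : ℝ) ^ (4 * N))⁻¹ * ev (latW L N) g ν
      (pot (permW (trans (L ^ N) (Multiplicative.ofAdd v))) 0 0 :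
        (Torus L N × Fin n → ℝ) → ℝ) =
      (ev (latW L N) g ν fun φ : Torus L N × Fin n → ℝ => sN φ 0) -
        n * ev (latW L N) g ν fun φ : Torus L N × Fin n → ℝ =>
          φ (0, 0) * φ ((fun j => (v j : ZMod (L ^ N))), 0) := by
  have hJ := isWeight_latW L N
  have hC := (nice_pot (n := n) (ν := ν) hJ hg).conf
  set w : Torus L N := fun j => (v j : ZMod (L ^ N)) with hw
  have e : (pot (permW (trans (L ^ N) (Multiplicative.ofAdd v))) 0 0 :
      (Torus L N × Fin n → ℝ) → ℝ) = fun φ => 1 / 2 * ∑ y, ((2 * sN φ y -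
        ∑ k, φ (y, k) * φ (y + w, k)) - ∑ k, φ (y, k) * φ (y - w, k)) := by
    funext φ
    unfold pot sN
    rw [Finset.sum_comm]
    simp only [zero_mul, Finset.sum_const_zero, zero_div, zero_add]
    congr 1
    refine Finset.sum_congr rfl fun y _ => ?_
    rw [Finset.mul_sum, ← Finset.sum_sub_distrib, ← Finset.sum_sub_distrib]
    refine Finset.sum_congr rfl fun k _ => ?_
    rw [gl_permW, trans_apply, trans_symm_apply]
    unfold cmp
    ring
  have t1 : ∀ y z : Torus L N, Tame fun φ : Torus L N × Fin n → ℝ =>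
      ∑ k, φ (y, k) * φ (z, k) := fun y z =>
    Tame.sum _ fun k _ => (Tame.coord _).mul (Tame.coord _)
  have h1 : ∀ y, wint (pot (latW L N) g ν) (fun φ : Torus L N × Fin n → ℝ => (2 * sN φ y -
        ∑ k, φ (y, k) * φ (y + w, k)) - ∑ k, φ (y, k) * φ (y - w, k)) =
      2 * (wint (pot (latW L N) g ν) (fun φ : Torus L N × Fin n → ℝ => sN φ 0) -
        n * wint (pot (latW L N) g ν) fun φ : Torus L N × Fin n → ℝ =>
          φ (0, 0) * φ (w, 0)) := fun y => by
    rw [wint_sub hC (((tame_sN y).const_mul 2).sub (t1 _ _)) (t1 _ _),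
      wint_sub hC ((tame_sN y).const_mul 2) (t1 _ _), wint_const_mul, wint_latW_sN_eq,
      wint_sum_component hJ hg _ _ 0, wint_sum_component hJ hg _ _ 0, wint_latW_two_point_eq]
    have h2 := wint_latW_two_point_eq (g := g) (ν := ν) N (0 : Fin n) (y - w) w
    rw [sub_add_cancel] at h2
    simp_rw [mul_comm (_ : ℝ) ((_ : Torus L N × Fin n → ℝ) (y - w, 0))]
    rw [h2]
    ring
  unfold ev
  rw [e, wint_const_mul, wint_sum hC _ fun y _ =>
    (((tame_sN y).const_mul 2).sub (t1 _ _)).sub (t1 _ _),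
    Finset.sum_congr rfl fun y _ => h1 y, Finset.sum_const, Finset.card_univ,
    nsmul_eq_mul, card_torus]
  have hL : (0 : ℝ) < L := Nat.cast_pos.2 (NeZero.pos L)
  field_simp

/-- Convergence of the two-point function. -/
lemma UGap.exists_tendsto_two_point [NeZero n] (hG : UGap n L g ν m) (hm : 0 < m) (hg : 0 < g)
    (hL2 : 2 ≤ L) {M : ℝ}
    (hM : Tendsto (fun N : ℕ => ev (latW L N) g ν fun φ : Torus L N × Fin n → ℝ => sN φ 0) atTop
      (𝓝 M)) (v : Fin 4 → ℤ) :
    ∃ G, Tendsto (fun N : ℕ => ev (latW L N) g ν fun φ : Torus L N × Fin n → ℝ =>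
      φ (0, 0) * φ ((fun j => (v j : ZMod (L ^ N))), 0)) atTop (𝓝 G) := by
  obtain ⟨η, hη, h⟩ := hG
  have hL : (0 : ℝ) < L := Nat.cast_pos.2 (NeZero.pos L)
  have hn : (n : ℝ) ≠ 0 := Nat.cast_ne_zero.2 (NeZero.ne n)
  have hF : ∀ s ∈ Set.Icc (0 : ℝ) (0 + η), ∃ p, Tendsto (fun N : ℕ => ((L : ℝ) ^ (4 * N))⁻¹ *
      fe n (torW (trans (L ^ N)) v s) g ν) atTop (𝓝 p) := fun s hs =>
    exists_tendsto_fe hL2 n v hs.1 hg ν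
  choose! F hF using hF
  have eJ : ∀ (N : ℕ) (s : ℝ), (fun x y => latW L N x y +
      s * permW (trans (L ^ N) (Multiplicative.ofAdd v)) x y) = torW (trans (L ^ N)) v s :=
    fun N s => by
      funext x y
      unfold latW torW
      rw [zero_mul, add_zero]
  set K := 1 / m * ((8 * 2 ^ 2 + 2 * 0 ^ 2) * (2 * n + (ν + 0 - 1 / 2) ^ 2 / (2 * g))) with hK
  obtain ⟨E, hE⟩ := exists_tendsto_coeff (t := 0) (K := K) hη (F := F)
    (f := fun N s => ((L : ℝ) ^ (4 * N))⁻¹ * fe n (torW (trans (L ^ N)) v s) g ν)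
    (e := fun N _ => -(((L : ℝ) ^ (4 * N))⁻¹ * ev (latW L N) g ν
      (pot (permW (trans (L ^ N) (Multiplicative.ofAdd v))) 0 0 :
        (Torus L N × Fin n → ℝ) → ℝ))) hF (by
    refine (h v).mono fun N hN s hs => ?_
    have h1 := fe_taylor (n := n) (ν := ν) (a := 0) (b := 0 + η) (K := K) (c := 0) (D := 2)
      (t := 0) (s := s) (isWeight_latW L N) hg
      (J' := permW (trans (L ^ N) (Multiplicative.ofAdd v))) (isWeight_permW _) zero_le_two
      (fun y => (sum_permW _ y).le) (fun t ht => ?_) ⟨le_rfl, by linarith⟩ hs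
    · simp_rw [eJ] at h1
      rw [torW_zero] at h1
      simp only [mul_zero, add_zero] at h1
      have h2 : (0 : ℝ) < ((L : ℝ) ^ (4 * N))⁻¹ := by positivity
      have h3 := mul_le_mul_of_nonneg_left h1 h2.le
      rw [← abs_of_pos h2, ← abs_mul, abs_of_pos h2, card_torus] at h3
      rw [torW_zero]
      refine le_of_eq_of_le ?_ (h3.trans (le_of_eq ?_))
      · congr 1
        unfold latW
        ring
      · field_simp
    · rw [eJ]
      refine ⟨isWeight_torW _ _ ht.1, m, hm, ?_, ?_⟩
      · rw [mul_zero, add_zero]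
        exact hN ν ⟨by linarith, by linarith⟩ t ⟨ht.1, by linarith [ht.2]⟩
      · rw [hK, mul_zero])
  refine ⟨1 / n * (M + E), ?_⟩
  refine ((hM.add hE).const_mul (1 / (n : ℝ))).congr fun N => ?_
  rw [ev_latW_permW hg]
  field_simp
  ring

end ThermodynamicLimit

section Decay

/-- Distance to the origin on a torus. -/
def tdist {M : ℕ} (x : Fin 4 → ZMod M) : ℝ := ∑ j, ((x j).valMinAbs.natAbs : ℝ)

lemma natAbs_valMinAbs_add_one_le {M : ℕ} (a : ZMod M) :
    (a + 1).valMinAbs.natAbs ≤ a.valMinAbs.natAbs + 1 := by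
  refine (ZMod.natAbs_valMinAbs_add_le a 1).trans ?_
  have h1 : (1 : ZMod M).valMinAbs.natAbs ≤ 1 := by
    rcases M with _ | _ | M
    · rfl
    · have : (1 : ZMod 1).valMinAbs = 0 := by
        rw [Subsingleton.elim (1 : ZMod 1) 0, ZMod.valMinAbs_zero]
      simp [this]
    · rcases M with _ | M
      · decide
      · have h := ZMod.valMinAbs_natCast_of_le_half (n := M + 3) (a := 1) (by omega)
        simp only [Nat.cast_one] at h
        simp [h]
  omega

lemma abs_tdist_add_single_sub_le {M : ℕ} (x : Fin 4 → ZMod M) (j : Fin 4) :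
    |tdist (x + fun i => ((Pi.single (M := fun _ => ℤ) j 1 i : ℤ) : ZMod M)) - tdist x| ≤ 1 := by
  have h2 : ∀ a : ZMod M, a.valMinAbs.natAbs ≤ (a + 1).valMinAbs.natAbs + 1 := fun a => by
    have := natAbs_valMinAbs_add_one_le (-(a + 1))
    rw [neg_add, add_assoc, neg_add_cancel, add_zero, ZMod.natAbs_valMinAbs_neg, ← neg_add,
      ZMod.natAbs_valMinAbs_neg] at this
    exact this
  unfold tdist
  rw [← Finset.sum_sub_distrib, Finset.sum_eq_single j]
  · simp only [Pi.add_apply, Pi.single_eq_same, Int.cast_one]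
    have h3 : ((x j + 1).valMinAbs.natAbs : ℝ) ≤ (x j).valMinAbs.natAbs + 1 := by
      exact_mod_cast natAbs_valMinAbs_add_one_le (x j)
    have h4 : ((x j).valMinAbs.natAbs : ℝ) ≤ (x j + 1).valMinAbs.natAbs + 1 := by
      exact_mod_cast h2 (x j)
    rw [abs_le]
    constructor <;> linarith
  · intro i _ hi
    simp [hi]
  · simp

lemma exists_exp_add_exp_neg_le {δ : ℝ} (hδ : 0 < δ) :
    ∃ μ > 0, Real.exp μ + Real.exp (-μ) - 2 ≤ δ := by
  have h : Tendsto (fun μ => Real.exp μ + Real.exp (-μ) - 2) (𝓝[>] 0) (𝓝 0) := by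
    have : Continuous fun μ : ℝ => Real.exp μ + Real.exp (-μ) - 2 := by fun_prop
    have h1 := (this.tendsto 0).mono_left (nhdsWithin_le_nhds (s := Set.Ioi 0))
    norm_num at h1
    exact h1
  obtain ⟨μ, h1, h2⟩ := ((h.eventually (ge_mem_nhds hδ)).and self_mem_nhdsWithin).exists
  exact ⟨μ, h2, h1⟩

lemma exp_sub_sq_le {μ a b : ℝ} (h : |a - b| ≤ 1) :
    (Real.exp (μ * a) - Real.exp (μ * b)) ^ 2 ≤
      (Real.exp μ + Real.exp (-μ) - 2) * (Real.exp (μ * a) * Real.exp (μ * b)) := by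
  set t := μ * (a - b) with ht
  have h1 : |t| ≤ |μ| := by
    rw [ht, abs_mul]
    exact mul_le_of_le_one_right (abs_nonneg _) h
  have h2 : Real.exp t + Real.exp (-t) ≤ Real.exp μ + Real.exp (-μ) := by
    have := Real.cosh_le_cosh.2 h1
    rw [Real.cosh_eq, Real.cosh_eq] at this
    linarith
  have h3 : (Real.exp (μ * a) - Real.exp (μ * b)) ^ 2 =
      (Real.exp t + Real.exp (-t) - 2) * (Real.exp (μ * a) * Real.exp (μ * b)) := by
    have e1 : Real.exp t * Real.exp (μ * b) = Real.exp (μ * a) := by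
      rw [← Real.exp_add]; congr 1; rw [ht]; ring
    have e2 : Real.exp (-t) * Real.exp (μ * a) = Real.exp (μ * b) := by
      rw [← Real.exp_add]; congr 1; rw [ht]; ring
    linear_combination -Real.exp (μ * a) * e1 - Real.exp (μ * b) * e2
  rw [h3]
  have : 0 ≤ Real.exp (μ * a) * Real.exp (μ * b) := by positivity
  nlinarith

variable {L n : ℕ} [NeZero L] {g ν m : ℝ}

lemma abs_tdist_sub_le_of_latW {N : ℕ} {y z : Torus L N} (h : latW L N y z ≠ 0) :
    |tdist y - tdist z| ≤ 1 := by
  unfold latW torW at h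
  rw [zero_mul, add_zero] at h
  obtain ⟨j, _, hj⟩ := Finset.exists_ne_zero_of_sum_ne_zero h
  unfold permW at hj
  rw [trans_apply, trans_apply] at hj
  by_cases h1 : (y + fun i => ((Pi.single (M := fun _ => ℤ) j 1 i : ℤ) : ZMod (L ^ N))) = z
  · rw [← h1, abs_sub_comm]
    exact abs_tdist_add_single_sub_le y j
  · by_cases h2 : (z + fun i => ((Pi.single (M := fun _ => ℤ) j 1 i : ℤ) : ZMod (L ^ N))) = y
    · rw [← h2]
      exact abs_tdist_add_single_sub_le z j
    · exact absurd hj (by rw [if_neg h1, if_neg h2]; norm_num)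

/-- Exponential decay of the two-point function, uniformly in the volume. -/
lemma exists_two_point_decay [NeZero n] (hg : 0 < g) (hm : 0 < m) :
    ∃ μ > 0, ∀ N : ℕ, Gap n (latW L N) g ν m → ∀ x : Torus L N,
      |ev (latW L N) g ν fun φ : Torus L N × Fin n → ℝ => φ (0, 0) * φ (x, 0)| ≤
        2 / m * Real.exp (-(μ * tdist x)) := by
  obtain ⟨μ, hμ, hκ⟩ := exists_exp_add_exp_neg_le (δ := m / 8) (by positivity)
  refine ⟨μ, hμ, fun N hG x => ?_⟩
  have h0 : 0 ≤ Real.exp μ + Real.exp (-μ) - 2 := by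
    have := Real.one_le_cosh μ
    rw [Real.cosh_eq] at this
    linarith
  have hD : ∀ y, ∑ z, latW L N y z ≤ 8 := fun y => by
    unfold latW
    rw [sum_torW]
    norm_num
  have h := hG.two_point_decay (isWeight_latW L N) hg hm hD (by norm_num) h0
    (c := m / 2) (by positivity) (by linarith) (r := fun y => Real.exp (μ * tdist y))
    (fun y z hyz => exp_sub_sq_le (abs_tdist_sub_le_of_latW hyz)) (o := 0)
    (by simp [tdist]) 0 x
  have hZ := wint_latW_one_pos (n := n) (L := L) (ν := ν) hg N
  unfold ev
  rw [abs_div, abs_of_pos hZ, div_le_iff₀ hZ, Real.exp_neg]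
  rw [abs_of_pos (Real.exp_pos _)] at h
  have h1 : (1 : ℝ) / (m / 2) = 2 / m := by field_simp
  rw [h1] at h
  rw [mul_right_comm, ← div_eq_mul_inv, le_div_iff₀ (Real.exp_pos _), mul_comm]
  exact h

lemma summable_exp_neg_sum_abs {μ : ℝ} (hμ : 0 < μ) :
    Summable fun v : Fin 4 → ℤ => Real.exp (-(μ * ∑ j, ((v j).natAbs : ℝ))) := by
  have h1 : Summable fun k : ℤ => Real.exp (-(μ * (k.natAbs : ℝ))) := by
    have hN : Summable fun k : ℕ => Real.exp (-(μ * (k : ℝ))) := by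
      have := Real.summable_exp_nat_mul_iff.2 (neg_lt_zero.2 hμ)
      refine this.congr fun k => ?_
      congr 1
      ring
    refine Summable.of_nat_of_neg ?_ ?_
    · simpa using hN
    · simpa using hN
  refine summable_of_sum_le (c := (∑' k : ℤ, Real.exp (-(μ * (k.natAbs : ℝ)))) ^ 4)
    (fun v => (Real.exp_pos _).le) fun u => ?_
  have h2 : u ⊆ Fintype.piFinset fun j => u.image fun v => v j := fun v hv => by
    rw [Fintype.mem_piFinset]
    exact fun j => Finset.mem_image_of_mem _ hv
  refine (Finset.sum_le_sum_of_subset_of_nonneg h2 fun v _ _ => (Real.exp_pos _).le).trans ?_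
  have h3 : ∀ v : Fin 4 → ℤ, Real.exp (-(μ * ∑ j, ((v j).natAbs : ℝ))) =
      ∏ j, Real.exp (-(μ * ((v j).natAbs : ℝ))) := fun v => by
    rw [← Real.exp_sum, Finset.mul_sum, Finset.sum_neg_distrib]
  simp_rw [h3]
  rw [← Finset.prod_univ_sum (fun j => u.image fun v => v j)
    (fun _ k => Real.exp (-(μ * ((k : ℤ).natAbs : ℝ))))]
  refine (Finset.prod_le_prod (fun j _ => Finset.sum_nonneg fun k _ => (Real.exp_pos _).le)
    fun j _ => h1.sum_le_tsum _ fun k _ => (Real.exp_pos _).le).trans ?_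
  simp

/-- Existence of the susceptibility. -/
lemma UGap.exists_tendsto_sum_two_point [NeZero n] (hG : UGap n L g ν m) (hm : 0 < m) (hg : 0 < g)
    (hL2 : 2 ≤ L) {M : ℝ}
    (hM : Tendsto (fun N : ℕ => ev (latW L N) g ν fun φ : Torus L N × Fin n → ℝ => sN φ 0) atTop
      (𝓝 M)) :
    ∃ χ, Tendsto (fun N : ℕ => ∑ x, ev (latW L N) g ν fun φ : Torus L N × Fin n → ℝ =>
      φ (0, 0) * φ (x, 0)) atTop (𝓝 χ) := by
  choose G hGt using fun v => hG.exists_tendsto_two_point hm hg hL2 hM v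
  obtain ⟨μ, hμ, hdec⟩ := exists_two_point_decay (L := L) (n := n) (ν := ν) hg hm
  let e : ∀ N, Torus L N → Fin 4 → ℤ := fun N x j => (x j).valMinAbs
  let c : ∀ N, (Fin 4 → ℤ) → Torus L N := fun N v j => (v j : ZMod (L ^ N))
  have hce : ∀ N x, c N (e N x) = x := fun N x => funext fun j => ZMod.coe_valMinAbs _
  let T : ∀ N, Torus L N → ℝ := fun N x =>
    ev (latW L N) g ν fun φ : Torus L N × Fin n → ℝ => φ (0, 0) * φ (x, 0)
  let F : ℕ → (Fin 4 → ℤ) → ℝ := fun N v => if e N (c N v) = v then T N (c N v) else 0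
  have hsum : ∀ N, ∑' v, F N v = ∑ x, T N x := fun N => by
    have hinj : Function.Injective (e N) := Function.LeftInverse.injective (hce N)
    rw [← hinj.tsum_eq (f := F N), tsum_fintype]
    · refine Finset.sum_congr rfl fun x _ => ?_
      simp only [F]
      rw [hce, if_pos rfl]
    · intro v hv
      have : e N (c N v) = v := by
        by_contra h
        exact hv (if_neg h)
      exact ⟨_, this⟩
  have hpt : ∀ v, Tendsto (fun N => F N v) atTop (𝓝 (G v)) := fun v => by
    refine (hGt v).congr' ?_
    have h1 : Tendsto (fun N : ℕ => L ^ N) atTop atTop := tendsto_pow_atTop_atTop_of_one_lt hL2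
    filter_upwards [h1.eventually_ge_atTop (2 * (∑ j, (v j).natAbs) + 1)] with N hN
    have h2 : e N (c N v) = v := by
      funext j
      have h3 : (v j).natAbs ≤ ∑ j, (v j).natAbs :=
        Finset.single_le_sum (f := fun j => (v j).natAbs) (fun _ _ => Nat.zero_le _)
          (Finset.mem_univ j)
      refine (ZMod.valMinAbs_spec _ _).2 ⟨rfl, ?_, ?_⟩
      · have : (-(L ^ N : ℕ) : ℤ) < v j * 2 := by omega
        exact this
      · have : v j * 2 ≤ ((L ^ N : ℕ) : ℤ) := by omega
        exact this
    simp only [F]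
    rw [if_pos h2]
  refine ⟨∑' v, G v, ?_⟩
  have := tendsto_tsum_of_dominated_convergence
    ((summable_exp_neg_sum_abs hμ).mul_left (2 / m)) hpt
    (hG.eventually_gap.mono fun N hN v => ?_)
  · refine this.congr fun N => hsum N
  · simp only [F]
    split_ifs with h
    · refine (hdec N hN (c N v)).trans (le_of_eq ?_)
      congr 4
      unfold tdist
      refine Finset.sum_congr rfl fun j _ => ?_
      conv_rhs => rw [← h]
    · rw [norm_zero]
      positivity

end Decay

section TorusGreen
variable {L : ℕ} [NeZero L]

/-- The diagonal Green function of `−Δ + β` on the discrete torus, as a sum over the dual torus. -/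
def torusGreen (L N : ℕ) [NeZero L] (β : ℝ) : ℝ :=
  ((L : ℝ) ^ (4 * N))⁻¹ * ∑ k : Torus L N, (lam (embed L N k) + β)⁻¹

lemma lam_nonneg (k : Fin 4 → ℝ) : 0 ≤ lam k := by
  unfold lam
  positivity

lemma continuous_lam : Continuous lam := by
  unfold lam
  fun_prop

lemma stdAddChar_add_neg (N : ℕ) (k : ZMod (L ^ N)) :
    (ZMod.stdAddChar k : ℂ) + ZMod.stdAddChar (-k) =
      ((2 - 4 * Real.sin (Real.pi * ((k.val : ℝ) / (L : ℝ) ^ N)) ^ 2 : ℝ) : ℂ) := by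
  set t : ℝ := Real.pi * ((k.val : ℝ) / (L : ℝ) ^ N) with ht
  have h1 : (ZMod.stdAddChar k : ℂ) = Complex.exp (((2 * t : ℝ) : ℂ) * Complex.I) := by
    rw [ZMod.stdAddChar_apply, ZMod.toCircle_apply]
    congr 1
    rw [ht]
    push_cast
    ring
  have h2 : (ZMod.stdAddChar (-k) : ℂ) = Complex.exp (-((2 * t : ℝ) : ℂ) * Complex.I) := by
    rw [AddChar.map_neg_eq_inv, h1, ← Complex.exp_neg, neg_mul]
  rw [h1, h2, ← Complex.two_cos, ← Complex.ofReal_cos, Real.cos_two_mul, Real.cos_sq']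
  push_cast
  ring

lemma map_sum_stdAddChar {M : ℕ} [NeZero M] {ι : Type*} (s : Finset ι) (f : ι → ZMod M) :
    (ZMod.stdAddChar (∑ j ∈ s, f j) : ℂ) = ∏ j ∈ s, (ZMod.stdAddChar (f j) : ℂ) := by
  classical
  induction s using Finset.induction_on with
  | empty => simp
  | insert a s ha ih => rw [Finset.sum_insert ha, Finset.prod_insert ha, AddChar.map_add_eq_mul, ih]

/-- The Fourier character on the torus. -/
def chr (L N : ℕ) [NeZero L] (k x : Torus L N) : ℂ := ZMod.stdAddChar (∑ j, k j * x j)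

lemma chr_add (N : ℕ) (k x y : Torus L N) : chr L N k (x + y) = chr L N k x * chr L N k y := by
  unfold chr
  rw [← AddChar.map_add_eq_mul, ← Finset.sum_add_distrib]
  simp_rw [Pi.add_apply, mul_add]

lemma chr_unitVec (N : ℕ) (k : Torus L N) (j : Fin 4) :
    chr L N k (unitVec L N j) = ZMod.stdAddChar (k j) := by
  unfold chr unitVec
  simp

lemma chr_neg_unitVec (N : ℕ) (k : Torus L N) (j : Fin 4) :
    chr L N k (-unitVec L N j) = ZMod.stdAddChar (-k j) := by
  unfold chr unitVec
  simp

lemma sum_chr (N : ℕ) (x : Torus L N) :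
    ∑ k, chr L N k x = if x = 0 then ((L : ℂ) ^ (4 * N)) else 0 := by
  have h1 : ∀ k, chr L N k x = ∏ j, (ZMod.stdAddChar (k j * x j) : ℂ) := fun k => by
    unfold chr
    exact map_sum_stdAddChar _ _
  simp_rw [h1]
  rw [← Fintype.prod_sum fun j (a : ZMod (L ^ N)) => (ZMod.stdAddChar (a * x j) : ℂ)]
  simp_rw [AddChar.sum_mulShift _ (ZMod.isPrimitive_stdAddChar _)]
  split_ifs with h
  · subst h
    simp [ZMod.card]
    ring
  · obtain ⟨j, hj⟩ := Function.ne_iff.1 h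
    refine Finset.prod_eq_zero (Finset.mem_univ j) ?_
    rw [if_neg (show ¬x j = 0 from hj)]
    simp

lemma chr_laplacian (N : ℕ) (k x : Torus L N) :
    ∑ j, ((chr L N k x - chr L N k (x + unitVec L N j)) +
      (chr L N k x - chr L N k (x - unitVec L N j))) = lam (embed L N k) * chr L N k x := by
  have h1 : ∀ j, (chr L N k x - chr L N k (x + unitVec L N j)) +
      (chr L N k x - chr L N k (x - unitVec L N j)) =
      ((4 * Real.sin (Real.pi * embed L N k j) ^ 2 : ℝ) : ℂ) * chr L N k x := fun j => by
    rw [sub_eq_add_neg x, chr_add, chr_add, chr_unitVec, chr_neg_unitVec]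
    have := stdAddChar_add_neg (L := L) N (k j)
    unfold embed
    push_cast at this ⊢
    linear_combination (-chr L N k x) * this
  simp_rw [h1, ← Finset.sum_mul]
  unfold lam
  rw [Finset.mul_sum]
  push_cast
  rfl

/-- The resolvent of the torus Laplacian, whose diagonal is `torusGreen`. -/
lemma exists_resolvent_torus (N : ℕ) {β : ℝ} (hβ : 0 < β) (x : Torus L N) :
    ∃ u : Torus L N → ℝ, u x = torusGreen L N β ∧
      ∀ y, β * u y + gl (latW L N) u y = if y = x then 1 else 0 := by
  have hV : (0 : ℝ) < (L : ℝ) ^ (4 * N) := by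
    have : (0 : ℝ) < L := by exact_mod_cast Nat.pos_of_ne_zero (NeZero.ne L)
    positivity
  let U : Torus L N → ℝ := fun y =>
    ((L : ℝ) ^ (4 * N))⁻¹ * ∑ k, (lam (embed L N k) + β)⁻¹ * (chr L N k (y - x)).re
  have hpos : ∀ k : Torus L N, 0 < lam (embed L N k) + β := fun k => by
    have := lam_nonneg (embed L N k)
    linarith
  refine ⟨U, ?_, fun y => ?_⟩
  · have : ∀ k, chr L N k 0 = 1 := fun k => by
      unfold chr
      simp
    simp [U, this, torusGreen]
  have h1 : ∀ k, ∑ j, (((chr L N k (y - x)).re - (chr L N k (y + unitVec L N j - x)).re) +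
      ((chr L N k (y - x)).re - (chr L N k (y - unitVec L N j - x)).re)) =
        lam (embed L N k) * (chr L N k (y - x)).re := fun k => by
    have := congrArg Complex.re (chr_laplacian N k (y - x))
    rw [Complex.re_ofReal_mul, Complex.re_sum] at this
    rw [← this]
    refine Finset.sum_congr rfl fun j _ => ?_
    rw [Complex.add_re, Complex.sub_re, Complex.sub_re, add_sub_right_comm, sub_right_comm]
  have h2 : gl (latW L N) U y = ((L : ℝ) ^ (4 * N))⁻¹ * ∑ k, (lam (embed L N k) + β)⁻¹ *
      (lam (embed L N k) * (chr L N k (y - x)).re) := by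
    rw [gl_latW]
    simp only [U]
    simp_rw [← h1, ← mul_sub, ← Finset.sum_sub_distrib, ← mul_add, ← Finset.sum_add_distrib,
      ← Finset.mul_sum]
    rw [Finset.sum_comm]
    congr 1
    refine Finset.sum_congr rfl fun k _ => ?_
    rw [Finset.mul_sum]
    refine Finset.sum_congr rfl fun j _ => ?_
    ring
  have h3 : β * U y + gl (latW L N) U y =
      ((L : ℝ) ^ (4 * N))⁻¹ * ∑ k, (chr L N k (y - x)).re := by
    rw [h2]
    simp only [U]
    rw [mul_left_comm, ← mul_add, Finset.mul_sum, ← Finset.sum_add_distrib]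
    congr 1
    refine Finset.sum_congr rfl fun k _ => ?_
    have := (hpos k).ne'
    field_simp
    ring
  have h4 := congrArg Complex.re (sum_chr N (y - x))
  rw [Complex.re_sum] at h4
  rw [h3, h4]
  simp only [sub_eq_zero]
  split_ifs
  · have : (((L : ℂ) ^ (4 * N))).re = (L : ℝ) ^ (4 * N) := by
      exact_mod_cast Complex.ofReal_re ((L : ℝ) ^ (4 * N))
    rw [this, inv_mul_cancel₀ hV.ne']
  · simp

open Pointwise in
lemma tendsto_torusGreen (hL : 2 ≤ L) {β : ℝ} (hβ : 0 < β) :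
    Tendsto (fun N => torusGreen L N β) atTop (𝓝 (green β)) := by
  let s : Set (Fin 4 → ℝ) := Set.univ.pi fun _ => Set.Ico 0 1
  let F : (Fin 4 → ℝ) → ℝ := fun k => (lam k + β)⁻¹
  have hF : Continuous F := (continuous_lam.add continuous_const).inv₀ fun k => by
    have := lam_nonneg k
    exact (add_pos_of_nonneg_of_pos this hβ).ne'
  have hs1 : Bornology.IsBounded s := Bornology.IsBounded.pi fun _ => Metric.isBounded_Ico 0 1
  have hs2 : MeasurableSet s := MeasurableSet.univ_pi fun _ => measurableSet_Ico
  have hs3 : volume (frontier s) = 0 :=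
    (convex_pi fun _ _ => convex_Ico (0 : ℝ) 1).addHaar_frontier volume
  have hI : ∫ x in s, F x = green β := by
    unfold green cube
    refine setIntegral_congr_set ?_
    exact (Measure.univ_pi_Ico_ae_eq_Icc (μ := fun _ : Fin 4 => (volume : Measure ℝ))
      (f := fun _ => 0) (g := fun _ => 1)).trans (by rw [Set.pi_univ_Icc]; exact ae_eq_refl _)
  have h := tendsto_tsum_div_pow_atTop_integral s F hF hs1 hs2 hs3
  rw [hI] at h
  refine (h.comp (tendsto_pow_atTop_atTop_of_one_lt (r := L) hL)).congr fun N => ?_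
  have hLN : (0 : ℝ) < (L : ℝ) ^ N := by
    have : (0 : ℝ) < L := by exact_mod_cast Nat.pos_of_ne_zero (NeZero.ne L)
    positivity
  dsimp only [Function.comp_apply]
  unfold torusGreen
  rw [Fintype.card_fin, Nat.cast_pow, ← pow_mul, mul_comm N 4, div_eq_inv_mul]
  congr 1
  have hmem : ∀ k : Torus L N, embed L N k ∈ s ∩ ((L : ℝ) ^ N)⁻¹ •
      (Submodule.span ℤ (Set.range (Pi.basisFun ℝ (Fin 4))) : Set (Fin 4 → ℝ)) := fun k => by
    refine ⟨fun j _ => ⟨by unfold embed; positivity, ?_⟩, ?_⟩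
    · unfold embed
      rw [div_lt_one hLN]
      exact_mod_cast ZMod.val_lt (k j)
    · refine ⟨fun j => ((k j).val : ℝ), ?_, ?_⟩
      · rw [SetLike.mem_coe, Module.Basis.mem_span_iff_repr_mem]
        intro j
        exact ⟨(k j).val, by simp⟩
      · funext j
        unfold embed
        simp [div_eq_inv_mul]
  let e : Torus L N → ↑(s ∩ ((L : ℝ) ^ N)⁻¹ •
      (Submodule.span ℤ (Set.range (Pi.basisFun ℝ (Fin 4))) : Set (Fin 4 → ℝ))) :=
    fun k => ⟨embed L N k, hmem k⟩
  have he : Function.Bijective e := by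
    constructor
    · intro k k' hk
      have h1 : embed L N k = embed L N k' := congrArg Subtype.val hk
      funext j
      have h2 := congrFun h1 j
      unfold embed at h2
      rw [div_left_inj' hLN.ne'] at h2
      exact ZMod.val_injective _ (by exact_mod_cast h2)
    · rintro ⟨z, hz1, w, hw, hwz⟩
      rw [SetLike.mem_coe, Module.Basis.mem_span_iff_repr_mem] at hw
      have hw' : ∀ j, ∃ a : ℤ, (a : ℝ) = w j := fun j => by
        obtain ⟨a, ha⟩ := hw j
        exact ⟨a, by simpa using ha⟩
      choose a ha using hw'
      have hz : ∀ j, z j = (a j : ℝ) / (L : ℝ) ^ N := fun j => by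
        rw [← hwz, ha, div_eq_inv_mul]
        rfl
      refine ⟨fun j => (a j : ZMod (L ^ N)), ?_⟩
      apply Subtype.ext
      funext j
      have h1 := hz1 j (Set.mem_univ j)
      rw [hz, Set.mem_Ico, le_div_iff₀ hLN, zero_mul, div_lt_one hLN] at h1
      have h2 : (0 : ℤ) ≤ a j := by exact_mod_cast h1.1
      have h3 : a j < (L : ℤ) ^ N := by exact_mod_cast h1.2
      change (((a j : ZMod (L ^ N)).val : ℕ) : ℝ) / (L : ℝ) ^ N = z j
      rw [hz]
      congr 1
      have h4 : (((a j : ZMod (L ^ N)).val : ℕ) : ℤ) = a j := by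
        rw [ZMod.val_intCast]
        exact Int.emod_eq_of_lt h2 (by exact_mod_cast h3)
      exact_mod_cast h4
  have := (Equiv.ofBijective e he).tsum_eq fun x => F x
  simp only [Equiv.ofBijective_apply] at this
  rw [← this, tsum_fintype]

end TorusGreen

section GapConstruction
variable {L n : ℕ} [NeZero L] {g ν m β s τ₁ τ₂ Q : ℝ}

lemma gl_torW_eq_latW (N : ℕ) (v : Fin 4 → ℤ) (s : ℝ) (f : Torus L N → ℝ) (x : Torus L N) :
    gl (torW (trans (L ^ N)) v s) f x =
      gl (latW L N) f x + s * gl (permW (trans (L ^ N) (Multiplicative.ofAdd v))) f x := by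
  unfold latW
  rw [gl_torW, gl_torW, zero_mul, add_zero]

lemma torusGreen_le_lyap_trace (N : ℕ) (v : Fin 4 → ℤ) (hs : 0 ≤ s) (hβ : 0 < β) (x : Torus L N)
    {A : Torus L N → Torus L N → ℝ} {ρ : Torus L N → ℝ}
    (h : Lyap (torW (trans (L ^ N)) v s) β x A ρ) :
    torusGreen L N β - 4 * s / β ^ 2 ≤ 2 * ∑ y, A y y := by
  obtain ⟨u, hu, hr⟩ := exists_resolvent_torus N hβ x
  have h1 := h.trace u
  have e : ∑ y, u y * (β * u y + gl (latW L N) u y) = u x := by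
    simp_rw [hr, mul_ite, mul_one, mul_zero, Finset.sum_ite_eq', Finset.mem_univ, if_true]
  have h2 : ∑ y, u y * (β * u y + gl (torW (trans (L ^ N)) v s) u y) =
      u x + s * ∑ y, u y * gl (permW (trans (L ^ N) (Multiplicative.ofAdd v))) u y := by
    rw [← e, Finset.mul_sum, ← Finset.sum_add_distrib]
    refine Finset.sum_congr rfl fun y _ => ?_
    rw [gl_torW_eq_latW]
    ring
  have h3 := (isWeight_permW (trans (L ^ N) (Multiplicative.ofAdd v))).sum_mul_gl_self_le
    (D := 2) (fun y => (sum_permW _ y).le) u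
  have h4 : β * ∑ y, u y ^ 2 ≤ u x := by
    have := (isWeight_latW L N).sum_mul_gl_self_nonneg u
    rw [← e]
    simp_rw [mul_add, Finset.sum_add_distrib]
    rw [Finset.mul_sum]
    have e2 : ∑ y, u y * (β * u y) = ∑ y, β * u y ^ 2 := Finset.sum_congr rfl fun y _ => by ring
    linarith
  have h5 : u x ^ 2 ≤ ∑ y, u y ^ 2 :=
    Finset.single_le_sum (f := fun y => u y ^ 2) (fun y _ => sq_nonneg _) (Finset.mem_univ x)
  have h6 : β * u x ≤ 1 := by
    by_contra hc
    push Not at hc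
    have : 0 < u x := pos_of_mul_pos_right (one_pos.trans hc) hβ.le
    nlinarith
  have h7 : ∑ y, u y ^ 2 ≤ 1 / β ^ 2 := by
    rw [le_div_iff₀ (by positivity)]
    nlinarith
  have h8 : s * ∑ y, u y * gl (permW (trans (L ^ N) (Multiplicative.ofAdd v))) u y ≤
      4 * s / β ^ 2 := by
    have := mul_le_mul_of_nonneg_left (h3.trans (mul_le_mul_of_nonneg_left h7 (by norm_num))) hs
    refine this.trans (le_of_eq ?_)
    ring
  rw [← hu]
  linarith

lemma Gap.mono {Λ : Type*} [Fintype Λ] [DecidableEq Λ] {J : Λ → Λ → ℝ} {m m' : ℝ}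
    (hG : Gap n J g ν m') (h : m ≤ m') : Gap n J g ν m := fun x u hu =>
  (mul_le_mul_of_nonneg_right (by linarith)
    (wint_nonneg fun φ => Finset.sum_nonneg fun i _ => sq_nonneg (u i φ))).trans (hG x u hu)

lemma gap_torW (hA : Admissible n g τ₁ τ₂ Q) (N : ℕ) (v : Fin 4 → ℤ) (hs : 0 ≤ s)
    (hsτ : 2 * s + τ₂ ≤ 2) (hβ : τ₁ ≤ β) (hβν : τ₁ ≤ β - ν) (hν : -τ₂ ≤ ν) :
    Gap n (torW (trans (L ^ N)) v s) g ν
      (ν + ((n + 2) * g * (torusGreen L N β - 4 * s / β ^ 2) - tolf n g τ₁ τ₂ Q)) := by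
  intro x u hu
  rw [add_sub_cancel_left]
  have hJ := isWeight_torW (trans (L ^ N)) v hs
  refine wint_form_bound hA hJ (D := 8 + 2 * s) (fun y => (sum_torW _ _ _ _).le) (by linarith) hβ
    hβν hν (fun y => ?_) x hu
  have hβ0 := hA.hτ₁.trans_le hβ
  obtain ⟨A, ρ, h⟩ := hJ.exists_lyap hβ0 y
  exact ⟨A, ρ, h, torusGreen_le_lyap_trace N v hs hβ0 y h⟩

lemma uGap_of_lt (hL : 2 ≤ L) (hA : Admissible n g τ₁ τ₂ Q) (hτ : τ₂ ≤ 1) (hβ : τ₁ ≤ β)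
    (hβν : τ₁ < β - ν) (hν : -τ₂ < ν)
    (hm : m < ν + ((n + 2) * g * green β - tolf n g τ₁ τ₂ Q)) : UGap n L g ν m := by
  have hβ0 := hA.hτ₁.trans_le hβ
  have hg := hA.hg
  have h1 : ∀ᶠ η : ℝ in 𝓝[>] 0, 0 < η ∧ η ≤ 1 / 2 ∧ η ≤ β - ν - τ₁ ∧ η ≤ ν + τ₂ ∧
      m < ν - η + ((n + 2) * g * (green β - η - 4 * η / β ^ 2) - tolf n g τ₁ τ₂ Q) := by
    have hc : Continuous fun η : ℝ =>
        ν - η + ((n + 2) * g * (green β - η - 4 * η / β ^ 2) - tolf n g τ₁ τ₂ Q) := by fun_prop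
    have h0 : ∀ c : ℝ, 0 < c → ∀ᶠ η : ℝ in 𝓝[>] 0, η ≤ c := fun c hc =>
      eventually_nhdsWithin_of_eventually_nhds (ge_mem_nhds hc)
    refine eventually_mem_nhdsWithin.and ((h0 _ (by norm_num)).and ((h0 _ (by linarith)).and
      ((h0 _ (by linarith)).and ?_)))
    refine ((hc.tendsto 0).mono_left nhdsWithin_le_nhds).eventually (lt_mem_nhds ?_)
    simpa using hm
  obtain ⟨η, hη, h2, h3, h4, h5⟩ := h1.exists
  refine ⟨η, hη, fun v => ?_⟩
  filter_upwards [(tendsto_torusGreen hL hβ0).eventually (le_mem_nhds (sub_lt_self (green β) hη))]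
    with N hN ν' hν' s hs
  have h6 := gap_torW (L := L) (ν := ν') hA N v hs.1 (by linarith [hs.2]) hβ
    (by linarith [hν'.2]) (by linarith [hν'.1])
  refine h6.mono (h5.le.trans ?_)
  have h7 : 4 * s / β ^ 2 ≤ 4 * η / β ^ 2 := by
    have := hs.2
    gcongr
  have h8 : (n + 2) * g * (green β - η - 4 * η / β ^ 2) ≤
      (n + 2) * g * (torusGreen L N β - 4 * s / β ^ 2) :=
    mul_le_mul_of_nonneg_left (by linarith) (by positivity)
  linarith [hν'.1]

end GapConstruction

section TwoSidedBounds
variable {L n : ℕ} [NeZero L] [NeZero n] {g ν m a : ℝ}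

/-- The expectation of the squared field length at the origin of the torus. -/
def meanSq (L N n : ℕ) [NeZero L] (g ν : ℝ) : ℝ :=
  ev (latW L N) g ν fun φ : Torus L N × Fin n → ℝ => sN φ 0

/-- The susceptibility on the torus. -/
def torusSusc (L N n : ℕ) [NeZero L] [NeZero n] (g ν : ℝ) : ℝ :=
  ∑ x, ev (latW L N) g ν fun φ : Torus L N × Fin n → ℝ => φ (0, 0) * φ (x, 0)

lemma wint_latW_sum_sq (hg : 0 < g) (N : ℕ) :
    wint (pot (latW L N) g ν) (fun φ : Torus L N × Fin n → ℝ => (∑ y, 1 * φ (y, 0)) ^ 2) =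
      (L : ℝ) ^ (4 * N) * (torusSusc L N n g ν *
        wint (pot (latW L N) g ν) (fun _ : Torus L N × Fin n → ℝ => 1)) := by
  have hC := (nice_pot (n := n) (ν := ν) (isWeight_latW L N) hg).conf
  have hZ := wint_latW_one_pos (n := n) (L := L) (ν := ν) hg N
  have e1 : ∀ φ : Torus L N × Fin n → ℝ, (∑ y, 1 * φ (y, 0)) ^ 2 =
      ∑ x : Torus L N, ∑ y : Torus L N, φ (x, 0) * φ (x + y, 0) := fun φ => by
    rw [sq, Finset.sum_mul_sum]
    refine Finset.sum_congr rfl fun x _ => ?_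
    rw [← Equiv.sum_comp (Equiv.addLeft x)]
    simp
  have ht : ∀ x y : Torus L N, Tame fun φ : Torus L N × Fin n → ℝ => φ (x, 0) * φ (y, 0) :=
    fun x y => (Tame.coord _).mul (Tame.coord _)
  simp_rw [e1]
  rw [wint_sum hC _ fun x _ => Tame.sum _ fun y _ => ht _ _]
  have e2 : ∀ x : Torus L N, wint (pot (latW L N) g ν)
      (fun φ : Torus L N × Fin n → ℝ => ∑ y, φ (x, 0) * φ (x + y, 0)) =
      torusSusc L N n g ν * wint (pot (latW L N) g ν)
        (fun _ : Torus L N × Fin n → ℝ => 1) := fun x => by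
    rw [wint_sum hC _ fun y _ => ht _ _]
    unfold torusSusc ev
    rw [Finset.sum_mul]
    refine Finset.sum_congr rfl fun y _ => ?_
    rw [wint_latW_two_point_eq, div_mul_cancel₀ _ hZ.ne']
  rw [Finset.sum_congr rfl fun x _ => e2 x, Finset.sum_const, Finset.card_univ, nsmul_eq_mul,
    card_torus]

lemma wint_latW_coord_sq (hg : 0 < g) (N : ℕ) (x : Torus L N) (i : Fin n) :
    wint (pot (latW L N) g ν) (fun φ : Torus L N × Fin n → ℝ => φ (x, i) ^ 2) =
      meanSq L N n g ν / n *
        wint (pot (latW L N) g ν) (fun _ : Torus L N × Fin n → ℝ => 1) := by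
  have hZ := wint_latW_one_pos (n := n) (L := L) (ν := ν) hg N
  have hn : (n : ℝ) ≠ 0 := NeZero.ne _
  have h := wint_sN_component (ν := ν) (isWeight_latW L N) hg x i
  rw [wint_latW_sN_eq] at h
  unfold meanSq ev
  rw [h]
  field_simp

lemma wint_latW_sN (hg : 0 < g) (N : ℕ) (x : Torus L N) :
    wint (pot (latW L N) g ν) (fun φ : Torus L N × Fin n → ℝ => sN φ x) =
      meanSq L N n g ν *
        wint (pot (latW L N) g ν) (fun _ : Torus L N × Fin n → ℝ => 1) := by
  have hZ := wint_latW_one_pos (n := n) (L := L) (ν := ν) hg N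
  rw [wint_latW_sN_eq]
  unfold meanSq ev
  rw [div_mul_cancel₀ _ hZ.ne']

lemma torus_volume_pos (L N : ℕ) [NeZero L] : (0 : ℝ) < (L : ℝ) ^ (4 * N) := by
  have : (0 : ℝ) < L := Nat.cast_pos.2 (NeZero.pos L)
  positivity

lemma gl_const {Λ : Type*} [Fintype Λ] (J : Λ → Λ → ℝ) (c : ℝ) (x : Λ) :
    gl J (fun _ => c) x = 0 := by
  unfold gl
  simp

lemma Gap.torusSusc_le {N : ℕ} (hG : Gap n (latW L N) g ν m) (hg : 0 < g) (hm : 0 < m) :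
    torusSusc L N n g ν ≤ 1 / m := by
  have hZ := wint_latW_one_pos (n := n) (L := L) (ν := ν) hg N
  have h := hG.wint_linear_sq_le (isWeight_latW L N) hg hm.le 0 (ψ := fun _ => 1)
    (ξ := fun _ => 1 / m) fun y => by
      rw [gl_const]
      field_simp
      ring
  rw [wint_latW_sum_sq hg, Finset.sum_const, Finset.card_univ, nsmul_eq_mul, card_torus, one_mul,
    mul_assoc, mul_le_mul_iff_right₀ (torus_volume_pos L N), mul_le_mul_iff_left₀ hZ] at h
  exact h

lemma sum_ite_mul_eq {Λ : Type*} [Fintype Λ] [DecidableEq Λ] (x : Λ) (f : Λ → ℝ) :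
    ∑ y, (if y = x then 1 else 0) * f y = f x := by
  simp

lemma Gap.meanSq_le {N : ℕ} (hG : Gap n (latW L N) g ν m) (hg : 0 < g) (hm : 0 < m) :
    meanSq L N n g ν / n ≤ torusGreen L N m := by
  have hZ := wint_latW_one_pos (n := n) (L := L) (ν := ν) hg N
  obtain ⟨u, hu, hr⟩ := exists_resolvent_torus N hm (0 : Torus L N)
  have h := hG.wint_linear_sq_le (isWeight_latW L N) hg hm.le 0 hr
  simp_rw [sum_ite_mul_eq] at h
  rw [wint_latW_coord_sq hg, hu, mul_le_mul_iff_left₀ hZ] at h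
  exact h

lemma mass_bound_wint (hg : 0 < g) {N : ℕ}
    (ha : ν + (n + 2) * g * (meanSq L N n g ν / n) ≤ a) (y : Torus L N) :
    ν * wint (pot (latW L N) g ν) (fun _ : Torus L N × Fin n → ℝ => 1) +
      g * wint (pot (latW L N) g ν) (fun φ : Torus L N × Fin n → ℝ => sN φ y) +
      2 * g * wint (pot (latW L N) g ν) (fun φ : Torus L N × Fin n → ℝ => φ (y, 0) ^ 2) ≤
      a * wint (pot (latW L N) g ν) (fun _ : Torus L N × Fin n → ℝ => 1) := by
  have hZ := wint_latW_one_pos (n := n) (L := L) (ν := ν) hg N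
  have hn : (n : ℝ) ≠ 0 := NeZero.ne _
  rw [wint_latW_sN hg, wint_latW_coord_sq hg]
  refine le_trans (le_of_eq ?_) (mul_le_mul_of_nonneg_right ha hZ.le)
  field_simp
  ring

lemma le_torusSusc (hg : 0 < g) (ha0 : 0 < a) {N : ℕ}
    (ha : ν + (n + 2) * g * (meanSq L N n g ν / n) ≤ a) : 1 / a ≤ torusSusc L N n g ν := by
  have hZ := wint_latW_one_pos (n := n) (L := L) (ν := ν) hg N
  have h := wint_linear_sq_ge (isWeight_latW L N) hg 0 (mass_bound_wint hg ha) (ψ := fun _ => 1)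
    (ξ := fun _ => 1 / a) fun y => by
      rw [gl_const]
      field_simp
      ring
  rw [wint_latW_sum_sq hg, Finset.sum_const, Finset.card_univ, nsmul_eq_mul, card_torus, one_mul,
    mul_assoc, mul_le_mul_iff_right₀ (torus_volume_pos L N), mul_le_mul_iff_left₀ hZ] at h
  exact h

lemma torusGreen_le_meanSq (hg : 0 < g) (ha0 : 0 < a) {N : ℕ}
    (ha : ν + (n + 2) * g * (meanSq L N n g ν / n) ≤ a) :
    torusGreen L N a ≤ meanSq L N n g ν / n := by
  have hZ := wint_latW_one_pos (n := n) (L := L) (ν := ν) hg N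
  obtain ⟨u, hu, hr⟩ := exists_resolvent_torus N ha0 (0 : Torus L N)
  have h := wint_linear_sq_ge (isWeight_latW L N) hg 0 (mass_bound_wint hg ha) hr
  simp_rw [sum_ite_mul_eq] at h
  rw [wint_latW_coord_sq hg, hu, mul_le_mul_iff_left₀ hZ] at h
  exact h

/-- Infinite-volume consequences of a uniform gap: the two-point function lies between those of
Gaussian fields of masses `m` and `a`. -/
lemma UGap.infinite_volume (hL : 2 ≤ L) (hG : UGap n L g ν m) (hm : 0 < m) (hg : 0 < g)
    {p : ℝ → ℝ} (hp : ∀ ν', Tendsto (fun N : ℕ => ((L : ℝ) ^ (4 * N))⁻¹ * fe n (latW L N) g ν')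
      atTop (𝓝 (p ν'))) :
    ∃ M χ, Tendsto (fun N => meanSq L N n g ν) atTop (𝓝 M) ∧
      Tendsto (fun N => torusSusc L N n g ν) atTop (𝓝 χ) ∧ HasDerivAt p (-(M / 2)) ν ∧
      χ ≤ 1 / m ∧ M / n ≤ green m ∧
      ∀ a, 0 < a → ν + (n + 2) * g * green m < a → 1 / a ≤ χ ∧ green a ≤ M / n := by
  obtain ⟨M, hM, hd⟩ := hG.hasDerivAt_pressure hm hg hp
  obtain ⟨χ, hχ⟩ := hG.exists_tendsto_sum_two_point hm hg hL hM
  have hM' : Tendsto (fun N => meanSq L N n g ν / n) atTop (𝓝 (M / n)) := hM.div_const _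
  have hMg := le_of_tendsto_of_tendsto hM' (tendsto_torusGreen hL hm)
    (hG.eventually_gap.mono fun N hN => hN.meanSq_le hg hm)
  refine ⟨M, χ, hM, hχ, hd, le_of_tendsto hχ
    (hG.eventually_gap.mono fun N hN => hN.torusSusc_le hg hm), hMg, fun a ha h => ?_⟩
  have h1 : ν + (n + 2) * g * (M / n) < a :=
    lt_of_le_of_lt (by have : 0 ≤ (n + 2) * g := by positivity
                       have := mul_le_mul_of_nonneg_left hMg this
                       linarith) h
  have h2 : ∀ᶠ N in atTop, ν + (n + 2) * g * (meanSq L N n g ν / n) ≤ a :=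
    ((hM'.const_mul _).const_add ν).eventually (ge_mem_nhds h1)
  exact ⟨ge_of_tendsto hχ (h2.mono fun N hN => le_torusSusc hg ha hN),
    le_of_tendsto_of_tendsto (tendsto_torusGreen hL ha) hM'
      (h2.mono fun N hN => torusGreen_le_meanSq hg ha hN)⟩

end TwoSidedBounds

section GreenEstimates
variable {a b m : ℝ} {k : Fin 4 → ℝ}

/-- The open unit cube. -/
def openCube : Set (Fin 4 → ℝ) := Set.univ.pi fun _ => Set.Ioo 0 1

lemma measurableSet_openCube : MeasurableSet openCube :=
  MeasurableSet.univ_pi fun _ => measurableSet_Ioo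

lemma volume_openCube : volume openCube = 1 := by
  unfold openCube
  rw [volume_pi_pi]
  simp

lemma green_eq (m : ℝ) : green m = ∫ k in openCube, (lam k + m)⁻¹ := by
  unfold green cube openCube
  refine (setIntegral_congr_set ?_).symm
  exact (Measure.univ_pi_Ioo_ae_eq_Icc (μ := fun _ : Fin 4 => (volume : Measure ℝ))
    (f := fun _ => 0) (g := fun _ => 1)).trans (by rw [Set.pi_univ_Icc]; exact ae_eq_refl _)

lemma sin_pos_of_mem_Ioo {t : ℝ} (ht : t ∈ Set.Ioo (0 : ℝ) 1) : 0 < Real.sin (Real.pi * t) :=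
  Real.sin_pos_of_pos_of_lt_pi (mul_pos Real.pi_pos ht.1)
    (mul_lt_of_lt_one_right Real.pi_pos ht.2)

lemma lam_pos (hk : k ∈ openCube) : 0 < lam k := by
  unfold lam
  refine mul_pos (by norm_num) (Finset.sum_pos (fun j _ => ?_) Finset.univ_nonempty)
  exact pow_pos (sin_pos_of_mem_Ioo (hk j (Set.mem_univ j))) 2

lemma lam_le (k : Fin 4 → ℝ) : lam k ≤ 16 := by
  unfold lam
  have : ∑ j : Fin 4, Real.sin (Real.pi * k j) ^ 2 ≤ ∑ j : Fin 4, (1 : ℝ) :=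
    Finset.sum_le_sum fun j _ => Real.sin_sq_le_one _
  simp at this
  linarith

lemma prod_sin_le_lam (hk : k ∈ openCube) :
    ∏ j, Real.sin (Real.pi * k j) ^ (1 / 2 : ℝ) ≤ lam k := by
  have hs : ∀ j, 0 < Real.sin (Real.pi * k j) := fun j =>
    sin_pos_of_mem_Ioo (hk j (Set.mem_univ j))
  have h := Real.geom_mean_le_arith_mean_weighted Finset.univ (fun _ : Fin 4 => (1 / 4 : ℝ))
    (fun j => Real.sin (Real.pi * k j) ^ 2) (fun _ _ => by norm_num) (by simp)
    (fun j _ => sq_nonneg _)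
  have e : ∀ j, (Real.sin (Real.pi * k j) ^ 2) ^ (1 / 4 : ℝ) =
      Real.sin (Real.pi * k j) ^ (1 / 2 : ℝ) := fun j => by
    rw [← Real.rpow_natCast, ← Real.rpow_mul (hs j).le]
    norm_num
  simp_rw [e] at h
  refine h.trans ?_
  unfold lam
  rw [← Finset.mul_sum]
  have : 0 ≤ ∑ j, Real.sin (Real.pi * k j) ^ 2 := Finset.sum_nonneg fun j _ => sq_nonneg _
  linarith

lemma sin_rpow_neg_le {t s : ℝ} (ht : t ∈ Set.Ioo (0 : ℝ) 1) (hs : 0 ≤ s) :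
    Real.sin (Real.pi * t) ^ (-s) ≤ t ^ (-s) + (1 - t) ^ (-s) := by
  have h1 : 0 < 1 - t := by linarith [ht.2]
  have key : ∀ r : ℝ, 0 < r → r ≤ 1 / 2 → r ≤ Real.sin (Real.pi * r) := fun r hr hr2 => by
    have := Real.mul_le_sin (x := Real.pi * r) (by positivity)
      (by have := Real.pi_pos; nlinarith)
    have e : 2 / Real.pi * (Real.pi * r) = 2 * r := by field_simp
    linarith
  rcases le_total t (1 / 2) with h | h
  · have := Real.rpow_le_rpow_of_nonpos ht.1 (key t ht.1 h) (neg_nonpos.2 hs)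
    have := Real.rpow_nonneg h1.le (-s)
    linarith
  · have h2 := key (1 - t) h1 (by linarith)
    rw [mul_sub, mul_one, Real.sin_pi_sub] at h2
    have := Real.rpow_le_rpow_of_nonpos h1 h2 (neg_nonpos.2 hs)
    have := Real.rpow_nonneg ht.1.le (-s)
    linarith

lemma integrableOn_sin_rpow {s : ℝ} (hs0 : 0 ≤ s) (hs : s < 1) :
    IntegrableOn (fun t : ℝ => Real.sin (Real.pi * t) ^ (-s)) (Set.Ioo 0 1) := by
  have h1 : IntegrableOn (fun t : ℝ => t ^ (-s)) (Set.Ioo 0 1) := by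
    have := intervalIntegral.intervalIntegrable_rpow' (a := 0) (b := 1) (r := -s) (by linarith)
    rw [intervalIntegrable_iff_integrableOn_Ioo_of_le zero_le_one] at this
    exact this
  have h2 : IntegrableOn (fun t : ℝ => (1 - t) ^ (-s)) (Set.Ioo 0 1) := by
    have := (intervalIntegral.intervalIntegrable_rpow' (a := 0) (b := 1) (r := -s)
      (by linarith)).comp_sub_left 1
    rw [sub_zero, sub_self] at this
    have := this.symm
    rw [intervalIntegrable_iff_integrableOn_Ioo_of_le zero_le_one] at this
    exact this
  refine (h1.add h2).mono'
    ((by fun_prop : Measurable fun t : ℝ =>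
      Real.sin (Real.pi * t)).pow_const _).aestronglyMeasurable ?_
  refine (ae_restrict_iff' measurableSet_Ioo).2 (ae_of_all _ fun t ht => ?_)
  rw [Real.norm_of_nonneg (Real.rpow_nonneg (sin_pos_of_mem_Ioo ht).le _)]
  exact sin_rpow_neg_le ht hs0

lemma integrableOn_lam_rpow {r : ℝ} (hr0 : 0 ≤ r) (hr : r < 2) :
    IntegrableOn (fun k => lam k ^ (-r)) openCube := by
  have h1 : IntegrableOn (fun k : Fin 4 → ℝ => ∏ j, Real.sin (Real.pi * k j) ^ (-(r / 2)))
      openCube := by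
    unfold IntegrableOn openCube
    rw [volume_pi, Measure.restrict_pi_pi]
    exact Integrable.fintype_prod fun _ =>
      integrableOn_sin_rpow (s := r / 2) (by linarith) (by linarith)
  refine h1.mono' (continuous_lam.measurable.pow_const _).aestronglyMeasurable ?_
  refine (ae_restrict_iff' measurableSet_openCube).2 (ae_of_all _ fun k hk => ?_)
  rw [Real.norm_of_nonneg (Real.rpow_nonneg (lam_nonneg k) _)]
  have hs : ∀ j, 0 < Real.sin (Real.pi * k j) := fun j =>
    sin_pos_of_mem_Ioo (hk j (Set.mem_univ j))
  have h2 := Real.rpow_le_rpow_of_nonpos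
    (Finset.prod_pos fun j _ => Real.rpow_pos_of_pos (hs j) (1 / 2 : ℝ)) (prod_sin_le_lam hk)
    (neg_nonpos.2 hr0)
  refine h2.trans (le_of_eq ?_)
  rw [← Real.finsetProd_rpow _ _ fun j _ => (Real.rpow_pos_of_pos (hs j) _).le]
  refine Finset.prod_congr rfl fun j _ => ?_
  rw [← Real.rpow_mul (hs j).le]
  congr 1
  ring

lemma integrableOn_green (hm : 0 ≤ m) : IntegrableOn (fun k => (lam k + m)⁻¹) openCube := by
  have h := integrableOn_lam_rpow zero_le_one one_lt_two
  refine h.mono' (continuous_lam.measurable.add_const m).inv.aestronglyMeasurable ?_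
  refine (ae_restrict_iff' measurableSet_openCube).2 (ae_of_all _ fun k hk => ?_)
  have := lam_pos hk
  rw [Real.norm_of_nonneg (by positivity), Real.rpow_neg_one]
  exact inv_anti₀ this (by linarith)

lemma green_anti (ha : 0 ≤ a) (hab : a ≤ b) : green b ≤ green a := by
  rw [green_eq, green_eq]
  refine setIntegral_mono_on (integrableOn_green (ha.trans hab)) (integrableOn_green ha)
    measurableSet_openCube fun k hk => ?_
  have := lam_pos hk
  exact inv_anti₀ (by linarith) (by linarith)

lemma le_green (hm : 0 ≤ m) : (16 + m)⁻¹ ≤ green m := by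
  rw [green_eq]
  have h1 : ∫ k in openCube, (16 + m)⁻¹ = (16 + m)⁻¹ := by
    rw [setIntegral_const, measureReal_def, volume_openCube]
    simp
  rw [← h1]
  refine setIntegral_mono_on (integrableOn_const (by rw [volume_openCube]; simp))
    (integrableOn_green hm) measurableSet_openCube fun k hk => ?_
  have := lam_pos hk
  exact inv_anti₀ (by linarith) (by linarith [lam_le k])

/-- The infrared integral controlling the regularity of the Green function in the mass. -/
def infrared (α : ℝ) : ℝ := ∫ k in openCube, lam k ^ (-(1 + α))

lemma infrared_nonneg (α : ℝ) : 0 ≤ infrared α :=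
  setIntegral_nonneg measurableSet_openCube fun k _ => Real.rpow_nonneg (lam_nonneg k) _

lemma green_zero_sub_le {α : ℝ} (h0 : 0 ≤ α) (h1 : α < 1) (hm : 0 < m) :
    green 0 - green m ≤ infrared α * m ^ α := by
  rw [green_eq, green_eq, ← integral_sub (integrableOn_green le_rfl) (integrableOn_green hm.le)]
  unfold infrared
  rw [← integral_mul_const]
  refine setIntegral_mono_on ((integrableOn_green le_rfl).sub (integrableOn_green hm.le))
    ((integrableOn_lam_rpow (by linarith) (by linarith)).mul_const _) measurableSet_openCube
    fun k hk => ?_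
  have hl := lam_pos hk
  have e : (lam k + 0)⁻¹ - (lam k + m)⁻¹ = (lam k)⁻¹ * (m / (lam k + m)) := by
    rw [add_zero]
    field_simp
    ring
  have e2 : lam k ^ (-(1 + α)) * m ^ α = (lam k)⁻¹ * (m / lam k) ^ α := by
    rw [neg_add, Real.rpow_add hl, Real.rpow_neg_one, Real.div_rpow hm.le hl.le,
      Real.rpow_neg hl.le]
    ring
  rw [e, e2]
  refine mul_le_mul_of_nonneg_left ?_ (by positivity)
  rcases le_total (m / lam k) 1 with h | h
  · refine (div_le_div_of_nonneg_left hm.le hl (by linarith)).trans ?_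
    have := Real.rpow_le_rpow_of_exponent_ge (x := m / lam k) (by positivity) h h1.le
    rwa [Real.rpow_one] at this
  · have h3 : m / (lam k + m) ≤ 1 := by
      rw [div_le_one (by positivity)]
      linarith
    exact h3.trans (Real.one_le_rpow h h0)

lemma green_sub_le {α : ℝ} (h0 : 0 ≤ α) (h1 : α < 1) (hm : 0 < m) (hma : m ≤ a) :
    green m - green a ≤ infrared α * ((a - m) * m ^ (α - 1)) := by
  have ha := hm.trans_le hma
  rw [green_eq, green_eq, ← integral_sub (integrableOn_green hm.le) (integrableOn_green ha.le)]
  unfold infrared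
  rw [← integral_mul_const]
  refine setIntegral_mono_on ((integrableOn_green hm.le).sub (integrableOn_green ha.le))
    ((integrableOn_lam_rpow (by linarith) (by linarith)).mul_const _) measurableSet_openCube
    fun k hk => ?_
  have hl := lam_pos hk
  have hlm : 0 < lam k + m := by linarith
  have hla : 0 < lam k + a := by linarith
  have e : (lam k + m)⁻¹ - (lam k + a)⁻¹ = (a - m) * ((lam k + m)⁻¹ * (lam k + a)⁻¹) := by
    field_simp
    ring
  rw [e, mul_left_comm (lam k ^ _)]
  refine mul_le_mul_of_nonneg_left ?_ (sub_nonneg.2 hma)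
  have h2 : (lam k + m)⁻¹ * (lam k + a)⁻¹ ≤ (lam k + m) ^ (-(1 + α)) * (lam k + m) ^ (α - 1) := by
    rw [← Real.rpow_add hlm, show -(1 + α) + (α - 1) = -2 by ring, Real.rpow_neg hlm.le,
      Real.rpow_two, sq, mul_inv]
    exact mul_le_mul_of_nonneg_left (inv_anti₀ hlm (by linarith)) (inv_nonneg.2 hlm.le)
  refine h2.trans (mul_le_mul ?_ ?_ (Real.rpow_nonneg hlm.le _) (Real.rpow_nonneg hl.le _))
  · exact Real.rpow_le_rpow_of_nonpos hl (by linarith) (by linarith)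
  · exact Real.rpow_le_rpow_of_nonpos hm (by linarith) (by linarith)

end GreenEstimates

section Parameters
variable {n : ℕ} {h ε : ℝ}

/-- The infrared integral at the exponent used throughout. -/
def irConst : ℝ := infrared (49 / 50)

/-- The constant in the error of the form bound. -/
def tolConst (n : ℕ) : ℝ := 360 * (n + 9) ^ 2 + 3 / 2

/-- The constant of the second-order correction to the critical point. -/
def corrConst (n : ℕ) : ℝ := 2 * ((n + 2) * irConst) + tolConst n + 2

/-- Smallness conditions on the coupling `h ^ 24`. -/
structure SmallCoupling (n : ℕ) (h : ℝ) : Prop where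
  pos : 0 < h
  le_one : h ≤ 1
  num : 960 * h ≤ 1
  comp : 6 * n * h ≤ 1
  crit : corrConst n * h ^ (49 / 50 : ℝ) < (n + 2) * green 0
  shift : (n + 2) * green 0 * h < 1
  ir : 4 * ((n + 2) * irConst) * h ≤ 1

/-- An approximate critical point, strictly above the true one. -/
def nuCrit (n : ℕ) (h : ℝ) : ℝ :=
  -((n + 2) * h ^ 24 * green 0) + corrConst n * (h ^ 24 * h ^ (49 / 50 : ℝ))

/-- The auxiliary mass at distance `ε` from `nuCrit`. -/
def auxMass (n : ℕ) (h ε : ℝ) : ℝ := max (nuCrit n h + ε) 0 + 2 * h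

/-- The lower mass bound at distance `ε` from `nuCrit`. -/
def lowMass (n : ℕ) (h ε : ℝ) : ℝ :=
  nuCrit n h + ε + ((n + 2) * h ^ 24 * green (auxMass n h ε) - (tolConst n + 1) * h ^ 25)

/-- The upper mass bound at distance `ε` from `nuCrit`. -/
def highMass (n : ℕ) (h ε : ℝ) : ℝ :=
  lowMass n h ε + corrConst n * (h ^ 24 * (auxMass n h ε ^ (49 / 50 : ℝ) + h))

lemma irConst_nonneg : 0 ≤ irConst := infrared_nonneg _

lemma tolConst_pos (n : ℕ) : 0 < tolConst n := by
  unfold tolConst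
  positivity

lemma corrConst_pos (n : ℕ) : 0 < corrConst n := by
  have := tolConst_pos n
  have := irConst_nonneg
  unfold corrConst
  positivity

lemma green_zero_pos : 0 < green 0 := by
  have := le_green le_rfl
  exact lt_of_lt_of_le (by norm_num) this

lemma exists_smallCoupling (n : ℕ) : ∃ h₀ > 0, ∀ h, 0 < h → h ≤ h₀ → SmallCoupling n h := by
  have hG := green_zero_pos
  have hlin : ∀ A : ℝ, ∀ᶠ h : ℝ in 𝓝[>] 0, A * h < 1 := fun A => by
    have hc : Continuous fun h : ℝ => A * h := by fun_prop
    refine ((hc.tendsto 0).mono_left nhdsWithin_le_nhds).eventually (gt_mem_nhds ?_)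
    simp
  have hcrit : ∀ᶠ h : ℝ in 𝓝[>] 0,
      corrConst n * h ^ (49 / 50 : ℝ) < (n + 2) * green 0 := by
    have hc : Continuous fun h : ℝ => corrConst n * h ^ (49 / 50 : ℝ) :=
      continuous_const.mul (Real.continuous_rpow_const (by norm_num))
    refine ((hc.tendsto 0).mono_left nhdsWithin_le_nhds).eventually (gt_mem_nhds ?_)
    rw [Real.zero_rpow (by norm_num), mul_zero]
    positivity
  have h1 : ∀ᶠ h : ℝ in 𝓝[>] 0, SmallCoupling n h := by
    filter_upwards [eventually_mem_nhdsWithin, hlin 1, hlin 960, hlin (6 * n), hcrit,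
      hlin ((n + 2) * green 0), hlin (4 * ((n + 2) * irConst))] with h h1 h2 h3 h4 h5 h6 h7
    exact ⟨h1, by linarith, h3.le, h4.le, h5, h6, h7.le⟩
  obtain ⟨u, hu, hs⟩ := (mem_nhdsGT_iff_exists_Ioc_subset (a := (0 : ℝ))).1 h1
  exact ⟨u, hu, fun h h0 h1 => hs ⟨h0, h1⟩⟩

namespace SmallCoupling

lemma coupling_pos (S : SmallCoupling n h) : 0 < h ^ 24 := pow_pos S.pos 24

lemma le_rpow (S : SmallCoupling n h) : h ≤ h ^ (49 / 50 : ℝ) := by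
  have := Real.rpow_le_rpow_of_exponent_ge S.pos S.le_one (by norm_num : (49 / 50 : ℝ) ≤ 1)
  rwa [Real.rpow_one] at this

lemma rpow_le_one (S : SmallCoupling n h) : h ^ (49 / 50 : ℝ) ≤ 1 :=
  Real.rpow_le_one S.pos.le S.le_one (by norm_num)

lemma nuCrit_neg (S : SmallCoupling n h) : nuCrit n h < 0 := by
  unfold nuCrit
  have := mul_lt_mul_of_pos_left S.crit S.coupling_pos
  linarith

lemma neg_lt_nuCrit (S : SmallCoupling n h) : -h ^ 12 < nuCrit n h := by
  have h0 := S.pos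
  have h1 : 0 ≤ corrConst n * (h ^ 24 * h ^ (49 / 50 : ℝ)) := by
    have := corrConst_pos n
    positivity
  have h2 : (n + 2) * h ^ 24 * green 0 < h ^ 12 := by
    have e : (n + 2) * h ^ 24 * green 0 = h ^ 12 * ((n + 2) * green 0 * h * h ^ 11) := by ring
    rw [e]
    refine mul_lt_of_lt_one_right (by positivity) ?_
    refine lt_of_le_of_lt (mul_le_of_le_one_right ?_ (pow_le_one₀ h0.le S.le_one)) S.shift
    have := green_zero_pos
    positivity
  unfold nuCrit
  linarith

lemma admissible (S : SmallCoupling n h) : Admissible n (h ^ 24) h (h ^ 12) ((h ^ 15)⁻¹) := by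
  have h0 := S.pos
  have hp : ∀ k : ℕ, h ^ (k + 1) ≤ h := fun k => by
    rw [pow_succ]
    exact mul_le_of_le_one_left h0.le (pow_le_one₀ h0.le S.le_one)
  refine ⟨S.coupling_pos, h0, by positivity, by positivity, ?_, ?_, le_of_eq (by ring), ?_⟩
  · have e : 24 * h ^ 24 = h ^ 2 * (24 * h ^ 22) := by ring
    rw [e]
    refine mul_le_of_le_one_right (by positivity) ?_
    have h22 : h ^ 22 ≤ h := hp 21
    linarith [S.num]
  · have e : 6 * n * h ^ 24 = h ^ 2 * (6 * n * h ^ 22) := by ring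
    rw [e]
    refine mul_le_of_le_one_right (by positivity) ?_
    exact (mul_le_mul_of_nonneg_left (hp 21) (by positivity)).trans S.comp
  · have e : 960 * h ^ 24 = h ^ 2 * h ^ 12 * (960 * h ^ 10) := by ring
    rw [e]
    refine mul_le_of_le_one_right (by positivity) ?_
    have h10 : h ^ 10 ≤ h := hp 9
    linarith [S.num]

lemma tolf_eq (S : SmallCoupling n h) :
    tolf n (h ^ 24) h (h ^ 12) ((h ^ 15)⁻¹) = tolConst n * h ^ 25 := by
  have h0 := S.pos.ne'
  unfold tolf tolConst
  field_simp

lemma auxMass_ge : 2 * h ≤ auxMass n h ε := by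
  unfold auxMass
  linarith [le_max_right (nuCrit n h + ε) 0]

lemma auxMass_pos (S : SmallCoupling n h) : 0 < auxMass n h ε := by
  linarith [auxMass_ge (n := n) (h := h) (ε := ε), S.pos]

lemma auxMass_le (S : SmallCoupling n h) (hε : 0 < ε) : auxMass n h ε ≤ ε + 2 * h := by
  unfold auxMass
  have := max_le (by linarith [S.nuCrit_neg] : nuCrit n h + ε ≤ ε) hε.le
  linarith

lemma uGap (S : SmallCoupling n h) {L : ℕ} [NeZero L] (hL : 2 ≤ L) (hε : 0 < ε) :
    UGap n L (h ^ 24) (nuCrit n h + ε) (lowMass n h ε) := by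
  have h0 := S.pos
  refine uGap_of_lt hL S.admissible (pow_le_one₀ h0.le S.le_one)
    (by linarith [auxMass_ge (n := n) (h := h) (ε := ε)] : h ≤ auxMass n h ε) ?_ (by linarith [S.neg_lt_nuCrit]) ?_
  · unfold auxMass
    linarith [le_max_left (nuCrit n h + ε) 0]
  · rw [S.tolf_eq]
    unfold lowMass
    have : 0 < h ^ 25 := by positivity
    linarith

lemma coupling_sub_green_le (S : SmallCoupling n h) :
    (n + 2) * h ^ 24 * (green 0 - green (auxMass n h ε)) ≤
      (n + 2) * irConst * (h ^ 24 * auxMass n h ε ^ (49 / 50 : ℝ)) := by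
  have := green_zero_sub_le (α := 49 / 50) (by norm_num) (by norm_num) (S.auxMass_pos (ε := ε))
  have h1 : 0 ≤ (n + 2) * h ^ 24 := by
    have := S.pos
    positivity
  refine (mul_le_mul_of_nonneg_left this h1).trans (le_of_eq ?_)
  unfold irConst
  ring

lemma auxMass_rpow_le (S : SmallCoupling n h) (hε : 0 < ε) :
    h ^ 24 * auxMass n h ε ^ (49 / 50 : ℝ) ≤ 2 * (h * ε + h ^ 24 * h ^ (49 / 50 : ℝ)) := by
  have h0 := S.pos
  have hβ := S.auxMass_pos (ε := ε)
  have e : ∀ t : ℝ, 0 < t → t ^ (49 / 50 : ℝ) = t * t ^ (-(1 / 50) : ℝ) := fun t ht => by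
    conv_rhs => rw [← Real.rpow_one_add' ht.le (by norm_num)]
    norm_num
  have h1 : auxMass n h ε ^ (-(1 / 50) : ℝ) ≤ h ^ (-(1 / 50) : ℝ) :=
    Real.rpow_le_rpow_of_nonpos h0 (by linarith [auxMass_ge (n := n) (h := h) (ε := ε)]) (by norm_num)
  have h2 : auxMass n h ε ^ (49 / 50 : ℝ) ≤ (ε + 2 * h) * h ^ (-(1 / 50) : ℝ) := by
    rw [e _ hβ]
    exact mul_le_mul (S.auxMass_le hε) h1 (Real.rpow_nonneg hβ.le _) (by positivity)
  have h3 : h ^ 24 * h ^ (-(1 / 50) : ℝ) ≤ h := by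
    have : h ^ 24 * h ^ (-(1 / 50) : ℝ) = h ^ 23 * h ^ (49 / 50 : ℝ) := by
      rw [e h h0]
      ring
    rw [this, pow_succ, mul_right_comm]
    refine mul_le_of_le_one_left h0.le ?_
    exact mul_le_one₀ (pow_le_one₀ h0.le S.le_one) (by positivity) S.rpow_le_one
  have h4 := mul_le_mul_of_nonneg_left h2 S.coupling_pos.le
  have h5 := mul_le_mul_of_nonneg_right h3 hε.le
  rw [e h h0]
  have : 0 ≤ h * ε := by positivity
  linarith

lemma le_lowMass (S : SmallCoupling n h) (hε : 0 < ε) :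
    ε / 2 + h ^ 24 * h ^ (49 / 50 : ℝ) ≤ lowMass n h ε := by
  have h1 := S.coupling_sub_green_le (ε := ε)
  have hc : 0 ≤ (n + 2) * irConst := by
    have := irConst_nonneg
    positivity
  have h2 := mul_le_mul_of_nonneg_left (S.auxMass_rpow_le hε) hc
  have h3 := mul_le_mul_of_nonneg_right S.ir hε.le
  have h4 : (tolConst n + 1) * h ^ 25 ≤ (tolConst n + 1) * (h ^ 24 * h ^ (49 / 50 : ℝ)) := by
    refine mul_le_mul_of_nonneg_left ?_ (by linarith [tolConst_pos n])
    rw [pow_succ]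
    exact mul_le_mul_of_nonneg_left S.le_rpow S.coupling_pos.le
  unfold lowMass nuCrit corrConst
  linarith

lemma lowMass_pos (S : SmallCoupling n h) (hε : 0 < ε) : 0 < lowMass n h ε := by
  have h0 := S.pos
  refine lt_of_lt_of_le ?_ (S.le_lowMass hε)
  positivity

lemma lowMass_le (S : SmallCoupling n h) :
    lowMass n h ε ≤ ε + corrConst n * (h ^ 24 * h ^ (49 / 50 : ℝ)) := by
  have h0 := S.pos
  have h1 : (n + 2) * h ^ 24 * green (auxMass n h ε) ≤ (n + 2) * h ^ 24 * green 0 :=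
    mul_le_mul_of_nonneg_left (green_anti le_rfl S.auxMass_pos.le) (by positivity)
  have h2 : 0 ≤ (tolConst n + 1) * h ^ 25 := by
    have := tolConst_pos n
    positivity
  unfold lowMass nuCrit
  linarith

lemma lowMass_le_highMass (S : SmallCoupling n h) : lowMass n h ε ≤ highMass n h ε := by
  have h0 := S.pos
  have := corrConst_pos n
  have := S.auxMass_pos (ε := ε)
  unfold highMass
  exact le_add_of_nonneg_right (by positivity)

lemma lt_highMass (S : SmallCoupling n h) (hε : 0 < ε) :
    nuCrit n h + ε + (n + 2) * h ^ 24 * green (lowMass n h ε) < highMass n h ε := by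
  have h0 := S.pos
  have hβ := S.auxMass_pos (ε := ε)
  have h1 := S.coupling_sub_green_le (ε := ε)
  have h2 : (n + 2) * h ^ 24 * green (lowMass n h ε) ≤ (n + 2) * h ^ 24 * green 0 :=
    mul_le_mul_of_nonneg_left (green_anti le_rfl (S.lowMass_pos hε).le) (by positivity)
  have h3 : 0 ≤ ((n + 2) * irConst) * (h ^ 24 * auxMass n h ε ^ (49 / 50 : ℝ)) := by
    have := irConst_nonneg
    positivity
  have h4 : 0 ≤ (tolConst n + 2) * (h ^ 24 * auxMass n h ε ^ (49 / 50 : ℝ)) := by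
    have := tolConst_pos n
    positivity
  have h5 : 0 ≤ ((n + 2) * irConst) * (h ^ 24 * h) := by
    have := irConst_nonneg
    positivity
  have h6 : 0 < h ^ 24 * h := by positivity
  have hlow : lowMass n h ε = nuCrit n h + ε +
    ((n + 2) * h ^ 24 * green (auxMass n h ε) - (tolConst n + 1) * (h ^ 24 * h)) := rfl
  unfold highMass corrConst
  linarith

lemma auxMass_rpow_add_le (S : SmallCoupling n h) (hε : 0 < ε) (h1 : ε ≤ h) :
    auxMass n h ε ^ (49 / 50 : ℝ) + h ≤ 4 * h ^ (49 / 50 : ℝ) := by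
  have h2 : auxMass n h ε ^ (49 / 50 : ℝ) ≤ (3 * h) ^ (49 / 50 : ℝ) :=
    Real.rpow_le_rpow S.auxMass_pos.le (by linarith [S.auxMass_le hε]) (by norm_num)
  rw [Real.mul_rpow (by norm_num) S.pos.le] at h2
  have h3 : (3 : ℝ) ^ (49 / 50 : ℝ) ≤ 3 :=
    Real.rpow_le_self_of_one_le (by norm_num) (by norm_num)
  have := mul_le_mul_of_nonneg_right h3 (Real.rpow_nonneg S.pos.le (49 / 50 : ℝ))
  linarith [S.le_rpow]

lemma auxMass_rpow_add_le' (S : SmallCoupling n h) (hε : 0 < ε) (h1 : h ≤ ε) :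
    auxMass n h ε ^ (49 / 50 : ℝ) + h ≤ 4 * ε ^ (49 / 50 : ℝ) := by
  have h2 : auxMass n h ε ^ (49 / 50 : ℝ) ≤ (3 * ε) ^ (49 / 50 : ℝ) :=
    Real.rpow_le_rpow S.auxMass_pos.le (by linarith [S.auxMass_le hε]) (by norm_num)
  rw [Real.mul_rpow (by norm_num) hε.le] at h2
  have h3 : (3 : ℝ) ^ (49 / 50 : ℝ) ≤ 3 :=
    Real.rpow_le_self_of_one_le (by norm_num) (by norm_num)
  have := mul_le_mul_of_nonneg_right h3 (Real.rpow_nonneg hε.le (49 / 50 : ℝ))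
  have := Real.rpow_le_rpow S.pos.le h1 (by norm_num : (0 : ℝ) ≤ 49 / 50)
  linarith [S.le_rpow]

lemma mass_ratio_le (S : SmallCoupling n h) (hε : 0 < ε) (hε1 : ε ≤ 1) :
    (auxMass n h ε ^ (49 / 50 : ℝ) + h) * lowMass n h ε ^ (49 / 50 - 1 : ℝ) ≤ 8 := by
  have h0 := S.pos
  have hm := S.le_lowMass hε
  have hm0 := Real.rpow_nonneg (S.lowMass_pos hε).le (49 / 50 - 1 : ℝ)
  rcases le_total ε h with h1 | h1
  · have h2 : h ^ 25 ≤ lowMass n h ε := by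
      have := mul_le_mul_of_nonneg_left S.le_rpow S.coupling_pos.le
      rw [← pow_succ] at this
      linarith
    have h3 : lowMass n h ε ^ (49 / 50 - 1 : ℝ) ≤ h ^ (-(1 / 2) : ℝ) := by
      refine (Real.rpow_le_rpow_of_nonpos (by positivity) h2 (by norm_num)).trans (le_of_eq ?_)
      rw [← Real.rpow_natCast, ← Real.rpow_mul h0.le]
      norm_num
    have h4 := mul_le_mul (S.auxMass_rpow_add_le hε h1) h3 hm0 (by positivity)
    have h5 : h ^ (49 / 50 : ℝ) * h ^ (-(1 / 2) : ℝ) ≤ 1 := by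
      rw [← Real.rpow_add h0]
      exact Real.rpow_le_one h0.le S.le_one (by norm_num)
    linarith
  · have h2 : ε / 2 ≤ lowMass n h ε := by
      have : 0 ≤ h ^ 24 * h ^ (49 / 50 : ℝ) := by positivity
      linarith
    have h3 : lowMass n h ε ^ (49 / 50 - 1 : ℝ) ≤ 2 * ε ^ (49 / 50 - 1 : ℝ) := by
      refine (Real.rpow_le_rpow_of_nonpos (by positivity) h2 (by norm_num)).trans ?_
      rw [Real.div_rpow hε.le (by norm_num), div_eq_mul_inv, mul_comm,
        ← Real.rpow_neg (by norm_num)]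
      refine mul_le_mul_of_nonneg_right ?_ (Real.rpow_nonneg hε.le _)
      exact Real.rpow_le_self_of_one_le (by norm_num) (by norm_num)
    have h4 := mul_le_mul (S.auxMass_rpow_add_le' hε h1) h3 hm0 (by positivity)
    have h5 : ε ^ (49 / 50 : ℝ) * ε ^ (49 / 50 - 1 : ℝ) ≤ 1 := by
      rw [← Real.rpow_add hε]
      exact Real.rpow_le_one hε.le hε1 (by norm_num)
    linarith

lemma highMass_le (S : SmallCoupling n h) (hε : 0 < ε) (hε1 : ε ≤ 1) :
    highMass n h ε ≤ 1 + 5 * corrConst n := by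
  have h0 := S.pos
  have hK := corrConst_pos n
  have hg : h ^ 24 ≤ 1 := pow_le_one₀ h0.le S.le_one
  have h1 : corrConst n * (h ^ 24 * h ^ (49 / 50 : ℝ)) ≤ corrConst n :=
    mul_le_of_le_one_right hK.le (mul_le_one₀ hg (by positivity) S.rpow_le_one)
  have h2 : auxMass n h ε ^ (49 / 50 : ℝ) + h ≤ 4 := by
    rcases le_total ε h with h3 | h3
    · linarith [S.auxMass_rpow_add_le hε h3, S.rpow_le_one]
    · linarith [S.auxMass_rpow_add_le' hε h3,
        Real.rpow_le_one hε.le hε1 (by norm_num : (0 : ℝ) ≤ 49 / 50)]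
  have h3 : h ^ 24 * (auxMass n h ε ^ (49 / 50 : ℝ) + h) ≤ 1 * 4 :=
    mul_le_mul hg h2 (by have := S.auxMass_pos (ε := ε); positivity) zero_le_one
  have h4 := mul_le_mul_of_nonneg_left h3 hK.le
  have h5 := S.lowMass_le (ε := ε)
  unfold highMass
  linarith

lemma highMass_rpow_le (S : SmallCoupling n h) (hε : 0 < ε) (hε1 : ε ≤ h ^ 24 * h ^ (49 / 50 : ℝ)) :
    highMass n h ε ^ (49 / 50 : ℝ) ≤ (1 + 5 * corrConst n) * h ^ 24 := by
  have h0 := S.pos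
  have hK := corrConst_pos n
  have hεh : ε ≤ h := by
    refine hε1.trans ?_
    rw [pow_succ, mul_right_comm]
    exact mul_le_of_le_one_left h0.le
      (mul_le_one₀ (pow_le_one₀ h0.le S.le_one) (by positivity) S.rpow_le_one)
  have h1 : highMass n h ε ≤ (1 + 5 * corrConst n) * (h ^ 24 * h ^ (49 / 50 : ℝ)) := by
    have h2 := mul_le_mul_of_nonneg_left (mul_le_mul_of_nonneg_left
      (S.auxMass_rpow_add_le hε hεh) S.coupling_pos.le) hK.le
    have h3 := S.lowMass_le (ε := ε)
    unfold highMass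
    linarith
  have h2 := Real.rpow_le_rpow ((S.lowMass_pos hε).le.trans S.lowMass_le_highMass) h1
    (by norm_num : (0 : ℝ) ≤ 49 / 50)
  rw [Real.mul_rpow (by positivity) (by positivity)] at h2
  have h3 : (1 + 5 * corrConst n) ^ (49 / 50 : ℝ) ≤ 1 + 5 * corrConst n :=
    Real.rpow_le_self_of_one_le (by linarith) (by norm_num)
  have h4 : (h ^ 24 * h ^ (49 / 50 : ℝ)) ^ (49 / 50 : ℝ) ≤ h ^ 24 := by
    rw [← Real.rpow_natCast, ← Real.rpow_add h0, ← Real.rpow_mul h0.le]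
    exact Real.rpow_le_rpow_of_exponent_ge h0 S.le_one (by norm_num)
  exact h2.trans (mul_le_mul h3 h4 (by positivity) (by positivity))

end SmallCoupling

end Parameters

section Pressure
variable {L n : ℕ} [NeZero L] [NeZero n] {g ν ν' h ε : ℝ}

lemma meanSq_antitone (hg : 0 < g) (N : ℕ) (hν : ν ≤ ν') :
    meanSq L N n g ν' ≤ meanSq L N n g ν := by
  have hV := isWeight_latW L N
  have key : ∀ s t : ℝ, fe n (latW L N) g s - (t - s) / 2 * ((L : ℝ) ^ (4 * N) * meanSq L N n g s)
      ≤ fe n (latW L N) g t := fun s t => by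
    have hC := (nice_pot (n := n) (ν := s) hV hg).conf
    have hC' := (nice_pot (n := n) (ν := t) hV hg).conf
    have hZ := wint_one_pos hC
    have h := log_wint_ge hC hC' ((tame_pot (n := n) (latW L N) g t).sub (tame_pot (latW L N) g s))
    have e : ∀ φ : Torus L N × Fin n → ℝ, pot (latW L N) g t φ - pot (latW L N) g s φ =
        (t - s) / 2 * ∑ y, sN φ y := fun φ => by
      unfold pot
      rw [add_sub_add_right_eq_sub, ← Finset.sum_sub_distrib, Finset.mul_sum]
      refine Finset.sum_congr rfl fun y _ => ?_
      ring
    simp_rw [e] at h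
    rw [wint_const_mul, wint_sum hC _ fun y _ => tame_sN y,
      Finset.sum_congr rfl fun y _ => wint_latW_sN hg N y, Finset.sum_const, Finset.card_univ,
      nsmul_eq_mul, card_torus, ← mul_assoc (_ ^ _), ← mul_assoc,
      mul_div_cancel_right₀ _ hZ.ne'] at h
    exact h
  rcases hν.eq_or_lt with rfl | hlt
  · exact le_rfl
  have h1 := key ν ν'
  have h2 := key ν' ν
  have h3 : 0 < (ν' - ν) / 2 * (L : ℝ) ^ (4 * N) :=
    mul_pos (by linarith) (torus_volume_pos L N)
  refine le_of_mul_le_mul_left ?_ h3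
  linarith

namespace SmallCoupling

lemma infinite_volume (S : SmallCoupling n h) (hL : 2 ≤ L) (hε : 0 < ε) (hε1 : ε ≤ 1)
    {p : ℝ → ℝ} (hp : ∀ ν', Tendsto (fun N : ℕ => ((L : ℝ) ^ (4 * N))⁻¹ *
      fe n (latW L N) (h ^ 24) ν') atTop (𝓝 (p ν'))) :
    ∃ M χ, Tendsto (fun N => meanSq L N n (h ^ 24) (nuCrit n h + ε)) atTop (𝓝 M) ∧
      Tendsto (fun N => torusSusc L N n (h ^ 24) (nuCrit n h + ε)) atTop (𝓝 χ) ∧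
      HasDerivAt p (-(M / 2)) (nuCrit n h + ε) ∧ 0 < χ ∧
      |M / n - green (1 / χ)| ≤ 8 * (irConst * corrConst n) * h ^ 24 ∧
      (17 + 5 * corrConst n)⁻¹ ≤ green (1 / χ) ∧
      M / n ≤ green 0 ∧ green (highMass n h ε) ≤ M / n := by
  have hm := S.lowMass_pos hε
  have hma := S.lowMass_le_highMass (ε := ε)
  have ha := hm.trans_le hma
  have hK := corrConst_pos n
  obtain ⟨M, χ, h1, h2, h3, h4, h5, h6⟩ := (S.uGap hL hε).infinite_volume hL hm S.coupling_pos hp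
  obtain ⟨h7, h8⟩ := h6 _ ha (S.lt_highMass hε)
  have hχ : 0 < χ := (one_div_pos.2 ha).trans_le h7
  have h9 : lowMass n h ε ≤ 1 / χ := (le_one_div hm hχ).2 h4
  have h10 : 1 / χ ≤ highMass n h ε := (one_div_le hχ ha).2 h7
  have h11 := green_anti hm.le h9
  have h12 := green_anti (one_div_pos.2 hχ).le h10
  have h13 := green_sub_le (α := 49 / 50) (by norm_num) (by norm_num) hm hma
  have h14 : infrared (49 / 50) * ((highMass n h ε - lowMass n h ε) *
      lowMass n h ε ^ (49 / 50 - 1 : ℝ)) ≤ 8 * (irConst * corrConst n) * h ^ 24 := by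
    have h15 : 0 ≤ irConst * corrConst n * h ^ 24 := by
      have := S.pos
      have := irConst_nonneg
      positivity
    have := mul_le_mul_of_nonneg_left (S.mass_ratio_le hε hε1) h15
    refine le_trans (le_of_eq ?_) (this.trans (le_of_eq ?_))
    · unfold highMass irConst
      ring
    · ring
  refine ⟨M, χ, h1, h2, h3, hχ, ?_, ?_, h5.trans (green_anti le_rfl hm.le), h8⟩
  · rw [abs_le]
    constructor <;> linarith
  · refine le_trans ?_ (h12.trans' (le_green ha.le))
    exact inv_anti₀ (by linarith) (by linarith [S.highMass_le hε hε1])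

lemma le_green_highMass (S : SmallCoupling n h) (hε : 0 < ε)
    (hε1 : ε ≤ h ^ 24 * h ^ (49 / 50 : ℝ)) :
    green 0 - irConst * (1 + 5 * corrConst n) * h ^ 24 ≤ green (highMass n h ε) := by
  have ha := (S.lowMass_pos hε).trans_le S.lowMass_le_highMass
  have h1 := green_zero_sub_le (α := 49 / 50) (by norm_num) (by norm_num) ha
  have h2 := mul_le_mul_of_nonneg_left (S.highMass_rpow_le hε hε1) irConst_nonneg
  change _ ≤ irConst * _ at h1
  linarith

end SmallCoupling

/-- The constant in the comparison with the Gaussian field. -/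
def errConst (n : ℕ) : ℝ :=
  4 * n * (irConst * corrConst n) * (17 + 5 * corrConst n) +
    8 * n * (irConst * (1 + 5 * corrConst n)) + 1

lemma errConst_pos (n : ℕ) : 0 < errConst n := by
  have := irConst_nonneg
  have := corrConst_pos n
  unfold errConst
  positivity

/-- Convergence of a monotone one-sided limit with eventual bounds. -/
lemma exists_tendsto_nhdsGT_of_antitone {f : ℝ → ℝ} {A B δ : ℝ} (hδ : 0 < δ)
    (hf : ∀ s t, 0 < s → s ≤ t → t ≤ δ → f t ≤ f s) (hB : ∀ s, 0 < s → s ≤ δ → f s ≤ B)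
    (hA : ∀ᶠ s in 𝓝[>] (0 : ℝ), A ≤ f s) :
    ∃ q, Tendsto f (𝓝[>] 0) (𝓝 q) ∧ A ≤ q ∧ q ≤ B := by
  have hne : (Set.Ioo 0 δ).Nonempty := ⟨δ / 2, by constructor <;> linarith⟩
  have ht := AntitoneOn.tendsto_nhdsWithin_Ioo_right (f := f) hne
    (fun s hs t ht hst => hf s t hs.1 hst ht.2.le)
    ⟨B, by rintro _ ⟨s, hs, rfl⟩; exact hB s hs.1 hs.2.le⟩
  refine ⟨_, ht, ge_of_tendsto ht hA, le_of_tendsto ht ?_⟩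
  filter_upwards [Ioo_mem_nhdsGT hδ] with s hs using hB s hs.1 hs.2.le

end Pressure

/-- the derivative of the pressure exists, equals half the infinite
volume limit of `⟨|φ_0|²⟩`, and is close to `(n/2)·C_{1/χ}(0)`; similarly for the
limit `ε ↓ 0`. -/
theorem pressure_derivative (n : ℕ) [NeZero n] (hn : 1 ≤ n) :
    ∃ L₀ : ℕ, ∀ (L : ℕ) [NeZero L], 2 ≤ L → L₀ ≤ L →
      ∃ δ C : ℝ, 0 < δ ∧ 0 < C ∧
        ∀ g : ℝ, 0 < g → g ≤ δ →
          ∃ (νc : ℝ) (χ p : ℝ → ℝ), νc < 0 ∧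
            (∀ ν : ℝ, νc < ν → ν ≤ νc + δ →
              Tendsto (fun N : ℕ => pressureN L N n g ν) atTop (𝓝 (p ν))) ∧
            (∀ ε : ℝ, 0 < ε → ε ≤ δ →
              Tendsto (fun N : ℕ => corrSum L N n g (νc + ε)) atTop (𝓝 (χ (νc + ε))) ∧
              0 < χ (νc + ε) ∧
              ∃ M : ℝ,
                HasDerivAt p (-(M / 2)) (νc + ε) ∧
                Tendsto (fun N : ℕ => expect L N n g (νc + ε) fun φ => normSq (φ 0))
                  atTop (𝓝 M) ∧
                |M / 2 - (n : ℝ) / 2 * green (1 / χ (νc + ε))| ≤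
                  C * g * green (1 / χ (νc + ε))) ∧
            ∃ q : ℝ,
              Tendsto (fun ε : ℝ => -deriv p (νc + ε)) (𝓝[>] (0 : ℝ)) (𝓝 q) ∧
              |q - (n : ℝ) / 2 * green 0| ≤ C * g * green 0 := by
  obtain ⟨h₀, hh₀, hS⟩ := exists_smallCoupling n
  refine ⟨2, fun L _ hL _ => ⟨min (h₀ ^ 24) 1, errConst n, by positivity, errConst_pos n,
    fun g hg hgδ => ?_⟩⟩
  set δ := min (h₀ ^ 24) 1 with hδ
  have hδ0 : 0 < δ := by positivity
  have hδ1 : δ ≤ 1 := min_le_right _ _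
  obtain ⟨h, hh, rfl⟩ : ∃ h : ℝ, 0 < h ∧ h ^ 24 = g :=
    ⟨g ^ ((24 : ℕ) : ℝ)⁻¹, by positivity, Real.rpow_inv_natCast_pow hg.le (by norm_num)⟩
  have S := hS h hh (le_of_pow_le_pow_left₀ (by norm_num) hh₀.le (hgδ.trans (min_le_left _ _)))
  have hn0 : (0 : ℝ) < n := Nat.cast_pos.2 hn
  have hI := irConst_nonneg
  have hK := corrConst_pos n
  choose p hp using fun ν => exists_tendsto_fe (L := L) hL n 0 le_rfl hg ν
  have hV : ∀ ε : ℝ, 0 < ε → ε ≤ δ → _ := fun ε h1 h2 =>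
    S.infinite_volume hL h1 (h2.trans hδ1) hp
  choose! M χ hM hχ hd hχ0 hG hlow hup hhigh using hV
  have hderiv : ∀ ε, 0 < ε → ε ≤ δ → -deriv p (nuCrit n h + ε) = M ε / 2 := fun ε h1 h2 => by
    rw [(hd ε h1 h2).deriv, neg_neg]
  refine ⟨nuCrit n h, fun ν => χ (ν - nuCrit n h), p, S.nuCrit_neg, fun ν _ _ => ?_,
    fun ε h1 h2 => ?_, ?_⟩
  · simp_rw [pressureN_eq]
    exact hp ν
  · simp only [add_sub_cancel_left]
    refine ⟨?_, hχ0 ε h1 h2, M ε, hd ε h1 h2, ?_, ?_⟩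
    · simp_rw [corrSum_eq]
      exact hχ ε h1 h2
    · simp_rw [expect_normSq_eq]
      exact hM ε h1 h2
    · have e : M ε / 2 - n / 2 * green (1 / χ ε) = n / 2 * (M ε / n - green (1 / χ ε)) := by
        field_simp
      rw [e, abs_mul, abs_of_pos (by positivity)]
      refine (mul_le_mul_of_nonneg_left (hG ε h1 h2) (by positivity)).trans ?_
      have h3 : 1 ≤ (17 + 5 * corrConst n) * green (1 / χ ε) :=
        (inv_le_iff_one_le_mul₀' (by positivity)).1 (hlow ε h1 h2)
      have h4 : 0 ≤ 4 * n * (irConst * corrConst n) * h ^ 24 := by positivity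
      have h5 : 0 ≤ (8 * n * (irConst * (1 + 5 * corrConst n)) + 1) * h ^ 24 *
          green (1 / χ ε) := by
        have : 0 ≤ green (1 / χ ε) := (hlow ε h1 h2).trans' (by positivity)
        positivity
      have := mul_le_mul_of_nonneg_left h3 h4
      unfold errConst
      linarith
  · obtain ⟨q, hq, hq1, hq2⟩ := exists_tendsto_nhdsGT_of_antitone
      (f := fun ε => -deriv p (nuCrit n h + ε)) (B := n / 2 * green 0)
      (A := n / 2 * (green 0 - irConst * (1 + 5 * corrConst n) * h ^ 24)) hδ0
      (fun s t h1 h2 h3 => by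
        rw [hderiv s h1 (h2.trans h3), hderiv t (h1.trans_le h2) h3]
        have := le_of_tendsto_of_tendsto' (hM t (h1.trans_le h2) h3) (hM s h1 (h2.trans h3))
          fun N => meanSq_antitone hg N (by linarith)
        linarith)
      (fun s h1 h2 => by
        rw [hderiv s h1 h2]
        have := (div_le_iff₀ hn0).1 (hup s h1 h2)
        linarith)
      (by
        have hρ : 0 < min δ (h ^ 24 * h ^ (49 / 50 : ℝ)) := lt_min hδ0 (by positivity)
        filter_upwards [Ioo_mem_nhdsGT hρ] with s hs
        have h1 := hs.2.le.trans (min_le_left _ _)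
        rw [hderiv s hs.1 h1]
        have h2 := (S.le_green_highMass hs.1 (hs.2.le.trans (min_le_right _ _))).trans
          (hhigh s hs.1 h1)
        rw [le_div_iff₀ hn0] at h2
        linarith)
    refine ⟨q, hq, ?_⟩
    have h1 : 1 / 16 ≤ green 0 := by
      have := le_green le_rfl
      norm_num at this ⊢
      exact this
    have h2 : 0 ≤ 8 * n * (irConst * (1 + 5 * corrConst n)) * h ^ 24 := by positivity
    have h3 := mul_le_mul_of_nonneg_left h1 h2
    have h4 : 0 ≤ (4 * n * (irConst * corrConst n) * (17 + 5 * corrConst n) + 1) * h ^ 24 *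
        green 0 := by
      have := green_zero_pos
      positivity
    rw [abs_le]
    unfold errConst
    constructor <;> linarith
end Phi4
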